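/- Let Ω₁, Ω₂ ⊂ ℂⁿ be bounded strictly pseudoconvex domains with C^∞ boundary and let φ : Ω₁ → Ω₂ be a proper holomorphic mapping. Then there is a constant C such that for all z ∈ Ω₁, the complex gradient of the (holomorphic) function det φ′ satisfies (Σ_{k=1}^n |∂(det φ′)/∂z_k (z)|²)^{1/2} ≤ C · dist(z, ∂Ω₁)^{−1/2}. -/

import Mathlib

open Complex Metric

noncomputable section

/-- The Wirtinger derivative `∂f/∂z_j` of `f : ℂⁿ → ℂ` at `z`. -/
def wDz (n : ℕ) (j : Fin n) (f : EuclideanSpace ℂ (Fin n) → ℂ)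
    (z : EuclideanSpace ℂ (Fin n)) : ℂ :=
  (fderiv ℝ f z (EuclideanSpace.single j 1)
    - Complex.I * fderiv ℝ f z (EuclideanSpace.single j Complex.I)) / 2

/-- The Wirtinger derivative `∂f/∂z̄_j` of `f : ℂⁿ → ℂ` at `z`. -/
def wDzBar (n : ℕ) (j : Fin n) (f : EuclideanSpace ℂ (Fin n) → ℂ)
    (z : EuclideanSpace ℂ (Fin n)) : ℂ :=
  (fderiv ℝ f z (EuclideanSpace.single j 1)
    + Complex.I * fderiv ℝ f z (EuclideanSpace.single j Complex.I)) / 2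

/-- The complex Hessian matrix `H(u)(z) = [∂²u/∂z_i∂z̄_j(z)]` of a real-valued `u`. -/
def cHess (n : ℕ) (u : EuclideanSpace ℂ (Fin n) → ℝ)
    (z : EuclideanSpace ℂ (Fin n)) : Matrix (Fin n) (Fin n) ℂ :=
  Matrix.of fun i j => wDz n i (fun w => wDzBar n j (fun v => ((u v : ℝ) : ℂ)) w) z

/-- The Hermitian form `Σ_{i,j} H(u)(z)_{ij} w_i w̄_j`. -/
def cHessForm (n : ℕ) (u : EuclideanSpace ℂ (Fin n) → ℝ)
    (z : EuclideanSpace ℂ (Fin n)) (w : Fin n → ℂ) : ℂ :=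
  ∑ i, ∑ j, cHess n u z i j * w i * (starRingEnd ℂ) (w j)

/-- The pairing `Σ_j (∂u/∂z_j)(z) w_j` of the complex gradient with a vector. -/
def cGradPair (n : ℕ) (u : EuclideanSpace ℂ (Fin n) → ℝ)
    (z : EuclideanSpace ℂ (Fin n)) (w : Fin n → ℂ) : ℂ :=
  ∑ j, wDz n j (fun v => ((u v : ℝ) : ℂ)) z * w j

/-- `ρ` is a `C^k` defining function for `Ω`, defined on the open neighborhood `U` of `Ω̄`. -/
def IsDefiningFn (n : ℕ) (k : ℕ∞) (Ω U : Set (EuclideanSpace ℂ (Fin n)))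
    (ρ : EuclideanSpace ℂ (Fin n) → ℝ) : Prop :=
  IsOpen U ∧ closure Ω ⊆ U ∧ ContDiffOn ℝ k ρ U ∧
    Ω = {z ∈ U | ρ z < 0} ∧ ∀ z ∈ frontier Ω, fderiv ℝ ρ z ≠ 0

/-- `Ω` is a bounded strictly pseudoconvex domain with `C^k` boundary. -/
def IsStrictlyPseudoconvexDomain (n : ℕ) (k : ℕ∞)
    (Ω : Set (EuclideanSpace ℂ (Fin n))) : Prop :=
  IsOpen Ω ∧ Bornology.IsBounded Ω ∧
    ∃ U ρ, IsDefiningFn n k Ω U ρ ∧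
      ∀ z ∈ frontier Ω, ∀ w : Fin n → ℂ, w ≠ 0 →
        cGradPair n ρ z w = 0 → 0 < (cHessForm n ρ z w).re

/-- The complex Jacobian matrix `φ'(z) = [∂φ_i/∂z_j(z)]` of `φ : ℂⁿ → ℂⁿ`. -/
def jacobian (n : ℕ) (φ : EuclideanSpace ℂ (Fin n) → EuclideanSpace ℂ (Fin n))
    (z : EuclideanSpace ℂ (Fin n)) : Matrix (Fin n) (Fin n) ℂ :=
  Matrix.of fun i j => wDz n j (fun w => φ w i) z

/-- `φ` is a proper map from `Ω₁` to `Ω₂`. -/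
def IsProperMapOn (n : ℕ) (φ : EuclideanSpace ℂ (Fin n) → EuclideanSpace ℂ (Fin n))
    (Ω₁ Ω₂ : Set (EuclideanSpace ℂ (Fin n))) : Prop :=
  Set.MapsTo φ Ω₁ Ω₂ ∧ ∀ K ⊆ Ω₂, IsCompact K → IsCompact {z ∈ Ω₁ | φ z ∈ K}


namespace GDJ
open Set Filter Topology MeasureTheory
open scoped ContDiff

abbrev EE (n : ℕ) := EuclideanSpace ℂ (Fin n)

/-- basis vector -/
def ev {n : ℕ} (j : Fin n) : EE n := EuclideanSpace.single j 1

/-- complex linear part of the real derivative -/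
def dz {n : ℕ} (h : EE n → ℂ) (z v : EE n) : ℂ :=
  (fderiv ℝ h z v - Complex.I * fderiv ℝ h z (Complex.I • v)) / 2

lemma wDz_eq {n : ℕ} (j : Fin n) (h : EE n → ℂ) (z : EE n) : wDz n j h z = dz h z (ev j) := by
  have : (EuclideanSpace.single j Complex.I : EE n) = Complex.I • ev j := by
    ext i
    simp [ev]
  simp only [wDz, dz, this]
  rfl

lemma vec_eq_sum {n : ℕ} (v : EE n) : v = ∑ j, v j • ev j := by
  ext i
  simp [ev, Pi.single_apply]

lemma dz_add_vec {n : ℕ} (h : EE n → ℂ) (z v w : EE n) : dz h z (v + w) = dz h z v + dz h z w := by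
  simp only [dz, smul_add, map_add]; ring

lemma dz_smul_vec {n : ℕ} (h : EE n → ℂ) (z v : EE n) (c : ℂ) :
    dz h z (c • v) = c * dz h z v := by
  have e1 : ∀ v : EE n, c • v = c.re • v + c.im • (Complex.I • v) := by
    intro v
    conv_lhs => rw [← Complex.re_add_im c]
    rw [add_smul, mul_smul]
    rfl
  have e2 : Complex.I • c • v = c.re • (Complex.I • v) - c.im • v := by
    rw [e1 v, smul_add, smul_comm Complex.I, smul_comm Complex.I, smul_smul Complex.I Complex.I,
      Complex.I_mul_I, neg_one_smul, smul_neg, sub_eq_add_neg]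
  simp only [dz, e2]
  rw [e1 v]
  simp only [map_add, map_sub, map_smul, Complex.real_smul]
  conv_rhs => rw [← Complex.re_add_im c]
  ring_nf
  rw [Complex.I_sq]
  ring

lemma dz_sum_vec {n : ℕ} {ι : Type*} (s : Finset ι) (h : EE n → ℂ) (z : EE n) (v : ι → EE n) :
    dz h z (∑ i ∈ s, v i) = ∑ i ∈ s, dz h z (v i) := by
  classical
  induction s using Finset.induction_on with
  | empty => simp [dz]
  | insert a s ha ih => rw [Finset.sum_insert ha, Finset.sum_insert ha, dz_add_vec, ih]

lemma dz_eq_sum {n : ℕ} (h : EE n → ℂ) (z v : EE n) :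
    dz h z v = ∑ j, v j * dz h z (ev j) := by
  conv_lhs => rw [vec_eq_sum v]
  rw [dz_sum_vec]
  simp [dz_smul_vec]

lemma dz_of_complex {n : ℕ} {h : EE n → ℂ} {z : EE n} (hh : DifferentiableAt ℂ h z) (v : EE n) :
    dz h z v = fderiv ℂ h z v := by
  rw [dz, hh.fderiv_restrictScalars ℝ]
  simp only [ContinuousLinearMap.coe_restrictScalars', map_smul, smul_eq_mul]
  linear_combination (-(fderiv ℂ h z v)/2) * Complex.I_mul_I

lemma dz_conj {n : ℕ} {h : EE n → ℂ} {z : EE n} (hh : DifferentiableAt ℂ h z) (v : EE n) :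
    dz (fun w => (starRingEnd ℂ) (h w)) z v = 0 := by
  have h1 : HasFDerivAt (fun w => (starRingEnd ℂ) (h w))
      ((Complex.conjCLE : ℂ →L[ℝ] ℂ).comp ((fderiv ℂ h z).restrictScalars ℝ)) z :=
    (Complex.conjCLE : ℂ →L[ℝ] ℂ).hasFDerivAt.comp z (hh.hasFDerivAt.restrictScalars ℝ)
  rw [dz, h1.fderiv]
  simp
  linear_combination ((starRingEnd ℂ) (fderiv ℂ h z v)) * Complex.I_mul_I

lemma dz_mul {n : ℕ} {g h : EE n → ℂ} {z : EE n} (hg : DifferentiableAt ℝ g z)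
    (hh : DifferentiableAt ℝ h z) (v : EE n) :
    dz (fun w => g w * h w) z v = g z * dz h z v + dz g z v * h z := by
  simp only [dz]
  rw [fderiv_fun_mul hg hh]
  simp
  ring

lemma dz_fun_sum {n : ℕ} {ι : Type*} (s : Finset ι) {g : ι → EE n → ℂ} {z : EE n}
    (hg : ∀ i ∈ s, DifferentiableAt ℝ (g i) z) (v : EE n) :
    dz (fun w => ∑ i ∈ s, g i w) z v = ∑ i ∈ s, dz (g i) z v := by
  simp only [dz]
  rw [fderiv_fun_sum hg]
  simp [Finset.mul_sum, ← Finset.sum_sub_distrib, Finset.sum_div]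

lemma dz_comp {n m : ℕ} {u : EE m → ℂ} {F : EE n → EE m} {z : EE n}
    (hu : DifferentiableAt ℝ u (F z)) (hF : DifferentiableAt ℂ F z) (v : EE n) :
    dz (fun w => u (F w)) z v = dz u (F z) (fderiv ℂ F z v) := by
  have h1 : HasFDerivAt (fun w => u (F w))
      ((fderiv ℝ u (F z)).comp ((fderiv ℂ F z).restrictScalars ℝ)) z :=
    hu.hasFDerivAt.comp z (hF.hasFDerivAt.restrictScalars ℝ)
  rw [dz, h1.fderiv]
  simp [dz]

lemma dz_congr {n : ℕ} {g h : EE n → ℂ} {z : EE n} (e : g =ᶠ[𝓝 z] h) (v : EE n) :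
    dz g z v = dz h z v := by
  simp only [dz, e.fderiv_eq]

lemma norm_dz_le {n : ℕ} (h : EE n → ℂ) (z v : EE n) : ‖dz h z v‖ ≤ ‖fderiv ℝ h z‖ * ‖v‖ := by
  have h1 := (fderiv ℝ h z).le_opNorm v
  have h2 := (fderiv ℝ h z).le_opNorm (Complex.I • v)
  rw [norm_smul, Complex.norm_I, one_mul] at h2
  rw [dz, norm_div]
  have h3 := norm_sub_le (fderiv ℝ h z v) (Complex.I * fderiv ℝ h z (Complex.I • v))
  rw [norm_mul, Complex.norm_I, one_mul] at h3
  have : ‖(2:ℂ)‖ = 2 := by simp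
  rw [this]
  linarith

/-- integral of a derivative of a compactly supported function -/
lemma integral_dz_eq_zero {n : ℕ} {h : EE n → ℂ} (hh : ContDiff ℝ 1 h) (hc : HasCompactSupport h)
    (v : EE n) : ∫ z, dz h z v = 0 := by
  have key : ∀ v : EE n, ∫ z, fderiv ℝ h z v = 0 := by
    intro v
    have hi : Integrable (fun z => fderiv ℝ h z v) := by
      apply Continuous.integrable_of_hasCompactSupport
      · exact (hh.continuous_fderiv one_ne_zero).clm_apply continuous_const
      · exact hc.fderiv_apply ℝ v
    have := integral_mul_fderiv_eq_neg_fderiv_mul_of_integrable (μ := (volume : Measure (EE n)))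
      (f := fun _ => (1:ℂ)) (g := h) (v := v) (by simp) (by simpa using hi)
      (by simpa using hh.continuous.integrable_of_hasCompactSupport hc)
      (fun x _ => by fun_prop) (fun x _ => hh.differentiable one_ne_zero x)
    simpa using this
  have hi : ∀ v, Integrable (fun z => fderiv ℝ h z v) := by
    intro v
    apply Continuous.integrable_of_hasCompactSupport
    · exact (hh.continuous_fderiv one_ne_zero).clm_apply continuous_const
    · exact hc.fderiv_apply ℝ v
  simp only [dz]
  rw [integral_div, integral_sub (hi v) ((hi _).const_mul _), integral_const_mul, key, key]
  simp

end GDJ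

namespace GDJ
open Set Filter Topology MeasureTheory
open scoped ContDiff

/-- Cauchy estimate for Frechet derivatives along one vector. -/
lemma norm_fderiv_apply_le {n : ℕ} {G : Type} [NormedAddCommGroup G] [NormedSpace ℂ G]
    {F : EE n → G} {z v : EE n} {M : ℝ}
    (hd : ∀ ζ : ℂ, ‖ζ‖ ≤ 1 → DifferentiableAt ℂ F (z + ζ • v))
    (hM : ∀ ζ : ℂ, ‖ζ‖ ≤ 1 → ‖F (z + ζ • v)‖ ≤ M) : ‖fderiv ℂ F z v‖ ≤ M := by
  have h1 : ∀ ζ : ℂ, ‖ζ‖ ≤ 1 → HasDerivAt (fun ζ : ℂ => F (z + ζ • v))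
      (fderiv ℂ F (z + ζ • v) v) ζ := by
    intro ζ hζ
    have h2 : HasDerivAt (fun ζ : ℂ => z + ζ • v) v ζ := by
      simpa using ((hasDerivAt_id ζ).smul_const v).const_add z
    exact (hd ζ hζ).hasFDerivAt.comp_hasDerivAt ζ h2
  have h3 := norm_deriv_le_of_forall_mem_sphere_norm_le (c := 0) (R := 1) (C := M)
    (f := fun ζ : ℂ => F (z + ζ • v)) one_pos ?_ ?_
  · rw [(h1 0 (by simp)).deriv] at h3
    simpa using h3
  · apply DifferentiableOn.diffContOnCl
    intro ζ hζ
    rw [closure_ball _ one_ne_zero] at hζ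
    exact (h1 ζ (by simpa using hζ)).differentiableAt.differentiableWithinAt
  · intro ζ hζ
    exact hM ζ (by simpa using hζ.le)

lemma norm_fderiv_le_of_ball {n : ℕ} {G : Type} [NormedAddCommGroup G] [NormedSpace ℂ G]
    {F : EE n → G} {z : EE n} {M r : ℝ} (hr : 0 < r) (hM0 : 0 ≤ M)
    (hd : ∀ w ∈ closedBall z r, DifferentiableAt ℂ F w)
    (hM : ∀ w ∈ closedBall z r, ‖F w‖ ≤ M) : ‖fderiv ℂ F z‖ ≤ M / r := by
  apply ContinuousLinearMap.opNorm_le_bound _ (by positivity)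
  intro v
  by_cases hv : v = 0
  · simp [hv]
  have hv' : 0 < ‖v‖ := norm_pos_iff.2 hv
  have key := norm_fderiv_apply_le (F := F) (z := z) (v := (((r / ‖v‖ : ℝ)) : ℂ) • v) (M := M) ?_ ?_
  · rw [map_smul, norm_smul] at key
    simp only [Complex.norm_real, Real.norm_eq_abs, abs_of_pos (div_pos hr hv')] at key
    rw [div_mul_eq_mul_div, div_le_iff₀ hv'] at key
    rw [div_mul_eq_mul_div, le_div_iff₀ hr]
    linarith
  all_goals
    intro ζ hζ
    have hm : z + ζ • (((r / ‖v‖ : ℝ)) : ℂ) • v ∈ closedBall z r := by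
      rw [mem_closedBall, dist_eq_norm, add_sub_cancel_left, norm_smul, norm_smul]
      simp only [Complex.norm_real, Real.norm_eq_abs, abs_of_pos (div_pos hr hv')]
      rw [div_mul_cancel₀ _ hv'.ne']
      nlinarith
    first
    | exact hd _ hm
    | exact hM _ hm

lemma differentiableAt_fderiv_apply {n : ℕ} {G : Type} [NormedAddCommGroup G] [NormedSpace ℂ G]
    [FiniteDimensional ℂ G]
    {Ω : Set (EE n)} (hΩ : IsOpen Ω) {F : EE n → G} (hF : DifferentiableOn ℂ F Ω) {z₀ : EE n}
    (hz : z₀ ∈ Ω) (v : EE n) : DifferentiableAt ℂ (fun z => fderiv ℂ F z v) z₀ := by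
  have : CompleteSpace G := FiniteDimensional.complete ℂ G
  have : ProperSpace G := FiniteDimensional.proper ℂ G
  have : FiniteDimensional ℂ (EE n →L[ℂ] G) := inferInstance
  have : ProperSpace (EE n →L[ℂ] G) := FiniteDimensional.proper ℂ _
  -- neighbourhood with bounds
  have hc : ContinuousAt F z₀ := (hF.differentiableAt (hΩ.mem_nhds hz)).continuousAt
  have hb : ∀ᶠ z in 𝓝 z₀, ‖F z‖ < ‖F z₀‖ + 1 := hc.norm.eventually_lt_const (by linarith)
  obtain ⟨R, hR, hRs⟩ := Metric.mem_nhds_iff.1 (hb.and (hΩ.mem_nhds hz))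
  set M := ‖F z₀‖ + 1
  obtain ⟨r, hr, hrR⟩ : ∃ r : ℝ, 0 < r ∧ r * 4 = R := ⟨R / 4, by linarith, by ring⟩
  have hdiff : ∀ z ∈ ball z₀ R, DifferentiableAt ℂ F z := fun z hz' =>
    hF.differentiableAt (hΩ.mem_nhds (hRs hz').2)
  have hder : ∀ z ∈ ball z₀ (3 * r), ‖fderiv ℂ F z‖ ≤ M / (r / 2) := by
    intro z hz'
    have hsub : closedBall z (r / 2) ⊆ ball z₀ R := by
      intro w hw
      rw [mem_closedBall] at hw
      rw [mem_ball] at hz' ⊢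
      linarith [dist_triangle w z z₀]
    exact norm_fderiv_le_of_ball (by linarith) (by positivity) (fun w hw => hdiff w (hsub hw))
      (fun w hw => (hRs (hsub hw)).1.le)
  -- reduce to small v
  obtain ⟨t, ht0, htv⟩ : ∃ t : ℝ, 0 < t ∧ t * ‖v‖ ≤ r := by
    refine ⟨r / (‖v‖ + 1), by positivity, ?_⟩
    rw [div_mul_eq_mul_div, div_le_iff₀ (by positivity)]
    nlinarith [norm_nonneg v]
  -- now formula with radius t
  have hmem : ∀ z ∈ ball z₀ r, ∀ ζ : ℂ, ‖ζ‖ ≤ t → z + ζ • v ∈ ball z₀ (3 * r) := by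
    intro z hz' ζ hζ
    rw [mem_ball, dist_eq_norm] at hz' ⊢
    calc ‖z + ζ • v - z₀‖ = ‖(z - z₀) + ζ • v‖ := by congr 1; abel
      _ ≤ ‖z - z₀‖ + ‖ζ‖ * ‖v‖ := by rw [← norm_smul]; exact norm_add_le _ _
      _ < 3 * r := by nlinarith [norm_nonneg v]
  have h3R : ball z₀ (3 * r) ⊆ ball z₀ R := ball_subset_ball (by linarith)
  have hformula : ∀ z ∈ ball z₀ r, fderiv ℂ F z v =
      (2 * Real.pi * I : ℂ)⁻¹ • ∫ θ in (0:ℝ)..2 * Real.pi, deriv (circleMap 0 t) θ •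
        (((circleMap 0 t θ) ^ 2)⁻¹ • F (z + circleMap 0 t θ • v)) := by
    intro z hz'
    have hda : ∀ ζ : ℂ, ‖ζ‖ ≤ t → HasDerivAt (fun ζ : ℂ => F (z + ζ • v))
        (fderiv ℂ F (z + ζ • v) v) ζ := by
      intro ζ hζ
      have h2 : HasDerivAt (fun ζ : ℂ => z + ζ • v) v ζ := by
        simpa using ((hasDerivAt_id ζ).smul_const v).const_add z
      exact (hdiff _ (h3R (hmem z hz' ζ hζ))).hasFDerivAt.comp_hasDerivAt ζ h2
    have hU : IsOpen {ζ : ℂ | z + ζ • v ∈ ball z₀ R} :=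
      isOpen_ball.preimage (by fun_prop)
    have e1 := Complex.cderiv_eq_deriv (f := fun ζ : ℂ => F (z + ζ • v)) (z := 0) (r := t) hU
      (by
        intro ζ hζ
        have h2 : HasDerivAt (fun ζ : ℂ => z + ζ • v) v ζ := by
          simpa using ((hasDerivAt_id ζ).smul_const v).const_add z
        exact ((hdiff _ hζ).hasFDerivAt.comp_hasDerivAt ζ
          h2).differentiableAt.differentiableWithinAt) ht0
      (by
        intro ζ hζ
        exact h3R (hmem z hz' ζ (by simpa using hζ)))
    rw [(hda 0 (by simpa using ht0.le)).deriv] at e1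
    simp only [zero_smul, add_zero] at e1
    rw [← e1, Complex.cderiv, circleIntegral]
    simp
  have hev : (fun z => fderiv ℂ F z v) =ᶠ[𝓝 z₀] fun z =>
      (2 * Real.pi * I : ℂ)⁻¹ • ∫ θ in (0:ℝ)..2 * Real.pi, deriv (circleMap 0 t) θ •
        (((circleMap 0 t θ) ^ 2)⁻¹ • F (z + circleMap 0 t θ • v)) := by
    filter_upwards [ball_mem_nhds z₀ hr] with z hz' using hformula z hz'
  refine DifferentiableAt.congr_of_eventuallyEq ?_ hev
  apply DifferentiableAt.const_smul
  have hcm : ∀ θ : ℝ, ‖circleMap 0 t θ‖ ≤ t := fun θ => by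
    rw [norm_circleMap_zero, abs_of_pos ht0]
  have hcont : ∀ z ∈ ball z₀ r, Continuous (fun θ : ℝ => deriv (circleMap 0 t) θ •
        (((circleMap 0 t θ) ^ 2)⁻¹ • F (z + circleMap 0 t θ • v))) := by
    intro z hz'
    have c1 : Continuous (fun θ : ℝ => F (z + circleMap 0 t θ • v)) := by
      rw [continuous_iff_continuousAt]
      intro θ
      have := (hdiff _ (h3R (hmem z hz' _ (hcm θ)))).continuousAt
      refine ContinuousAt.comp (f := fun θ : ℝ => z + circleMap 0 t θ • v) this ?_
      fun_prop
    have c2 : Continuous (fun θ : ℝ => ((circleMap 0 t θ) ^ 2)⁻¹) := by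
      refine Continuous.inv₀ (by fun_prop) (fun θ => pow_ne_zero _ (circleMap_ne_center ht0.ne'))
    have c3 : Continuous (fun θ : ℝ => deriv (circleMap 0 t) θ) := by
      simp only [deriv_circleMap]
      fun_prop
    exact c3.smul (c2.smul c1)
  refine (intervalIntegral.hasFDerivAt_integral_of_dominated_of_fderiv_le (𝕜 := ℂ)
    (F' := fun z θ => deriv (circleMap 0 t) θ •
        (((circleMap 0 t θ) ^ 2)⁻¹ • fderiv ℂ F (z + circleMap 0 t θ • v)))
    (bound := fun _ => t * ((t ^ 2)⁻¹ * (M / (r / 2)))) (s := ball z₀ r)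
    (ball_mem_nhds z₀ hr) ?_ ?_ ?_ ?_ ?_ ?_).differentiableAt
  · filter_upwards [ball_mem_nhds z₀ hr] with z hz'
    exact (hcont z hz').aestronglyMeasurable
  · exact (hcont z₀ (mem_ball_self hr)).intervalIntegrable _ _
  · apply Measurable.aestronglyMeasurable
    have m1 : Measurable (fun θ : ℝ => fderiv ℂ F (z₀ + circleMap 0 t θ • v)) :=
      (measurable_fderiv ℂ F).comp (by fun_prop : Continuous (fun θ : ℝ => z₀ + circleMap 0 t θ • v)).measurable
    have c3 : Continuous (fun θ : ℝ => deriv (circleMap 0 t) θ) := by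
      simp only [deriv_circleMap]
      fun_prop
    have c2 : Continuous (fun θ : ℝ => ((circleMap 0 t θ) ^ 2)⁻¹) := by
      refine Continuous.inv₀ (by fun_prop) (fun θ => pow_ne_zero _ (circleMap_ne_center ht0.ne'))
    exact c3.measurable.smul (c2.measurable.smul m1)
  · refine Eventually.of_forall (fun θ _ z hz' => ?_)
    rw [norm_smul, norm_smul, deriv_circleMap, norm_mul, norm_inv, norm_pow, norm_circleMap_zero,
      abs_of_pos ht0, Complex.norm_I, mul_one]
    gcongr
    exact hder _ (hmem z hz' _ (hcm θ))
  · simp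
  · refine Eventually.of_forall (fun θ _ z hz' => ?_)
    have h2 : HasFDerivAt (fun z => F (z + circleMap 0 t θ • v))
        (fderiv ℂ F (z + circleMap 0 t θ • v)) z := by
      have h3 := (hdiff _ (h3R (hmem z hz' _ (hcm θ)))).hasFDerivAt
      have h4 : HasFDerivAt (fun z => z + circleMap 0 t θ • v) (ContinuousLinearMap.id ℂ (EE n)) z :=
        (hasFDerivAt_id z).add_const _
      have h5 := h3.comp z h4
      rw [ContinuousLinearMap.comp_id] at h5
      exact h5
    exact (h2.const_smul _).const_smul _

lemma differentiableOn_fderiv {n : ℕ} {G : Type} [NormedAddCommGroup G] [NormedSpace ℂ G]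
    [FiniteDimensional ℂ G]
    {Ω : Set (EE n)} (hΩ : IsOpen Ω) {F : EE n → G} (hF : DifferentiableOn ℂ F Ω) :
    DifferentiableOn ℂ (fderiv ℂ F) Ω := by
  intro z hz
  apply DifferentiableAt.differentiableWithinAt
  -- expand in basis
  have e : fderiv ℂ F = fun z => ∑ j, ContinuousLinearMap.smulRight
      ((EuclideanSpace.proj j : EE n →L[ℂ] ℂ)) (fderiv ℂ F z (ev j)) := by
    funext z
    ext w
    conv_lhs => rw [vec_eq_sum w]
    simp
  rw [e]
  apply DifferentiableAt.fun_sum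
  intro j _
  have := differentiableAt_fderiv_apply hΩ hF hz (ev j)
  exact ((ContinuousLinearMap.smulRightL ℂ (EE n) G
    (EuclideanSpace.proj j : EE n →L[ℂ] ℂ)).differentiableAt).comp z this

lemma contDiffOn_holo_nat {n : ℕ} {Ω : Set (EE n)} (hΩ : IsOpen Ω) (k : ℕ) :
    ∀ {G : Type} [NormedAddCommGroup G] [NormedSpace ℂ G] [FiniteDimensional ℂ G]
    {F : EE n → G} (_ : DifferentiableOn ℂ F Ω), ContDiffOn ℂ k F Ω := by
  induction k with
  | zero =>
    intro G _ _ _ F hF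
    exact contDiffOn_zero.2 hF.continuousOn
  | succ k ih =>
    intro G _ _ _ F hF
    rw [Nat.cast_succ, contDiffOn_succ_iff_fderiv_of_isOpen hΩ]
    refine ⟨hF, fun h => ?_, ih (differentiableOn_fderiv hΩ hF)⟩
    simp at h

lemma contDiffOn_holo {n : ℕ} {Ω : Set (EE n)} (hΩ : IsOpen Ω)
    {G : Type} [NormedAddCommGroup G] [NormedSpace ℂ G] [FiniteDimensional ℂ G]
    {F : EE n → G} (hF : DifferentiableOn ℂ F Ω) : ContDiffOn ℂ ∞ F Ω :=
  contDiffOn_infty.2 fun k => contDiffOn_holo_nat hΩ k hF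

end GDJ

namespace GDJ
open Set Filter Topology MeasureTheory
open scoped ContDiff

/-- complex Jacobian matrix through the complex Frechet derivative -/
def Jac {n : ℕ} (F : EE n → EE n) (z : EE n) : Matrix (Fin n) (Fin n) ℂ :=
  Matrix.of fun l j => (fderiv ℂ F z (ev j)) l

lemma jacobian_eq {n : ℕ} {F : EE n → EE n} {z : EE n} (h : DifferentiableAt ℂ F z) :
    jacobian n F z = Jac F z := by
  ext l j
  simp only [jacobian, Jac, Matrix.of_apply]
  rw [wDz_eq]
  have h1 : HasFDerivAt (fun w => F w l) ((EuclideanSpace.proj l : EE n →L[ℂ] ℂ).comp (fderiv ℂ F z)) z :=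
    (EuclideanSpace.proj l : EE n →L[ℂ] ℂ).hasFDerivAt.comp z h.hasFDerivAt
  rw [dz_of_complex h1.differentiableAt, h1.fderiv]
  simp

/-- determinant as a continuous multilinear map of the rows -/
def detCM (n : ℕ) : ContinuousMultilinearMap ℂ (fun _ : Fin n => (Fin n → ℂ)) ℂ :=
  { (Matrix.detRowAlternating : (Fin n → ℂ) [⋀^Fin n]→ₗ[ℂ] ℂ).toMultilinearMap with
    cont := by
      show Continuous (fun M : Fin n → Fin n → ℂ => Matrix.det (Matrix.of M))
      exact Continuous.matrix_det (by exact continuous_id) }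

lemma detCM_apply {n : ℕ} (M : Fin n → Fin n → ℂ) : detCM n M = Matrix.det (Matrix.of M) := rfl

lemma hasFDerivAt_det {n : ℕ} {A : EE n → Matrix (Fin n) (Fin n) ℂ}
    {A' : Fin n → (EE n →L[ℂ] (Fin n → ℂ))} {z : EE n}
    (h : ∀ l, HasFDerivAt (fun w => A w l) (A' l) z) :
    ∃ D : EE n →L[ℂ] ℂ, HasFDerivAt (fun w => (A w).det) D z ∧
      ∀ v, D v = ∑ l, ((A z).updateRow l (A' l v)).det := by
  refine ⟨_, HasFDerivAt.multilinear_comp (f := detCM n) (g := fun l w => A w l) h, ?_⟩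
  intro v
  simp only [ContinuousLinearMap.sum_apply, ContinuousLinearMap.comp_apply]
  apply Finset.sum_congr rfl
  intro l _
  rfl

lemma det_swap_rows {n : ℕ} (A : Matrix (Fin n) (Fin n) ℂ) {k l : Fin n} (hkl : k ≠ l)
    (a b : Fin n → ℂ) :
    ((A.updateRow k a).updateRow l b).det = - ((A.updateRow k b).updateRow l a).det := by
  have h := Matrix.det_permute (Equiv.swap k l) ((A.updateRow k b).updateRow l a)
  rw [Equiv.Perm.sign_swap hkl] at h
  have e : ((A.updateRow k b).updateRow l a).submatrix (Equiv.swap k l) id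
      = (A.updateRow k a).updateRow l b := by
    ext i j
    simp only [Matrix.submatrix_apply, id, Matrix.updateRow_apply]
    by_cases hi : i = k
    · subst hi
      simp [hkl]
    · by_cases hi' : i = l
      · subst hi'
        simp [hkl]
      · rw [Equiv.swap_apply_of_ne_of_ne hi hi']
        simp [hi, hi']
  rw [e] at h
  simpa using h

lemma piola_alg {n : ℕ} (A : Matrix (Fin n) (Fin n) ℂ) {k l : Fin n} (hkl : k ≠ l)
    (H : Fin n → Fin n → ℂ) (hH : ∀ i j, H i j = H j i) :
    ∑ j, ((A.updateRow k (Pi.single j 1)).updateRow l (H j)).det = 0 := by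
  set a : Fin n → Fin n → ℂ := fun j i =>
    ((A.updateRow k (Pi.single j 1)).updateRow l (Pi.single i 1)).det with ha
  have hanti : ∀ i j, a i j = - a j i := fun i j => det_swap_rows A hkl _ _
  have e : ∀ j, ((A.updateRow k (Pi.single j 1)).updateRow l (H j)).det = ∑ i, H j i * a j i := by
    intro j
    have h1 : H j = ∑ i, H j i • (Pi.single i (1:ℂ) : Fin n → ℂ) := by
      ext i
      simp [Pi.single_apply]
    set B := A.updateRow k (Pi.single j 1)
    have h2 : ∀ w : Fin n → ℂ, (B.updateRow l w).det
        = ((Matrix.detRowAlternating : (Fin n → ℂ) [⋀^Fin n]→ₗ[ℂ] ℂ).toMultilinearMap.toLinearMap B l) w :=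
      fun w => rfl
    rw [h2]
    conv_lhs => rw [h1, map_sum]
    apply Finset.sum_congr rfl
    intro i _
    rw [map_smul, ← h2]
    rfl
  simp only [e]
  have h3 : ∑ j, ∑ i, H j i * a j i = - ∑ j, ∑ i, H j i * a j i := by
    conv_lhs => rw [Finset.sum_comm]
    rw [← Finset.sum_neg_distrib]
    refine Finset.sum_congr rfl fun i _ => ?_
    rw [← Finset.sum_neg_distrib]
    refine Finset.sum_congr rfl fun j _ => ?_
    rw [hH j i, hanti j i]
    ring
  have h4 : (2:ℂ) * ∑ j, ∑ i, H j i * a j i = 0 := by linear_combination h3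
  simpa using h4

variable {n : ℕ} {Ω : Set (EE n)} {F : EE n → EE n}

/-- row of the Jacobian, differentiable -/
lemma hasFDerivAt_Jac_row (hΩ : IsOpen Ω) (hF : DifferentiableOn ℂ F Ω) {z : EE n} (hz : z ∈ Ω)
    (l : Fin n) : HasFDerivAt (fun w => Jac F w l)
      (ContinuousLinearMap.pi fun j => (EuclideanSpace.proj l : EE n →L[ℂ] ℂ).comp
        ((ContinuousLinearMap.apply ℂ (EE n) (ev j)).comp (fderiv ℂ (fderiv ℂ F) z))) z := by
  rw [hasFDerivAt_pi]
  intro j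
  have h1 := ((differentiableOn_fderiv hΩ hF).differentiableAt (hΩ.mem_nhds hz)).hasFDerivAt
  have h2 := (ContinuousLinearMap.apply ℂ (EE n) (ev j)).hasFDerivAt.comp z h1
  exact (EuclideanSpace.proj l : EE n →L[ℂ] ℂ).hasFDerivAt.comp z h2

lemma differentiableOn_det (hΩ : IsOpen Ω) (hF : DifferentiableOn ℂ F Ω) :
    DifferentiableOn ℂ (fun z => (Jac F z).det) Ω := by
  intro z hz
  obtain ⟨D, hD, -⟩ := hasFDerivAt_det (A := Jac F) (fun l => hasFDerivAt_Jac_row hΩ hF hz l)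
  exact hD.differentiableAt.differentiableWithinAt

lemma symm_snd (hΩ : IsOpen Ω) (hF : DifferentiableOn ℂ F Ω) {z : EE n} (hz : z ∈ Ω) (v w : EE n) :
    fderiv ℂ (fderiv ℂ F) z v w = fderiv ℂ (fderiv ℂ F) z w v := by
  have h : ContDiffAt ℂ ∞ F z := (contDiffOn_holo hΩ hF).contDiffAt (hΩ.mem_nhds hz)
  exact (h.isSymmSndFDerivAt (by simp [minSmoothness_of_isRCLikeNormedField];
                                 exact WithTop.coe_le_coe.2 le_top)) v w

lemma hasFDerivAt_adj (hΩ : IsOpen Ω) (hF : DifferentiableOn ℂ F Ω) {z : EE n} (hz : z ∈ Ω)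
    (j k : Fin n) : ∃ D : EE n →L[ℂ] ℂ, HasFDerivAt (fun w => (Jac F w).adjugate j k) D z ∧
      ∀ v, D v = ∑ l, if l = k then 0 else
        (((Jac F z).updateRow k (Pi.single j 1)).updateRow l
          (fun i => (fderiv ℂ (fderiv ℂ F) z v (ev i)) l)).det := by
  have hrow : ∀ l, HasFDerivAt (fun w => (Jac F w).updateRow k (Pi.single j 1) l)
      (if l = k then 0 else (ContinuousLinearMap.pi fun j => (EuclideanSpace.proj l : EE n →L[ℂ] ℂ).comp
        ((ContinuousLinearMap.apply ℂ (EE n) (ev j)).comp (fderiv ℂ (fderiv ℂ F) z)))) z := by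
    intro l
    by_cases hl : l = k
    · subst hl
      simp only [Matrix.updateRow_self, if_true]
      exact hasFDerivAt_const _ _
    · simp only [hl, if_false]
      have e : (fun w => (Jac F w).updateRow k (Pi.single j 1) l) = fun w => Jac F w l := by
        funext w
        exact Matrix.updateRow_ne hl
      rw [e]
      exact hasFDerivAt_Jac_row hΩ hF hz l
  obtain ⟨D, hD, hD'⟩ := hasFDerivAt_det (A := fun w => (Jac F w).updateRow k (Pi.single j 1)) hrow
  refine ⟨D, ?_, ?_⟩
  · simpa only [Matrix.adjugate_apply] using hD
  · intro v
    rw [hD' v]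
    apply Finset.sum_congr rfl
    intro l _
    by_cases hl : l = k
    · simp only [hl, if_true]
      apply Matrix.det_eq_zero_of_row_eq_zero k
      intro i
      simp
    · simp only [hl, if_false]
      rfl

lemma piola (hΩ : IsOpen Ω) (hF : DifferentiableOn ℂ F Ω) {z : EE n} (hz : z ∈ Ω) (k : Fin n) :
    ∑ j, dz (fun w => (Jac F w).adjugate j k) z (ev j) = 0 := by
  have h : ∀ j, dz (fun w => (Jac F w).adjugate j k) z (ev j) = ∑ l, if l = k then 0 else
        (((Jac F z).updateRow k (Pi.single j 1)).updateRow l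
          (fun i => (fderiv ℂ (fderiv ℂ F) z (ev j) (ev i)) l)).det := by
    intro j
    obtain ⟨D, hD, hD'⟩ := hasFDerivAt_adj hΩ hF hz j k
    rw [dz_of_complex hD.differentiableAt, hD.fderiv, hD']
  simp only [h]
  rw [Finset.sum_comm]
  apply Finset.sum_eq_zero
  intro l _
  by_cases hl : l = k
  · simp [hl]
  · simp only [hl, if_false]
    apply piola_alg _ (Ne.symm hl) (fun j i => (fderiv ℂ (fderiv ℂ F) z (ev j) (ev i)) l)
    intro i j
    simp only
    rw [symm_snd hΩ hF hz]

lemma differentiableOn_adj (hΩ : IsOpen Ω) (hF : DifferentiableOn ℂ F Ω) (j k : Fin n) :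
    DifferentiableOn ℂ (fun w => (Jac F w).adjugate j k) Ω := by
  intro z hz
  obtain ⟨D, hD, -⟩ := hasFDerivAt_adj hΩ hF hz j k
  exact hD.differentiableAt.differentiableWithinAt

/-- Piola identity with a composed function. -/
lemma piola_comp (hΩ : IsOpen Ω) (hF : DifferentiableOn ℂ F Ω) {z : EE n} (hz : z ∈ Ω) (k : Fin n)
    {u : EE n → ℂ} (hu : DifferentiableAt ℝ u (F z)) :
    ∑ j, dz (fun w => (Jac F w).adjugate j k * u (F w)) z (ev j)
      = (Jac F z).det * dz u (F z) (ev k) := by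
  have hFz : DifferentiableAt ℂ F z := hF.differentiableAt (hΩ.mem_nhds hz)
  have huF : DifferentiableAt ℝ (fun w => u (F w)) z :=
    hu.comp z (hFz.restrictScalars ℝ)
  have h1 : ∀ j, dz (fun w => (Jac F w).adjugate j k * u (F w)) z (ev j)
      = (Jac F z).adjugate j k * (∑ l, Jac F z l j * dz u (F z) (ev l))
        + dz (fun w => (Jac F w).adjugate j k) z (ev j) * u (F z) := by
    intro j
    rw [dz_mul (((differentiableOn_adj hΩ hF j k).differentiableAt
      (hΩ.mem_nhds hz)).restrictScalars ℝ) huF, dz_comp hu hFz, dz_eq_sum]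
    rfl
  simp only [h1]
  rw [Finset.sum_add_distrib, ← Finset.sum_mul, piola hΩ hF hz k, zero_mul, add_zero]
  simp only [Finset.mul_sum]
  rw [Finset.sum_comm]
  have h2 : ∀ l, ∑ j, (Jac F z).adjugate j k * (Jac F z l j * dz u (F z) (ev l))
      = (Jac F z * (Jac F z).adjugate) l k * dz u (F z) (ev l) := by
    intro l
    rw [Matrix.mul_apply, Finset.sum_mul]
    apply Finset.sum_congr rfl
    intro j _
    ring
  simp only [h2, Matrix.mul_adjugate, Matrix.smul_apply, smul_eq_mul, Matrix.one_apply]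
  simp

end GDJ

namespace GDJ
open Set Filter Topology MeasureTheory
open scoped ContDiff

/-- Integral over an open set of a derivative of a function vanishing off a compact. -/
lemma setIntegral_dz_eq_zero {n : ℕ} {B K : Set (EE n)} (hB : IsOpen B) (hK : IsCompact K)
    (hKB : K ⊆ B) {h : EE n → ℂ} (hh : ContDiffOn ℝ 1 h B) (h0 : ∀ z ∈ B, z ∉ K → h z = 0)
    (v : EE n) : ∫ z in B, dz h z v = 0 ∧ IntegrableOn (fun z => dz h z v) B := by
  classical
  set g : EE n → ℂ := B.indicator h with hg
  have hgB : ∀ z ∈ B, g =ᶠ[𝓝 z] h := fun z hz => by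
    filter_upwards [hB.mem_nhds hz] with w hw
    simp [hg, hw]
  have hgK : ∀ z ∉ K, g =ᶠ[𝓝 z] 0 := fun z hz => by
    filter_upwards [hK.isClosed.isOpen_compl.mem_nhds hz] with w hw
    by_cases hwB : w ∈ B
    · simp [hg, hwB, h0 w hwB hw]
    · simp [hg, hwB]
  have hgc : ContDiff ℝ 1 g := by
    rw [contDiff_iff_contDiffAt]
    intro z
    by_cases hz : z ∈ K
    · exact (hh.contDiffAt (hB.mem_nhds (hKB hz))).congr_of_eventuallyEq (hgB z (hKB hz))
    · exact contDiffAt_const.congr_of_eventuallyEq (hgK z hz)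
  have hgs : HasCompactSupport g := by
    apply HasCompactSupport.intro hK
    intro z hz
    exact (hgK z hz).eq_of_nhds
  have hdB : ∀ z ∈ B, dz g z v = dz h z v := fun z hz => dz_congr (hgB z hz) v
  have hdK : ∀ z ∉ K, dz g z v = 0 := fun z hz => by
    rw [dz_congr (hgK z hz) v]
    simp [dz]
  have hintg : Integrable (fun z => dz g z v) := by
    apply Continuous.integrable_of_hasCompactSupport
    · have := hgc.continuous_fderiv one_ne_zero
      simp only [dz]
      fun_prop
    · exact HasCompactSupport.intro hK hdK
  constructor
  · calc ∫ z in B, dz h z v = ∫ z in B, dz g z v :=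
          setIntegral_congr_fun hB.measurableSet (fun z hz => (hdB z hz).symm)
      _ = ∫ z, dz g z v := setIntegral_eq_integral_of_forall_compl_eq_zero
          (fun z hz => hdK z (fun hz' => hz (hKB hz')))
      _ = 0 := integral_dz_eq_zero hgc hgs v
  · exact (hintg.integrableOn (s := B)).congr_fun (fun z hz => hdB z hz) hB.measurableSet

lemma fderiv_real_eq_dz {n : ℕ} {u : EE n → ℝ} {w : EE n} (hu : DifferentiableAt ℝ u w) (y : EE n) :
    fderiv ℝ u w y = 2 * (dz (fun w => ((u w : ℝ) : ℂ)) w y).re := by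
  have h1 : HasFDerivAt (fun w => ((u w : ℝ) : ℂ)) (Complex.ofRealCLM.comp (fderiv ℝ u w)) w :=
    Complex.ofRealCLM.hasFDerivAt.comp w hu.hasFDerivAt
  rw [dz, h1.fderiv]
  simp
  ring

lemma stability_aux {n : ℕ} {Ω : Set (EE n)} (hΩ : IsOpen Ω) {G : EE n → EE n}
    (hG : DifferentiableOn ℂ G Ω) {p : EE n} {r τ : ℝ} (hr : 0 < r) (hτ : 0 < τ)
    (hsub : closedBall p r ⊆ Ω) (hp : G p = 0) (hdet : (Jac G p).det ≠ 0) (y : EE n)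
    (hs : ∀ z ∈ sphere p r, ∀ t ∈ Icc (0:ℝ) 1, τ < ‖G z - t • y‖) :
    ∃ z ∈ closedBall p r, ‖G z - y‖ ≤ τ := by
  by_contra hcon
  push Not at hcon
  set B := ball p r with hB
  have hBo : IsOpen B := isOpen_ball
  have hBΩ : B ⊆ Ω := ball_subset_closedBall.trans hsub
  let u : ContDiffBump (0 : EE n) := ⟨τ / 2, τ, by linarith, by linarith⟩
  have hu : ContDiff ℝ ∞ (u : EE n → ℝ) := u.contDiff
  have hu0 : ∀ w : EE n, τ ≤ ‖w‖ → u w = 0 := fun w hw => by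
    apply u.zero_of_le_dist
    simpa [dist_eq_norm] using hw
  set J : EE n → ℂ := fun z => (Jac G z).det with hJ
  have hJh : DifferentiableOn ℂ J Ω := differentiableOn_det hΩ hG
  have hJc : ContinuousOn J (closedBall p r) := hJh.continuousOn.mono hsub
  have hGc : ContinuousOn G (closedBall p r) := hG.continuousOn.mono hsub
  obtain ⟨M, hM⟩ := (isCompact_closedBall p r).exists_bound_of_continuousOn hJc
  have hM0 : 0 ≤ M := (norm_nonneg _).trans (hM p (mem_closedBall_self hr.le))
  -- derivative bound for u
  have huc : HasCompactSupport (u : EE n → ℝ) := u.hasCompactSupport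
  have hduc : Continuous (fderiv ℝ (u : EE n → ℝ)) := hu.continuous_fderiv (by simp)
  obtain ⟨M1, hM1⟩ : ∃ M1, ∀ w, ‖fderiv ℝ (u : EE n → ℝ) w‖ ≤ M1 :=
    hduc.bounded_above_of_compact_support (huc.fderiv ℝ)
  have hM10 : 0 ≤ M1 := (norm_nonneg _).trans (hM1 0)
  set f : ℝ → EE n → ℝ := fun t z => u (G z - t • y) * ‖J z‖ ^ 2 with hf
  set f' : ℝ → EE n → ℝ := fun t z => - fderiv ℝ (u : EE n → ℝ) (G z - t • y) y * ‖J z‖ ^ 2 with hf'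
  have hvolB : volume B < ⊤ := measure_ball_lt_top
  have hfc : ∀ t, ContinuousOn (f t) (closedBall p r) := by
    intro t
    apply ContinuousOn.mul
    · exact hu.continuous.comp_continuousOn (hGc.sub continuousOn_const)
    · exact hJc.norm.pow 2
  have hfc' : ∀ t, ContinuousOn (f' t) (closedBall p r) := by
    intro t
    apply ContinuousOn.mul
    · apply ContinuousOn.neg
      exact (hduc.comp_continuousOn (hGc.sub continuousOn_const)).clm_apply continuousOn_const
    · exact hJc.norm.pow 2
  have hfi : ∀ t, IntegrableOn (f t) B := fun t =>
    ((hfc t).integrableOn_compact (isCompact_closedBall p r)).mono_set ball_subset_closedBall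
  -- derivative under the integral
  have hderiv : ∀ t, HasDerivAt (fun t => ∫ z in B, f t z) (∫ z in B, f' t z) t := by
    intro t
    refine (hasDerivAt_integral_of_dominated_loc_of_deriv_le (F := f) (F' := f') (x₀ := t)
      (s := univ) (bound := fun _ => M1 * ‖y‖ * M ^ 2) univ_mem ?_ (hfi t) ?_ ?_ ?_ ?_).2
    · exact Eventually.of_forall fun t => (hfi t).aestronglyMeasurable
    · exact (((hfc' t).integrableOn_compact (isCompact_closedBall p r)).mono_set
        ball_subset_closedBall).aestronglyMeasurable
    · refine (ae_restrict_mem hBo.measurableSet).mono fun z hz t _ => ?_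
      simp only [hf', norm_mul, norm_neg, norm_pow, norm_norm]
      gcongr
      · exact (ContinuousLinearMap.le_opNorm _ _).trans (by gcongr; exact hM1 _)
      · exact hM z (ball_subset_closedBall hz)
    · exact integrableOn_const hvolB.ne
    · refine Eventually.of_forall fun z t _ => ?_
      have h1 : HasDerivAt (fun t : ℝ => G z - t • y) (-y) t := by
        simpa using ((hasDerivAt_id t).smul_const y).const_sub (G z)
      have h2 := ((hu.differentiable (by simp) (G z - t • y)).hasFDerivAt.comp_hasDerivAt t
        h1).mul_const (‖J z‖ ^ 2)
      simpa [hf, hf'] using h2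
  -- vanishing of the derivative
  have hzero : ∀ t ∈ Icc (0:ℝ) 1, ∫ z in B, f' t z = 0 := by
    intro t ht
    set U : EE n → ℂ := fun w => ((u (w - t • y) : ℝ) : ℂ) with hU
    have hUs : ContDiff ℝ ∞ U := Complex.ofRealCLM.contDiff.comp (hu.comp (by fun_prop))
    -- compact set
    set K : Set (EE n) := {z ∈ closedBall p r | ‖G z - t • y‖ ≤ τ} with hK
    have hKc : IsCompact K := by
      have : K = closedBall p r ∩ (fun z => ‖G z - t • y‖) ⁻¹' (Iic τ) := rfl
      rw [this]
      have hcl := (hGc.sub (continuousOn_const (c := t • y))).norm.preimage_isClosed_of_isClosed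
        isClosed_closedBall (isClosed_Iic (a := τ))
      exact (isCompact_closedBall p r).of_isClosed_subset hcl inter_subset_left
    have hKB : K ⊆ B := by
      rintro z ⟨hz1, hz2⟩
      by_contra hz3
      have : z ∈ sphere p r := by
        rw [mem_closedBall] at hz1
        simp only [hB, mem_ball, not_lt] at hz3
        exact le_antisymm hz1 hz3
      exact absurd hz2 (not_le.2 (hs z this t ht))
    have hUdiff : ∀ w, DifferentiableAt ℝ U w := fun w => hUs.differentiable (by simp) w
    have hUG : ∀ z ∈ B, DifferentiableAt ℝ (fun z => U (G z)) z := fun z hz =>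
      (hUdiff _).comp z ((hG.differentiableAt (hΩ.mem_nhds (hBΩ hz))).restrictScalars ℝ)
    have hk : ∀ k, ∫ z in B, dz U (G z) (ev k) * (J z * (starRingEnd ℂ) (J z)) = 0 := by
      intro k
      set h : Fin n → EE n → ℂ := fun j z => ((Jac G z).adjugate j k * U (G z)) *
        (starRingEnd ℂ) (J z) with hh
      have hJr : ContDiffOn ℝ 1 J B := ((contDiffOn_holo hΩ hJh).mono hBΩ |>.restrict_scalars ℝ).of_le
        (by exact_mod_cast le_top)
      have hadj : ∀ j, ContDiffOn ℝ 1 (fun z => (Jac G z).adjugate j k) B := fun j =>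
        (((contDiffOn_holo hΩ (differentiableOn_adj hΩ hG j k)).mono hBΩ).restrict_scalars ℝ).of_le
        (by exact_mod_cast le_top)
      have hGr : ContDiffOn ℝ 1 G B :=
        (((contDiffOn_holo hΩ hG).mono hBΩ).restrict_scalars ℝ).of_le (by exact_mod_cast le_top)
      have hhc : ∀ j, ContDiffOn ℝ 1 (h j) B := by
        intro j
        refine ((hadj j).mul ?_).mul ?_
        · exact (hUs.of_le (by exact_mod_cast le_top)).comp_contDiffOn hGr
        · exact ((Complex.conjCLE : ℂ →L[ℝ] ℂ).contDiff).comp_contDiffOn hJr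
      have hh0 : ∀ j, ∀ z ∈ B, z ∉ K → h j z = 0 := by
        intro j z hz hzK
        have : τ ≤ ‖G z - t • y‖ := by
          by_contra hlt
          exact hzK ⟨ball_subset_closedBall hz, (not_le.1 hlt).le⟩
        simp [hh, hU, hu0 _ this]
      have e1 : ∀ z ∈ B, dz U (G z) (ev k) * (J z * (starRingEnd ℂ) (J z))
          = ∑ j, dz (h j) z (ev j) := by
        intro z hz
        have e2 : ∀ j, dz (h j) z (ev j) =
            dz (fun w => (Jac G w).adjugate j k * U (G w)) z (ev j) * (starRingEnd ℂ) (J z) := by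
          intro j
          have hJd := hJh.differentiableAt (hΩ.mem_nhds (hBΩ hz))
          rw [dz_mul (h := fun z => (starRingEnd ℂ) (J z)) _ _, dz_conj hJd]
          · ring
          · exact (((differentiableOn_adj hΩ hG j k).differentiableAt
              (hΩ.mem_nhds (hBΩ hz))).restrictScalars ℝ).mul (hUG z hz)
          · exact (Complex.conjCLE : ℂ →L[ℝ] ℂ).differentiableAt.comp z (hJd.restrictScalars ℝ)
        simp only [e2, ← Finset.sum_mul]
        rw [piola_comp hΩ hG (hBΩ hz) k (hUdiff _)]
        ring
      rw [setIntegral_congr_fun hBo.measurableSet e1, integral_finset_sum]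
      · exact Finset.sum_eq_zero fun j _ =>
          (setIntegral_dz_eq_zero hBo hKc hKB (hhc j) (hh0 j) (ev j)).1
      · exact fun j _ => (setIntegral_dz_eq_zero hBo hKc hKB (hhc j) (hh0 j) (ev j)).2
    -- assemble
    have hdzc : ∀ v, Continuous (fun w => dz U w v) := by
      intro v
      have := hUs.continuous_fderiv (by simp)
      simp only [dz]
      fun_prop
    have hintg : ∀ v, IntegrableOn (fun z => dz U (G z) v * (J z * (starRingEnd ℂ) (J z))) B := by
      intro v
      refine (ContinuousOn.integrableOn_compact (isCompact_closedBall p r) ?_).mono_set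
        ball_subset_closedBall
      refine ((hdzc v).comp_continuousOn hGc).mul (hJc.mul ?_)
      exact Complex.continuous_conj.comp_continuousOn hJc
    have hy : ∫ z in B, dz U (G z) y * (J z * (starRingEnd ℂ) (J z)) = 0 := by
      have e : ∀ z, dz U (G z) y * (J z * (starRingEnd ℂ) (J z)) =
          ∑ k, y k * (dz U (G z) (ev k) * (J z * (starRingEnd ℂ) (J z))) := by
        intro z
        rw [dz_eq_sum, Finset.sum_mul]
        exact Finset.sum_congr rfl fun k _ => by ring
      simp only [e]
      rw [integral_finset_sum _ (fun k _ => (hintg _).const_mul _)]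
      exact Finset.sum_eq_zero fun k _ => by rw [integral_const_mul, hk, mul_zero]
    have hre : ∀ z, f' t z = -2 * (dz U (G z) y * (J z * (starRingEnd ℂ) (J z))).re := by
      intro z
      have h1 : fderiv ℝ (u : EE n → ℝ) (G z - t • y) y = 2 * (dz U (G z) y).re := by
        have h2 : DifferentiableAt ℝ (fun w => u (w - t • y)) (G z) :=
          (hu.comp (by fun_prop : ContDiff ℝ ∞ fun w : EE n => w - t • y)).differentiable (by simp) _
        rw [← fderiv_real_eq_dz h2]
        simp only [sub_eq_add_neg]
        rw [fderiv_comp_add_right]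
      simp only [hf', h1]
      rw [Complex.mul_conj, Complex.normSq_eq_norm_sq]
      rw [Complex.re_mul_ofReal]
      ring
    simp only [hre]
    rw [integral_const_mul]
    have := integral_re (hintg y)
    rw [hy] at this
    simp only [RCLike.re_eq_complex_re] at this
    rw [this]
    simp
  -- constancy
  have hconst : (∫ z in B, f 1 z) = ∫ z in B, f 0 z := by
    have := constant_of_has_deriv_right_zero (f := fun t => ∫ z in B, f t z) (a := 0) (b := 1)
      (fun t _ => (hderiv t).continuousAt.continuousWithinAt)
      (fun t ht => by
        have h := (hderiv t).hasDerivWithinAt (s := Ici t)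
        rwa [hzero t ⟨ht.1, ht.2.le⟩] at h)
    exact this 1 (by simp)
  have h1 : ∫ z in B, f 1 z = 0 := by
    rw [← integral_zero (EE n) ℝ (μ := volume.restrict B)]
    refine setIntegral_congr_fun hBo.measurableSet fun z hz => ?_
    have := hcon z (ball_subset_closedBall hz)
    simp [hf, hu0 _ this.le]
  have h0 : 0 < ∫ z in B, f 0 z := by
    rw [setIntegral_pos_iff_support_of_nonneg_ae
      (Eventually.of_forall fun z => mul_nonneg u.nonneg (by positivity)) (hfi 0)]
    have hpos : f 0 p ≠ 0 := by
      have hu1 : u (0 : EE n) = 1 := u.one_of_mem_closedBall (by simpa using (by linarith : 0 ≤ τ/2))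
      simp only [hf, hp, zero_smul, sub_zero, hu1, one_mul]
      have : J p ≠ 0 := hdet
      positivity
    have hev : ∀ᶠ z in 𝓝 p, f 0 z ≠ 0 ∧ z ∈ B := by
      refine Eventually.and ?_ (hBo.mem_nhds (mem_ball_self hr))
      exact ((hfc 0).continuousAt (closedBall_mem_nhds p hr)).eventually_ne hpos
    have : (Function.support (f 0) ∩ B) ∈ 𝓝 p := hev
    exact Measure.measure_pos_of_mem_nhds volume this
  rw [h1] at hconst
  exact absurd hconst.symm h0.ne'

/-- Stability of isolated zeros. -/
lemma stability {n : ℕ} {Ω : Set (EE n)} (hΩ : IsOpen Ω) {F : EE n → EE n}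
    (hF : DifferentiableOn ℂ F Ω) {p : EE n} {r : ℝ} (hr : 0 < r)
    (hsub : closedBall p r ⊆ Ω) (hp : F p = 0) (hs : ∀ z ∈ sphere p r, F z ≠ 0) :
    ∃ η > 0, ∀ y : EE n, ‖y‖ < η → ∃ z ∈ closedBall p r, F z = y := by
  have hFc : ContinuousOn F (closedBall p r) := hF.continuousOn.mono hsub
  obtain ⟨m, hm, hmF⟩ : ∃ m > 0, ∀ z ∈ sphere p r, m ≤ ‖F z‖ := by
    rcases (sphere p r).eq_empty_or_nonempty with he | hne
    · exact ⟨1, one_pos, by simp [he]⟩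
    · obtain ⟨z, hz, hmin⟩ := (isCompact_sphere p r).exists_isMinOn hne
        (hFc.norm.mono sphere_subset_closedBall)
      exact ⟨‖F z‖, norm_pos_iff.2 (hs z hz), fun w hw => hmin hw⟩
  refine ⟨m / 4, by positivity, fun y hy => ?_⟩
  -- approximate solutions
  have happ : ∀ τ > 0, τ < m / 4 → ∃ z ∈ closedBall p r, ‖F z - y‖ ≤ 2 * τ := by
    intro τ hτ hτm
    obtain ⟨ε, hε0, hε1, hεdet⟩ : ∃ ε : ℝ, 0 < ε ∧ ε * r ≤ τ ∧
        (Jac F p + (ε : ℂ) • (1 : Matrix (Fin n) (Fin n) ℂ)).det ≠ 0 := by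
      have hfin : {x : ℂ | (Matrix.charpoly (-(Jac F p))).IsRoot x}.Finite :=
        Polynomial.finite_setOf_isRoot (Matrix.charpoly_monic _).ne_zero
      have hinf : (Ioo (0:ℝ) (τ / r)).Infinite := Ioo_infinite (by positivity)
      have hinf2 : ((fun x : ℝ => (x : ℂ)) '' (Ioo (0:ℝ) (τ / r))).Infinite :=
        hinf.image (Complex.ofReal_injective.injOn)
      obtain ⟨x, ⟨ε, hε, rfl⟩, hx⟩ := (hinf2.diff hfin).nonempty
      refine ⟨ε, hε.1, ?_, ?_⟩
      · have := hε.2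
        rw [lt_div_iff₀ hr] at this
        exact this.le
      · intro h
        apply hx
        simp only [mem_setOf_eq, Polynomial.IsRoot.def, Matrix.eval_charpoly]
        rw [← h]
        congr 1
        rw [sub_neg_eq_add, add_comm, Matrix.smul_one_eq_diagonal]
        rfl
    set G : EE n → EE n := fun z => F z + (ε : ℂ) • (z - p) with hGdef
    have hG : DifferentiableOn ℂ G Ω := hF.add (by fun_prop)
    have hJG : Jac G p = Jac F p + (ε : ℂ) • (1 : Matrix (Fin n) (Fin n) ℂ) := by
      have hFd := (hF.differentiableAt (hΩ.mem_nhds (hsub (mem_closedBall_self hr.le)))).hasFDerivAt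
      have h1 : HasFDerivAt G (fderiv ℂ F p + (ε : ℂ) • ContinuousLinearMap.id ℂ (EE n)) p :=
        hFd.add (((hasFDerivAt_id p).sub_const p).const_smul (ε : ℂ))
      ext i j
      simp only [Jac, h1.fderiv, Matrix.of_apply, Matrix.add_apply, Matrix.smul_apply]
      simp [ev, Matrix.one_apply, Pi.single_apply]
    have hGF : ∀ z ∈ closedBall p r, ‖G z - F z‖ ≤ τ := by
      intro z hz
      have : G z - F z = (ε : ℂ) • (z - p) := by simp [hGdef]
      rw [this, norm_smul, Complex.norm_real, Real.norm_eq_abs, abs_of_pos hε0]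
      rw [mem_closedBall, dist_eq_norm] at hz
      exact (mul_le_mul_of_nonneg_left hz hε0.le).trans hε1
    obtain ⟨z, hz, hzy⟩ := stability_aux hΩ hG hr hτ hsub (by simp [hGdef, hp]) (by rw [hJG]; exact hεdet)
      y (by
        intro z hz t ht
        have h1 := hmF z hz
        have h2 := hGF z (sphere_subset_closedBall hz)
        have h3 : ‖t • y‖ ≤ ‖y‖ := by
          rw [norm_smul, Real.norm_eq_abs, abs_of_nonneg ht.1]
          nlinarith [norm_nonneg y, ht.2]
        have h4 : ‖F z‖ ≤ ‖G z - t • y‖ + ‖t • y‖ + ‖G z - F z‖ := by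
          have : F z = (G z - t • y) + t • y - (G z - F z) := by abel
          calc ‖F z‖ = ‖(G z - t • y) + t • y - (G z - F z)‖ := by rw [← this]
            _ ≤ _ := (norm_sub_le _ _).trans (by gcongr; exact norm_add_le _ _)
        linarith)
    refine ⟨z, hz, ?_⟩
    have h2 := hGF z hz
    have : F z - y = (G z - y) - (G z - F z) := by abel
    rw [this]
    exact (norm_sub_le _ _).trans (by linarith)
  obtain ⟨z, hz, hmin⟩ := (isCompact_closedBall p r).exists_isMinOn ⟨p, mem_closedBall_self hr.le⟩
    (hFc.sub (continuousOn_const (c := y))).norm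
  refine ⟨z, hz, ?_⟩
  rw [← sub_eq_zero, ← norm_le_zero_iff]
  by_contra hpos
  push Not at hpos
  obtain ⟨w, hw, hw2⟩ := happ (min (m / 8) (‖F z - y‖ / 4)) (by positivity)
    ((min_le_left _ _).trans_lt (by linarith))
  have h1 : ‖F z - y‖ ≤ ‖F w - y‖ := hmin hw
  have h2 := min_le_right (m / 8) (‖F z - y‖ / 4)
  linarith

end GDJ

namespace GDJ
open Set Filter Topology MeasureTheory
open scoped ContDiff

/-- complex linear functional whose real part is the derivative of `ρ` -/
def ell {n : ℕ} (ρ : EE n → ℝ) (z : EE n) : EE n →L[ℂ] ℂ :=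
  StrongDual.extendRCLike (fderiv ℝ ρ z)

lemma ell_apply {n : ℕ} (ρ : EE n → ℝ) (z v : EE n) :
    ell ρ z v = (fderiv ℝ ρ z v : ℂ) - Complex.I * (fderiv ℝ ρ z (Complex.I • v) : ℂ) := by
  simp [ell, StrongDual.extendRCLike_apply]

lemma ell_re {n : ℕ} (ρ : EE n → ℝ) (z v : EE n) : (ell ρ z v).re = fderiv ℝ ρ z v := by
  simp [ell_apply]

lemma ell_im {n : ℕ} (ρ : EE n → ℝ) (z v : EE n) :
    (ell ρ z v).im = - fderiv ℝ ρ z (Complex.I • v) := by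
  simp [ell_apply]

lemma ell_normSq {n : ℕ} (ρ : EE n → ℝ) (z v : EE n) :
    ‖ell ρ z v‖ ^ 2 = (fderiv ℝ ρ z v) ^ 2 + (fderiv ℝ ρ z (Complex.I • v)) ^ 2 := by
  rw [← Complex.normSq_eq_norm_sq, Complex.normSq_apply, ell_re, ell_im]; ring

lemma norm_ell {n : ℕ} (ρ : EE n → ℝ) (z : EE n) : ‖ell ρ z‖ = ‖fderiv ℝ ρ z‖ := by
  simp [ell]

/-- second derivative -/
def D2 {n : ℕ} (ρ : EE n → ℝ) (z : EE n) : EE n →L[ℝ] EE n →L[ℝ] ℝ :=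
  fderiv ℝ (fderiv ℝ ρ) z

/-- Levi form -/
def Lv {n : ℕ} (ρ : EE n → ℝ) (z v : EE n) : ℝ :=
  (D2 ρ z v v + D2 ρ z (Complex.I • v) (Complex.I • v)) / 4

/-- holomorphic quadratic part of the second derivative -/
def qf {n : ℕ} (ρ : EE n → ℝ) (z v : EE n) : ℂ :=
  ((D2 ρ z v v : ℂ) - D2 ρ z (Complex.I • v) (Complex.I • v)
    - Complex.I * (D2 ρ z v (Complex.I • v) + D2 ρ z (Complex.I • v) v)) / 4

lemma half_D2_eq {n : ℕ} (ρ : EE n → ℝ) (z v : EE n) :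
    D2 ρ z v v / 2 = (qf ρ z v).re + Lv ρ z v := by
  have : (qf ρ z v).re = (D2 ρ z v v - D2 ρ z (Complex.I • v) (Complex.I • v)) / 4 := by
    have h4 : (qf ρ z v) = (((D2 ρ z v v - D2 ρ z (Complex.I • v) (Complex.I • v)) / 4 : ℝ) : ℂ)
      - Complex.I * (((D2 ρ z v (Complex.I • v) + D2 ρ z (Complex.I • v) v) / 4 : ℝ) : ℂ) := by
      rw [qf]; push_cast; ring
    rw [h4]
    simp only [Complex.sub_re, Complex.ofReal_re, Complex.mul_re, Complex.I_re, Complex.ofReal_im,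
      Complex.I_im]
    ring
  rw [this, Lv]; ring

lemma norm_I_smul' {n : ℕ} (v : EE n) : ‖Complex.I • v‖ = ‖v‖ := by
  rw [norm_smul, Complex.norm_I, one_mul]

lemma abs_D2_le {n : ℕ} (ρ : EE n → ℝ) (z v w : EE n) : |D2 ρ z v w| ≤ ‖D2 ρ z‖ * ‖v‖ * ‖w‖ := by
  have := (D2 ρ z).le_opNorm₂ v w
  rwa [Real.norm_eq_abs] at this

lemma norm_qf_le {n : ℕ} (ρ : EE n → ℝ) (z v : EE n) : ‖qf ρ z v‖ ≤ ‖D2 ρ z‖ * ‖v‖ ^ 2 := by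
  have h1 := abs_D2_le ρ z v v
  have h2 := abs_D2_le ρ z v (Complex.I • v)
  have h3 := abs_D2_le ρ z (Complex.I • v) v
  have h4 := abs_D2_le ρ z (Complex.I • v) (Complex.I • v)
  rw [norm_I_smul'] at *
  rw [qf, norm_div]
  have : ‖(4:ℂ)‖ = 4 := by simp
  rw [this, div_le_iff₀ (by norm_num)]
  calc _ ≤ ‖(D2 ρ z v v : ℂ)‖ + ‖(D2 ρ z (Complex.I • v) (Complex.I • v) : ℂ)‖
        + ‖Complex.I * (D2 ρ z v (Complex.I • v) + D2 ρ z (Complex.I • v) v)‖ :=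
        (norm_sub_le _ _).trans (add_le_add_left (norm_sub_le _ _) _)
    _ ≤ |D2 ρ z v v| + |D2 ρ z (Complex.I • v) (Complex.I • v)|
        + (|D2 ρ z v (Complex.I • v)| + |D2 ρ z (Complex.I • v) v|) := by
        rw [norm_mul, Complex.norm_I, one_mul]
        gcongr
        · simp
        · simp
        · refine (norm_add_le _ _).trans ?_
          simp
    _ ≤ _ := by nlinarith

lemma abs_Lv_le {n : ℕ} (ρ : EE n → ℝ) (z v : EE n) : |Lv ρ z v| ≤ ‖D2 ρ z‖ * ‖v‖ ^ 2 := by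
  have h1 := abs_D2_le ρ z v v
  have h4 := abs_D2_le ρ z (Complex.I • v) (Complex.I • v)
  rw [norm_I_smul'] at *
  rw [Lv, abs_div, abs_of_pos (by norm_num : (0:ℝ) < 4), div_le_iff₀ (by norm_num)]
  refine (abs_add_le _ _).trans ?_
  have : 0 ≤ ‖D2 ρ z‖ * ‖v‖ ^ 2 := by positivity
  nlinarith

/-- polynomial version: bilinear extension -/
lemma smul_I_I {n : ℕ} (v : EE n) : Complex.I • Complex.I • v = - v := by
  rw [smul_smul, Complex.I_mul_I, neg_one_smul]

lemma real_smul {n : ℕ} (a : ℝ) (v : EE n) : ((a : ℂ)) • v = a • v := by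
  exact Complex.coe_smul a v

lemma cplx_smul {n : ℕ} (c : ℂ) (v : EE n) : c • v = c.re • v + c.im • (Complex.I • v) := by
  conv_lhs => rw [← Complex.re_add_im c]
  rw [add_smul, mul_smul, real_smul, real_smul]

lemma qf_smul {n : ℕ} (ρ : EE n → ℝ) (z v : EE n) (c : ℂ) : qf ρ z (c • v) = c ^ 2 * qf ρ z v := by
  have h2 : Complex.I • (c • v) = c.re • (Complex.I • v) - c.im • v := by
    rw [cplx_smul c v, smul_add, smul_comm Complex.I c.re, smul_comm Complex.I c.im, smul_I_I, smul_neg,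
      sub_eq_add_neg]
  rw [qf, h2, cplx_smul c v, qf]
  simp only [map_add, map_sub, map_smul, ContinuousLinearMap.add_apply, ContinuousLinearMap.sub_apply,
    ContinuousLinearMap.smul_apply, smul_eq_mul]
  push_cast
  have hc : c ^ 2 = (c.re : ℂ)^2 - (c.im : ℂ)^2 + 2 * c.re * c.im * Complex.I := by
    conv_lhs => rw [← Complex.re_add_im c]
    ring_nf
    rw [Complex.I_sq]; ring
  rw [hc]
  ring_nf
  rw [Complex.I_sq]
  ring

lemma Lv_smul {n : ℕ} (ρ : EE n → ℝ) (z v : EE n) (c : ℂ) : Lv ρ z (c • v) = ‖c‖ ^ 2 * Lv ρ z v := by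
  have h2 : Complex.I • (c • v) = c.re • (Complex.I • v) - c.im • v := by
    rw [cplx_smul c v, smul_add, smul_comm Complex.I c.re, smul_comm Complex.I c.im, smul_I_I, smul_neg,
      sub_eq_add_neg]
  rw [Lv, h2, cplx_smul c v, Lv]
  simp only [map_add, map_sub, map_smul, ContinuousLinearMap.add_apply, ContinuousLinearMap.sub_apply,
    ContinuousLinearMap.smul_apply, smul_eq_mul]
  have hc : ‖c‖ ^ 2 = c.re^2 + c.im^2 := by
    rw [← Complex.normSq_eq_norm_sq, Complex.normSq_apply]; ring
  rw [hc]
  ring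

/-- bilinear version -/
def qb {n : ℕ} (ρ : EE n → ℝ) (z v w : EE n) : ℂ :=
  dz (fun x => dz (fun y => ((D2 ρ z x y : ℝ) : ℂ)) 0 w) 0 v

lemma dz_linear {n : ℕ} (Λ : EE n →L[ℝ] ℂ) (z v : EE n) :
    dz Λ z v = (Λ v - Complex.I * Λ (Complex.I • v)) / 2 := by
  rw [dz, Λ.fderiv]

lemma qb_inner {n : ℕ} (ρ : EE n → ℝ) (z x w : EE n) :
    dz (fun y => ((D2 ρ z x y : ℝ) : ℂ)) 0 w
      = ((D2 ρ z x w : ℂ) - Complex.I * (D2 ρ z x (Complex.I • w) : ℂ)) / 2 :=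
  dz_linear (Complex.ofRealCLM.comp (D2 ρ z x)) 0 w

lemma qb_eq {n : ℕ} (ρ : EE n → ℝ) (z v w : EE n) :
    qb ρ z v w = ((D2 ρ z v w : ℂ) - D2 ρ z (Complex.I • v) (Complex.I • w)
    - Complex.I * (D2 ρ z v (Complex.I • w) + D2 ρ z (Complex.I • v) w)) / 4 := by
  have := dz_linear ((1/2 : ℂ) • (Complex.ofRealCLM.comp ((D2 ρ z).flip w)
      - Complex.I • Complex.ofRealCLM.comp ((D2 ρ z).flip (Complex.I • w)))) 0 v
  rw [qb]
  have h2 : (fun x => dz (fun y => ((D2 ρ z x y : ℝ) : ℂ)) 0 w) =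
    ⇑((1/2 : ℂ) • (Complex.ofRealCLM.comp ((D2 ρ z).flip w)
      - Complex.I • Complex.ofRealCLM.comp ((D2 ρ z).flip (Complex.I • w)))) := by
    funext x
    rw [qb_inner]
    simp
    ring
  rw [h2, this]
  simp
  ring_nf
  rw [Complex.I_sq]
  ring

lemma qf_eq_sum {n : ℕ} (ρ : EE n → ℝ) (z v : EE n) :
    qf ρ z v = ∑ i, v i * ∑ j, v j * qb ρ z (ev i) (ev j) := by
  have h0 : qf ρ z v = qb ρ z v v := by rw [qb_eq, qf]
  have h1 : ∀ w, qb ρ z v w = ∑ i, v i * qb ρ z (ev i) w := by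
    intro w
    rw [qb, dz_eq_sum]
    rfl
  have h3 : ∀ a w, qb ρ z a w = ∑ j, w j * qb ρ z a (ev j) := by
    intro a w
    rw [qb]
    have h2 : (fun x => dz (fun y => ((D2 ρ z x y : ℝ) : ℂ)) 0 w) =
      fun x => ∑ j, w j * dz (fun y => ((D2 ρ z x y : ℝ) : ℂ)) 0 (ev j) := by
      funext x; rw [dz_eq_sum]
    have h5 : ∀ j, DifferentiableAt ℝ (fun x => dz (fun y => ((D2 ρ z x y : ℝ) : ℂ)) 0 (ev j)) 0 := by
      intro j
      simp only [qb_inner]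
      fun_prop
    rw [h2, dz_fun_sum]
    · refine Finset.sum_congr rfl fun j _ => ?_
      rw [dz_mul (by fun_prop) (h5 j), ← qb]
      simp [dz]
    · intro j _
      exact (h5 j).const_mul _
  rw [h0, h1]
  refine Finset.sum_congr rfl fun i _ => ?_
  rw [h3]

lemma differentiable_qf {n : ℕ} (ρ : EE n → ℝ) (z : EE n) : Differentiable ℂ (qf ρ z) := by
  have : qf ρ z = fun v => ∑ i, v i * ∑ j, v j * qb ρ z (ev i) (ev j) := by
    funext v; exact qf_eq_sum ρ z v
  rw [this]
  fun_prop

end GDJ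

namespace GDJ
open Set Filter Topology MeasureTheory
open scoped ContDiff

lemma fderiv_ofReal_comp {n : ℕ} {ρ : EE n → ℝ} {z : EE n} (h : DifferentiableAt ℝ ρ z) (v : EE n) :
    fderiv ℝ (fun w => ((ρ w : ℝ) : ℂ)) z v = (fderiv ℝ ρ z v : ℂ) := by
  have : HasFDerivAt (fun w => ((ρ w : ℝ) : ℂ)) (Complex.ofRealCLM.comp (fderiv ℝ ρ z)) z :=
    Complex.ofRealCLM.hasFDerivAt.comp z h.hasFDerivAt
  rw [this.fderiv]; simp

lemma dz_ofReal {n : ℕ} {ρ : EE n → ℝ} {z : EE n} (h : DifferentiableAt ℝ ρ z) (v : EE n) :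
    dz (fun w => ((ρ w : ℝ) : ℂ)) z v = ell ρ z v / 2 := by
  rw [dz, fderiv_ofReal_comp h, fderiv_ofReal_comp h, ell_apply]

lemma cGradPair_eq {n : ℕ} {ρ : EE n → ℝ} {z : EE n} (h : DifferentiableAt ℝ ρ z) (v : EE n) :
    cGradPair n ρ z v = ell ρ z v / 2 := by
  rw [cGradPair, ← dz_ofReal h, dz_eq_sum]
  refine Finset.sum_congr rfl fun j _ => ?_
  rw [wDz_eq, mul_comm]

lemma cHessForm_re {n : ℕ} {ρ : EE n → ℝ} {z : EE n} (h : ∀ᶠ w in 𝓝 z, DifferentiableAt ℝ ρ w)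
    (h2 : DifferentiableAt ℝ (fderiv ℝ ρ) z) (v : EE n) :
    (cHessForm n ρ z v).re = Lv ρ z v := by
  have hb : ∀ j, (fun w => wDzBar n j (fun v => ((ρ v : ℝ) : ℂ)) w) =ᶠ[𝓝 z]
      fun w => ((fderiv ℝ ρ w (ev j) : ℂ) + Complex.I * (fderiv ℝ ρ w (Complex.I • ev j) : ℂ)) / 2 := by
    intro j
    filter_upwards [h] with w hw
    have : (EuclideanSpace.single j Complex.I : EE n) = Complex.I • ev j := by
      ext i
      simp [ev]
    rw [wDzBar, this, ← ev, fderiv_ofReal_comp hw, fderiv_ofReal_comp hw]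
  have hd : ∀ a : EE n, HasFDerivAt (fun w => (fderiv ℝ ρ w a : ℂ))
      (Complex.ofRealCLM.comp ((D2 ρ z).flip a)) z := by
    intro a
    have h3 : HasFDerivAt (fun w => fderiv ℝ ρ w a) ((D2 ρ z).flip a) z := by
      have := h2.hasFDerivAt.clm_apply (hasFDerivAt_const a z)
      rw [ContinuousLinearMap.comp_zero, zero_add] at this
      exact this
    exact Complex.ofRealCLM.hasFDerivAt.comp z h3
  have hd2 : ∀ a : EE n, HasFDerivAt (fun w => ((fderiv ℝ ρ w a : ℂ) + Complex.I * (fderiv ℝ ρ w (Complex.I • a) : ℂ)) / 2)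
      ((1/2:ℂ) • (Complex.ofRealCLM.comp ((D2 ρ z).flip a) + Complex.I • Complex.ofRealCLM.comp ((D2 ρ z).flip (Complex.I • a)))) z := by
    intro a
    have := ((hd a).add ((hd (Complex.I • a)).const_mul Complex.I)).const_mul (1/2 : ℂ)
    refine this.congr_of_eventuallyEq (Eventually.of_forall fun w => ?_)
    simp only [Pi.add_apply]
    ring
  have hconj : ∀ w, ∑ j, (starRingEnd ℂ) (v j) * (((fderiv ℝ ρ w (ev j) : ℂ) + Complex.I * (fderiv ℝ ρ w (Complex.I • ev j) : ℂ)) / 2)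
      = ((fderiv ℝ ρ w v : ℂ) + Complex.I * (fderiv ℝ ρ w (Complex.I • v) : ℂ)) / 2 := by
    intro w
    have e1 : ∀ a, ((fderiv ℝ ρ w a : ℂ) + Complex.I * (fderiv ℝ ρ w (Complex.I • a) : ℂ)) / 2
       = (starRingEnd ℂ) (ell ρ w a / 2) := by
      intro a
      rw [ell_apply]; simp [Complex.conj_ofNat]
    simp only [e1]
    rw [← Complex.conj_conj (∑ j, _), map_sum]
    congr 1
    conv_rhs => rw [vec_eq_sum v]
    simp [map_sum, Finset.sum_div]
    refine Finset.sum_congr rfl fun j _ => by ring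
  have key : cHessForm n ρ z v = dz (fun w => ((fderiv ℝ ρ w v : ℂ) + Complex.I * (fderiv ℝ ρ w (Complex.I • v) : ℂ)) / 2) z v := by
    have : (fun w => ((fderiv ℝ ρ w v : ℂ) + Complex.I * (fderiv ℝ ρ w (Complex.I • v) : ℂ)) / 2) =
       fun w => ∑ j, (starRingEnd ℂ) (v j) * (((fderiv ℝ ρ w (ev j) : ℂ) + Complex.I * (fderiv ℝ ρ w (Complex.I • ev j) : ℂ)) / 2) := by
      funext w; rw [hconj]
    rw [this, dz_fun_sum]
    · rw [cHessForm, Finset.sum_comm]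
      refine Finset.sum_congr rfl fun j _ => ?_
      rw [dz_mul (by fun_prop) (hd2 (ev j)).differentiableAt]
      simp only [cHess, Matrix.of_apply, wDz_eq]
      have : dz (fun w => (starRingEnd ℂ) (v j)) z v = 0 := by simp [dz]
      rw [this]
      simp only [zero_mul, mul_zero, zero_add, add_zero]
      rw [dz_eq_sum, Finset.mul_sum]
      refine Finset.sum_congr rfl fun i _ => ?_
      rw [dz_congr (hb j)]
      ring
    · intro j _
      exact (hd2 (ev j)).differentiableAt.const_mul _
  rw [key, dz, (hd2 v).fderiv, Lv]
  simp
  ring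
  
/-- compactness -/
lemma compact_pos {X : Type*} [TopologicalSpace X] {K : Set X} (hK : IsCompact K) {f g : X → ℝ}
    (hf : ContinuousOn f K) (hg : ContinuousOn g K) (hg0 : ∀ x ∈ K, 0 ≤ g x)
    (hfg : ∀ x ∈ K, g x = 0 → 0 < f x) : ∃ A > 0, ∃ c > 0, ∀ x ∈ K, c ≤ f x + A * g x := by
  rcases K.eq_empty_or_nonempty with rfl | hne
  · exact ⟨1, one_pos, 1, one_pos, by simp⟩
  -- the set where f ≤ 0
  have hK' : IsCompact (K ∩ f ⁻¹' Iic 0) := by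
    obtain ⟨V, hV, hVe⟩ := continuousOn_iff_isClosed.1 hf (Iic 0) isClosed_Iic
    rw [inter_comm, hVe, inter_comm]
    exact hK.inter_right hV
  obtain ⟨xm, hxm, hfm⟩ := hK.exists_isMinOn hne hf
  have hA : ∃ A > 0, ∀ x ∈ K, 0 < f x + A * g x := by
    rcases (K ∩ f ⁻¹' Iic 0).eq_empty_or_nonempty with he | hne'
    · refine ⟨1, one_pos, fun x hx => ?_⟩
      have : 0 < f x := by
        by_contra hc
        have : x ∈ (∅ : Set X) := he ▸ ⟨hx, not_lt.1 hc⟩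
        exact this
      have := hg0 x hx
      linarith
    · obtain ⟨y, hy, hym⟩ := hK'.exists_isMinOn hne' (hg.mono inter_subset_left)
      have hgy : 0 < g y := by
        rcases (hg0 y hy.1).eq_or_lt with h | h
        · exact absurd (hfg y hy.1 h.symm) (not_lt.2 hy.2)
        · exact h
      refine ⟨(|f xm| + 1) / g y, by positivity, fun x hx => ?_⟩
      by_cases hfx : f x ≤ 0
      · have h1 : g y ≤ g x := hym ⟨hx, hfx⟩
        have h2 : f xm ≤ f x := hfm hx
        have h3 : (|f xm| + 1) ≤ (|f xm| + 1) / g y * g x := by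
          rw [div_mul_eq_mul_div, le_div_iff₀ hgy]
          gcongr
        have := neg_abs_le (f xm)
        linarith
      · have : 0 ≤ (|f xm| + 1) / g y * g x := mul_nonneg (by positivity) (hg0 x hx)
        linarith [not_le.1 hfx]
  obtain ⟨A, hA0, hA⟩ := hA
  obtain ⟨y, hy, hym⟩ := hK.exists_isMinOn hne (hf.add (hg.const_smul A))
  exact ⟨A, hA0, f y + A * g y, hA y hy, fun x hx => by simpa using hym hx⟩

lemma compact_pos' {X : Type*} [TopologicalSpace X] {K : Set X} (hK : IsCompact K) {f g : X → ℝ}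
    (hf : ContinuousOn f K) (hg : ContinuousOn g K) (hg0 : ∀ x ∈ K, 0 ≤ g x)
    (hfg : ∀ x ∈ K, g x = 0 → 0 < f x) : ∃ c > 0, ∀ x ∈ K, g x < c → c ≤ f x := by
  obtain ⟨A, hA, c, hc, h⟩ := compact_pos hK hf hg hg0 hfg
  refine ⟨min (c/2) (c / (2 * A)), by positivity, fun x hx hgx => ?_⟩
  have h1 := h x hx
  have h2 : A * g x ≤ c / 2 := by
    have : g x ≤ c / (2*A) := (hgx.trans_le (min_le_right _ _)).le
    calc A * g x ≤ A * (c / (2 * A)) := by gcongr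
      _ = c / 2 := by field_simp
  have := min_le_left (c/2) (c / (2 * A))
  linarith

lemma compact_bdd {X Y : Type*} [TopologicalSpace X] [SeminormedAddCommGroup Y] {K : Set X} (hK : IsCompact K) {f : X → Y}
    (hf : ContinuousOn f K) : ∃ C > 0, ∀ x ∈ K, ‖f x‖ ≤ C := by
  obtain ⟨C, hC⟩ := hK.exists_bound_of_continuousOn hf
  exact ⟨max C 1, by positivity, fun x hx => (hC x hx).trans (le_max_left _ _)⟩

end GDJ

namespace GDJ
open Set Filter Topology MeasureTheory
open scoped ContDiff

/-- quantitative data of a strictly pseudoconvex domain -/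
structure Dom {n : ℕ} (Ω : Set (EE n)) (ρ : EE n → ℝ) (c C r : ℝ) : Prop where
  op : IsOpen Ω
  bd : Bornology.IsBounded Ω
  hc : 0 < c
  hC : 1 ≤ C
  hr : 0 < r
  smooth : ∀ z ∈ Ω, ∀ w ∈ ball z r, ContDiffAt ℝ ∞ ρ w
  mem : ∀ z ∈ Ω, ∀ w ∈ ball z r, (w ∈ Ω ↔ ρ w < 0)
  d1 : ∀ z ∈ Ω, ∀ w ∈ ball z r, ‖fderiv ℝ ρ w‖ ≤ C
  d2 : ∀ z ∈ Ω, ∀ w ∈ ball z r, ‖D2 ρ w‖ ≤ C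
  t2 : ∀ z ∈ Ω, ∀ ζ : EE n, ‖ζ‖ < r → |ρ (z + ζ) - ρ z - fderiv ℝ ρ z ζ| ≤ C * ‖ζ‖ ^ 2
  t3 : ∀ z ∈ Ω, ∀ ζ : EE n, ‖ζ‖ < r →
    |ρ (z + ζ) - ρ z - fderiv ℝ ρ z ζ - D2 ρ z ζ ζ / 2| ≤ C * ‖ζ‖ ^ 3
  levi : ∀ z ∈ Ω, -c < ρ z → ∀ v, c * ‖v‖ ^ 2 ≤ Lv ρ z v
  grad : ∀ z ∈ Ω, -c < ρ z → c ≤ ‖fderiv ℝ ρ z‖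
  cpt : ∀ ε > 0, IsCompact {z ∈ Ω | ρ z ≤ -ε}
  dist : ∀ z ∈ Ω, infDist z (frontier Ω) ≤ C * (-ρ z)
  bnd : ∀ z ∈ Ω, -C ≤ ρ z

lemma continuousOn_D2 {n : ℕ} {U : Set (EE n)} {ρ : EE n → ℝ} (hU : IsOpen U) (h : ContDiffOn ℝ ∞ ρ U) :
    ContDiffOn ℝ ∞ (fderiv ℝ ρ) U ∧ ContDiffOn ℝ ∞ (D2 ρ) U := by
  have h1 : ContDiffOn ℝ ∞ (fderiv ℝ ρ) U := h.fderiv_of_isOpen hU (by simp)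
  exact ⟨h1, h1.fderiv_of_isOpen hU (by simp)⟩

lemma continuousOn_Lv {n : ℕ} {U : Set (EE n)} {ρ : EE n → ℝ} (hU : IsOpen U) (h : ContDiffOn ℝ ∞ ρ U) :
    ContinuousOn (fun p : EE n × EE n => Lv ρ p.1 p.2) (U ×ˢ univ) := by
  have h2 := (continuousOn_D2 hU h).2.continuousOn
  have h3 : ContinuousOn (fun p : EE n × EE n => D2 ρ p.1) (U ×ˢ univ) :=
    h2.comp continuousOn_fst fun p hp => hp.1
  unfold Lv
  refine ContinuousOn.div_const (ContinuousOn.add ?_ ?_) _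
  · exact (h3.clm_apply continuousOn_snd).clm_apply continuousOn_snd
  · have h4 : ContinuousOn (fun p : EE n × EE n => Complex.I • p.2) (U ×ˢ univ) :=
      by fun_prop
    exact (h3.clm_apply h4).clm_apply h4

lemma bdd_fderiv {n : ℕ} {F : Type} [NormedAddCommGroup F] [NormedSpace ℝ F] {U K : Set (EE n)} {g : EE n → F}
    (hU : IsOpen U) (hg : ContDiffOn ℝ ∞ g U) (hK : IsCompact K) (hKU : K ⊆ U) :
    ∃ C > 0, ∀ x ∈ K, ‖fderiv ℝ g x‖ ≤ C := by
  have h1 : ContDiffOn ℝ ∞ (fderiv ℝ g) U := hg.fderiv_of_isOpen hU (by simp)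
  exact compact_bdd hK (h1.continuousOn.mono hKU)

set_option maxHeartbeats 1000000 in
lemma dom_aux {n : ℕ} {Ω U : Set (EE n)} {ρ : EE n → ℝ} (hΩ : IsOpen Ω) (hb : Bornology.IsBounded Ω)
    (hU : IsOpen U) (hcl : closure Ω ⊆ U) (hs : ContDiffOn ℝ ∞ ρ U) (hdef : Ω = {z ∈ U | ρ z < 0})
    (hg : ∀ z ∈ frontier Ω, fderiv ℝ ρ z ≠ 0)
    (hL : ∀ z ∈ frontier Ω, ∀ v : EE n, v ≠ 0 → 0 < Lv ρ z v) :
    ∃ c C r, Dom Ω ρ c C r := by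
  have hK : IsCompact (closure Ω) := hb.isCompact_closure
  obtain ⟨r, hr, hrU⟩ := hK.exists_cthickening_subset_open hU hcl
  have hK2 : IsCompact (cthickening r (closure Ω)) := hK.cthickening
  obtain ⟨s1, s2⟩ := continuousOn_D2 hU hs
  obtain ⟨C1, hC1, b1⟩ := compact_bdd hK2 (s1.continuousOn.mono hrU)
  obtain ⟨C2, hC2, b2⟩ := compact_bdd hK2 (s2.continuousOn.mono hrU)
  obtain ⟨C3, hC3, b3⟩ := bdd_fderiv hU s2 hK2 hrU
  obtain ⟨C0, hC0, b0⟩ := compact_bdd hK2 (hs.continuousOn.mono hrU)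
  have hball : ∀ z ∈ Ω, ball z r ⊆ cthickening r (closure Ω) := fun z hz w hw =>
    mem_cthickening_of_dist_le w z r _ (subset_closure hz) (le_of_lt hw)
  have hΩU : Ω ⊆ U := subset_closure.trans hcl
  have hρcl : ∀ z ∈ closure Ω, ρ z ≤ 0 := by
    intro z hz
    have h1 : ContinuousWithinAt ρ Ω z := (hs.continuousOn z (hcl hz)).mono hΩU
    refine ContinuousWithinAt.closure_le hz h1 continuousWithinAt_const ?_
    intro y hy
    rw [hdef] at hy
    exact hy.2.le
  have hfr : ∀ z ∈ closure Ω, ρ z = 0 → z ∈ frontier Ω := by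
    intro z hz h0
    rw [frontier, hΩ.interior_eq]
    refine ⟨hz, fun h => ?_⟩
    rw [hdef] at h
    linarith [h.2]
  have hneg : ∀ z ∈ closure Ω, 0 ≤ - ρ z := fun z hz => by linarith [hρcl z hz]
  -- gradient
  obtain ⟨c1, hc1, g1⟩ := compact_pos' (f := fun z => ‖fderiv ℝ ρ z‖) (g := fun z => - ρ z) hK (s1.continuousOn.mono hcl).norm
    (hs.continuousOn.mono hcl).neg hneg (fun z hz h0 => norm_pos_iff.2 (hg z (hfr z hz (by linarith))))
  -- levi
  obtain ⟨c2, hc2, g2⟩ := compact_pos' (X := EE n × EE n) (K := closure Ω ×ˢ sphere 0 1) (f := fun p => Lv ρ p.1 p.2)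
    (g := fun p => - ρ p.1) (hK.prod (isCompact_sphere _ _))
    ((continuousOn_Lv hU hs).mono (prod_mono hcl (subset_univ _)))
    ((hs.continuousOn.mono hcl).comp continuousOn_fst fun p hp => hp.1).neg (fun p hp => hneg _ hp.1)
    (fun p hp h0 => hL _ (hfr _ hp.1 (by linarith)) _ (by
      intro h
      have := hp.2
      simp [h] at this))
  have hlev : ∀ z ∈ Ω, -c2 < ρ z → ∀ v, c2 * ‖v‖ ^ 2 ≤ Lv ρ z v := by
    intro z hz hzc v
    by_cases hv : v = 0
    · subst hv; simp [Lv]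
    have hv' : 0 < ‖v‖ := norm_pos_iff.2 hv
    have h1 := g2 (z, ((‖v‖⁻¹ : ℝ) : ℂ) • v) ⟨subset_closure hz, by
      rw [mem_sphere_zero_iff_norm, norm_smul]
      simp [hv]⟩ (by linarith)
    simp only [Lv_smul] at h1
    rw [Complex.norm_real, norm_inv, norm_norm] at h1
    calc c2 * ‖v‖ ^ 2 ≤ ((‖v‖⁻¹) ^ 2 * Lv ρ z v) * ‖v‖ ^ 2 := by gcongr
      _ = _ := by field_simp
  have dAt : ∀ z ∈ Ω, ∀ w ∈ ball z r, ContDiffAt ℝ ∞ ρ w := fun z hz w hw =>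
    (hs w (hrU (hball z hz hw))).contDiffAt (hU.mem_nhds (hrU (hball z hz hw)))
  have dAt1 : ∀ z ∈ Ω, ∀ w ∈ ball z r, DifferentiableAt ℝ ρ w := fun z hz w hw =>
    (dAt z hz w hw).differentiableAt (by simp)
  have dAt2 : ∀ z ∈ Ω, ∀ w ∈ ball z r, DifferentiableAt ℝ (fderiv ℝ ρ) w := fun z hz w hw =>
    ((s1 w (hrU (hball z hz hw))).contDiffAt (hU.mem_nhds (hrU (hball z hz hw)))).differentiableAt (by simp)
  have dAt3 : ∀ z ∈ Ω, ∀ w ∈ ball z r, DifferentiableAt ℝ (D2 ρ) w := fun z hz w hw =>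
    ((s2 w (hrU (hball z hz hw))).contDiffAt (hU.mem_nhds (hrU (hball z hz hw)))).differentiableAt (by simp)
  have hsub : ∀ z ζ : EE n, ‖ζ‖ < r → closedBall z ‖ζ‖ ⊆ ball z r := fun z ζ h => closedBall_subset_ball h
  have hm : ∀ z ζ : EE n, z + ζ ∈ closedBall z ‖ζ‖ := fun z ζ => by simp [mem_closedBall, dist_eq_norm]
  have hm0 : ∀ z ζ : EE n, z ∈ closedBall z ‖ζ‖ := fun z ζ => by simp
  have e1 : ∀ z ∈ Ω, ∀ ζ : EE n, ‖ζ‖ < r → ‖fderiv ℝ ρ (z + ζ) - fderiv ℝ ρ z‖ ≤ C2 * ‖ζ‖ := by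
    intro z hz ζ hζ
    have := (convex_ball z r).norm_image_sub_le_of_norm_fderiv_le (𝕜 := ℝ) (f := fderiv ℝ ρ) (C := C2) (dAt2 z hz)
      (fun w hw => b2 w (hball z hz hw)) (mem_ball_self hr) (hsub z ζ hζ (hm z ζ))
    simpa using this
  have e2 : ∀ z ∈ Ω, ∀ ζ : EE n, ‖ζ‖ < r → ‖D2 ρ (z + ζ) - D2 ρ z‖ ≤ C3 * ‖ζ‖ := by
    intro z hz ζ hζ
    have := (convex_ball z r).norm_image_sub_le_of_norm_fderiv_le (𝕜 := ℝ) (f := D2 ρ) (C := C3) (dAt3 z hz)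
      (fun w hw => b3 w (hball z hz hw)) (mem_ball_self hr) (hsub z ζ hζ (hm z ζ))
    simpa using this
  have e3 : ∀ z ∈ Ω, ∀ ζ : EE n, ‖ζ‖ < r → |ρ (z + ζ) - ρ z - fderiv ℝ ρ z ζ| ≤ C2 * ‖ζ‖ ^ 2 := by
    intro z hz ζ hζ
    have := (convex_closedBall z ‖ζ‖).norm_image_sub_le_of_norm_fderiv_le' (𝕜 := ℝ) (f := ρ) (C := C2 * ‖ζ‖)
      (φ := fderiv ℝ ρ z)
      (fun w hw => dAt1 z hz w (hsub z ζ hζ hw))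
      (fun w hw => by
        rw [mem_closedBall, dist_eq_norm] at hw
        have := e1 z hz (w - z) (hw.trans_lt hζ)
        rw [add_sub_cancel] at this
        exact this.trans (by gcongr)) (hm0 z ζ) (hm z ζ)
    simpa [pow_two, mul_assoc] using this
  have e4 : ∀ z ∈ Ω, ∀ ζ : EE n, ‖ζ‖ < r → ‖fderiv ℝ ρ (z + ζ) - fderiv ℝ ρ z - D2 ρ z ζ‖ ≤ C3 * ‖ζ‖ ^ 2 := by
    intro z hz ζ hζ
    have := (convex_closedBall z ‖ζ‖).norm_image_sub_le_of_norm_fderiv_le' (𝕜 := ℝ) (f := fderiv ℝ ρ) (C := C3 * ‖ζ‖)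
      (φ := D2 ρ z)
      (fun w hw => dAt2 z hz w (hsub z ζ hζ hw))
      (fun w hw => by
        rw [mem_closedBall, dist_eq_norm] at hw
        have := e2 z hz (w - z) (hw.trans_lt hζ)
        rw [add_sub_cancel] at this
        exact this.trans (by gcongr)) (hm0 z ζ) (hm z ζ)
    simpa [pow_two, mul_assoc] using this
  have e5 : ∀ z ∈ Ω, ∀ ζ : EE n, ‖ζ‖ < r →
      |ρ (z + ζ) - ρ z - fderiv ℝ ρ z ζ - D2 ρ z ζ ζ / 2| ≤ C3 * ‖ζ‖ ^ 3 := by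
    intro z hz ζ hζ
    have hsym : IsSymmSndFDerivAt ℝ ρ z := (dAt z hz z (mem_ball_self hr)).isSymmSndFDerivAt (by
      rw [minSmoothness_of_isRCLikeNormedField]
      exact WithTop.coe_le_coe.2 le_top)
    have hd : ∀ w ∈ closedBall z ‖ζ‖, HasFDerivAt (fun w => ρ w - D2 ρ z (w - z) (w - z) / 2)
        (fderiv ℝ ρ w - D2 ρ z (w - z)) w := by
      intro w hw
      have h1 := (dAt1 z hz w (hsub z ζ hζ hw)).hasFDerivAt
      have h2 : HasFDerivAt (fun w : EE n => w - z) (ContinuousLinearMap.id ℝ (EE n)) w :=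
        (hasFDerivAt_id w).sub_const z
      have h3 : HasFDerivAt (fun w : EE n => D2 ρ z (w - z)) ((D2 ρ z).comp (ContinuousLinearMap.id ℝ (EE n))) w :=
        (D2 ρ z).hasFDerivAt.comp w h2
      have h4 := h3.clm_apply h2
      have h5 := h1.sub (h4.const_mul (1/2 : ℝ))
      have h6 : fderiv ℝ ρ w - (1/2 : ℝ) • ((D2 ρ z (w - z)).comp (ContinuousLinearMap.id ℝ (EE n))
          + ((D2 ρ z).comp (ContinuousLinearMap.id ℝ (EE n))).flip (w - z)) = fderiv ℝ ρ w - D2 ρ z (w - z) := by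
        ext x
        have := hsym x (w - z)
        simp only [ContinuousLinearMap.sub_apply, ContinuousLinearMap.smul_apply, ContinuousLinearMap.add_apply,
          ContinuousLinearMap.comp_id, ContinuousLinearMap.flip_apply, smul_eq_mul]
        have h7 : D2 ρ z x (w - z) = D2 ρ z (w - z) x := this
        rw [h7]; ring
      rw [← h6]
      refine h5.congr_of_eventuallyEq (Eventually.of_forall fun w => ?_)
      simp only [Pi.sub_apply]
      ring
    have := (convex_closedBall z ‖ζ‖).norm_image_sub_le_of_norm_hasFDerivWithin_le' (𝕜 := ℝ)
      (f := fun w => ρ w - D2 ρ z (w - z) (w - z) / 2) (C := C3 * ‖ζ‖ ^ 2)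
      (φ := fderiv ℝ ρ z) (f' := fun w => fderiv ℝ ρ w - D2 ρ z (w - z))
      (fun w hw => (hd w hw).hasFDerivWithinAt)
      (fun w hw => by
        rw [mem_closedBall, dist_eq_norm] at hw
        have := e4 z hz (w - z) (hw.trans_lt hζ)
        rw [add_sub_cancel, sub_right_comm] at this
        exact this.trans (by gcongr)) (hm0 z ζ) (hm z ζ)
    rw [Real.norm_eq_abs] at this
    simp only [sub_self, map_zero, add_sub_cancel_left, zero_div, sub_zero] at this
    have h9 : ρ (z + ζ) - ρ z - fderiv ℝ ρ z ζ - D2 ρ z ζ ζ / 2 = ρ (z + ζ) - (D2 ρ z ζ) ζ / 2 - ρ z - (fderiv ℝ ρ z) ζ := by ring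
    rw [h9]
    calc _ ≤ _ := this
      _ = _ := by ring
  have hmemU : ∀ w ∈ U, (w ∈ Ω ↔ ρ w < 0) := by
    intro w hw
    constructor
    · intro h; rw [hdef] at h; exact h.2
    · intro h; rw [hdef]; exact ⟨hw, h⟩
  -- distance estimate
  have hdist : ∃ C > 0, ∀ z ∈ Ω, infDist z (frontier Ω) ≤ C * (-ρ z) := by
    rcases (frontier Ω).eq_empty_or_nonempty with he | ⟨y0, hy0⟩
    · refine ⟨1, one_pos, fun z hz => ?_⟩
      rw [he, infDist_empty, one_mul]
      exact hneg z (subset_closure hz)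
    obtain ⟨D, hD⟩ := hb.closure.subset_closedBall y0
    set t0 := min (r / 2) (c1 / (4 * C2)) with ht0
    have ht0p : 0 < t0 := by positivity
    set σ := min c1 (t0 * c1 / 4) with hσ
    have hσp : 0 < σ := by positivity
    refine ⟨max (|D| / σ) (4 / c1), by positivity, fun z hz => ?_⟩
    have hρz : 0 < - ρ z := by
      have := (hmemU z (hΩU hz)).1 hz; linarith
    by_cases hcase : σ ≤ - ρ z
    · have h1 : infDist z (frontier Ω) ≤ |D| := by
        refine (infDist_le_dist_of_mem hy0).trans ?_
        have := hD (subset_closure hz)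
        rw [mem_closedBall] at this
        exact this.trans (le_abs_self _)
      calc infDist z (frontier Ω) ≤ |D| := h1
        _ = |D| / σ * σ := by field_simp
        _ ≤ max (|D| / σ) (4 / c1) * (- ρ z) := by
          gcongr
          exact le_max_left _ _
    · push Not at hcase
      have hgz := g1 z (subset_closure hz) (hcase.trans_le (min_le_left _ _))
      -- direction
      have hdir : ∃ v : EE n, ‖v‖ ≤ 1 ∧ c1 / 2 ≤ fderiv ℝ ρ z v := by
        by_contra hcon
        push Not at hcon
        have : ‖fderiv ℝ ρ z‖ ≤ c1 / 2 := by
          apply ContinuousLinearMap.opNorm_le_of_unit_norm (by positivity)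
          intro x hx
          rw [Real.norm_eq_abs, abs_le]
          have := hcon x hx.le
          have h2 := hcon (-x) (by rw [norm_neg]; exact hx.le)
          rw [map_neg] at h2
          constructor <;> linarith
        linarith
      obtain ⟨v, hv1, hv2⟩ := hdir
      set t := 4 * (- ρ z) / c1 with ht
      have htp : 0 < t := by positivity
      have htt0 : t ≤ t0 := by
        rw [ht, div_le_iff₀ hc1]
        have := hcase.trans_le (min_le_right _ _)
        linarith
      have hnt : ‖t • v‖ ≤ t := by
        rw [norm_smul, Real.norm_of_nonneg htp.le]
        exact mul_le_of_le_one_right htp.le hv1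
      have htr : ‖t • v‖ < r := by
        have := min_le_left (r / 2) (c1 / (4 * C2))
        linarith
      have h3 := e3 z hz (t • v) htr
      rw [map_smul, smul_eq_mul] at h3
      have h4 := (abs_le.1 h3).1
      have h5 : C2 * ‖t • v‖ ^ 2 ≤ t * c1 / 4 := by
        have h6 : t ≤ c1 / (4 * C2) := htt0.trans (min_le_right _ _)
        calc C2 * ‖t • v‖ ^ 2 ≤ C2 * t ^ 2 := by gcongr
          _ = C2 * t * t := by ring
          _ ≤ C2 * (c1 / (4 * C2)) * t := by gcongr
          _ = _ := by field_simp
      have h7 : t * c1 = 4 * (- ρ z) := by rw [ht]; field_simp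
      have h8 : t * (c1 / 2) ≤ t * fderiv ℝ ρ z v := by gcongr
      have h9 : 0 ≤ ρ (z + t • v) := by nlinarith
      have h10 : z + t • v ∉ Ω := by
        intro h
        have := (hmemU _ (hΩU h)).1 h
        linarith
      have h11 : Ω ≠ univ := fun h => h10 (h ▸ mem_univ _)
      obtain ⟨y, hy, hyd⟩ := exists_mem_frontier_infDist_compl_eq_dist hz h11
      calc infDist z (frontier Ω) ≤ dist z y := infDist_le_dist_of_mem hy
        _ = infDist z Ωᶜ := hyd.symm
        _ ≤ dist z (z + t • v) := infDist_le_dist_of_mem h10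
        _ ≤ t := by rw [dist_self_add_right]; exact hnt
        _ = 4 / c1 * (- ρ z) := by rw [ht]; ring
        _ ≤ _ := by
          gcongr
          exact le_max_right _ _
  obtain ⟨C4, hC4, hdist⟩ := hdist
  set C := 1 + C0 + C1 + C2 + C3 + C4 with hC
  have iC : 1 ≤ C := by rw [hC]; linarith
  refine ⟨min c1 c2, C, r, hΩ, hb, by positivity, iC, hr, dAt,
    fun z hz w hw => hmemU w (hrU (hball z hz hw)), fun z hz w hw => (b1 w (hball z hz hw)).trans (by linarith),
    fun z hz w hw => (b2 w (hball z hz hw)).trans (by linarith),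
    fun z hz ζ hζ => (e3 z hz ζ hζ).trans (by gcongr; linarith),
    fun z hz ζ hζ => (e5 z hz ζ hζ).trans (by gcongr; linarith),
    fun z hz hzc v => ?_, fun z hz hzc => ?_, fun ε hε => ?_, fun z hz => (hdist z hz).trans ?_, fun z hz => ?_⟩
  · refine le_trans ?_ (hlev z hz (lt_of_le_of_lt (neg_le_neg (min_le_right _ _)) hzc) v)
    gcongr
    exact min_le_right _ _
  · exact (min_le_left _ _).trans (g1 z (subset_closure hz) (by have := min_le_left c1 c2; linarith))
  · have : {z ∈ Ω | ρ z ≤ -ε} = closure Ω ∩ ρ ⁻¹' (Iic (-ε)) := by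
      ext z
      constructor
      · rintro ⟨h1, h2⟩
        exact ⟨subset_closure h1, h2⟩
      · rintro ⟨h1, h2⟩
        refine ⟨(hmemU z (hcl h1)).2 ?_, h2⟩
        have : ρ z ≤ -ε := h2
        linarith
    rw [this]
    exact hK.of_isClosed_subset ((hs.continuousOn.mono hcl).preimage_isClosed_of_isClosed isClosed_closure isClosed_Iic)
      inter_subset_left
  · gcongr
    · exact hneg z (subset_closure hz)
    · linarith
  · have := b0 z (hball z hz (mem_ball_self hr))
    rw [Real.norm_eq_abs] at this
    have := (abs_le.1 this).1
    linarith

set_option maxHeartbeats 1000000 in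
lemma exists_dom {n : ℕ} {Ω : Set (EE n)} (h : IsStrictlyPseudoconvexDomain n ⊤ Ω) :
    ∃ ρ c C r, Dom Ω ρ c C r := by
  obtain ⟨hΩ, hb, U, ρ, ⟨hU, hcl, hs, hdef, hg⟩, hps⟩ := h
  have hs : ContDiffOn ℝ ∞ ρ U := hs
  obtain ⟨s1, s2⟩ := continuousOn_D2 hU hs
  have hfrU : frontier Ω ⊆ U := frontier_subset_closure.trans hcl
  have d1 : ∀ z ∈ U, DifferentiableAt ℝ ρ z := fun z hz =>
    ((hs z hz).contDiffAt (hU.mem_nhds hz)).differentiableAt (by simp)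
  have d2 : ∀ z ∈ U, DifferentiableAt ℝ (fderiv ℝ ρ) z := fun z hz =>
    ((s1 z hz).contDiffAt (hU.mem_nhds hz)).differentiableAt (by simp)
  have hKf : IsCompact (frontier Ω) := hb.isCompact_closure.of_isClosed_subset isClosed_frontier frontier_subset_closure
  have hell : ContinuousOn (fun p : EE n × EE n => ‖ell ρ p.1 p.2‖ ^ 2 / 4) (U ×ˢ univ) := by
    have h3 : ContinuousOn (fun p : EE n × EE n => fderiv ℝ ρ p.1) (U ×ˢ univ) :=
      s1.continuousOn.comp continuousOn_fst fun p hp => hp.1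
    simp only [ell_normSq]
    have h4 : ContinuousOn (fun p : EE n × EE n => Complex.I • p.2) (U ×ˢ univ) := by fun_prop
    exact (((h3.clm_apply continuousOn_snd).pow 2).add ((h3.clm_apply h4).pow 2)).div_const _
  obtain ⟨A, hA, c, hc, hAc⟩ := compact_pos (X := EE n × EE n) (K := frontier Ω ×ˢ sphere 0 1)
    (f := fun p => Lv ρ p.1 p.2) (g := fun p => ‖ell ρ p.1 p.2‖ ^ 2 / 4) (hKf.prod (isCompact_sphere _ _))
    ((continuousOn_Lv hU hs).mono (prod_mono hfrU (subset_univ _)))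
    (hell.mono (prod_mono hfrU (subset_univ _))) (fun p _ => by positivity)
    (by
      intro p hp h0
      have hz := hfrU hp.1
      have hv : p.2 ≠ 0 := by
        intro h
        have := hp.2
        simp [h] at this
      have h1 : ell ρ p.1 p.2 = 0 := by
        have : ‖ell ρ p.1 p.2‖ ^ 2 = 0 := by
          have h0' : ‖ell ρ p.1 p.2‖ ^ 2 / 4 = 0 := h0
          linarith
        simpa using this
      have h2 := hps p.1 hp.1 p.2.ofLp (by
        intro h
        apply hv
        ext i
        simp [h]) (by
        rw [cGradPair_eq (d1 _ hz), h1, zero_div])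
      rwa [cHessForm_re (by filter_upwards [hU.mem_nhds hz] with w hw using d1 w hw) (d2 _ hz)] at h2)
  -- new defining function
  have hρ' : ∀ z ∈ U, HasFDerivAt (fun z => Real.exp (A * ρ z) - 1) ((A * Real.exp (A * ρ z)) • fderiv ℝ ρ z) z := by
    intro z hz
    have h1 := (((d1 z hz).hasFDerivAt.const_mul A).exp).sub_const 1
    rw [smul_smul, mul_comm] at h1
    exact h1
  have hD2 : ∀ z ∈ U, ∀ v w, D2 (fun z => Real.exp (A * ρ z) - 1) z v w =
      A * Real.exp (A * ρ z) * (D2 ρ z v w + A * (fderiv ℝ ρ z v * fderiv ℝ ρ z w)) := by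
    intro z hz v w
    have e : fderiv ℝ (fun z => Real.exp (A * ρ z) - 1) =ᶠ[𝓝 z] fun z => (A * Real.exp (A * ρ z)) • fderiv ℝ ρ z := by
      filter_upwards [hU.mem_nhds hz] with w hw
      exact (hρ' w hw).fderiv
    have h1 : HasFDerivAt (fun z => A * Real.exp (A * ρ z)) (A • (Real.exp (A * ρ z) • (A • fderiv ℝ ρ z))) z :=
      (((d1 z hz).hasFDerivAt.const_mul A).exp).const_mul A
    have h2 := h1.smul (d2 z hz).hasFDerivAt
    rw [D2, e.fderiv_eq]
    have h3 := h2.fderiv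
    have h4 : (fderiv ℝ (fun z => (A * Real.exp (A * ρ z)) • fderiv ℝ ρ z) z) v w =
      ((A * Real.exp (A * ρ z)) • fderiv ℝ (fderiv ℝ ρ) z +
        (A • (Real.exp (A * ρ z) • (A • fderiv ℝ ρ z))).smulRight (fderiv ℝ ρ z)) v w := by
      rw [← h3]; rfl
    rw [h4]
    simp [D2]
    ring
  obtain ⟨c', C', r', h⟩ := dom_aux (ρ := fun z => Real.exp (A * ρ z) - 1) hΩ hb hU hcl
    ((Real.contDiff_exp.comp_contDiffOn (contDiffOn_const.mul hs)).sub contDiffOn_const)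
    (by
      rw [hdef]
      ext z
      simp only [mem_setOf_eq, sub_neg, Real.exp_lt_one_iff]
      refine and_congr_right fun _ => ?_
      constructor
      · intro h; nlinarith
      · intro h; nlinarith)
    (fun z hz => by
      rw [(hρ' z (hfrU hz)).fderiv]
      exact smul_ne_zero (by positivity) (hg z hz))
    (fun z hz v hv => by
      have hv' : 0 < ‖v‖ := norm_pos_iff.2 hv
      have h1 := hAc (z, ((‖v‖⁻¹ : ℝ) : ℂ) • v) ⟨hz, by
        rw [mem_sphere_zero_iff_norm, norm_smul]
        simp [hv]⟩
      simp only [Lv_smul, map_smul, norm_smul] at h1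
      rw [Complex.norm_real, norm_inv, norm_norm] at h1
      have h2 : 0 < Lv ρ z v + A * (‖ell ρ z v‖ ^ 2 / 4) := by
        have h3 : ‖v‖⁻¹ ^ 2 * Lv ρ z v + A * ((‖v‖⁻¹ * ‖ell ρ z v‖) ^ 2 / 4)
          = ‖v‖⁻¹ ^ 2 * (Lv ρ z v + A * (‖ell ρ z v‖ ^ 2 / 4)) := by ring
        rw [h3] at h1
        exact pos_of_mul_pos_right (hc.trans_le h1) (by positivity)
      have h4 : Lv (fun z => Real.exp (A * ρ z) - 1) z v = A * Real.exp (A * ρ z) * (Lv ρ z v + A * (‖ell ρ z v‖ ^ 2 / 4)) := by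
        rw [Lv, hD2 z (hfrU hz), hD2 z (hfrU hz), ell_normSq, Lv]
        ring
      rw [h4]
      positivity)
  exact ⟨_, _, _, _, h⟩

end GDJ

namespace GDJ
open Set Filter Topology MeasureTheory
open scoped ContDiff

lemma Dom.mono {n : ℕ} {Ω : Set (EE n)} {ρ : EE n → ℝ} {c C r c' C' r' : ℝ} (h : Dom Ω ρ c C r)
    (hc : 0 < c') (hcc : c' ≤ c) (hCC : C ≤ C') (hr : 0 < r') (hrr : r' ≤ r) : Dom Ω ρ c' C' r' where
  op := h.op
  bd := h.bd
  hc := hc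
  hC := h.hC.trans hCC
  hr := hr
  smooth z hz w hw := h.smooth z hz w (ball_subset_ball hrr hw)
  mem z hz w hw := h.mem z hz w (ball_subset_ball hrr hw)
  d1 z hz w hw := (h.d1 z hz w (ball_subset_ball hrr hw)).trans hCC
  d2 z hz w hw := (h.d2 z hz w (ball_subset_ball hrr hw)).trans hCC
  t2 z hz ζ hζ := (h.t2 z hz ζ (hζ.trans_le hrr)).trans (by gcongr)
  t3 z hz ζ hζ := (h.t3 z hz ζ (hζ.trans_le hrr)).trans (by gcongr)
  levi z hz hzc v := le_trans (by gcongr) (h.levi z hz (by linarith) v)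
  grad z hz hzc := hcc.trans (h.grad z hz (by linarith))
  cpt := h.cpt
  dist z hz := (h.dist z hz).trans (by
    have : ρ z < 0 := (h.mem z hz z (mem_ball_self h.hr)).1 hz
    have : 0 ≤ - ρ z := by linarith
    gcongr)
  bnd z hz := by linarith [h.bnd z hz]

/-- the whole setting -/
structure Setup {n : ℕ} (Ω₁ Ω₂ : Set (EE n)) (ρ₁ ρ₂ : EE n → ℝ) (c C r : ℝ) (φ : EE n → EE n) : Prop where
  D1 : Dom Ω₁ ρ₁ c C r
  D2 : Dom Ω₂ ρ₂ c C r
  holo : DifferentiableOn ℂ φ Ω₁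
  proper : IsProperMapOn n φ Ω₁ Ω₂

lemma exists_setup {n : ℕ} {Ω₁ Ω₂ : Set (EE n)} {φ : EE n → EE n}
    (h1 : IsStrictlyPseudoconvexDomain n ⊤ Ω₁) (h2 : IsStrictlyPseudoconvexDomain n ⊤ Ω₂)
    (hφ : DifferentiableOn ℂ φ Ω₁) (hp : IsProperMapOn n φ Ω₁ Ω₂) :
    ∃ ρ₁ ρ₂ c C r, Setup Ω₁ Ω₂ ρ₁ ρ₂ c C r φ := by
  obtain ⟨ρ₁, c₁, C₁, r₁, d1⟩ := exists_dom h1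
  obtain ⟨ρ₂, c₂, C₂, r₂, d2⟩ := exists_dom h2
  have := d1.hc
  have := d2.hc
  have := d1.hr
  have := d2.hr
  exact ⟨ρ₁, ρ₂, min c₁ c₂, max C₁ C₂, min r₁ r₂,
    d1.mono (by positivity) (min_le_left _ _) (le_max_left _ _) (by positivity) (min_le_left _ _),
    d2.mono (by positivity) (min_le_right _ _) (le_max_right _ _) (by positivity) (min_le_right _ _), hφ, hp⟩

lemma Dom.neg {n : ℕ} {Ω : Set (EE n)} {ρ : EE n → ℝ} {c C r : ℝ} (h : Dom Ω ρ c C r) {z : EE n} (hz : z ∈ Ω) :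
    ρ z < 0 := (h.mem z hz z (mem_ball_self h.hr)).1 hz

lemma Dom.cont {n : ℕ} {Ω : Set (EE n)} {ρ : EE n → ℝ} {c C r : ℝ} (h : Dom Ω ρ c C r) :
    ContinuousOn ρ Ω := fun z hz =>
  (h.smooth z hz z (mem_ball_self h.hr)).continuousAt.continuousWithinAt

lemma compact_neg {X : Type*} [TopologicalSpace X] {K : Set X} (hK : IsCompact K) {f : X → ℝ}
    (hf : ContinuousOn f K) (hg0 : ∀ x ∈ K, f x < 0) : ∃ ε > 0, ∀ x ∈ K, f x ≤ -ε := by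
  rcases K.eq_empty_or_nonempty with rfl | hne
  · exact ⟨1, one_pos, by simp⟩
  obtain ⟨x, hx, hm⟩ := hK.exists_isMaxOn hne hf
  exact ⟨- f x, by linarith [hg0 x hx], fun y hy => by have : f y ≤ f x := hm hy; linarith⟩

section
variable {n : ℕ} {Ω₁ Ω₂ : Set (EE n)} {ρ₁ ρ₂ : EE n → ℝ} {c C r : ℝ} {φ : EE n → EE n}

lemma Setup.down (S : Setup Ω₁ Ω₂ ρ₁ ρ₂ c C r φ) {ε : ℝ} (hε : 0 < ε) :
    ∃ ε' > 0, ∀ z ∈ Ω₁, ρ₂ (φ z) ≤ -ε → ρ₁ z ≤ -ε' := by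
  have hK := S.proper.2 _ (fun z hz => hz.1) (S.D2.cpt ε hε)
  obtain ⟨ε', h1, h2⟩ := compact_neg hK (S.D1.cont.mono fun z hz => hz.1) (fun z hz => S.D1.neg hz.1)
  exact ⟨ε', h1, fun z hz h => h2 z ⟨hz, S.proper.1 hz, h⟩⟩

lemma Setup.up (S : Setup Ω₁ Ω₂ ρ₁ ρ₂ c C r φ) {ε : ℝ} (hε : 0 < ε) :
    ∃ ε' > 0, ∀ z ∈ Ω₁, ρ₁ z ≤ -ε → ρ₂ (φ z) ≤ -ε' := by
  obtain ⟨ε', h1, h2⟩ := compact_neg (f := fun z => ρ₂ (φ z)) (S.D1.cpt ε hε)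
    (S.D2.cont.comp (S.holo.continuousOn.mono fun z hz => hz.1) fun z hz => S.proper.1 hz.1)
    (fun z hz => S.D2.neg (S.proper.1 hz.1))
  exact ⟨ε', h1, fun z hz h => h2 z ⟨hz, h⟩⟩

lemma exists_unit (ℓ : EE n →L[ℂ] ℂ) (h : ℓ ≠ 0) : ∃ ν : EE n, ‖ν‖ = 1 ∧ ∀ v, ℓ v = ‖ℓ‖ * inner ℂ ν v := by
  set y := (InnerProductSpace.toDual ℂ (EE n)).symm ℓ with hy
  have hn : ‖y‖ = ‖ℓ‖ := by rw [hy]; exact LinearIsometryEquiv.norm_map _ _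
  have h0 : 0 < ‖ℓ‖ := norm_pos_iff.2 h
  refine ⟨((‖ℓ‖⁻¹ : ℝ) : ℂ) • y, ?_, fun v => ?_⟩
  · rw [norm_smul, hn]; simp [h0.ne']
  · rw [inner_smul_left, hy, InnerProductSpace.toDual_symm_apply]
    simp [h0.ne']

/-- lower Levi estimate -/
lemma Dom.lower {Ω : Set (EE n)} {ρ : EE n → ℝ} (h : Dom Ω ρ c C r) {z : EE n} (hz : z ∈ Ω) (hzc : -c < ρ z)
    {ζ : EE n} (hζ : ‖ζ‖ < r) (hζ2 : C * ‖ζ‖ ≤ c / 2) :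
    ρ z + (ell ρ z ζ + qf ρ z ζ).re + c / 2 * ‖ζ‖ ^ 2 ≤ ρ (z + ζ) := by
  have h1 := (abs_le.1 (h.t3 z hz ζ hζ)).1
  have h2 := h.levi z hz hzc ζ
  rw [half_D2_eq] at h1
  rw [Complex.add_re, ell_re]
  have h3 : C * ‖ζ‖ ^ 3 ≤ c / 2 * ‖ζ‖ ^ 2 := by
    calc C * ‖ζ‖ ^ 3 = C * ‖ζ‖ * ‖ζ‖ ^ 2 := by ring
      _ ≤ _ := by gcongr
  linarith

lemma no_local_max {Ω : Set (EE n)} {ρ : EE n → ℝ} (h : Dom Ω ρ c C r) (hφ : DifferentiableOn ℂ φ Ω)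
    {z : EE n} (hz : z ∈ Ω) (hzc : -c < ρ z) {ν wc : EE n} (hν : ‖ν‖ = 1) {τ : ℂ} (hτ : τ ≠ 0)
    (hφz : φ z = wc + τ • ν) (ε : ℝ)
    (hmax : ∀ᶠ w in 𝓝 z, ∀ τ' : ℂ, φ w = wc + τ' • ν → ρ w - ε * Real.log ‖τ'‖ ≤ ρ z - ε * Real.log ‖τ‖) :
    False := by
  have hνν : inner ℂ ν ν = (1 : ℂ) := by
    rw [inner_self_eq_norm_sq_to_K, hν]; simp
  set T : EE n → ℂ := fun w => inner ℂ ν (φ w - wc) with hT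
  have hTz : T z = τ := by simp [hT, hφz, inner_smul_right, hν]
  have hTd : DifferentiableOn ℂ T Ω := by
    have : DifferentiableOn ℂ (fun w => innerSL ℂ ν (φ w - wc)) Ω :=
      (innerSL ℂ ν).differentiable.comp_differentiableOn (hφ.sub_const wc)
    simpa using this
  set P : EE n → ℂ := fun w => ell ρ z (w - z) + qf ρ z (w - z) - ε * Complex.log (T w / τ) with hP
  set F : EE n → EE n := fun w => (φ w - φ z) - (inner ℂ ν (φ w - φ z) : ℂ) • ν + P w • ν with hF
  have hTc : ContinuousAt T z := (hTd.differentiableAt (h.op.mem_nhds hz)).continuousAt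
  have hslit : ∀ᶠ w in 𝓝 z, T w / τ ∈ slitPlane := by
    have : ContinuousAt (fun w => T w / τ) z := hTc.div_const τ
    apply this.preimage_mem_nhds
    simp only [hTz, div_self hτ]
    exact isOpen_slitPlane.mem_nhds (by simp)
  have hr := h.hr
  have hc := h.hc
  have hC : 0 < C := by linarith [h.hC]
  have hsmall : ∀ᶠ w in 𝓝 z, ‖w - z‖ < min r (c / (2 * C)) := by
    have : ball z (min r (c / (2 * C))) ∈ 𝓝 z := ball_mem_nhds _ (by positivity)
    filter_upwards [this] with w hw
    rwa [mem_ball, dist_eq_norm] at hw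
  have hall := ((hslit.and hsmall).and hmax).and (h.op.mem_nhds hz)
  obtain ⟨R, hR, hRb⟩ := Metric.eventually_nhds_iff_ball.1 hall
  have key : ∀ w ∈ ball z R, (φ w - φ z) - (inner ℂ ν (φ w - φ z) : ℂ) • ν = 0 →
      (P w).re ≤ - (c / 2 * ‖w - z‖ ^ 2) := by
    intro w hw h0
    obtain ⟨⟨⟨h1, h2⟩, h3⟩, h4⟩ := hRb w hw
    have h5 : φ w = wc + T w • ν := by
      have : φ w - φ z = (inner ℂ ν (φ w - φ z) : ℂ) • ν := sub_eq_zero.1 h0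
      have h6 : T w = τ + inner ℂ ν (φ w - φ z) := by
        rw [← hTz, hT]
        simp only
        rw [← inner_add_right]; congr 1; abel
      rw [h6, add_smul, ← this, hφz]; abel
    have h7 := h3 (T w) h5
    have h8 := h.lower (ζ := w - z) hz hzc (h2.trans_le (min_le_left _ _)) (by
      have : ‖w - z‖ ≤ c / (2 * C) := (h2.trans_le (min_le_right _ _)).le
      calc C * ‖w - z‖ ≤ C * (c / (2 * C)) := by gcongr
        _ = c / 2 := by field_simp)
    rw [add_sub_cancel] at h8
    have hTw : T w ≠ 0 := by
      intro h9
      rw [h9, zero_div] at h1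
      simp at h1
    have h9 : (P w).re = (ell ρ z (w - z) + qf ρ z (w - z)).re - ε * (Real.log ‖T w‖ - Real.log ‖τ‖) := by
      rw [hP]
      simp only [Complex.sub_re, Complex.re_ofReal_mul, Complex.log_re, norm_div]
      rw [Real.log_div (norm_ne_zero_iff.2 hTw) (norm_ne_zero_iff.2 hτ)]
    rw [h9]
    nlinarith
  have hdecomp : ∀ w (a : ℂ), F w = a • ν → (φ w - φ z) - (inner ℂ ν (φ w - φ z) : ℂ) • ν = 0 ∧ P w = a := by
    intro w a hw
    have h1 : inner ℂ ν (F w) = a := by rw [hw, inner_smul_right, hνν, mul_one]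
    have h2 : inner ℂ ν (F w) = P w := by
      simp only [hF, inner_add_right, inner_sub_right, inner_smul_right, hνν]
      ring
    have h3 : P w = a := by rw [← h2, h1]
    refine ⟨?_, h3⟩
    have : (φ w - φ z) - (inner ℂ ν (φ w - φ z) : ℂ) • ν + P w • ν = a • ν := hw
    rw [h3] at this
    simpa using this
  have hFd : DifferentiableOn ℂ F (ball z R) := by
    intro w hw
    obtain ⟨⟨⟨h1, h2⟩, h3⟩, h4⟩ := hRb w hw
    have dφ : DifferentiableAt ℂ φ w := hφ.differentiableAt (h.op.mem_nhds h4)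
    have dT : DifferentiableAt ℂ T w := hTd.differentiableAt (h.op.mem_nhds h4)
    have dP : DifferentiableAt ℂ P w := by
      refine DifferentiableAt.sub (DifferentiableAt.add ?_ ?_) ?_
      · exact (ell ρ z).differentiableAt.comp w (differentiableAt_id.sub_const z)
      · exact ((differentiable_qf ρ z) (w - z)).comp w (differentiableAt_id.sub_const z)
      · have e1 : DifferentiableAt ℂ (fun w => T w / τ) w := by
          simp only [div_eq_mul_inv]
          exact dT.mul_const _
        exact DifferentiableAt.const_mul (e1.clog h1) _
    have dI : DifferentiableAt ℂ (fun w => inner ℂ ν (φ w - φ z)) w := by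
      have : DifferentiableAt ℂ (fun w => innerSL ℂ ν (φ w - φ z)) w :=
        (innerSL ℂ ν).differentiableAt.comp w (dφ.sub_const _)
      exact this
    exact (((dφ.sub_const _).sub (dI.smul_const ν)).add (dP.smul_const ν)).differentiableWithinAt
  have hFz : F z = 0 := by
    simp [hF, hP, hTz, hτ, qf]
  obtain ⟨η, hη, hst⟩ := stability isOpen_ball hFd (p := z) (r := R / 2) (by positivity)
    (closedBall_subset_ball (by linarith)) hFz (fun w hw h0 => by
      obtain ⟨h1, h2⟩ := hdecomp w 0 (by rw [h0, zero_smul])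
      rw [mem_sphere, dist_eq_norm] at hw
      have := key w (by rw [mem_ball, dist_eq_norm, hw]; linarith) h1
      rw [h2, hw] at this
      simp only [Complex.zero_re] at this
      have : 0 < c / 2 * (R / 2) ^ 2 := by positivity
      linarith)
  obtain ⟨w, hw, hwF⟩ := hst (((η / 2 : ℝ) : ℂ) • ν) (by
    rw [norm_smul, hν, Complex.norm_real, Real.norm_of_nonneg (by positivity)]; linarith)
  obtain ⟨h1, h2⟩ := hdecomp w _ hwF
  have := key w (closedBall_subset_ball (by linarith) hw) h1
  rw [h2, Complex.ofReal_re] at this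
  have : 0 ≤ c / 2 * ‖w - z‖ ^ 2 := by positivity
  linarith

end
end GDJ

namespace GDJ
open Set Filter Topology MeasureTheory
open scoped ContDiff

section
variable {n : ℕ} {Ω₁ Ω₂ : Set (EE n)} {ρ₁ ρ₂ : EE n → ℝ} {c C r : ℝ} {φ : EE n → EE n}

/-- Upper bound for `ρ` on a complex normal line. -/
lemma Dom.line_upper {Ω : Set (EE n)} {ρ : EE n → ℝ} (h : Dom Ω ρ c C r) {w : EE n} (hw : w ∈ Ω)
    {ν : EE n} (hν : ‖ν‖ = 1) {g : ℝ} (hg : ∀ v, ell ρ w v = g * inner ℂ ν v)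
    (σ : ℂ) (hσ : ‖σ‖ < r) : |ρ (w + σ • ν) - ρ w - g * σ.re| ≤ C * ‖σ‖ ^ 2 := by
  have h1 := h.t2 w hw (σ • ν) (by rwa [norm_smul, hν, mul_one])
  rw [norm_smul, hν, mul_one, ← ell_re, hg, inner_smul_right, inner_self_eq_norm_sq_to_K, hν] at h1
  simpa using h1

set_option maxHeartbeats 2000000 in
lemma Setup.hopf_near (S : Setup Ω₁ Ω₂ ρ₁ ρ₂ c C r φ) :
    ∃ K > 0, ∃ η₀ > 0, ∀ z ∈ Ω₁, -η₀ < ρ₂ (φ z) → -ρ₂ (φ z) ≤ K * (-ρ₁ z) := by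
  have hc := S.D1.hc
  have hr := S.D1.hr
  have hC1 := S.D1.hC
  have hC : 0 < C := by linarith
  obtain ⟨s, hs, hup⟩ := S.up hc
  obtain ⟨a, ha, ha1, ha2, ha3, ha4⟩ : ∃ a > 0, 4 * a ≤ r ∧ 2 * C * a ≤ c ∧ 3 * a ≤ 1 ∧ 12 * C * a ≤ s := by
    refine ⟨min (min (r/4) (c/(2*C))) (min (1/3) (s/(12*C))), by positivity, ?_, ?_, ?_, ?_⟩
    · have := (min_le_left (min (r/4) (c/(2*C))) (min (1/3) (s/(12*C)))).trans (min_le_left _ _)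
      linarith
    · have := (min_le_left (min (r/4) (c/(2*C))) (min (1/3) (s/(12*C)))).trans (min_le_right _ _)
      rw [le_div_iff₀ (by positivity)] at this
      linarith
    · have := (min_le_right (min (r/4) (c/(2*C))) (min (1/3) (s/(12*C)))).trans (min_le_left _ _)
      linarith
    · have := (min_le_right (min (r/4) (c/(2*C))) (min (1/3) (s/(12*C)))).trans (min_le_right _ _)
      rw [le_div_iff₀ (by positivity)] at this
      linarith
  obtain ⟨c₀, hc₀, hdown⟩ := S.down (ε := 3/8 * c * a) (by positivity)
  have hl4 : 0 < Real.log 4 := Real.log_pos (by norm_num)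
  set ε := c₀ / Real.log 4 with hε
  have hεp : 0 < ε := by positivity
  refine ⟨4 * C * a / ε, by positivity, min (min c (s/2)) (2 * c * a), by positivity, fun z₀ hz₀ hzη => ?_⟩
  set w₀ := φ z₀ with hw₀
  have hw₀Ω : w₀ ∈ Ω₂ := S.proper.1 hz₀
  set η := - ρ₂ w₀ with hη
  have hη0 : 0 < η := by have := S.D2.neg hw₀Ω; linarith
  have hηm : η < min (min c (s/2)) (2 * c * a) := by linarith
  have hηc : η < c := hηm.trans_le ((min_le_left _ _).trans (min_le_left _ _))
  have hηs : η < s / 2 := hηm.trans_le ((min_le_left _ _).trans (min_le_right _ _))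
  have hηa : η < 2 * c * a := hηm.trans_le (min_le_right _ _)
  have hg1 := S.D2.grad w₀ hw₀Ω (by linarith)
  have hg2 := S.D2.d1 w₀ hw₀Ω w₀ (mem_ball_self hr)
  rw [← norm_ell] at hg1 hg2
  obtain ⟨ν, hν, hνℓ⟩ := exists_unit (ell ρ₂ w₀) (by
    intro h; rw [h, norm_zero] at hg1; linarith)
  set g := ‖ell ρ₂ w₀‖ with hg
  have hgp : 0 < g := by linarith
  have hνν : inner ℂ ν ν = (1 : ℂ) := by
    rw [inner_self_eq_norm_sq_to_K, hν]; simp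
  set d := η / (2 * g) with hd
  have hdp : 0 < d := by positivity
  have hda : d ≤ a := by
    rw [hd, div_le_iff₀ (by positivity)]; nlinarith
  have hdg : 2 * g * d = η := by rw [hd]; field_simp
  set R := a + d with hR
  set wc := w₀ - (a : ℂ) • ν with hwc
  have hpt : ∀ τ : ℂ, wc + τ • ν = w₀ + (τ - a) • ν := by
    intro τ; rw [hwc, sub_smul]; abel
  have hnorm : ∀ τ : ℂ, ‖τ - a‖ ^ 2 = ‖τ‖ ^ 2 - 2 * a * τ.re + a ^ 2 := by
    intro τ
    rw [← Complex.normSq_eq_norm_sq, ← Complex.normSq_eq_norm_sq, Complex.normSq_apply, Complex.normSq_apply]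
    simp; ring
  have hsm : ∀ τ : ℂ, ‖τ‖ ≤ R → ‖τ - a‖ ≤ 3 * a := by
    intro τ hτ
    have := norm_sub_le τ (a : ℂ)
    rw [Complex.norm_real, Real.norm_of_nonneg ha.le] at this
    linarith
  have hline : ∀ τ : ℂ, ‖τ‖ ≤ R → |ρ₂ (wc + τ • ν) + η - g * (τ.re - a)| ≤ C * ‖τ - a‖ ^ 2 := by
    intro τ hτ
    have h1 := S.D2.line_upper hw₀Ω hν hνℓ (τ - a) (by have := hsm τ hτ; linarith)
    rw [hpt]
    simp only [Complex.sub_re, Complex.ofReal_re] at h1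
    have h2 : ρ₂ (w₀ + (τ - a) • ν) + η - g * (τ.re - a) = ρ₂ (w₀ + (τ - a) • ν) - ρ₂ w₀ - g * (τ.re - a) := by
      rw [hη]; ring
    rw [h2]; exact h1
  have hCg : 2 * C * a ≤ g := by linarith
  have hΩ : ∀ τ : ℂ, ‖τ‖ ≤ R → wc + τ • ν ∈ Ω₂ := by
    intro τ hτ
    have h1 := (abs_le.1 (hline τ hτ)).2
    have hrb : wc + τ • ν ∈ ball w₀ r := by
      rw [hpt, mem_ball, dist_eq_norm, add_sub_cancel_left, norm_smul, hν, mul_one]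
      have := hsm τ hτ; linarith
    rw [S.D2.mem w₀ hw₀Ω _ hrb]
    rw [hnorm] at h1
    have h2 : τ.re ≤ R := (Complex.re_le_norm τ).trans hτ
    have h3 : ‖τ‖ ^ 2 ≤ R ^ 2 := by gcongr
    have h4 : (g - 2 * C * a) * τ.re ≤ (g - 2 * C * a) * R := mul_le_mul_of_nonneg_left h2 (by linarith)
    have h5 : C * ‖τ‖^2 ≤ C * R^2 := by gcongr
    have h6 : C * d ^ 2 ≤ g * d / 2 := by nlinarith
    have h7 : C * (R - a)^2 = C * d^2 := by rw [hR]; ring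
    nlinarith
  have hin : ∀ τ : ℂ, ‖τ‖ = a / 2 → ρ₂ (wc + τ • ν) ≤ -(3/8 * c * a) := by
    intro τ hτ
    have h1 := (abs_le.1 (hline τ (by rw [hτ]; linarith))).2
    rw [hnorm, hτ] at h1
    have h2 : τ.re ≤ a / 2 := (Complex.re_le_norm τ).trans hτ.le
    have h4 : (g - 2 * C * a) * τ.re ≤ (g - 2 * C * a) * (a/2) := mul_le_mul_of_nonneg_left h2 (by linarith)
    nlinarith
  have hann : ∀ τ : ℂ, ‖τ‖ ≤ R → -s < ρ₂ (wc + τ • ν) := by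
    intro τ hτ
    have h1 := (abs_le.1 (hline τ hτ)).1
    have h2 := hsm τ hτ
    have h3 : |(τ - a).re| ≤ ‖τ - a‖ := Complex.abs_re_le_norm _
    have h4 : -(3 * a) ≤ τ.re - a := by
      have := (abs_le.1 (h3.trans h2)).1
      simpa using this
    have h5 : -(C * (3 * a)) ≤ g * (τ.re - a) := by
      have : g * (-(3*a)) ≤ g * (τ.re - a) := by gcongr
      have : g * (3 * a) ≤ C * (3 * a) := by gcongr
      linarith
    have h6 : ‖τ - a‖ ^ 2 ≤ 3 * a := by
      have : ‖τ - a‖ ^ 2 ≤ (3 * a) ^ 2 := by gcongr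
      exact this.trans (by rw [pow_two]; exact mul_le_of_le_one_left (by positivity) ha3)
    have h7 : C * ‖τ - a‖ ^ 2 ≤ C * (3 * a) := by gcongr
    linarith
  -- the compact set
  set KL : Set (EE n) := (fun τ : ℂ => wc + τ • ν) '' (closedBall 0 R ∩ {τ | a / 2 ≤ ‖τ‖}) with hKL
  have hKLc : IsCompact KL := by
    apply IsCompact.image
    · exact (isCompact_closedBall _ _).inter_right (isClosed_le continuous_const continuous_norm)
    · fun_prop
  have hKLΩ : KL ⊆ Ω₂ := by
    rintro w ⟨τ, ⟨h1, h2⟩, rfl⟩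
    exact hΩ τ (by simpa using h1)
  have hX := S.proper.2 KL hKLΩ hKLc
  set X := {z ∈ Ω₁ | φ z ∈ KL} with hXdef
  set T : EE n → ℂ := fun w => inner ℂ ν (φ w - wc) with hT
  have hTd : DifferentiableOn ℂ T Ω₁ := by
    have : DifferentiableOn ℂ (fun w => innerSL ℂ ν (φ w - wc)) Ω₁ :=
      (innerSL ℂ ν).differentiable.comp_differentiableOn (S.holo.sub_const wc)
    exact this
  have hTeq : ∀ z τ, φ z = wc + τ • ν → T z = τ := by
    intro z τ h
    simp [hT, h, inner_smul_right, hν]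
  have hXT : ∀ z ∈ X, z ∈ Ω₁ ∧ φ z = wc + T z • ν ∧ ‖T z‖ ≤ R ∧ a / 2 ≤ ‖T z‖ := by
    rintro z ⟨h1, τ, ⟨h2, h3⟩, h4⟩
    have h5 := hTeq z τ h4.symm
    rw [h5]
    exact ⟨h1, h4.symm, by simpa using h2, h3⟩
  have hz₀T : φ z₀ = wc + (a : ℂ) • ν := by
    rw [hwc]; simp [hw₀]
  have hTz₀ := hTeq z₀ a hz₀T
  have hz₀X : z₀ ∈ X := ⟨hz₀, a, ⟨by simp [abs_of_pos ha]; linarith, by simp [abs_of_pos ha]; linarith⟩, hz₀T.symm⟩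
  set V : EE n → ℝ := fun z => ρ₁ z - ε * Real.log ‖T z‖ with hV
  have hVc : ContinuousOn V X := by
    refine (S.D1.cont.mono fun z hz => hz.1).sub (ContinuousOn.mul continuousOn_const ?_)
    refine ContinuousOn.log (hTd.continuousOn.mono fun z hz => hz.1).norm ?_
    intro z hz
    have := (hXT z hz).2.2.2
    linarith
  obtain ⟨z, hzX, hzmax⟩ := hX.exists_isMaxOn ⟨z₀, hz₀X⟩ hVc
  obtain ⟨hzΩ, hφz, hTR, hTa⟩ := hXT z hzX
  have hTp : 0 < ‖T z‖ := by linarith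
  have hVz : V z ≤ - (ε * Real.log R) := by
    by_contra hcon
    push Not at hcon
    have hTR' : ‖T z‖ < R := by
      refine lt_of_le_of_ne hTR fun h => ?_
      simp only [hV] at hcon
      rw [h] at hcon
      have := S.D1.neg hzΩ
      linarith
    have hTa' : a / 2 < ‖T z‖ := by
      refine lt_of_le_of_ne hTa fun h => ?_
      have h1 := hin (T z) h.symm
      rw [← hφz] at h1
      have h2 := hdown z hzΩ h1
      simp only [hV] at hcon
      rw [← h] at hcon
      have h3 : Real.log R - Real.log (a/2) ≤ Real.log 4 := by
        rw [← Real.log_div (by positivity) (by positivity)]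
        apply Real.log_le_log (by positivity)
        rw [div_le_iff₀ (by positivity)]
        linarith
      have h4 : ε * (Real.log R - Real.log (a/2)) ≤ ε * Real.log 4 := by gcongr
      have h5 : ε * Real.log 4 = c₀ := by rw [hε]; field_simp
      linarith
    have hzc : -c < ρ₁ z := by
      by_contra hh
      push Not at hh
      have h1 := hup z hzΩ hh
      have h2 := hann (T z) hTR
      rw [← hφz] at h2
      linarith
    refine no_local_max S.D1 S.holo hzΩ hzc hν (norm_pos_iff.1 hTp) hφz ε ?_
    have hTc : ContinuousAt T z := (hTd.differentiableAt (S.D1.op.mem_nhds hzΩ)).continuousAt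
    have e1 : ∀ᶠ w in 𝓝 z, ‖T w‖ < R := hTc.norm.eventually_lt continuousAt_const hTR'
    have e2 : ∀ᶠ w in 𝓝 z, a / 2 < ‖T w‖ := continuousAt_const.eventually_lt hTc.norm hTa'
    filter_upwards [e1, e2, S.D1.op.mem_nhds hzΩ] with w h1 h2 h3 τ' hτ'
    have h4 := hTeq w τ' hτ'
    have h5 : w ∈ X := ⟨h3, τ', ⟨by rw [← h4]; simpa using h1.le, by rw [← h4]; exact h2.le⟩, hτ'.symm⟩
    have h6 : V w ≤ V z := hzmax h5
    simp only [hV] at h6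
    rwa [h4] at h6
  have hfin : V z₀ ≤ V z := hzmax hz₀X
  have h1 : ρ₁ z₀ - ε * Real.log a ≤ - (ε * Real.log R) := by
    have h2 : V z₀ = ρ₁ z₀ - ε * Real.log a := by
      simp only [hV, hTz₀, Complex.norm_real, Real.norm_of_nonneg ha.le]
    linarith
  have h2 : d / (2 * a) ≤ Real.log R - Real.log a := by
    rw [← Real.log_div (by positivity) (by positivity)]
    refine le_trans ?_ (Real.one_sub_inv_le_log_of_pos (by positivity))
    rw [inv_div]
    have hRp : (0:ℝ) < R := by positivity
    have : 1 - a / R = d / R := by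
      rw [eq_div_iff hRp.ne', sub_mul, div_mul_cancel₀ _ hRp.ne']; rw [hR]; ring
    rw [this]
    gcongr
    linarith
  have h3 : ε * (d / (2 * a)) ≤ ε * (Real.log R - Real.log a) := by gcongr
  have h4 : ε * (d / (2 * a)) ≤ - ρ₁ z₀ := by linarith
  have h5 : d = η / (2 * g) := hd
  calc η = 2 * g * d := hdg.symm
    _ ≤ 2 * C * d := by gcongr
    _ = 4 * C * a / ε * (ε * (d / (2 * a))) := by field_simp; ring
    _ ≤ 4 * C * a / ε * (- ρ₁ z₀) := by gcongr

lemma Setup.hopf (S : Setup Ω₁ Ω₂ ρ₁ ρ₂ c C r φ) :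
    ∃ K > 0, ∀ z ∈ Ω₁, -ρ₂ (φ z) ≤ K * (-ρ₁ z) := by
  obtain ⟨K, hK, η, hη, h⟩ := S.hopf_near
  obtain ⟨e, he, hd⟩ := S.down hη
  have hC := S.D1.hC
  refine ⟨max K (C / e), by positivity, fun z hz => ?_⟩
  have hn := S.D1.neg hz
  by_cases hz2 : -η < ρ₂ (φ z)
  · refine (h z hz hz2).trans ?_
    have : 0 ≤ - ρ₁ z := by linarith
    gcongr
    exact le_max_left _ _
  · have h1 := hd z hz (not_lt.1 hz2)
    have h2 := S.D2.bnd _ (S.proper.1 hz)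
    calc -ρ₂ (φ z) ≤ C := by linarith
      _ = C / e * e := by field_simp
      _ ≤ max K (C / e) * (-ρ₁ z) := by
        gcongr
        · exact le_max_right _ _
        · linarith

end
end GDJ

namespace GDJ
open Set Filter Topology MeasureTheory
open scoped ContDiff

lemma disc_max {u : ℂ → ℝ} (hu : ContinuousOn u (closedBall 0 1))
    (hm : ∀ ζ ∈ ball (0:ℂ) 1, ∃ h : ℂ → ℂ, (∀ᶠ x in 𝓝 ζ, DifferentiableAt ℂ h x) ∧ h ζ = 0 ∧
      ∀ᶠ x in 𝓝 ζ, u ζ + (h x).re ≤ u x) (hb : ∀ ζ, ‖ζ‖ = 1 → u ζ ≤ 0) : u 0 ≤ 0 := by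
  refine le_of_forall_pos_le_add fun ε hε => ?_
  have hc : ContinuousOn (fun ζ : ℂ => u ζ + ε * ‖ζ‖ ^ 2) (closedBall 0 1) := by fun_prop
  obtain ⟨ζ, hζ, hmax⟩ := (isCompact_closedBall (0:ℂ) 1).exists_isMaxOn ⟨0, by simp⟩ hc
  have h0 : u 0 ≤ u ζ + ε * ‖ζ‖ ^ 2 := by
    have := hmax (show (0:ℂ) ∈ closedBall 0 1 by simp)
    simpa using this
  have hζ1 : ‖ζ‖ ≤ 1 := by simpa using hζ
  rcases hζ1.eq_or_lt with h1 | h1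
  · have := hb ζ h1
    rw [h1] at h0; linarith
  exfalso
  have hζb : ζ ∈ ball (0:ℂ) 1 := by simpa using h1
  obtain ⟨h, hd, hz, hle⟩ := hm ζ hζb
  set H : ℂ → ℂ := fun x => Complex.exp (h x + 2 * ε * (starRingEnd ℂ ζ) * (x - ζ)) with hH
  have hnH : ∀ x, ‖H x‖ = Real.exp ((h x).re + 2 * ε * ((starRingEnd ℂ ζ) * (x - ζ)).re) := by
    intro x
    rw [hH, Complex.norm_exp, Complex.add_re]
    congr 2
    have : (2 * ε * (starRingEnd ℂ ζ) * (x - ζ) : ℂ) = ((2 * ε : ℝ) : ℂ) * ((starRingEnd ℂ ζ) * (x - ζ)) := by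
      push_cast; ring
    rw [this, Complex.re_ofReal_mul]
  have key : ∀ᶠ x in 𝓝 ζ, ‖H x‖ ≤ Real.exp (-ε * ‖x - ζ‖ ^ 2) := by
    filter_upwards [hle, isOpen_ball.mem_nhds hζb] with x h3 h4
    rw [hnH]
    apply Real.exp_le_exp.2
    have h5 : u x + ε * ‖x‖ ^ 2 ≤ u ζ + ε * ‖ζ‖ ^ 2 := hmax (ball_subset_closedBall h4)
    have h6 : ‖x‖ ^ 2 = ‖ζ‖ ^ 2 + 2 * ((starRingEnd ℂ ζ) * (x - ζ)).re + ‖x - ζ‖ ^ 2 := by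
      simp only [← Complex.normSq_eq_norm_sq, Complex.normSq_apply, Complex.mul_re, Complex.conj_re, Complex.conj_im,
        Complex.sub_re, Complex.sub_im]
      ring
    rw [h6] at h5
    nlinarith
  have hmaxH : IsLocalMax (norm ∘ H) ζ := by
    filter_upwards [key] with x hx
    have : ‖H ζ‖ = 1 := by rw [hnH]; simp [hz]
    simp only [Function.comp, this]
    refine hx.trans ?_
    rw [Real.exp_le_one_iff]
    nlinarith [sq_nonneg ‖x - ζ‖]
  have hdH : ∀ᶠ x in 𝓝 ζ, DifferentiableAt ℂ H x := by
    filter_upwards [hd] with x hx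
    exact (hx.add (by fun_prop)).cexp
  have hev := eventually_eq_of_isLocalMax_norm hdH hmaxH
  have hall := (hev.and key)
  obtain ⟨x, ⟨hx1, hx2⟩, hx3⟩ := ((hall.filter_mono nhdsWithin_le_nhds).and
    (self_mem_nhdsWithin : {ζ}ᶜ ∈ 𝓝[≠] ζ)).exists
  have : ‖H ζ‖ = 1 := by rw [hnH]; simp [hz]
  rw [hx1, this] at hx2
  rw [Real.one_le_exp_iff] at hx2
  have : 0 < ‖x - ζ‖ := norm_pos_iff.2 (sub_ne_zero.2 hx3)
  nlinarith [pow_pos this 2]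

variable {n : ℕ} {Ω₁ Ω₂ : Set (EE n)} {ρ₁ ρ₂ : EE n → ℝ} {c C r : ℝ} {φ : EE n → EE n}

lemma normsq_expand (a b : EE n) : ‖b‖ ^ 2 = ‖a‖ ^ 2 + 2 * (inner ℂ a (b - a) : ℂ).re + ‖b - a‖ ^ 2 := by
  have h := @norm_add_sq ℂ (EE n) _ _ _ a (b - a)
  rw [add_sub_cancel] at h
  exact h

lemma Dom.schwarz_disc {Ω : Set (EE n)} {ρ : EE n → ℝ} (D : Dom Ω ρ c C r) {g : ℂ → EE n} {U : Set ℂ} (hU : IsOpen U)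
    (hUb : closedBall 0 1 ⊆ U) (hg : DifferentiableOn ℂ g U) (hm : ∀ ζ ∈ U, g ζ ∈ Ω)
    (hc : ∀ ζ, ‖ζ‖ ≤ 1 → -c < ρ (g ζ)) :
    c / 2 * ‖deriv g 0‖ ^ 2 ≤ -ρ (g 0) := by
  have h0U : (0:ℂ) ∈ U := hUb (by simp)
  set k := dslope g 0 with hk
  have hkd : DifferentiableOn ℂ k U := (differentiableOn_dslope (hU.mem_nhds h0U)).2 hg
  have hρc : ContinuousOn (fun ζ => ρ (g ζ)) U := D.cont.comp hg.continuousOn hm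
  have hgc := hg.continuousOn
  have hkc := hkd.continuousOn
  have hc0 := D.hc
  have hC := D.hC
  set u : ℂ → ℝ := fun ζ => ρ (g ζ) - c / 2 * ‖g ζ - g 0‖ ^ 2 + c / 2 * ‖k ζ‖ ^ 2 with hu
  have main : u 0 ≤ 0 := by
    apply disc_max
    · have c1 : ContinuousOn (fun ζ => c / 2 * ‖g ζ - g 0‖ ^ 2) U := by fun_prop
      have c2 : ContinuousOn (fun ζ => c / 2 * ‖k ζ‖ ^ 2) U := by fun_prop
      have : ContinuousOn u U := (hρc.sub c1).add c2
      exact this.mono hUb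
    · intro ζ hζ
      have hζU : ζ ∈ U := hUb (ball_subset_closedBall hζ)
      refine ⟨fun x => ell ρ (g ζ) (g x - g ζ) + qf ρ (g ζ) (g x - g ζ) - c * inner ℂ (g ζ - g 0) (g x - g ζ)
          + c * inner ℂ (k ζ) (k x - k ζ), ?_, ?_, ?_⟩
      · filter_upwards [hU.mem_nhds hζU] with x hx
        have h1 : DifferentiableAt ℂ g x := hg.differentiableAt (hU.mem_nhds hx)
        have h2 : DifferentiableAt ℂ k x := hkd.differentiableAt (hU.mem_nhds hx)
        have h3 : DifferentiableAt ℂ (fun x => g x - g ζ) x := h1.sub_const _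
        have h4 : DifferentiableAt ℂ (fun x => k x - k ζ) x := h2.sub_const _
        have e1 : DifferentiableAt ℂ (fun x => ell ρ (g ζ) (g x - g ζ)) x :=
          (ell ρ (g ζ)).differentiableAt.comp x h3
        have e2 : DifferentiableAt ℂ (fun x => qf ρ (g ζ) (g x - g ζ)) x :=
          DifferentiableAt.comp x (differentiable_qf ρ (g ζ)).differentiableAt h3
        have e3 : DifferentiableAt ℂ (fun x => innerSL ℂ (g ζ - g 0) (g x - g ζ)) x :=
          (innerSL ℂ (g ζ - g 0)).differentiableAt.comp x h3
        have e4 : DifferentiableAt ℂ (fun x => innerSL ℂ (k ζ) (k x - k ζ)) x :=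
          (innerSL ℂ (k ζ)).differentiableAt.comp x h4
        simp only [innerSL_apply_apply] at e3 e4
        exact ((e1.add e2).sub (e3.const_mul _)).add (e4.const_mul _)
      · simp [qf, D2]
      · have hgcζ : ContinuousAt g ζ := hgc.continuousAt (hU.mem_nhds hζU)
        have e1 : ∀ᶠ x in 𝓝 ζ, ‖g x - g ζ‖ < min r (c / 2 / C) := by
          have : Tendsto (fun x => ‖g x - g ζ‖) (𝓝 ζ) (𝓝 0) := by
            have := (hgcζ.sub_const (g ζ)).norm
            simpa [ContinuousAt] using this
          exact this.eventually_lt_const (lt_min D.hr (by positivity))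
        filter_upwards [e1] with x hx
        have hl := D.lower (hm ζ hζU) (hc ζ (mem_ball_zero_iff.1 hζ).le) (hx.trans_le (min_le_left _ _)) (by
          have := hx.le.trans (min_le_right _ _)
          rw [le_div_iff₀ (by positivity)] at this
          linarith)
        rw [add_sub_cancel] at hl
        have n1 := normsq_expand (g ζ - g 0) (g x - g 0)
        have n2 := normsq_expand (k ζ) (k x)
        rw [sub_sub_sub_cancel_right] at n1
        simp only [hu]
        rw [n1, n2]
        simp only [Complex.add_re, Complex.sub_re, Complex.re_ofReal_mul] at hl ⊢
        nlinarith [sq_nonneg ‖k x - k ζ‖]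
    · intro ζ hζ
      have h1 : ‖g ζ - g 0‖ = ‖k ζ‖ := by
        have := sub_smul_dslope g 0 ζ
        rw [sub_zero] at this
        rw [← this, norm_smul, hζ, one_mul]
      simp only [hu, h1]
      have := D.neg (hm ζ (hUb (by simp [hζ])))
      linarith
  have : k 0 = deriv g 0 := dslope_same g 0
  simp only [hu, this, sub_self, norm_zero] at main
  nlinarith

lemma disc_open {Ω : Set (EE n)} (hΩ : IsOpen Ω) (z v : EE n) : IsOpen {ζ : ℂ | z + ζ • v ∈ Ω} :=
  hΩ.preimage (by fun_prop)

lemma disc_deriv (hΩ : IsOpen Ω₁) (hφ : DifferentiableOn ℂ φ Ω₁) {z v : EE n} (hz : z ∈ Ω₁) :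
    HasDerivAt (fun ζ : ℂ => φ (z + ζ • v)) (fderiv ℂ φ z v) 0 := by
  have h1 : HasFDerivAt φ (fderiv ℂ φ z) (z + (0:ℂ) • v) := by
    simpa using (hφ.differentiableAt (hΩ.mem_nhds hz)).hasFDerivAt
  have h2 : HasDerivAt (fun ζ : ℂ => z + ζ • v) v 0 := by
    simpa using ((hasDerivAt_id (0:ℂ)).smul_const v).const_add z
  exact h1.comp_hasDerivAt (0:ℂ) h2

lemma disc_diff (hφ : DifferentiableOn ℂ φ Ω₁) (z v : EE n) :
    DifferentiableOn ℂ (fun ζ : ℂ => φ (z + ζ • v)) {ζ : ℂ | z + ζ • v ∈ Ω₁} :=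
  hφ.comp (by fun_prop) fun _ h => h

lemma Setup.schwarz (S : Setup Ω₁ Ω₂ ρ₁ ρ₂ c C r φ) {z v : EE n} (h1 : ∀ ζ : ℂ, ‖ζ‖ ≤ 1 → z + ζ • v ∈ Ω₁)
    (h2 : ∀ ζ : ℂ, ‖ζ‖ ≤ 1 → -c < ρ₂ (φ (z + ζ • v))) :
    c / 2 * ‖fderiv ℂ φ z v‖ ^ 2 ≤ -ρ₂ (φ z) := by
  have hz : z ∈ Ω₁ := by simpa using h1 0 (by simp)
  have := S.D2.schwarz_disc (disc_open S.D1.op z v) (fun ζ hζ => h1 ζ (by simpa using hζ))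
    (disc_diff S.holo z v) (fun ζ hζ => S.proper.1 hζ) h2
  rw [(disc_deriv S.D1.op S.holo hz).deriv] at this
  simpa using this

lemma Setup.schwarz_normal (S : Setup Ω₁ Ω₂ ρ₁ ρ₂ c C r φ) {z v : EE n} {M : ℝ} (hM : 0 < M)
    (hMc : M < c) (hMr : 8 * M / c < r ^ 2)
    (h1 : ∀ ζ : ℂ, ‖ζ‖ ≤ 1 → z + ζ • v ∈ Ω₁)
    (h2 : ∀ ζ : ℂ, ‖ζ‖ ≤ 1 → -M ≤ ρ₂ (φ (z + ζ • v))) :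
    ‖ell ρ₂ (φ z) (fderiv ℂ φ z v)‖ ≤ 2 * Real.exp (1 + 8 * C / c) * M := by
  have hz : z ∈ Ω₁ := by simpa using h1 0 (by simp)
  have hc := S.D2.hc
  have hC := S.D2.hC
  have hr := S.D2.hr
  set g : ℂ → EE n := fun ζ => φ (z + ζ • v) with hg
  have hU := disc_open S.D1.op z v
  have hgd : DifferentiableOn ℂ g {ζ : ℂ | z + ζ • v ∈ Ω₁} := disc_diff S.holo z v
  have hder : ∀ ζ : ℂ, ‖ζ‖ ≤ 1 / 2 → ‖deriv g ζ‖ ≤ Real.sqrt (8 * M / c) := by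
    intro ζ hζ
    have hb : ∀ ξ : ℂ, ‖ξ‖ ≤ 1 → ‖ζ + ξ / 2‖ ≤ 1 := by
      intro ξ hξ
      refine (norm_add_le _ _).trans ?_
      rw [norm_div]; norm_num; linarith
    have he : ∀ ξ : ℂ, z + ζ • v + ξ • ((1 / 2 : ℂ) • v) = z + (ζ + ξ / 2) • v := by
      intro ξ; rw [add_assoc, smul_smul, ← add_smul]; congr 3; ring
    have hs := S.schwarz (z := z + ζ • v) (v := (1 / 2 : ℂ) • v)
      (fun ξ hξ => by rw [he]; exact h1 _ (hb ξ hξ))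
      (fun ξ hξ => by rw [he]; linarith [h2 _ (hb ξ hξ)])
    have hzζ := h1 ζ (by linarith)
    have hd : deriv g ζ = fderiv ℂ φ (z + ζ • v) v := by
      have h3 := (S.holo.differentiableAt (S.D1.op.mem_nhds hzζ)).hasFDerivAt
      have h4 : HasDerivAt (fun ζ : ℂ => z + ζ • v) v ζ := by
        simpa using ((hasDerivAt_id ζ).smul_const v).const_add z
      exact (h3.comp_hasDerivAt ζ h4).deriv
    rw [map_smul, ← hd, norm_smul] at hs
    have := h2 ζ (by linarith)
    apply Real.le_sqrt_of_sq_le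
    rw [le_div_iff₀ hc]
    norm_num at hs
    nlinarith
  have hdist : ∀ ζ : ℂ, ‖ζ‖ ≤ 1 / 2 → ‖g ζ - g 0‖ ^ 2 ≤ 8 * M / c := by
    intro ζ hζ
    have := (convex_closedBall (0:ℂ) (1/2)).norm_image_sub_le_of_norm_deriv_le (f := g)
      (fun x hx => hgd.differentiableAt (hU.mem_nhds (h1 x (by
        have : ‖x‖ ≤ 1 / 2 := by simpa using hx
        linarith)))) (fun x hx => hder x (by simpa using hx)) (show (0:ℂ) ∈ _ by simp)
        (show ζ ∈ _ by simpa using hζ)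
    rw [sub_zero] at this
    have h3 : ‖g ζ - g 0‖ ≤ Real.sqrt (8 * M / c) := by
      refine this.trans ?_
      have := Real.sqrt_nonneg (8 * M / c)
      nlinarith
    calc ‖g ζ - g 0‖ ^ 2 ≤ Real.sqrt (8 * M / c) ^ 2 := by gcongr
      _ = _ := Real.sq_sqrt (by positivity)
  have hg0 : g 0 = φ z := by simp [hg]
  set G : ℂ → ℂ := fun ζ => Complex.exp (ell ρ₂ (φ z) (g ζ - g 0) / M) with hG
  have hGb : ∀ ζ : ℂ, ‖ζ‖ ≤ 1 / 2 → ‖G ζ‖ ≤ Real.exp (1 + 8 * C / c) := by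
    intro ζ hζ
    rw [hG, Complex.norm_exp, Complex.div_ofReal_re, ell_re]
    apply Real.exp_le_exp.2
    rw [div_le_iff₀ hM]
    have hd := hdist ζ hζ
    have hlt : ‖g ζ - g 0‖ < r := lt_of_pow_lt_pow_left₀ 2 hr.le (hd.trans_lt hMr)
    have h3 := (abs_le.1 (S.D2.t2 (φ z) (S.proper.1 hz) (g ζ - g 0) hlt)).1
    rw [← hg0, add_sub_cancel] at h3
    have h4 := S.D2.neg (S.proper.1 (h1 ζ (by linarith)))
    have h5 := h2 0 (by simp)
    have h6 : C * ‖g ζ - g 0‖ ^ 2 ≤ C * (8 * M / c) := by gcongr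
    have h7 : C * (8 * M / c) = 8 * C / c * M := by ring
    have h8 : g ζ = φ (z + ζ • v) := rfl
    have h9 : g 0 = φ (z + (0:ℂ) • v) := rfl
    rw [h8] at h3
    rw [← h9] at h5
    rw [hg0] at *
    linarith
  have hGd : ∀ ζ : ℂ, ‖ζ‖ ≤ 1 / 2 → DifferentiableAt ℂ G ζ := by
    intro ζ hζ
    have h3 := hgd.differentiableAt (hU.mem_nhds (h1 ζ (by linarith)))
    have h4 : DifferentiableAt ℂ (fun ζ => ell ρ₂ (φ z) (g ζ - g 0)) ζ :=
      (ell ρ₂ (φ z)).differentiableAt.comp ζ (h3.sub_const _)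
    exact (h4.div_const _).cexp
  have hDC : DiffContOnCl ℂ G (ball 0 (1 / 2)) := by
    apply DifferentiableOn.diffContOnCl
    rw [closure_ball _ (by norm_num)]
    intro x hx
    exact (hGd x (by simpa using hx)).differentiableWithinAt
  have hfin := norm_deriv_le_of_forall_mem_sphere_norm_le (by norm_num) hDC
    (fun ζ hζ => hGb ζ (by simpa using (mem_sphere_zero_iff_norm.1 hζ).le))
  have hGder : deriv G 0 = ell ρ₂ (φ z) (fderiv ℂ φ z v) / M := by
    have h3 : HasDerivAt g (fderiv ℂ φ z v) 0 := disc_deriv S.D1.op S.holo hz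
    have h4 : HasDerivAt (fun ζ => ell ρ₂ (φ z) (g ζ - g 0)) (ell ρ₂ (φ z) (fderiv ℂ φ z v)) 0 :=
      (ell ρ₂ (φ z)).hasFDerivAt.comp_hasDerivAt (0:ℂ) (h3.sub_const (g 0))
    have h5 := (h4.div_const (M:ℂ)).cexp
    rw [h5.deriv]; simp
  rw [hGder, norm_div, Complex.norm_real, Real.norm_of_nonneg hM.le, div_le_iff₀ hM] at hfin
  linarith

end GDJ

namespace GDJ
open Set Filter Topology MeasureTheory
open scoped ContDiff

def TT {n : ℕ} (e : ℂ) (ν : EE n) : Matrix (Fin n) (Fin n) ℂ :=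
  e • (1 + Matrix.replicateCol Unit (fun i => (e - 1) * ν i) * Matrix.replicateRow Unit (fun i => (starRingEnd ℂ) (ν i)))

lemma TT_apply {n : ℕ} (e : ℂ) (ν : EE n) (i j : Fin n) :
    TT e ν i j = e * ((1 : Matrix (Fin n) (Fin n) ℂ) i j + (e - 1) * ν i * (starRingEnd ℂ) (ν j)) := by
  simp [TT, Matrix.mul_apply]

lemma TT_det {n : ℕ} (e : ℂ) (ν : EE n) (hν : ‖ν‖ = 1) : (TT e ν).det = e ^ n * e := by
  have h1 : ∑ i, (starRingEnd ℂ) (ν i) * ν i = 1 := by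
    have := EuclideanSpace.norm_sq_eq ν
    rw [hν] at this
    have h2 : ((∑ i, ‖ν i‖ ^ 2 : ℝ) : ℂ) = 1 := by rw [← this]; simp
    rw [← h2]
    push_cast
    refine Finset.sum_congr rfl fun i _ => ?_
    rw [mul_comm, Complex.mul_conj, Complex.normSq_eq_norm_sq]; push_cast; rfl
  rw [TT, Matrix.det_smul, Matrix.det_one_add_replicateCol_mul_replicateRow]
  have : (fun i => (starRingEnd ℂ) (ν i)) ⬝ᵥ (fun i => (e - 1) * ν i) = (e - 1) := by
    simp only [dotProduct]
    calc ∑ i, (starRingEnd ℂ) (ν i) * ((e - 1) * ν i) = (e - 1) * ∑ i, (starRingEnd ℂ) (ν i) * ν i := by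
          rw [Finset.mul_sum]
          refine Finset.sum_congr rfl fun i _ => ?_
          ring
      _ = _ := by rw [h1, mul_one]
  rw [this]; simp

lemma coord_le {n : ℕ} (v : EE n) (i : Fin n) : ‖v i‖ ≤ ‖v‖ := PiLp.norm_apply_le v i

lemma one_entry {n : ℕ} (i j : Fin n) : ‖(1 : Matrix (Fin n) (Fin n) ℂ) i j‖ ≤ 1 := by
  by_cases h : i = j
  · subst h; simp
  · simp [h]

lemma TT_entry {n : ℕ} (e : ℂ) (ν : EE n) (hν : ‖ν‖ = 1) (i j : Fin n) : ‖TT e ν i j‖ ≤ ‖e‖ * (1 + ‖e - 1‖) := by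
  rw [TT_apply, norm_mul]
  gcongr
  refine (norm_add_le _ _).trans (add_le_add (one_entry i j) ?_)
  rw [norm_mul, norm_mul, RCLike.norm_conj]
  have h1 := coord_le ν i
  have h2 := coord_le ν j
  rw [hν] at h1 h2
  calc ‖e - 1‖ * ‖ν i‖ * ‖ν j‖ ≤ ‖e - 1‖ * 1 * 1 := by gcongr
    _ = _ := by ring

lemma norm_det_le {n : ℕ} {A : Matrix (Fin n) (Fin n) ℂ} {B : ℝ} (h : ∀ i j, ‖A i j‖ ≤ B) :
    ‖A.det‖ ≤ n.factorial * B ^ n := by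
  have := Matrix.det_le (abv := (NormedField.toAbsoluteValue ℂ)) (A := A) (x := B) h
  rw [Fintype.card_fin, nsmul_eq_mul] at this
  exact this

lemma norm_adj_le {n : ℕ} {A : Matrix (Fin n) (Fin n) ℂ} {B : ℝ} (hB : 1 ≤ B) (h : ∀ i j, ‖A i j‖ ≤ B) (i j : Fin n) :
    ‖A.adjugate i j‖ ≤ n.factorial * B ^ n := by
  rw [Matrix.adjugate_apply]
  apply norm_det_le
  intro a b
  by_cases hj : a = j
  · subst hj
    rw [Matrix.updateRow_self]
    by_cases hb : b = i
    · subst hb; simpa using hB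
    · simp [hb]; linarith
  · rw [Matrix.updateRow_ne hj]; exact h a b

lemma mat_bound {n : ℕ} {M : Matrix (Fin n) (Fin n) ℂ} {ν μ : EE n} (hν : ‖ν‖ = 1) (hμ : ‖μ‖ = 1) {e B : ℝ}
    (he : 0 < e) (he1 : e ≤ 1) (hB : 1 ≤ B) (h : ∀ i j, ‖(TT (e⁻¹ : ℂ) μ * M * TT (e:ℂ) ν) i j‖ ≤ B) :
    ‖M.det‖ ≤ n.factorial * B ^ n ∧ ∀ i j, ‖M.adjugate i j‖ * e ≤ 4 * n ^ 2 * (n.factorial * B ^ n) := by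
  have hec : (e:ℂ) ≠ 0 := by exact_mod_cast he.ne'
  set S := TT (e⁻¹ : ℂ) μ with hS
  set T := TT (e:ℂ) ν with hT
  have hST : S.det * T.det = 1 := by
    rw [hS, hT, TT_det _ _ hν, TT_det _ _ hμ, inv_pow]
    field_simp
  constructor
  · have : (S * M * T).det = M.det := by
      rw [Matrix.det_mul, Matrix.det_mul, mul_right_comm, hST, one_mul]
    rw [← this]
    exact norm_det_le h
  · intro i j
    have hadj : M.adjugate = T * (S * M * T).adjugate * S := by
      rw [Matrix.adjugate_mul_distrib, Matrix.adjugate_mul_distrib]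
      calc M.adjugate = (T.det • (1 : Matrix _ _ ℂ)) * M.adjugate * (S.det • (1 : Matrix _ _ ℂ)) := by
            simp [smul_smul, hST]
        _ = (T * T.adjugate) * M.adjugate * (S.adjugate * S) := by
            rw [Matrix.mul_adjugate, Matrix.adjugate_mul]
        _ = _ := by simp only [Matrix.mul_assoc]
    have hTe : ∀ a b, ‖T a b‖ ≤ 2 * e := by
      intro a b
      refine (TT_entry _ _ hν a b).trans ?_
      rw [Complex.norm_real, Real.norm_of_nonneg he.le]
      have : ‖(e:ℂ) - 1‖ ≤ 1 := by
        rw [← Complex.ofReal_one, ← Complex.ofReal_sub, Complex.norm_real, Real.norm_eq_abs, abs_le]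
        constructor <;> linarith
      nlinarith
    have hSe : ∀ a b, ‖S a b‖ ≤ 2 * (e⁻¹ * e⁻¹) := by
      intro a b
      refine (TT_entry _ _ hμ a b).trans ?_
      rw [norm_inv, Complex.norm_real, Real.norm_of_nonneg he.le]
      have h1 : 1 ≤ e⁻¹ := (one_le_inv₀ he).2 he1
      have : ‖(e:ℂ)⁻¹ - 1‖ ≤ e⁻¹ := by
        rw [← Complex.ofReal_one, ← Complex.ofReal_inv, ← Complex.ofReal_sub, Complex.norm_real, Real.norm_eq_abs, abs_le]
        constructor <;> linarith
      nlinarith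
    set Q := (n.factorial * B ^ n : ℝ) with hQ
    have hQ0 : 0 ≤ Q := by positivity
    have h1 : ‖M.adjugate i j‖ ≤ ∑ _b : Fin n, ∑ _a : Fin n, 2 * e * Q * (2 * (e⁻¹ * e⁻¹)) := by
      rw [hadj, Matrix.mul_apply]
      refine norm_sum_le_of_le _ fun b _ => ?_
      rw [Matrix.mul_apply, Finset.sum_mul]
      refine norm_sum_le_of_le _ fun a _ => ?_
      rw [norm_mul, norm_mul]
      have := hTe i a
      have := norm_adj_le hB h a b
      have := hSe b j
      gcongr
    simp only [Finset.sum_const, Finset.card_univ, Fintype.card_fin, nsmul_eq_mul] at h1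
    calc ‖M.adjugate i j‖ * e ≤ (n * (n * (2 * e * Q * (2 * (e⁻¹ * e⁻¹))))) * e := by gcongr
      _ = 4 * n ^ 2 * Q := by field_simp; ring

variable {n : ℕ} {Ω₁ Ω₂ : Set (EE n)} {ρ₁ ρ₂ : EE n → ℝ} {c C r : ℝ} {φ : EE n → EE n}

lemma Dom.disc {Ω : Set (EE n)} {ρ : EE n → ℝ} (D : Dom Ω ρ c C r) :
    ∃ c₀ > 0, c₀ ≤ 1 ∧ ∀ z ∈ Ω, ∀ v : EE n, ‖ell ρ z v‖ ≤ c₀ * (-ρ z) → ‖v‖ ^ 2 ≤ c₀ * (-ρ z) →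
      ∀ ζ : ℂ, ‖ζ‖ ≤ 1 → z + ζ • v ∈ Ω ∧ -ρ (z + ζ • v) ≤ 2 * (-ρ z) ∧ (-ρ z) / 2 ≤ -ρ (z + ζ • v) := by
  have hC := D.hC
  have hr := D.hr
  refine ⟨min (1 / (4 * C)) (r ^ 2 / (2 * C)), by positivity, ?_, ?_⟩
  · refine (min_le_left _ _).trans ?_
    rw [div_le_one (by positivity)]; linarith
  intro z hz v h1 h2 ζ hζ
  have hδ := D.neg hz
  have hδC := D.bnd z hz
  set δ := -ρ z with hδd
  have hδ0 : 0 < δ := by linarith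
  set c₀ := min (1 / (4 * C)) (r ^ 2 / (2 * C)) with hc₀
  have a1 : c₀ * (4 * C) ≤ 1 := by
    have : c₀ ≤ 1 / (4 * C) := min_le_left _ _
    rwa [le_div_iff₀ (by positivity)] at this
  have a2 : c₀ * (2 * C) ≤ r ^ 2 := by
    have : c₀ ≤ r ^ 2 / (2 * C) := min_le_right _ _
    rwa [le_div_iff₀ (by positivity)] at this
  have hc0 : 0 < c₀ := by positivity
  have a3 : c₀ ≤ 1 / 4 := by nlinarith
  have hn : ‖ζ • v‖ ≤ ‖v‖ := by
    rw [norm_smul]; nlinarith [norm_nonneg v]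
  have hlt : ‖ζ • v‖ < r := by
    refine lt_of_le_of_lt hn (lt_of_pow_lt_pow_left₀ 2 hr.le ?_)
    have : c₀ * δ ≤ c₀ * C := by gcongr; linarith
    nlinarith [mul_pos hc0 (by linarith : (0:ℝ) < C)]
  have h3 := abs_le.1 (D.t2 z hz _ hlt)
  have h4 : |fderiv ℝ ρ z (ζ • v)| ≤ c₀ * δ := by
    rw [← ell_re]
    refine (Complex.abs_re_le_norm _).trans ?_
    rw [map_smul, norm_smul]
    nlinarith [norm_nonneg (ell ρ z v)]
  have h5 : C * ‖ζ • v‖ ^ 2 ≤ 1 / 4 * δ := by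
    calc C * ‖ζ • v‖ ^ 2 ≤ C * (c₀ * δ) := by
          gcongr
          exact (pow_le_pow_left₀ (norm_nonneg _) hn 2).trans h2
      _ = c₀ * (4 * C) * δ / 4 := by ring
      _ ≤ 1 * δ / 4 := by gcongr
      _ = _ := by ring
  have h6 : c₀ * δ ≤ 1 / 4 * δ := by gcongr
  have h7 := abs_le.1 h4
  have h8 : ρ (z + ζ • v) ≤ - δ / 2 := by linarith [h3.2]
  refine ⟨?_, ?_, by linarith⟩
  · rw [D.mem z hz _ (by simpa [dist_eq_norm] using hlt)]
    linarith
  · linarith [h3.1]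

lemma Setup.aniso (S : Setup Ω₁ Ω₂ ρ₁ ρ₂ c C r φ) :
    ∃ c₀ > 0, c₀ ≤ 1 ∧ ∃ s > 0, s ≤ 1 ∧ s ≤ c ∧ (∀ z ∈ Ω₁, -s < ρ₁ z → -c < ρ₂ (φ z)) ∧
      ∃ B ≥ 1, ∀ z ∈ Ω₁, -s < ρ₁ z → ∀ v : EE n,
      ‖ell ρ₁ z v‖ ≤ c₀ * (-ρ₁ z) → ‖v‖ ^ 2 ≤ c₀ * (-ρ₁ z) →
      ‖fderiv ℂ φ z v‖ ≤ B * Real.sqrt (-ρ₁ z) ∧ ‖ell ρ₂ (φ z) (fderiv ℂ φ z v)‖ ≤ B * (-ρ₁ z) := by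
  obtain ⟨c₀, hc₀, hc1, hdisc⟩ := S.D1.disc
  obtain ⟨K, hK, hopf⟩ := S.hopf
  have hc := S.D2.hc
  have hC := S.D2.hC
  have hr := S.D2.hr
  set s := min (min 1 c) (min (c / (2 * K)) (r ^ 2 * c / (16 * K))) with hs
  have hs0 : 0 < s := by positivity
  have hsc : 2 * K * s ≤ c := by
    have : s ≤ c / (2 * K) := (min_le_right _ _).trans (min_le_left _ _)
    rw [le_div_iff₀ (by positivity)] at this; linarith
  have hsr : 16 * K * s ≤ r ^ 2 * c := by
    have : s ≤ r ^ 2 * c / (16 * K) := (min_le_right _ _).trans (min_le_right _ _)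
    rw [le_div_iff₀ (by positivity)] at this; linarith
  refine ⟨c₀, hc₀, hc1, s, hs0, (min_le_left _ _).trans (min_le_left _ _), (min_le_left _ _).trans (min_le_right _ _),
    ?_, max 1 (max (Real.sqrt (2 * K / c)) (2 * Real.exp (1 + 8 * C / c) * (2 * K))), le_max_left _ _, ?_⟩
  · intro z hz hzs
    have := hopf z hz
    nlinarith
  intro z hz hzs v h1 h2
  have hδ := S.D1.neg hz
  set δ := -ρ₁ z with hδd
  have hδ0 : 0 < δ := by linarith
  have hδs : δ < s := by linarith
  have hd := hdisc z hz v h1 h2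
  have hM : ∀ ζ : ℂ, ‖ζ‖ ≤ 1 → -(2 * K * δ) ≤ ρ₂ (φ (z + ζ • v)) := by
    intro ζ hζ
    have h3 := hopf _ (hd ζ hζ).1
    have h4 := (hd ζ hζ).2.1
    nlinarith
  have hMc : 2 * K * δ < c := by nlinarith
  have hs1 := S.schwarz (fun ζ hζ => (hd ζ hζ).1) (fun ζ hζ => by linarith [hM ζ hζ])
  have hs2 := S.schwarz_normal (M := 2 * K * δ) (by positivity) hMc (by
    rw [div_lt_iff₀ hc]; nlinarith) (fun ζ hζ => (hd ζ hζ).1) hM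
  constructor
  · have h3 : ‖fderiv ℂ φ z v‖ ≤ Real.sqrt (2 * K / c * δ) := by
      apply Real.le_sqrt_of_sq_le
      have := hopf z hz
      rw [div_mul_eq_mul_div, le_div_iff₀ hc]
      nlinarith
    rw [Real.sqrt_mul (by positivity)] at h3
    refine h3.trans ?_
    gcongr
    exact (le_max_left _ _).trans (le_max_right _ _)
  · refine hs2.trans ?_
    rw [← mul_assoc]
    gcongr
    exact (le_max_right _ _).trans (le_max_right _ _)

end GDJ

namespace GDJ
open Set Filter Topology MeasureTheory
open scoped ContDiff

variable {n : ℕ} {Ω₁ Ω₂ : Set (EE n)} {ρ₁ ρ₂ : EE n → ℝ} {c C r : ℝ} {φ : EE n → EE n}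

/-- the column vectors of TT -/
def colv (e : ℂ) (ν : EE n) (b : Fin n) : EE n := e • (ev b + ((e - 1) * (starRingEnd ℂ) (ν b)) • ν)

lemma colv_apply (e : ℂ) (ν : EE n) (i b : Fin n) : colv e ν b i = TT e ν i b := by
  rw [TT_apply]
  simp only [colv, ev, PiLp.smul_apply, PiLp.add_apply, smul_eq_mul]
  have : (EuclideanSpace.single b (1:ℂ) : EE n) i = (1 : Matrix (Fin n) (Fin n) ℂ) i b := by
    simp [Matrix.one_apply, Pi.single_apply]
  rw [this]; ring

lemma norm_ev (b : Fin n) : ‖(ev b : EE n)‖ = 1 := by simp [ev]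

lemma norm_colv {e : ℝ} (he : 0 < e) (he1 : e ≤ 1) {ν : EE n} (hν : ‖ν‖ = 1) (b : Fin n) : ‖colv (e:ℂ) ν b‖ ≤ 2 * e := by
  rw [colv, norm_smul, Complex.norm_real, Real.norm_of_nonneg he.le, mul_comm 2]
  gcongr
  refine (norm_add_le _ _).trans ?_
  rw [norm_ev, norm_smul, norm_mul, RCLike.norm_conj, hν]
  have : ‖(e:ℂ) - 1‖ ≤ 1 := by
    rw [← Complex.ofReal_one, ← Complex.ofReal_sub, Complex.norm_real, Real.norm_eq_abs, abs_le]
    constructor <;> linarith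
  have h2 := coord_le ν b
  rw [hν] at h2
  nlinarith [norm_nonneg (ν b), norm_nonneg ((e:ℂ) - 1)]

lemma inner_colv {e : ℂ} {ν : EE n} (hν : ‖ν‖ = 1) (b : Fin n) :
    inner ℂ ν (colv e ν b) = e * (e * (starRingEnd ℂ) (ν b)) := by
  have h1 : inner ℂ ν (ev b) = (starRingEnd ℂ) (ν b) := by
    simp [ev, EuclideanSpace.inner_single_right]
  simp only [colv, inner_smul_right, inner_add_right, h1, inner_self_eq_norm_sq_to_K, hν]
  simp; ring_nf; simp

lemma Jac_mul_TT (e : ℂ) (ν : EE n) (φ : EE n → EE n) (z : EE n) (l b : Fin n) :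
    (Jac φ z * TT e ν) l b = (fderiv ℂ φ z (colv e ν b)) l := by
  conv_rhs => rw [vec_eq_sum (colv e ν b), map_sum]
  simp only [map_smul, Matrix.mul_apply, Jac, Matrix.of_apply, colv_apply]
  simp [mul_comm]

lemma TT_mul (e : ℂ) (μ : EE n) (X : Matrix (Fin n) (Fin n) ℂ) (a b : Fin n) :
    (TT e μ * X) a b = e * (X a b + (e - 1) * μ a * ∑ l, (starRingEnd ℂ) (μ l) * X l b) := by
  simp only [Matrix.mul_apply, TT_apply]
  simp only [add_mul, mul_add, Finset.sum_add_distrib, mul_assoc, ← Finset.mul_sum]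
  congr 2
  simp [Matrix.one_apply]

lemma entry_eq (e e' : ℂ) (ν μ : EE n) (φ : EE n → EE n) (z : EE n) (a b : Fin n) :
    (TT e' μ * Jac φ z * TT e ν) a b = e' * ((fderiv ℂ φ z (colv e ν b)) a
      + (e' - 1) * μ a * inner ℂ μ (fderiv ℂ φ z (colv e ν b))) := by
  rw [Matrix.mul_assoc, TT_mul]
  simp only [Jac_mul_TT]
  congr 3
  rw [PiLp.inner_apply]
  refine Finset.sum_congr rfl fun i _ => ?_
  simp [mul_comm]

lemma Setup.bounds_near (S : Setup Ω₁ Ω₂ ρ₁ ρ₂ c C r φ) : ∃ s > 0, ∃ B ≥ 1, ∀ z ∈ Ω₁, -s < ρ₁ z →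
    ‖(Jac φ z).det‖ ≤ B ∧ ∀ j k, ‖(Jac φ z).adjugate j k‖ * Real.sqrt (-ρ₁ z) ≤ B := by
  obtain ⟨c₀, hc₀, hc₀1, s, hs, hs1, hsc, hs2, B, hB, han⟩ := S.aniso
  have hc := S.D2.hc
  have hC := S.D2.hC
  set c₁ := c₀ / (4 * C) with hc₁d
  have hc₁ : 0 < c₁ := by positivity
  have hc₁C : c₁ * (4 * C) = c₀ := by rw [hc₁d]; field_simp
  have hc₁le : 4 * c₁ ≤ c₀ := by nlinarith
  set B' := max 1 (B / c₁ * (1 + 1 / c)) with hB'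
  have hB'1 : 1 ≤ B' := le_max_left _ _
  refine ⟨s, hs, max 1 (max (n.factorial * B' ^ n) (4 * n ^ 2 * (n.factorial * B' ^ n))), le_max_left _ _, ?_⟩
  intro z hz hzs
  have hδ := S.D1.neg hz
  have han := han z hz hzs
  have hw := hs2 z hz hzs
  set δ := -ρ₁ z with hδd
  have hδ0 : 0 < δ := by linarith
  set e := Real.sqrt δ with he
  have he0 : 0 < e := Real.sqrt_pos.2 hδ0
  have hee : e * e = δ := Real.mul_self_sqrt hδ0.le
  have he1 : e ≤ 1 := Real.sqrt_le_one.2 (by linarith)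
  have hl1 : c ≤ ‖ell ρ₁ z‖ := by rw [norm_ell]; exact S.D1.grad z hz (by linarith)
  have hl1C : ‖ell ρ₁ z‖ ≤ C := by rw [norm_ell]; exact S.D1.d1 z hz z (mem_ball_self S.D1.hr)
  have hl2 : c ≤ ‖ell ρ₂ (φ z)‖ := by rw [norm_ell]; exact S.D2.grad _ (S.proper.1 hz) hw
  obtain ⟨ν, hν, hνe⟩ := exists_unit (ell ρ₁ z) (norm_pos_iff.1 (by linarith))
  obtain ⟨μ, hμ, hμe⟩ := exists_unit (ell ρ₂ (φ z)) (norm_pos_iff.1 (by linarith))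
  have hent : ∀ i j, ‖(TT (e⁻¹ : ℂ) μ * Jac φ z * TT (e:ℂ) ν) i j‖ ≤ B' := by
    intro a b
    rw [entry_eq]
    set v := colv (e:ℂ) ν b with hv
    have hvn : ‖v‖ ≤ 2 * e := norm_colv he0 he1 hν b
    have hve : ‖ell ρ₁ z v‖ ≤ C * δ := by
      rw [hνe, hv, inner_colv hν, norm_mul, norm_mul, norm_mul, RCLike.norm_conj]
      have := coord_le ν b
      rw [hν] at this
      simp only [Complex.norm_real, norm_norm, Real.norm_of_nonneg he0.le]
      calc ‖ell ρ₁ z‖ * (e * (e * ‖ν b‖)) ≤ C * (e * (e * 1)) := by gcongr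
        _ = C * δ := by rw [mul_one, hee]
    have hcc : ‖(c₁ : ℂ)‖ = c₁ := by rw [Complex.norm_real, Real.norm_of_nonneg hc₁.le]
    obtain ⟨b1, b2⟩ := han ((c₁ : ℂ) • v) (by
        rw [map_smul, norm_smul, hcc]
        calc c₁ * ‖ell ρ₁ z v‖ ≤ c₁ * (C * δ) := by gcongr
          _ ≤ c₁ * (4 * C) * δ := by nlinarith [mul_pos (mul_pos hc₁ (by linarith : 0 < C)) hδ0]
          _ = _ := by rw [hc₁C]) (by
        rw [norm_smul, hcc]
        calc (c₁ * ‖v‖) ^ 2 ≤ (c₁ * (2 * e)) ^ 2 := by gcongr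
          _ = (4 * c₁) * c₁ * (e * e) := by ring
          _ ≤ c₀ * 1 * (e * e) := by gcongr; linarith
          _ = _ := by rw [hee, mul_one])
    rw [map_smul, norm_smul, hcc] at b1
    rw [map_smul, map_smul, norm_smul, hcc] at b2
    set y := fderiv ℂ φ z v with hy
    have b1' : ‖y‖ ≤ B / c₁ * e := by
      rw [div_mul_eq_mul_div, le_div_iff₀ hc₁]; linarith
    have b2' : ‖inner ℂ μ y‖ ≤ B / c₁ * (1 / c) * δ := by
      rw [hμe, norm_mul, Complex.norm_real, norm_norm] at b2
      have : c₁ * (c * ‖inner ℂ μ y‖) ≤ B * δ := le_trans (by gcongr) b2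
      rw [div_mul_div_comm, mul_one, div_mul_eq_mul_div, le_div_iff₀ (by positivity)]
      linarith
    have he1' : 1 ≤ e⁻¹ := (one_le_inv₀ he0).2 he1
    have he2 : ‖(e:ℂ)⁻¹ - 1‖ ≤ e⁻¹ := by
      rw [← Complex.ofReal_one, ← Complex.ofReal_inv, ← Complex.ofReal_sub, Complex.norm_real, Real.norm_eq_abs, abs_le]
      constructor <;> linarith
    have hma := coord_le μ a
    rw [hμ] at hma
    have hya := (coord_le y a).trans b1'
    rw [norm_mul, norm_inv, Complex.norm_real, Real.norm_of_nonneg he0.le]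
    calc e⁻¹ * ‖y a + ((e:ℂ)⁻¹ - 1) * μ a * inner ℂ μ y‖
        ≤ e⁻¹ * (B / c₁ * e + e⁻¹ * 1 * (B / c₁ * (1 / c) * δ)) := by
          gcongr
          refine (norm_add_le _ _).trans ?_
          rw [norm_mul, norm_mul]
          gcongr
      _ = B / c₁ * (1 + 1 / c) := by rw [← hee]; field_simp
      _ ≤ B' := le_max_right _ _
  obtain ⟨m1, m2⟩ := mat_bound hν hμ he0 he1 hB'1 hent
  exact ⟨m1.trans ((le_max_left _ _).trans (le_max_right _ _)), fun j k => (m2 j k).trans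
    ((le_max_right _ _).trans (le_max_right _ _))⟩

lemma Setup.bounds (S : Setup Ω₁ Ω₂ ρ₁ ρ₂ c C r φ) : ∃ B ≥ 1, ∀ z ∈ Ω₁,
    ‖(Jac φ z).det‖ ≤ B ∧ ∀ j k, ‖(Jac φ z).adjugate j k‖ * Real.sqrt (-ρ₁ z) ≤ B := by
  obtain ⟨s, hs, B, hB, h⟩ := S.bounds_near
  have hK := S.D1.cpt s hs
  have hsub : {z ∈ Ω₁ | ρ₁ z ≤ -s} ⊆ Ω₁ := fun z hz => hz.1
  obtain ⟨B1, hB1, h1⟩ := compact_bdd hK ((differentiableOn_det S.D1.op S.holo).continuousOn.mono hsub)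
  have h2 : ∀ j k, ∃ C > 0, ∀ x ∈ {z ∈ Ω₁ | ρ₁ z ≤ -s}, ‖(Jac φ x).adjugate j k * (Real.sqrt (-ρ₁ x) : ℂ)‖ ≤ C := by
    intro j k
    refine compact_bdd hK (ContinuousOn.mul ((differentiableOn_adj S.D1.op S.holo j k).continuousOn.mono hsub) ?_)
    exact Complex.continuous_ofReal.comp_continuousOn (S.D1.cont.mono hsub).neg.sqrt
  choose B2 hB2 h2 using h2
  have hB2s : ∀ j k, B2 j k ≤ ∑ j, ∑ k, B2 j k := fun j k =>
    (Finset.single_le_sum (f := fun k => B2 j k) (fun k _ => (hB2 j k).le) (Finset.mem_univ k)).trans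
      (Finset.single_le_sum (f := fun j => ∑ k, B2 j k) (fun j _ => Finset.sum_nonneg fun k _ => (hB2 j k).le)
        (Finset.mem_univ j))
  refine ⟨max B (max B1 (∑ j, ∑ k, B2 j k)), hB.trans (le_max_left _ _), fun z hz => ?_⟩
  by_cases hzs : -s < ρ₁ z
  · exact ⟨(h z hz hzs).1.trans (le_max_left _ _), fun j k => ((h z hz hzs).2 j k).trans (le_max_left _ _)⟩
  · push Not at hzs
    refine ⟨(h1 z ⟨hz, hzs⟩).trans ((le_max_left _ _).trans (le_max_right _ _)), fun j k => ?_⟩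
    have := h2 j k z ⟨hz, hzs⟩
    rw [norm_mul, Complex.norm_real, Real.norm_of_nonneg (Real.sqrt_nonneg _)] at this
    exact this.trans ((hB2s j k).trans ((le_max_right _ _).trans (le_max_right _ _)))

lemma Setup.tangential (S : Setup Ω₁ Ω₂ ρ₁ ρ₂ c C r φ) : ∃ B > 0, ∀ z ∈ Ω₁, ∀ t : EE n, ell ρ₁ z t = 0 →
    ‖fderiv ℂ (fun w => (Jac φ w).det) z t‖ * Real.sqrt (-ρ₁ z) ≤ B * ‖t‖ := by
  obtain ⟨B, hB, hb⟩ := S.bounds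
  obtain ⟨c₀, hc₀, hc1, hdisc⟩ := S.D1.disc
  refine ⟨B / Real.sqrt c₀, by positivity, fun z hz t ht => ?_⟩
  by_cases ht0 : t = 0
  · simp [ht0]
  have htp : 0 < ‖t‖ := norm_pos_iff.2 ht0
  have hδ := S.D1.neg hz
  set δ := -ρ₁ z with hδd
  have hδ0 : 0 < δ := by linarith
  set a : ℝ := Real.sqrt (c₀ * δ) / ‖t‖ with ha
  have ha0 : 0 < a := by positivity
  have hd := hdisc z hz ((a:ℂ) • t) (by rw [map_smul, ht, smul_zero, norm_zero]; positivity) (by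
    rw [norm_smul, Complex.norm_real, Real.norm_of_nonneg ha0.le, ha, div_mul_cancel₀ _ htp.ne', Real.sq_sqrt (by positivity)])
  have := norm_fderiv_apply_le (F := fun w => (Jac φ w).det) (z := z) (v := (a:ℂ) • t) (M := B)
    (fun ζ hζ => (differentiableOn_det S.D1.op S.holo).differentiableAt (S.D1.op.mem_nhds (hd ζ hζ).1))
    (fun ζ hζ => (hb _ (hd ζ hζ).1).1)
  rw [map_smul, norm_smul, Complex.norm_real, Real.norm_of_nonneg ha0.le, ha, Real.sqrt_mul hc₀.le,
    div_mul_eq_mul_div, div_le_iff₀ htp] at this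
  rw [div_mul_eq_mul_div, le_div_iff₀ (by positivity)]
  linarith

end GDJ

namespace GDJ
open Set Filter Topology MeasureTheory
open scoped ContDiff

lemma smoothTransition_deriv_bdd : ∃ D ≥ 0, ∀ x, |deriv Real.smoothTransition x| ≤ D := by
  have hs : ContDiff ℝ 1 Real.smoothTransition := Real.smoothTransition.contDiff
  have hcont : Continuous (deriv Real.smoothTransition) := hs.continuous_deriv le_rfl
  obtain ⟨D, hD⟩ := (isCompact_Icc (a := (0:ℝ)) (b := 1)).exists_bound_of_continuousOn hcont.continuousOn
  refine ⟨max D 0, le_max_right _ _, fun x => ?_⟩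
  by_cases hx : x ∈ Icc (0:ℝ) 1
  · exact (hD x hx).trans (le_max_left _ _)
  · have : deriv Real.smoothTransition x = 0 := by
      rw [mem_Icc, not_and_or] at hx
      rcases hx with hx | hx
      · push Not at hx
        have : Real.smoothTransition =ᶠ[𝓝 x] fun _ => 0 := by
          filter_upwards [Iio_mem_nhds hx] with y hy using Real.smoothTransition.zero_of_nonpos (le_of_lt hy)
        rw [this.deriv_eq]; simp
      · push Not at hx
        have : Real.smoothTransition =ᶠ[𝓝 x] fun _ => 1 := by
          filter_upwards [Ioi_mem_nhds hx] with y hy using Real.smoothTransition.one_of_one_le (le_of_lt hy)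
        rw [this.deriv_eq]; simp
    rw [this]; simp

lemma exists_theta {c : ℝ} (hc : 0 < c) : ∃ A ≥ 1, ∀ ε > 0, ∃ Θ : ℝ → ℝ, ContDiff ℝ 1 Θ ∧
    (∀ r ≤ -c / 2, Θ r = 0) ∧ (∀ r, -ε < r → Θ r = 0) ∧ (∀ r, |Θ r| ≤ |r|) ∧ (∀ r ≤ 0, |deriv Θ r| ≤ A) ∧
    (∀ r ≤ 0, r < -2 * ε → |1 - deriv Θ r| ≤ A * |r|) := by
  obtain ⟨D, hD0, hD⟩ := smoothTransition_deriv_bdd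
  refine ⟨max (1 + 4 * D) ((2 + 4 * D) * (4 / c)), ?_, fun ε hε => ?_⟩
  · exact le_trans (by linarith) (le_max_left _ _)
  set p : ℝ → ℝ := fun r => Real.smoothTransition ((-r - ε) / ε) with hp
  set q : ℝ → ℝ := fun r => Real.smoothTransition (2 + 4 * r / c) with hq
  have hs : ContDiff ℝ 1 Real.smoothTransition := Real.smoothTransition.contDiff
  have hsd : Differentiable ℝ Real.smoothTransition := hs.differentiable (by simp)
  have hpd : ∀ r, HasDerivAt p (deriv Real.smoothTransition ((-r - ε) / ε) * (-1 / ε)) r := by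
    intro r
    have h1 : HasDerivAt (fun r : ℝ => (-r - ε) / ε) (-1 / ε) r := ((hasDerivAt_id r).neg.sub_const ε).div_const ε
    exact (hsd _).hasDerivAt.comp r h1
  have hqd : ∀ r, HasDerivAt q (deriv Real.smoothTransition (2 + 4 * r / c) * (4 / c)) r := by
    intro r
    have h1 : HasDerivAt (fun r : ℝ => 2 + 4 * r / c) (4 / c) r := by
      have := (((hasDerivAt_id r).const_mul 4).div_const c).const_add 2
      simpa using this
    exact (hsd _).hasDerivAt.comp r h1
  have hp01 : ∀ r, 0 ≤ p r ∧ p r ≤ 1 := fun r => ⟨Real.smoothTransition.nonneg _, Real.smoothTransition.le_one _⟩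
  have hq01 : ∀ r, 0 ≤ q r ∧ q r ≤ 1 := fun r => ⟨Real.smoothTransition.nonneg _, Real.smoothTransition.le_one _⟩
  have hp1 : ∀ r ≤ -2 * ε, p r = 1 := fun r hr => Real.smoothTransition.one_of_one_le (by
    rw [le_div_iff₀ hε]; linarith)
  have hp0 : ∀ r, -ε ≤ r → p r = 0 := fun r hr => Real.smoothTransition.zero_of_nonpos (by
    rw [div_le_iff₀ hε]; linarith)
  have hq0 : ∀ r ≤ -c / 2, q r = 0 := fun r hr => Real.smoothTransition.zero_of_nonpos (by
    have : 4 * r / c ≤ -2 := by rw [div_le_iff₀ hc]; linarith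
    linarith)
  have hq1 : ∀ r, -c / 4 ≤ r → q r = 1 := fun r hr => Real.smoothTransition.one_of_one_le (by
    have : -1 ≤ 4 * r / c := by rw [le_div_iff₀ hc]; linarith
    linarith)
  have hder : ∀ r, HasDerivAt (fun r => r * (p r * q r)) (1 * (p r * q r) + r *
      ((deriv Real.smoothTransition ((-r - ε) / ε) * (-1 / ε)) * q r + p r *
        (deriv Real.smoothTransition (2 + 4 * r / c) * (4 / c)))) r := fun r =>
    (hasDerivAt_id r).mul ((hpd r).mul (hqd r))
  have hrp : ∀ r ≤ 0, |r * (deriv Real.smoothTransition ((-r - ε) / ε) * (-1 / ε))| ≤ 2 * D := by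
    intro r hr
    rw [abs_mul, abs_mul]
    by_cases h2 : r < -2 * ε
    · have : p =ᶠ[𝓝 r] fun _ => 1 := by
        filter_upwards [Iio_mem_nhds h2] with y hy using hp1 y (le_of_lt hy)
      have h3 := this.deriv_eq
      rw [(hpd r).deriv] at h3
      rw [← abs_mul (deriv _ _), h3]; simp; positivity
    · push Not at h2
      have h4 : |r| ≤ 2 * ε := by rw [abs_le]; constructor <;> linarith
      have h5 : |(-1 / ε)| = 1 / ε := by rw [abs_div, abs_neg, abs_one, abs_of_pos hε]
      calc |r| * (|deriv Real.smoothTransition ((-r - ε) / ε)| * |(-1 / ε)|) ≤ (2 * ε) * (D * (1 / ε)) := by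
            rw [h5]; gcongr; exact hD _
        _ = 2 * D := by field_simp
  have hrq : ∀ r ≤ 0, |r * (deriv Real.smoothTransition (2 + 4 * r / c) * (4 / c))| ≤ 2 * D := by
    intro r hr
    rw [abs_mul, abs_mul]
    by_cases h2 : r < -c / 2
    · have : q =ᶠ[𝓝 r] fun _ => 0 := by
        filter_upwards [Iio_mem_nhds h2] with y hy using hq0 y (le_of_lt hy)
      have h3 := this.deriv_eq
      rw [(hqd r).deriv] at h3
      rw [← abs_mul (deriv _ _), h3]; simp; positivity
    · push Not at h2
      have h4 : |r| ≤ c / 2 := by rw [abs_le]; constructor <;> linarith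
      have h5 : |(4 / c)| = 4 / c := abs_of_pos (by positivity)
      calc |r| * (|deriv Real.smoothTransition (2 + 4 * r / c)| * |(4 / c)|) ≤ (c / 2) * (D * (4 / c)) := by
            rw [h5]; gcongr; exact hD _
        _ = 2 * D := by field_simp; ring
  have hbd : ∀ r ≤ 0, |deriv (fun r => r * (p r * q r)) r| ≤ 1 + 4 * D := by
    intro r hr
    rw [(hder r).deriv]
    have e1 : |p r * q r| ≤ 1 := by
      rw [abs_of_nonneg (mul_nonneg (hp01 r).1 (hq01 r).1)]
      exact mul_le_one₀ (hp01 r).2 (hq01 r).1 (hq01 r).2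
    have e2 := hrp r hr
    have e3 := hrq r hr
    set x := r * (deriv Real.smoothTransition ((-r - ε) / ε) * (-1 / ε))
    set y := r * (deriv Real.smoothTransition (2 + 4 * r / c) * (4 / c))
    have e4 : |x * q r| ≤ 2 * D := by
      rw [abs_mul, abs_of_nonneg (hq01 r).1]
      nlinarith [abs_nonneg x, (hq01 r).1, (hq01 r).2]
    have e5 : |p r * y| ≤ 2 * D := by
      rw [abs_mul, abs_of_nonneg (hp01 r).1]
      nlinarith [abs_nonneg y, (hp01 r).1, (hp01 r).2]
    calc _ = |p r * q r + x * q r + p r * y| := by congr 1; ring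
      _ ≤ |p r * q r| + |x * q r| + |p r * y| := abs_add_three _ _ _
      _ ≤ _ := by linarith
  refine ⟨fun r => r * (p r * q r), ?_, ?_, ?_, ?_, ?_, ?_⟩
  · refine contDiff_id.mul ((hs.comp ?_).mul (hs.comp ?_)) <;> fun_prop
  · intro r hr; simp [hq0 r hr]
  · intro r hr; simp [hp0 r hr.le]
  · intro r
    rw [abs_mul, abs_of_nonneg (mul_nonneg (hp01 r).1 (hq01 r).1)]
    have := mul_le_one₀ (hp01 r).2 (hq01 r).1 (hq01 r).2
    nlinarith [abs_nonneg r]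
  · intro r hr; exact (hbd r hr).trans (le_max_left _ _)
  · intro r hr hr2
    by_cases h4 : -c / 4 < r
    · have : (fun r => r * (p r * q r)) =ᶠ[𝓝 r] fun r => r := by
        filter_upwards [Iio_mem_nhds hr2, Ioi_mem_nhds h4] with y h1 h2
        rw [hp1 y (le_of_lt h1), hq1 y (le_of_lt h2)]; ring
      rw [this.deriv_eq]
      simp; positivity
    · push Not at h4
      have h5 := hbd r hr
      have h6 : |r| * (4 / c) ≥ 1 := by
        rw [abs_of_nonpos hr, ge_iff_le, mul_div_assoc', le_div_iff₀ hc]; linarith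
      calc |1 - deriv (fun r => r * (p r * q r)) r| ≤ |1| + |deriv (fun r => r * (p r * q r)) r| := abs_sub _ _
        _ ≤ 2 + 4 * D := by rw [abs_one]; linarith
        _ ≤ (2 + 4 * D) * (|r| * (4 / c)) := by nlinarith
        _ = (2 + 4 * D) * (4 / c) * |r| := by ring
        _ ≤ _ := by gcongr; exact le_max_right _ _

variable {n : ℕ} {Ω₁ Ω₂ : Set (EE n)} {ρ₁ ρ₂ : EE n → ℝ} {c C r : ℝ} {φ : EE n → EE n}

def aa (j : Fin n) (A : EE n →L[ℝ] ℝ) : ℂ := (A (ev j) - Complex.I * A (Complex.I • ev j)) / 2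
def bb (j : Fin n) (A : EE n →L[ℝ] ℝ) : ℂ := (A (ev j) + Complex.I * A (Complex.I • ev j)) / 2
def GG (k : Fin n) (A : EE n →L[ℝ] ℝ) : ℂ := bb k A / ∑ j, aa j A * bb j A

lemma contDiff_ev (v : EE n) : ContDiff ℝ ∞ (fun A : EE n →L[ℝ] ℝ => ((A v : ℝ) : ℂ)) :=
  Complex.ofRealCLM.contDiff.comp (ContinuousLinearMap.apply ℝ ℝ v).contDiff

lemma contDiff_aa (j : Fin n) : ContDiff ℝ ∞ (aa j : (EE n →L[ℝ] ℝ) → ℂ) := by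
  unfold aa
  exact ((contDiff_ev _).sub (contDiff_const.mul (contDiff_ev _))).div_const _

lemma contDiff_bb (j : Fin n) : ContDiff ℝ ∞ (bb j : (EE n →L[ℝ] ℝ) → ℂ) := by
  unfold bb
  exact ((contDiff_ev _).add (contDiff_const.mul (contDiff_ev _))).div_const _

lemma sum_ab (A : EE n →L[ℝ] ℝ) (hA : A ≠ 0) : ∑ j, aa j A * bb j A ≠ 0 := by
  have h1 : ∑ j, aa j A * bb j A = ((∑ j, ((A (ev j)) ^ 2 + (A (Complex.I • ev j)) ^ 2) / 4 : ℝ) : ℂ) := by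
    push_cast
    refine Finset.sum_congr rfl fun j _ => ?_
    simp only [aa, bb]
    linear_combination (-(A (Complex.I • ev j) : ℂ) ^ 2 / 4) * Complex.I_mul_I
  rw [h1]
  norm_cast
  intro h0
  apply hA
  have h2 := (Finset.sum_eq_zero_iff_of_nonneg (fun j _ => by positivity)).1 h0
  have h3 : ∀ j, A (ev j) = 0 ∧ A (Complex.I • ev j) = 0 := by
    intro j
    have := h2 j (Finset.mem_univ j)
    constructor <;> nlinarith [sq_nonneg (A (ev j)), sq_nonneg (A (Complex.I • ev j))]
  ext v
  rw [vec_eq_sum v, map_sum]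
  refine Finset.sum_eq_zero fun j _ => ?_
  have : v j • (ev j : EE n) = (v j).re • (ev j : EE n) + (v j).im • (Complex.I • ev j : EE n) := by
    conv_lhs => rw [← Complex.re_add_im (v j)]
    rw [add_smul, mul_smul]
    rfl
  rw [this, map_add, map_smul, map_smul, (h3 j).1, (h3 j).2]; simp

lemma contDiffAt_GG (k : Fin n) {A : EE n →L[ℝ] ℝ} (hA : A ≠ 0) : ContDiffAt ℝ ∞ (GG k) A := by
  have h1 : ContDiff ℝ ∞ (fun A : EE n →L[ℝ] ℝ => ∑ j, aa j A * bb j A) :=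
    ContDiff.sum fun j _ => (contDiff_aa j).mul (contDiff_bb j)
  have h2 : ContDiffAt ℝ ∞ (fun A : EE n →L[ℝ] ℝ => bb k A * (∑ j, aa j A * bb j A)⁻¹) A :=
    (contDiff_bb k).contDiffAt.mul (h1.contDiffAt.inv (sum_ab A hA))
  exact h2

lemma GG_bdd (k : Fin n) (hc : 0 < c) : ∃ B > 0, ∀ A : EE n →L[ℝ] ℝ, c ≤ ‖A‖ → ‖A‖ ≤ C → ‖GG k A‖ ≤ B ∧ ‖fderiv ℝ (GG k) A‖ ≤ B := by
  have hK : IsCompact ({A : EE n →L[ℝ] ℝ | c ≤ ‖A‖} ∩ closedBall 0 C) :=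
    (isCompact_closedBall _ _).inter_left (isClosed_le continuous_const continuous_norm)
  have hsub : ({A : EE n →L[ℝ] ℝ | c ≤ ‖A‖} ∩ closedBall 0 C) ⊆ {0}ᶜ := by
    rintro A ⟨h1, -⟩ rfl
    simp at h1; linarith
  have h1 : ContDiffOn ℝ ∞ (GG k) ({0}ᶜ : Set (EE n →L[ℝ] ℝ)) := fun A hA => (contDiffAt_GG k hA).contDiffWithinAt
  have h2 : ContDiffOn ℝ ∞ (fderiv ℝ (GG k)) ({0}ᶜ : Set (EE n →L[ℝ] ℝ)) := h1.fderiv_of_isOpen isOpen_compl_singleton (by simp)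
  obtain ⟨B1, p1, b1⟩ := compact_bdd hK (h1.continuousOn.mono hsub)
  obtain ⟨B2, p2, b2⟩ := compact_bdd hK (h2.continuousOn.mono hsub)
  exact ⟨max B1 B2, by positivity, fun A h3 h4 => ⟨(b1 A ⟨h3, by simpa using h4⟩).trans (le_max_left _ _),
    (b2 A ⟨h3, by simpa using h4⟩).trans (le_max_right _ _)⟩⟩

end GDJ

namespace GDJ
open Set Filter Topology MeasureTheory
open scoped ContDiff

variable {n : ℕ} {Ω₁ Ω₂ : Set (EE n)} {ρ₁ ρ₂ : EE n → ℝ} {c C r : ℝ} {φ : EE n → EE n}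

lemma dz_real_comp {ρ : EE n → ℝ} {Θ : ℝ → ℝ} {w : EE n} (hΘ : DifferentiableAt ℝ Θ (ρ w)) (hρ : DifferentiableAt ℝ ρ w)
    (v : EE n) : dz (fun w => ((Θ (ρ w) : ℝ) : ℂ)) w v = deriv Θ (ρ w) *
      ((fderiv ℝ ρ w v - Complex.I * fderiv ℝ ρ w (Complex.I • v)) / 2) := by
  have h1 : HasFDerivAt (fun w => Θ (ρ w)) (deriv Θ (ρ w) • fderiv ℝ ρ w) w :=
    hΘ.hasDerivAt.comp_hasFDerivAt w hρ.hasFDerivAt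
  rw [dz, fderiv_ofReal_comp h1.differentiableAt, fderiv_ofReal_comp h1.differentiableAt, h1.fderiv]
  simp
  ring

set_option maxHeartbeats 1000000 in
lemma Dom.field {Ω : Set (EE n)} {ρ : EE n → ℝ} (D : Dom Ω ρ c C r) : ∃ A ≥ 1, ∀ ε > 0, ∃ η : Fin n → EE n → ℂ,
    (∀ k, ContDiffOn ℝ 1 (η k) Ω) ∧ (∀ k, ∀ w ∈ Ω, ‖η k w‖ ≤ A * (-ρ w)) ∧
    (∀ k, ∀ w ∈ Ω, -ε < ρ w → η k w = 0) ∧ (∀ w ∈ Ω, ‖1 - ∑ k, dz (η k) w (ev k)‖ ≤ A) ∧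
    (∀ w ∈ Ω, ρ w < -2 * ε → ‖1 - ∑ k, dz (η k) w (ev k)‖ ≤ A * (-ρ w)) := by
  have hc := D.hc
  have hC := D.hC
  obtain ⟨A, hA, hΘ⟩ := exists_theta hc
  choose B hB hBb using fun k : Fin n => GG_bdd (c := c) (C := C) k hc
  set BB := ∑ k, B k with hBB
  have hBle : ∀ k, B k ≤ BB := fun k => Finset.single_le_sum (fun k _ => (hB k).le) (Finset.mem_univ k)
  have hBB0 : 0 ≤ BB := Finset.sum_nonneg fun k _ => (hB k).le
  set A' := (1 + A + n * (BB * C) + BB) * C + 2 / c with hA'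
  have hA'1 : 1 + A + n * (BB * C) * C ≤ A' := by
    have : (0:ℝ) < 2 / c := by positivity
    have h2 : 0 ≤ (n:ℝ) * (BB * C) := by positivity
    nlinarith
  have hA'2 : A + n * (BB * C) ≤ A' := by
    have : (0:ℝ) < 2 / c := by positivity
    have h2 : 0 ≤ (n:ℝ) * (BB * C) := by positivity
    nlinarith
  have hA'3 : BB ≤ A' := by
    have : (0:ℝ) < 2 / c := by positivity
    have h2 : 0 ≤ (n:ℝ) * (BB * C) := by positivity
    nlinarith
  have hA'4 : 2 / c ≤ A' := by
    have h2 : 0 ≤ (n:ℝ) * (BB * C) := by positivity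
    have : 0 ≤ (1 + A + n * (BB * C) + BB) * C := by positivity
    linarith
  have hnn : 0 ≤ (n:ℝ) * (BB * C) := by positivity
  refine ⟨A', by nlinarith, fun ε hε => ?_⟩
  obtain ⟨Θ, t1, t2, t3, t4, t5, t6⟩ := hΘ ε hε
  have hΘd : Differentiable ℝ Θ := t1.differentiable (by simp)
  have hsm : ∀ w ∈ Ω, ContDiffAt ℝ ∞ ρ w := fun w hw => D.smooth w hw w (mem_ball_self D.hr)
  have hgC : ∀ w ∈ Ω, ‖fderiv ℝ ρ w‖ ≤ C := fun w hw => D.d1 w hw w (mem_ball_self D.hr)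
  have hg2C : ∀ w ∈ Ω, ‖D2 ρ w‖ ≤ C := fun w hw => D.d2 w hw w (mem_ball_self D.hr)
  have hX : ∀ w ∈ Ω, -c < ρ w → ∀ k, ContDiffAt ℝ 1 (fun w => GG k (fderiv ℝ ρ w)) w := by
    intro w hw hwc k
    have h1 : fderiv ℝ ρ w ≠ 0 := by
      have := D.grad w hw hwc
      exact norm_pos_iff.1 (by linarith)
    have h2 : ContDiffAt ℝ 1 (fderiv ℝ ρ) w := (hsm w hw).fderiv_right (m := 1) (WithTop.coe_le_coe.2 le_top)
    exact ContDiffAt.comp w ((contDiffAt_GG k h1).of_le (by exact_mod_cast le_top)) h2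
  have hzero : ∀ w ∈ Ω, ρ w < -c / 2 → ∀ k, (fun w => (Θ (ρ w) : ℂ) * GG k (fderiv ℝ ρ w)) =ᶠ[𝓝 w] fun _ => 0 := by
    intro w hw hwc k
    have := ((hsm w hw).continuousAt).eventually_lt_const hwc
    filter_upwards [this] with y hy
    simp [t2 _ hy.le]
  have hdz0 : ∀ w ∈ Ω, ρ w < -c / 2 → ∑ k, dz (fun w => (Θ (ρ w) : ℂ) * GG k (fderiv ℝ ρ w)) w (ev k) = 0 := by
    intro w hw hwc
    refine Finset.sum_eq_zero fun k _ => ?_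
    rw [dz_congr (hzero w hw hwc k)]
    simp [dz]
  have hTC : ∀ w ∈ Ω, ContDiffAt ℝ 1 (fun w => ((Θ (ρ w) : ℝ) : ℂ)) w := fun w hw =>
    Complex.ofRealCLM.contDiff.contDiffAt.comp w (t1.contDiffAt.comp w ((hsm w hw).of_le (by exact_mod_cast le_top)))
  have hdz1 : ∀ w ∈ Ω, -c < ρ w → ∃ d : ℂ, ‖d‖ ≤ n * (BB * C) * (-ρ w) ∧
      ∑ k, dz (fun w => (Θ (ρ w) : ℂ) * GG k (fderiv ℝ ρ w)) w (ev k) = deriv Θ (ρ w) + d := by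
    intro w hw hwc
    have hneg := D.neg hw
    have hgr := D.grad w hw hwc
    have hne : fderiv ℝ ρ w ≠ 0 := norm_pos_iff.1 (by linarith)
    refine ⟨∑ k, (Θ (ρ w) : ℂ) * dz (fun w => GG k (fderiv ℝ ρ w)) w (ev k), ?_, ?_⟩
    · have : ∀ k ∈ (Finset.univ : Finset (Fin n)), ‖(Θ (ρ w) : ℂ) * dz (fun w => GG k (fderiv ℝ ρ w)) w (ev k)‖ ≤ (-ρ w) * (BB * C) := by
        intro k _
        rw [norm_mul, Complex.norm_real, Real.norm_eq_abs]
        have h1 := t4 (ρ w)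
        rw [abs_of_neg hneg] at h1
        have h2 := norm_dz_le (fun w => GG k (fderiv ℝ ρ w)) w (ev k)
        rw [norm_ev, mul_one] at h2
        have h3 : HasFDerivAt (fun w => GG k (fderiv ℝ ρ w)) ((fderiv ℝ (GG k) (fderiv ℝ ρ w)).comp (D2 ρ w)) w := by
          have h4 : DifferentiableAt ℝ (fderiv ℝ ρ) w :=
            ((hsm w hw).fderiv_right (m := 1) (WithTop.coe_le_coe.2 le_top)).differentiableAt (by simp)
          exact ((contDiffAt_GG k hne).differentiableAt (by simp)).hasFDerivAt.comp w h4.hasFDerivAt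
        have h5 : ‖fderiv ℝ (fun w => GG k (fderiv ℝ ρ w)) w‖ ≤ BB * C := by
          rw [h3.fderiv]
          refine (ContinuousLinearMap.opNorm_comp_le _ _).trans ?_
          have b1 := ((hBb k _ hgr (hgC w hw)).2).trans (hBle k)
          have b2 := hg2C w hw
          gcongr
        gcongr
        · linarith
        · exact h2.trans h5
      refine (norm_sum_le_of_le _ this).trans ?_
      simp only [Finset.sum_const, Finset.card_univ, Fintype.card_fin, nsmul_eq_mul]
      linarith
    · have h1 : ∀ k, dz (fun w => (Θ (ρ w) : ℂ) * GG k (fderiv ℝ ρ w)) w (ev k) =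
          (Θ (ρ w) : ℂ) * dz (fun w => GG k (fderiv ℝ ρ w)) w (ev k) +
            deriv Θ (ρ w) * (aa k (fderiv ℝ ρ w) * GG k (fderiv ℝ ρ w)) := by
        intro k
        rw [dz_mul ((hTC w hw).differentiableAt (by simp)) ((hX w hw hwc k).differentiableAt (by simp)),
          dz_real_comp (hΘd _) ((hsm w hw).differentiableAt (by simp))]
        simp only [aa]; ring
      simp only [h1, Finset.sum_add_distrib, ← Finset.mul_sum]
      have h2 : ∑ k, aa k (fderiv ℝ ρ w) * GG k (fderiv ℝ ρ w) = 1 := by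
        simp only [GG, mul_div_assoc']
        rw [← Finset.sum_div, div_self (sum_ab _ hne)]
      rw [h2, mul_one, add_comm]
  refine ⟨fun k w => (Θ (ρ w) : ℂ) * GG k (fderiv ℝ ρ w), ?_, ?_, ?_, ?_, ?_⟩
  · intro k w hw
    apply ContDiffAt.contDiffWithinAt
    by_cases hwc : -c < ρ w
    · exact (hTC w hw).mul (hX w hw hwc k)
    · exact contDiffAt_const.congr_of_eventuallyEq (hzero w hw (by linarith) k)
  · intro k w hw
    have hneg := D.neg hw
    by_cases hwc : -c < ρ w
    · rw [norm_mul, Complex.norm_real, Real.norm_eq_abs, mul_comm]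
      have h1 := t4 (ρ w)
      rw [abs_of_neg hneg] at h1
      have h2 := ((hBb k _ (D.grad w hw hwc) (hgC w hw)).1).trans ((hBle k).trans hA'3)
      have : (0:ℝ) ≤ A' := by linarith
      gcongr
    · have h0 : Θ (ρ w) = 0 := t2 _ (by linarith)
      simp only [h0, Complex.ofReal_zero, zero_mul, norm_zero]
      have : (0:ℝ) ≤ A' := by linarith
      have : 0 ≤ -ρ w := by linarith
      positivity
  · intro k w hw h
    simp [t3 _ h]
  · intro w hw
    have hneg := D.neg hw
    by_cases hwc : -c < ρ w
    · obtain ⟨d, hd, he⟩ := hdz1 w hw hwc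
      rw [he]
      have h1 := t5 _ hneg.le
      have h2 : ‖((deriv Θ (ρ w) : ℝ) : ℂ)‖ ≤ A := by rwa [Complex.norm_real]
      have h3 := D.bnd w hw
      calc ‖(1:ℂ) - (((deriv Θ (ρ w) : ℝ) : ℂ) + d)‖ ≤ ‖(1:ℂ)‖ + (‖((deriv Θ (ρ w) : ℝ) : ℂ)‖ + ‖d‖) :=
            (norm_sub_le _ _).trans (by gcongr; exact norm_add_le _ _)
        _ ≤ 1 + (A + n * (BB * C) * C) := by
            rw [norm_one]; gcongr; refine hd.trans ?_; gcongr; linarith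
        _ ≤ A' := by linarith
    · rw [hdz0 w hw (by linarith)]; simp; nlinarith
  · intro w hw hwe
    have hneg := D.neg hw
    by_cases hwc : -c < ρ w
    · obtain ⟨d, hd, he⟩ := hdz1 w hw hwc
      rw [he]
      have h1 := t6 _ hneg.le hwe
      rw [abs_of_neg hneg] at h1
      have h2 : ‖(1:ℂ) - ((deriv Θ (ρ w) : ℝ) : ℂ)‖ ≤ A * (-ρ w) := by
        rw [← Complex.ofReal_one, ← Complex.ofReal_sub, Complex.norm_real]; exact h1
      calc ‖(1:ℂ) - (((deriv Θ (ρ w) : ℝ) : ℂ) + d)‖ ≤ ‖(1:ℂ) - ((deriv Θ (ρ w) : ℝ) : ℂ)‖ + ‖d‖ := by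
            rw [← sub_sub]; exact norm_sub_le _ _
        _ ≤ A * (-ρ w) + n * (BB * C) * (-ρ w) := by gcongr
        _ = (A + n * (BB * C)) * (-ρ w) := by ring
        _ ≤ _ := by gcongr; linarith
    · rw [hdz0 w hw (by linarith)]; simp only [sub_zero, norm_one]
      push Not at hwc
      have : 2 / c * c = 2 := by field_simp
      calc (1:ℝ) ≤ 2 / c * c := by linarith
        _ ≤ A' * (-ρ w) := by gcongr; linarith

end GDJ

namespace GDJ
open Set Filter Topology MeasureTheory
open scoped ContDiff

variable {n : ℕ} {Ω₁ Ω₂ : Set (EE n)} {ρ₁ ρ₂ : EE n → ℝ} {c C r : ℝ} {φ : EE n → EE n}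

lemma continuousOn_dz {B : Set (EE n)} (hB : IsOpen B) {h : EE n → ℂ} (hh : ContDiffOn ℝ 1 h B) (v : EE n) :
    ContinuousOn (fun z => dz h z v) B := by
  have h1 : ContinuousOn (fderiv ℝ h) B := hh.continuousOn_fderiv_of_isOpen hB le_rfl
  have h2 : ContinuousOn (fun z => fderiv ℝ h z v) B := h1.clm_apply continuousOn_const
  have h3 : ContinuousOn (fun z => fderiv ℝ h z (Complex.I • v)) B := h1.clm_apply continuousOn_const
  unfold dz
  fun_prop

lemma contDiffOn_real_of_holo {B : Set (EE n)} (hB : IsOpen B) {h : EE n → ℂ} (hh : DifferentiableOn ℂ h B) :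
    ContDiffOn ℝ 1 h B :=
  ((contDiffOn_holo hB hh).restrict_scalars ℝ).of_le (by exact_mod_cast le_top)

lemma bdd_mul_integrable {B : Set (EE n)} (hB : IsOpen B) {f h : EE n → ℂ} (hf : ContinuousOn f B) {M : ℝ}
    (hM : ∀ z ∈ B, ‖f z‖ ≤ M) (hh : IntegrableOn h B) : IntegrableOn (fun z => f z * h z) B := by
  refine Integrable.bdd_mul (c := M) hh (hf.aestronglyMeasurable hB.measurableSet) ?_
  exact (ae_restrict_iff' hB.measurableSet).2 (ae_of_all _ hM)

set_option maxHeartbeats 1000000 in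
/-- one step of the Bell identity -/
lemma Setup.bell_step (S : Setup Ω₁ Ω₂ ρ₁ ρ₂ c C r φ) : ∃ A > 0, ∀ ε > 0, ∀ h : EE n → ℂ, ContDiffOn ℝ 1 h Ω₁ →
    IntegrableOn h Ω₁ → (∀ j, IntegrableOn (fun z => dz h z (ev j)) Ω₁) →
    ‖∫ z in Ω₁, (Jac φ z).det * h z‖ ≤ A * ((∫ z in Ω₁, (-ρ₁ z) * ‖h z‖) + ∫ z in Ω₁, ∑ j, ‖dz h z (ev j)‖) +
      A * ∫ z in Ω₁, {z | -2 * ε ≤ ρ₂ (φ z)}.indicator (fun z => ‖h z‖) z := by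
  obtain ⟨A, hA, hfield⟩ := S.D2.field
  obtain ⟨K, hK, hopf⟩ := S.hopf
  obtain ⟨B, hB, hb⟩ := S.bounds
  have hC := S.D1.hC
  have hop := S.D1.op
  have hA0 : 0 < A := by linarith
  set A' := max (B * A * (1 + K)) (n * (B * A * K * Real.sqrt C)) with hA'
  have hA'0 : 0 < A' := lt_max_of_lt_left (by positivity)
  refine ⟨A', hA'0, fun ε hε h hh hi hdi => ?_⟩
  obtain ⟨η, e1, e2, e3, e4, e5⟩ := hfield ε hε
  set f : EE n → ℂ := fun z => (Jac φ z).det with hf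
  have hfd : DifferentiableOn ℂ f Ω₁ := differentiableOn_det hop S.holo
  have hφ1 : ContDiffOn ℝ 1 φ Ω₁ := ((contDiffOn_holo hop S.holo).restrict_scalars ℝ).of_le (by exact_mod_cast le_top)
  have hηφ : ∀ k, ContDiffOn ℝ 1 (fun z => η k (φ z)) Ω₁ := fun k => (e1 k).comp hφ1 S.proper.1
  have haη : ∀ j k, ContDiffOn ℝ 1 (fun z => (Jac φ z).adjugate j k * η k (φ z)) Ω₁ := fun j k =>
    (contDiffOn_real_of_holo hop (differentiableOn_adj hop S.holo j k)).mul (hηφ k)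
  set θ : Fin n → EE n → ℂ := fun j z => ∑ k, (Jac φ z).adjugate j k * η k (φ z) with hθ
  have hθ1 : ∀ j, ContDiffOn ℝ 1 (θ j) Ω₁ := fun j => ContDiffOn.sum fun k _ => haη j k
  have hda : ∀ {g : EE n → ℂ}, ContDiffOn ℝ 1 g Ω₁ → ∀ z ∈ Ω₁, DifferentiableAt ℝ g z := fun hg z hz =>
    (hg.contDiffAt (hop.mem_nhds hz)).differentiableAt (by simp)
  -- divergence of θ
  have hdiv : ∀ z ∈ Ω₁, ∑ j, dz (θ j) z (ev j) = f z * ∑ k, dz (η k) (φ z) (ev k) := by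
    intro z hz
    have h1 : ∀ j, dz (θ j) z (ev j) = ∑ k, dz (fun z => (Jac φ z).adjugate j k * η k (φ z)) z (ev j) := fun j =>
      dz_fun_sum _ (fun k _ => hda (haη j k) z hz) _
    simp only [h1]
    rw [Finset.sum_comm, Finset.mul_sum]
    refine Finset.sum_congr rfl fun k _ => ?_
    exact piola_comp hop S.holo hz k
      (((e1 k).contDiffAt (S.D2.op.mem_nhds (S.proper.1 hz))).differentiableAt (by simp))
  -- compact support
  set K₂ := {w ∈ Ω₂ | ρ₂ w ≤ -ε} with hK₂
  have hK₂c := S.D2.cpt ε hε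
  have hKc := S.proper.2 K₂ (fun w hw => hw.1) hK₂c
  have hθ0 : ∀ j, ∀ z ∈ Ω₁, z ∉ {z ∈ Ω₁ | φ z ∈ K₂} → θ j z * h z = 0 := by
    intro j z hz hzK
    have : -ε < ρ₂ (φ z) := by
      by_contra hcon
      push Not at hcon
      exact hzK ⟨hz, S.proper.1 hz, hcon⟩
    have : θ j z = 0 := Finset.sum_eq_zero fun k _ => by rw [e3 k _ (S.proper.1 hz) this, mul_zero]
    rw [this, zero_mul]
  have hibp : ∀ j, ∫ z in Ω₁, dz (fun z => θ j z * h z) z (ev j) = 0 ∧ IntegrableOn (fun z => dz (fun z => θ j z * h z) z (ev j)) Ω₁ :=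
    fun j => setIntegral_dz_eq_zero hop hKc (fun z hz => hz.1) ((hθ1 j).mul hh) (hθ0 j) (ev j)
  -- bound of θ
  have hθb : ∀ j, ∀ z ∈ Ω₁, ‖θ j z‖ ≤ A' := by
    intro j z hz
    have hneg := S.D1.neg hz
    have hbn := S.D1.bnd z hz
    have h1 : ∀ k ∈ (Finset.univ : Finset (Fin n)), ‖(Jac φ z).adjugate j k * η k (φ z)‖ ≤ B * A * K * Real.sqrt C := by
      intro k _
      rw [norm_mul]
      have h2 := (hb z hz).2 j k
      have h3 := e2 k _ (S.proper.1 hz)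
      have h4 := hopf z hz
      have h5 : -ρ₁ z = Real.sqrt (-ρ₁ z) * Real.sqrt (-ρ₁ z) := (Real.mul_self_sqrt (by linarith)).symm
      have h6 : Real.sqrt (-ρ₁ z) ≤ Real.sqrt C := Real.sqrt_le_sqrt (by linarith)
      calc ‖(Jac φ z).adjugate j k‖ * ‖η k (φ z)‖ ≤ ‖(Jac φ z).adjugate j k‖ * (A * (K * (-ρ₁ z))) := by
            gcongr; exact h3.trans (by gcongr)
        _ = (‖(Jac φ z).adjugate j k‖ * Real.sqrt (-ρ₁ z)) * (A * K * Real.sqrt (-ρ₁ z)) := by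
            conv_lhs => rw [h5]
            ring
        _ ≤ B * (A * K * Real.sqrt C) := by gcongr
        _ = _ := by ring
    refine (norm_sum_le_of_le _ h1).trans ?_
    simp only [Finset.sum_const, Finset.card_univ, Fintype.card_fin, nsmul_eq_mul]
    exact le_max_right _ _
  -- the error term
  set E : EE n → ℂ := fun z => f z - ∑ j, dz (θ j) z (ev j) with hE
  have hEeq : ∀ z ∈ Ω₁, E z = f z * (1 - ∑ k, dz (η k) (φ z) (ev k)) := by
    intro z hz
    simp only [hE, hdiv z hz]; ring
  have hEc : ContinuousOn E Ω₁ := hfd.continuousOn.sub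
    (continuousOn_finset_sum _ fun j _ => continuousOn_dz hop (hθ1 j) (ev j))
  have hEb1 : ∀ z ∈ Ω₁, ‖E z‖ ≤ B * A := by
    intro z hz
    rw [hEeq z hz, norm_mul]
    have := (hb z hz).1
    have := e4 _ (S.proper.1 hz)
    gcongr
  have hBA : B * A ≤ A' := (by nlinarith [mul_pos (by linarith : 0 < B) hA0] : B * A ≤ B * A * (1 + K)).trans (le_max_left _ _)
  have hEb2 : ∀ z ∈ Ω₁, ρ₂ (φ z) < -2 * ε → ‖E z‖ ≤ A' * (-ρ₁ z) := by
    intro z hz hze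
    rw [hEeq z hz, norm_mul]
    have h1 := (hb z hz).1
    have h2 := e5 _ (S.proper.1 hz) hze
    have h3 := hopf z hz
    have hneg := S.D1.neg hz
    calc ‖f z‖ * ‖1 - ∑ k, dz (η k) (φ z) (ev k)‖ ≤ B * (A * (K * (-ρ₁ z))) := by
          gcongr; exact h2.trans (by gcongr)
      _ = B * A * K * (-ρ₁ z) := by ring
      _ ≤ A' * (-ρ₁ z) := by
          have : 0 ≤ -ρ₁ z := by linarith
          gcongr
          refine le_trans ?_ (le_max_left _ _)
          nlinarith [mul_pos (by linarith : 0 < B) hA0]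
  -- integrability
  have i1 : IntegrableOn (fun z => E z * h z) Ω₁ := bdd_mul_integrable hop hEc hEb1 hi
  have i2 : ∀ j, IntegrableOn (fun z => θ j z * dz h z (ev j)) Ω₁ := fun j =>
    bdd_mul_integrable hop (hθ1 j).continuousOn (hθb j) (hdi j)
  have hdec : ∀ z ∈ Ω₁, f z * h z = E z * h z + (∑ j, dz (fun z => θ j z * h z) z (ev j) - ∑ j, θ j z * dz h z (ev j)) := by
    intro z hz
    have h1 : ∀ j, dz (fun z => θ j z * h z) z (ev j) = θ j z * dz h z (ev j) + dz (θ j) z (ev j) * h z := fun j =>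
      dz_mul (hda (hθ1 j) z hz) (hda hh z hz) _
    simp only [h1, Finset.sum_add_distrib, ← Finset.sum_mul, hE]
    ring
  have hintg : ∫ z in Ω₁, f z * h z = (∫ z in Ω₁, E z * h z) - ∫ z in Ω₁, ∑ j, θ j z * dz h z (ev j) := by
    rw [setIntegral_congr_fun hop.measurableSet hdec, integral_add i1, integral_sub, integral_finset_sum]
    · simp [(hibp _).1, sub_eq_add_neg]
    · exact fun j _ => (hibp j).2
    · exact integrable_finset_sum _ fun j _ => (hibp j).2
    · exact integrable_finset_sum _ fun j _ => i2 j
    · exact (integrable_finset_sum _ fun j _ => (hibp j).2).sub (integrable_finset_sum _ fun j _ => i2 j)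
  have hAmeas : NullMeasurableSet {z | -2 * ε ≤ ρ₂ (φ z)} (volume.restrict Ω₁) := by
    have h1 : AEMeasurable (fun z => ρ₂ (φ z)) (volume.restrict Ω₁) :=
      (S.D2.cont.comp S.holo.continuousOn S.proper.1).aemeasurable hop.measurableSet
    exact nullMeasurableSet_le aemeasurable_const h1
  have i3 : IntegrableOn (fun z => (-ρ₁ z) * ‖h z‖) Ω₁ := by
    refine Integrable.bdd_mul (c := C) hi.norm (S.D1.cont.neg.aestronglyMeasurable hop.measurableSet) ?_
    refine (ae_restrict_iff' hop.measurableSet).2 (ae_of_all _ fun z hz => ?_)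
    have hneg := S.D1.neg hz
    rw [Real.norm_of_nonneg (by linarith)]
    linarith [S.D1.bnd z hz]
  have i4 : Integrable ({z | -2 * ε ≤ ρ₂ (φ z)}.indicator (fun z => ‖h z‖)) (volume.restrict Ω₁) :=
    hi.norm.indicator₀ hAmeas
  have i5 : IntegrableOn (fun z => ∑ j, ‖dz h z (ev j)‖) Ω₁ := integrable_finset_sum _ fun j _ => (hdi j).norm
  rw [hintg]
  have t1 : ‖∫ z in Ω₁, E z * h z‖ ≤ A' * (∫ z in Ω₁, (-ρ₁ z) * ‖h z‖) +
      A' * ∫ z in Ω₁, {z | -2 * ε ≤ ρ₂ (φ z)}.indicator (fun z => ‖h z‖) z := by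
    rw [← integral_const_mul, ← integral_const_mul, ← integral_add (i3.const_mul A') (i4.const_mul A')]
    refine norm_integral_le_of_norm_le ((i3.const_mul A').add (i4.const_mul A')) ?_
    refine (ae_restrict_iff' hop.measurableSet).2 (ae_of_all _ fun z hz => ?_)
    rw [norm_mul]
    have hneg := S.D1.neg hz
    by_cases hze : -2 * ε ≤ ρ₂ (φ z)
    · rw [indicator_of_mem (show z ∈ {z | -2 * ε ≤ ρ₂ (φ z)} from hze)]
      have := (hEb1 z hz).trans hBA
      have h2 : 0 ≤ A' * (-ρ₁ z * ‖h z‖) := mul_nonneg hA'0.le (mul_nonneg (by linarith) (norm_nonneg _))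
      have h3 : ‖E z‖ * ‖h z‖ ≤ A' * ‖h z‖ := by gcongr
      linarith
    · rw [indicator_of_notMem (show z ∉ {z | -2 * ε ≤ ρ₂ (φ z)} from hze)]
      push Not at hze
      have h3 : ‖E z‖ * ‖h z‖ ≤ A' * (-ρ₁ z) * ‖h z‖ := by gcongr; exact hEb2 z hz hze
      linarith
  have t2 : ‖∫ z in Ω₁, ∑ j, θ j z * dz h z (ev j)‖ ≤ A' * ∫ z in Ω₁, ∑ j, ‖dz h z (ev j)‖ := by
    rw [← integral_const_mul]
    refine norm_integral_le_of_norm_le (i5.const_mul A') ?_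
    refine (ae_restrict_iff' hop.measurableSet).2 (ae_of_all _ fun z hz => ?_)
    rw [Finset.mul_sum]
    refine norm_sum_le_of_le _ fun j _ => ?_
    rw [norm_mul]
    gcongr
    exact hθb j z hz
  refine (norm_sub_le _ _).trans ?_
  linarith

lemma Setup.bell (S : Setup Ω₁ Ω₂ ρ₁ ρ₂ c C r φ) : ∃ A > 0, ∀ h : EE n → ℂ, ContDiffOn ℝ 1 h Ω₁ →
    IntegrableOn h Ω₁ → (∀ j, IntegrableOn (fun z => dz h z (ev j)) Ω₁) →
    ‖∫ z in Ω₁, (Jac φ z).det * h z‖ ≤ A * ((∫ z in Ω₁, (-ρ₁ z) * ‖h z‖) + ∫ z in Ω₁, ∑ j, ‖dz h z (ev j)‖) := by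
  obtain ⟨A, hA, hstep⟩ := S.bell_step
  refine ⟨A, hA, fun h hh hi hdi => ?_⟩
  have hop := S.D1.op
  have hlim : Tendsto (fun N : ℕ => ∫ z in Ω₁, {z | -2 * (1 / ((N:ℝ) + 1)) ≤ ρ₂ (φ z)}.indicator (fun z => ‖h z‖) z) atTop
      (𝓝 (∫ z in Ω₁, (0:ℝ))) := by
    refine tendsto_integral_of_dominated_convergence (fun z => ‖h z‖) ?_ hi.norm ?_ ?_
    · intro N
      have hAmeas : NullMeasurableSet {z | -2 * (1 / ((N:ℝ) + 1)) ≤ ρ₂ (φ z)} (volume.restrict Ω₁) := by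
        have h1 : AEMeasurable (fun z => ρ₂ (φ z)) (volume.restrict Ω₁) :=
          (S.D2.cont.comp S.holo.continuousOn S.proper.1).aemeasurable hop.measurableSet
        exact nullMeasurableSet_le aemeasurable_const h1
      exact hi.norm.aestronglyMeasurable.indicator₀ hAmeas
    · intro N
      refine ae_of_all _ fun z => ?_
      refine (norm_indicator_le_norm_self _ _).trans (by simp)
    · refine (ae_restrict_iff' hop.measurableSet).2 (ae_of_all _ fun z hz => ?_)
      have hneg := S.D2.neg (S.proper.1 hz)
      have h1 : Tendsto (fun N : ℕ => -2 * (1 / ((N:ℝ) + 1))) atTop (𝓝 (-2 * 0)) :=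
        tendsto_one_div_add_atTop_nhds_zero_nat.const_mul _
      rw [mul_zero] at h1
      have h2 := h1.eventually_const_lt hneg
      refine tendsto_const_nhds.congr' ?_
      filter_upwards [h2] with N hN
      rw [indicator_of_notMem]
      simpa using hN
  simp only [integral_zero] at hlim
  have hlim2 := (hlim.const_mul A).const_add
    (A * ((∫ z in Ω₁, (-ρ₁ z) * ‖h z‖) + ∫ z in Ω₁, ∑ j, ‖dz h z (ev j)‖))
  rw [mul_zero, add_zero] at hlim2
  exact ge_of_tendsto' hlim2 fun N => hstep _ (by positivity) h hh hi hdi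

end GDJ

namespace GDJ
open Set Filter Topology MeasureTheory
open scoped ContDiff

lemma rot_mean {V : Type*} [NormedAddCommGroup V] [NormedSpace ℂ V] [SecondCountableTopology V]
    [MeasurableSpace V] [BorelSpace V]
    {μ : Measure V} [SFinite μ] (hrot : ∀ c : ℂ, ‖c‖ = 1 → MeasurePreserving (fun t : V => c • t) μ μ)
    {B : Set V} (hB : IsOpen B) (hbal : ∀ c : ℂ, ‖c‖ ≤ 1 → ∀ t ∈ B, c • t ∈ B)
    {w g : V → ℂ} (hw : IntegrableOn w B μ) (hwr : ∀ c : ℂ, ‖c‖ = 1 → ∀ t, w (c • t) = w t)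
    (hg : DifferentiableOn ℂ g B) {M : ℝ} (hM : ∀ t ∈ B, ‖g t‖ ≤ M) :
    ∫ t in B, w t * g t ∂μ = g 0 * ∫ t in B, w t ∂μ := by
  have hcm : ∀ θ : ℝ, ‖circleMap 0 1 θ‖ = 1 := by intro θ; simp [circleMap]
  -- rotated integrals
  have h1 : ∀ c : ℂ, ‖c‖ = 1 → ∫ t in B, w t * g (c • t) ∂μ = ∫ t in B, w t * g t ∂μ := by
    intro c hc
    have hc0 : c ≠ 0 := by rintro rfl; simp at hc
    have hemb : MeasurableEmbedding (fun t : V => c • t) :=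
      (Homeomorph.smulOfNeZero c hc0).measurableEmbedding
    have hpre : (fun t : V => c • t) ⁻¹' B = B := by
      ext t
      constructor
      · intro ht
        have := hbal c⁻¹ (by simp [hc]) _ ht
        simpa [smul_smul, hc0] using this
      · intro ht; exact hbal c hc.le t ht
    have := (hrot c hc).setIntegral_preimage_emb hemb (fun t => w t * g t) B
    rw [hpre] at this
    rw [← this]
    refine setIntegral_congr_fun hB.measurableSet fun t ht => ?_
    simp only [hwr c hc]
  have hgc : ContinuousOn g B := hg.continuousOn
  -- mean value
  have h2 : ∀ t ∈ B, (∫ θ in (0:ℝ)..(2 * Real.pi), g (circleMap 0 1 θ • t)) = 2 * Real.pi * g 0 := by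
    intro t ht
    have hd : DiffContOnCl ℂ (fun ζ : ℂ => g (ζ • t)) (ball 0 |1|) := by
      have : DifferentiableOn ℂ (fun ζ : ℂ => g (ζ • t)) (closedBall 0 1) := by
        intro ζ hζ
        have hm : ζ • t ∈ B := hbal ζ (by simpa using hζ) t ht
        have e1 : DifferentiableAt ℂ g (ζ • t) := hg.differentiableAt (hB.mem_nhds hm)
        exact (e1.comp ζ (differentiableAt_id.smul_const t)).differentiableWithinAt
      rw [abs_one]
      refine DifferentiableOn.diffContOnCl ?_
      rw [closure_ball _ one_ne_zero]; exact this
    have := hd.circleAverage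
    simp only [Real.circleAverage, zero_smul] at this
    rw [← this, Complex.real_smul, ← mul_assoc]
    have hp : (Real.pi : ℂ) ≠ 0 := by exact_mod_cast Real.pi_ne_zero
    simp
    field_simp
  have h3 : ∫ θ in (0:ℝ)..(2 * Real.pi), ∫ t in B, w t * g (circleMap 0 1 θ • t) ∂μ
      = ∫ t in B, (∫ θ in (0:ℝ)..(2 * Real.pi), w t * g (circleMap 0 1 θ • t)) ∂μ := by
    have h2pi : (0:ℝ) ≤ 2 * Real.pi := by positivity
    simp only [intervalIntegral.integral_of_le h2pi]
    refine integral_integral_swap ?_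
    have e1 : Integrable (fun p : ℝ × V => w p.2) ((volume.restrict (Ioc 0 (2 * Real.pi))).prod (μ.restrict B)) :=
      hw.comp_snd _
    have e2 : AEStronglyMeasurable (fun p : ℝ × V => g (circleMap 0 1 p.1 • p.2))
        ((volume.restrict (Ioc 0 (2 * Real.pi))).prod (μ.restrict B)) := by
      rw [Measure.prod_restrict]
      refine ContinuousOn.aestronglyMeasurable ?_ (measurableSet_Ioc.prod hB.measurableSet)
      refine hgc.comp (by fun_prop) ?_
      rintro ⟨θ, t⟩ ⟨_, ht⟩
      exact hbal _ (hcm θ).le t ht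
    have e3 : ∀ᵐ p ∂((volume.restrict (Ioc 0 (2 * Real.pi))).prod (μ.restrict B)),
        ‖g (circleMap 0 1 p.1 • p.2)‖ ≤ M := by
      rw [Measure.prod_restrict]
      refine (ae_restrict_iff' (measurableSet_Ioc.prod hB.measurableSet)).2 (ae_of_all _ ?_)
      rintro ⟨θ, t⟩ ⟨_, ht⟩
      exact hM _ (hbal _ (hcm θ).le t ht)
    have := e1.bdd_mul (c := M) e2 e3
    refine this.congr (ae_of_all _ fun p => ?_)
    simp only [Function.uncurry]; exact mul_comm _ _
  have h4 : ∫ θ in (0:ℝ)..(2 * Real.pi), ∫ t in B, w t * g (circleMap 0 1 θ • t) ∂μ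
      = 2 * Real.pi * ∫ t in B, w t * g t ∂μ := by
    simp only [h1 _ (hcm _)]
    simp
  have h5 : ∫ t in B, (∫ θ in (0:ℝ)..(2 * Real.pi), w t * g (circleMap 0 1 θ • t)) ∂μ
      = 2 * Real.pi * (g 0 * ∫ t in B, w t ∂μ) := by
    rw [← integral_const_mul, ← integral_const_mul]
    refine setIntegral_congr_fun hB.measurableSet fun t ht => ?_
    simp only [intervalIntegral.integral_const_mul]
    rw [h2 t ht]; ring
  have hp : (2 * Real.pi : ℂ) ≠ 0 := by
    have : (Real.pi : ℂ) ≠ 0 := by exact_mod_cast Real.pi_ne_zero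
    simp [this]
  exact mul_left_cancel₀ hp (h4.symm.trans (h3.trans h5))

lemma rot_complex (c : ℂ) (hc : ‖c‖ = 1) : MeasurePreserving (fun t : ℂ => c • t) volume volume := by
  have := (rotation (⟨c, mem_sphere_zero_iff_norm.2 hc⟩ : Circle)).measurePreserving
  exact this

lemma rot_EE (m : ℕ) (c : ℂ) (hc : ‖c‖ = 1) : MeasurePreserving (fun t : EE m => c • t) volume volume := by
  have hc0 : c ≠ 0 := by rintro rfl; simp at hc
  let e : EE m ≃ₗᵢ[ℝ] EE m :=
    { (LinearEquiv.smulOfNeZero ℂ (EE m) c hc0).restrictScalars ℝ with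
      norm_map' := fun x => by
        change ‖c • x‖ = ‖x‖
        rw [norm_smul, hc, one_mul] }
  exact e.measurePreserving

end GDJ

namespace GDJ
open Set Filter Topology MeasureTheory
open scoped ContDiff

lemma det_mul_complex (d : ℂ) :
    (((ContinuousLinearMap.toSpanSingleton ℂ d : ℂ →L[ℂ] ℂ)).restrictScalars ℝ).det = ‖d‖ ^ 2 := by
  rw [← Complex.normSq_eq_norm_sq, ← Algebra.norm_complex_apply, Algebra.norm_apply]
  change LinearMap.det _ = _
  congr 1
  ext x <;> simp [mul_comm]

/-- change of variables for an injective holomorphic function of one variable -/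
lemma integral_image_holo {s : Set ℂ} (hs : MeasurableSet s) {f f' : ℂ → ℂ}
    (hf : ∀ x ∈ s, HasDerivAt f (f' x) x) (hi : InjOn f s) (g : ℂ → ℂ) :
    ∫ x in f '' s, g x = ∫ x in s, ((‖f' x‖ ^ 2 : ℝ) : ℂ) * g (f x) := by
  rw [integral_image_eq_integral_abs_det_fderiv_smul volume hs
    (f' := fun x => (ContinuousLinearMap.toSpanSingleton ℂ (f' x) : ℂ →L[ℂ] ℂ).restrictScalars ℝ) _ hi]
  · refine setIntegral_congr_fun hs fun x hx => ?_
    simp only [det_mul_complex]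
    rw [abs_of_nonneg (by positivity), Complex.real_smul]
  · intro x hx
    exact ((hf x hx).hasFDerivAt.restrictScalars ℝ).hasFDerivWithinAt

def YY (K δ : ℝ) (u : ℂ) : ℝ := 2 * u.re - δ - K * ‖u‖ ^ 2

def c1 (m : ℕ) : ℝ := ∫ y in ball (0:ℂ) 1, (1 - ‖y‖ ^ 2) ^ m * ‖y‖ ^ 2

lemma c1_pos (m : ℕ) : 0 < c1 m := by
  unfold c1
  have hintg : IntegrableOn (fun y : ℂ => (1 - ‖y‖ ^ 2) ^ m * ‖y‖ ^ 2) (ball 0 1) := by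
    refine IntegrableOn.mono_set (t := closedBall 0 1) ?_ ball_subset_closedBall
    exact ContinuousOn.integrableOn_compact (isCompact_closedBall 0 1) (by fun_prop)
  rw [setIntegral_pos_iff_support_of_nonneg_ae _ hintg]
  · have : ball (1/2 : ℂ) (1/2) ⊆ Function.support (fun y : ℂ => (1 - ‖y‖ ^ 2) ^ m * ‖y‖ ^ 2) ∩ ball 0 1 := by
      intro y hy
      rw [mem_ball, dist_eq_norm] at hy
      have h12 : ‖(1/2 : ℂ)‖ = 1/2 := by norm_num
      have h1 : ‖y‖ < 1 := by
        have := norm_add_le (y - 1/2) (1/2)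
        rw [sub_add_cancel, h12] at this; linarith
      have h0 : 0 < ‖y‖ := by
        have := norm_sub_norm_le (1/2 : ℂ) y
        rw [norm_sub_rev, h12] at this; linarith
      refine ⟨?_, by simpa using h1⟩
      have h3 : 0 < 1 - ‖y‖ ^ 2 := by nlinarith
      exact (by positivity : (0:ℝ) < (1 - ‖y‖ ^ 2) ^ m * ‖y‖ ^ 2).ne'
    exact lt_of_lt_of_le (measure_ball_pos volume _ (by norm_num)) (measure_mono this)
  · refine (ae_restrict_iff' measurableSet_ball).2 (ae_of_all _ fun y hy => ?_)
    have h1 : ‖y‖ < 1 := by simpa using hy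
    have h3 : 0 ≤ 1 - ‖y‖ ^ 2 := by nlinarith [norm_nonneg y]
    simp only [Pi.zero_apply]; positivity

set_option maxHeartbeats 1000000 in
lemma disc_mean {m : ℕ} {H : ℂ → ℂ} {M : ℝ} (hH : DifferentiableOn ℂ H (ball 0 1)) (hM : ∀ y ∈ ball (0:ℂ) 1, ‖H y‖ ≤ M)
    (h0 : H 0 = 0) (a b : ℂ) :
    ∫ y in ball (0:ℂ) 1, (((1 - ‖y‖ ^ 2) ^ m : ℝ) : ℂ) * (H y * (a + b * (starRingEnd ℂ) y)) = b * deriv H 0 * c1 m := by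
  have hbal : ∀ c : ℂ, ‖c‖ ≤ 1 → ∀ t ∈ ball (0:ℂ) 1, c • t ∈ ball (0:ℂ) 1 := by
    intro c hc t ht
    simp only [mem_ball, dist_zero_right, smul_eq_mul, norm_mul] at ht ⊢
    nlinarith [norm_nonneg t]
  have hintc : ∀ w : ℂ → ℂ, Continuous w → IntegrableOn w (ball 0 1) := fun w hw =>
    IntegrableOn.mono_set (t := closedBall 0 1)
      (ContinuousOn.integrableOn_compact (isCompact_closedBall 0 1) hw.continuousOn) ball_subset_closedBall
  have hwc : Continuous (fun y : ℂ => (((1 - ‖y‖ ^ 2) ^ m : ℝ) : ℂ)) := by fun_prop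
  have hwc2 : Continuous (fun y : ℂ => (((1 - ‖y‖ ^ 2) ^ m * ‖y‖ ^ 2 : ℝ) : ℂ)) := by fun_prop
  have m1 := rot_mean rot_complex isOpen_ball hbal (hintc _ hwc)
    (by intro c hc t; simp [hc]) hH hM
  rw [h0, zero_mul] at m1
  set Q := dslope H 0 with hQ
  have hQd : DifferentiableOn ℂ Q (ball 0 1) := (differentiableOn_dslope (isOpen_ball.mem_nhds (by simp))).2 hH
  have hQe : ∀ y, H y = y * Q y := by
    intro y
    have := sub_smul_dslope H 0 y
    simp only [sub_zero, smul_eq_mul, h0] at this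
    exact this.symm
  obtain ⟨M1, hM1, hM1b⟩ := compact_bdd (isCompact_closedBall (0:ℂ) (1/2))
    (hQd.continuousOn.mono (closedBall_subset_ball (by norm_num)))
  have hQb : ∀ y ∈ ball (0:ℂ) 1, ‖Q y‖ ≤ M1 + 2 * M := by
    intro y hy
    have hM0 : 0 ≤ M := (norm_nonneg _).trans (hM y hy)
    by_cases hh : ‖y‖ ≤ 1/2
    · have := hM1b y (by simpa using hh); linarith
    · push Not at hh
      have := hM y hy
      rw [hQe, norm_mul] at this
      nlinarith [norm_nonneg (Q y)]
  have m2 := rot_mean rot_complex isOpen_ball hbal (hintc _ hwc2)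
    (by intro c hc t; simp [hc]) hQd hQb
  have hsplit : ∀ y : ℂ, (((1 - ‖y‖ ^ 2) ^ m : ℝ) : ℂ) * (H y * (a + b * (starRingEnd ℂ) y))
      = a * ((((1 - ‖y‖ ^ 2) ^ m : ℝ) : ℂ) * H y) + b * ((((1 - ‖y‖ ^ 2) ^ m * ‖y‖ ^ 2 : ℝ) : ℂ) * Q y) := by
    intro y
    have e : ((‖y‖ : ℝ) : ℂ) ^ 2 = y * (starRingEnd ℂ) y := by rw [Complex.mul_conj, Complex.normSq_eq_norm_sq]; push_cast; rfl
    push_cast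
    have e2 : H y * (starRingEnd ℂ) y = ((‖y‖ : ℝ) : ℂ) ^ 2 * Q y := by rw [e, hQe y]; ring
    linear_combination (1 - (‖y‖:ℂ)^2)^m * b * e2
  have i1 : IntegrableOn (fun y : ℂ => (((1 - ‖y‖ ^ 2) ^ m : ℝ) : ℂ) * H y) (ball 0 1) := by
    have := (hintc _ hwc).bdd_mul (c := M) (hH.continuousOn.aestronglyMeasurable measurableSet_ball)
      ((ae_restrict_iff' measurableSet_ball).2 (ae_of_all _ hM))
    exact this.congr (ae_of_all _ fun y => mul_comm _ _)
  have i2 : IntegrableOn (fun y : ℂ => (((1 - ‖y‖ ^ 2) ^ m * ‖y‖ ^ 2 : ℝ) : ℂ) * Q y) (ball 0 1) := by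
    have := (hintc _ hwc2).bdd_mul (c := M1 + 2 * M) (hQd.continuousOn.aestronglyMeasurable measurableSet_ball)
      ((ae_restrict_iff' measurableSet_ball).2 (ae_of_all _ hQb))
    exact this.congr (ae_of_all _ fun y => mul_comm _ _)
  simp only [hsplit]
  rw [integral_add (i1.const_mul a) (i2.const_mul b), integral_const_mul, integral_const_mul, m1, m2]
  rw [hQ, dslope_same, integral_complex_ofReal]
  simp only [c1]; ring

set_option maxHeartbeats 1000000 in
lemma one_var (m : ℕ) {K δ M : ℝ} (hK : 0 < K) (hδ : 0 < δ) (hKδ : K * δ ≤ 1/2) {F : ℂ → ℂ}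
    (hF : DifferentiableOn ℂ F {u | 0 < YY K δ u}) (hM : ∀ u, 0 < YY K δ u → ‖F u‖ ≤ M) (h0 : F δ = 0) :
    (1/2) ^ (m+2) * c1 m * ‖deriv F δ‖ ≤
      ‖∫ u in {u | 0 < YY K δ u}, ((YY K δ u ^ m : ℝ) : ℂ) * (F u * ((starRingEnd ℂ) u ^ (m+3))⁻¹)‖ := by
  set a : ℝ := 1/δ with ha
  have ha0 : 0 < a := by positivity
  have haδ : a * δ = 1 := by rw [ha]; field_simp
  set R : ℝ := Real.sqrt ((1 - K * δ)) / δ with hR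
  have hKδ' : 0 < 1 - K * δ := by linarith
  have hR0 : 0 < R := by have := Real.sqrt_pos.2 hKδ'; positivity
  have hR2 : R ^ 2 * δ ^ 2 = 1 - K * δ := by
    rw [hR, div_pow, Real.sq_sqrt hKδ'.le]; field_simp
  have hRa : R < a := by
    have : (R * δ) ^ 2 < 1 := by rw [mul_pow, hR2]; nlinarith [mul_pos hK hδ]
    have h2 : R * δ < 1 := by nlinarith [mul_pos hR0 hδ]
    nlinarith
  set V : ℂ → ℂ := fun y => a + R * y with hV
  set T : ℂ → ℂ := fun y => (V y)⁻¹ with hT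
  have hVne : ∀ y ∈ ball (0:ℂ) 1, V y ≠ 0 ∧ a - R ≤ ‖V y‖ := by
    intro y hy
    have hy1 : ‖y‖ < 1 := by simpa using hy
    have h1 : a - R ≤ ‖V y‖ := by
      have := norm_sub_norm_le (a:ℂ) (-(R * y))
      simp only [sub_neg_eq_add, norm_neg, norm_mul, Complex.norm_real, Real.norm_eq_abs, abs_of_pos ha0, abs_of_pos hR0] at this
      have e : R * ‖y‖ ≤ R := by nlinarith
      simp only [hV]; linarith
    refine ⟨?_, h1⟩
    intro h; rw [h] at h1; simp at h1; linarith
  have hkey : ∀ y, V y ≠ 0 → YY K δ (T y) * ‖V y‖ ^ 2 = δ * R ^ 2 * (1 - ‖y‖ ^ 2) := by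
    intro y hy
    have hn : 0 < ‖V y‖ ^ 2 := by have := norm_pos_iff.2 hy; positivity
    have e1 : (T y).re * ‖V y‖ ^ 2 = (V y).re := by
      simp only [hT, Complex.inv_re, Complex.normSq_eq_norm_sq]; field_simp
    have e2 : ‖T y‖ ^ 2 * ‖V y‖ ^ 2 = 1 := by
      simp only [hT, norm_inv]; field_simp
    have e3 : (V y).re = a + R * y.re := by simp [hV]
    have e4 : (V y).im = R * y.im := by simp [hV]
    have e5 : ‖V y‖ ^ 2 = (a + R * y.re) ^ 2 + (R * y.im) ^ 2 := by
      rw [← Complex.normSq_eq_norm_sq, Complex.normSq_apply, e3, e4]; ring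
    have e6 : ‖y‖ ^ 2 = y.re ^ 2 + y.im ^ 2 := by
      rw [← Complex.normSq_eq_norm_sq, Complex.normSq_apply]; ring
    have : YY K δ (T y) * ‖V y‖ ^ 2 = 2 * (V y).re - δ * ‖V y‖ ^ 2 - K := by
      unfold YY; linear_combination 2 * e1 - K * e2
    rw [this, e5, e3, e6]
    have e7 : δ * R ^ 2 = a - K := by
      have : δ * (δ * R ^ 2) = δ * (a - K) := by linear_combination hR2 - haδ
      exact mul_left_cancel₀ hδ.ne' this
    have e8 : δ * a ^ 2 = a := by linear_combination a * haδ
    linear_combination -e7 - e8 + (-2 * R * y.re) * haδ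
  have himg : {u | 0 < YY K δ u} = T '' ball 0 1 := by
    ext u
    constructor
    · intro hu
      have hu' : 0 < YY K δ u := hu
      have hu0 : u ≠ 0 := by
        rintro rfl
        simp [YY] at hu'; linarith
      have hRc : (R : ℂ) ≠ 0 := by exact_mod_cast hR0.ne'
      have hVe : V ((u⁻¹ - a) / R) = u⁻¹ := by simp only [hV]; field_simp; ring
      refine ⟨(u⁻¹ - a) / R, ?_, by simp only [hT]; rw [hVe, inv_inv]⟩
      have hk := hkey ((u⁻¹ - a) / R) (by rw [hVe]; exact inv_ne_zero hu0)
      have hTe : T ((u⁻¹ - a) / R) = u := by simp only [hT]; rw [hVe, inv_inv]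
      rw [hTe] at hk
      have hp : 0 < YY K δ u * ‖V ((u⁻¹ - a) / R)‖ ^ 2 := by
        rw [hVe]; have := norm_pos_iff.2 (inv_ne_zero hu0); positivity
      rw [hk] at hp
      have h2 : 0 < δ * R ^ 2 := by positivity
      have h3 : 0 < 1 - ‖(u⁻¹ - a) / R‖ ^ 2 := by
        by_contra hcon; push Not at hcon
        nlinarith
      rw [mem_ball, dist_zero_right]
      nlinarith [norm_nonneg ((u⁻¹ - a) / R)]
    · rintro ⟨y, hy, rfl⟩
      have hk := hkey y (hVne y hy).1
      have hy1 : ‖y‖ < 1 := by simpa using hy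
      have h3 : 0 < 1 - ‖y‖ ^ 2 := by nlinarith [norm_nonneg y]
      have : 0 < δ * R ^ 2 * (1 - ‖y‖ ^ 2) := by positivity
      rw [← hk] at this
      by_contra hcon
      simp only [mem_setOf_eq, not_lt] at hcon
      nlinarith [sq_nonneg ‖V y‖]
  have hVd : ∀ y, HasDerivAt V (R:ℂ) y := by
    intro y
    have := ((hasDerivAt_id y).const_mul (R:ℂ)).const_add (a:ℂ)
    rw [mul_one] at this
    exact this
  have hTd : ∀ y ∈ ball (0:ℂ) 1, HasDerivAt T (-(R:ℂ) / (V y) ^ 2) y := by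
    intro y hy
    exact (hVd y).inv (hVne y hy).1
  have hinj : InjOn T (ball 0 1) := by
    intro x hx y hy hxy
    simp only [hT, hV] at hxy
    have := inv_injective hxy
    have hRc : (R : ℂ) ≠ 0 := by exact_mod_cast hR0.ne'
    simpa [hRc] using this
  set H : ℂ → ℂ := fun y => F (T y) * ((V y) ^ (m+2))⁻¹ with hH
  have hopen : IsOpen {u | 0 < YY K δ u} := by
    refine isOpen_lt continuous_const ?_
    unfold YY; fun_prop
  have hTm : ∀ y ∈ ball (0:ℂ) 1, 0 < YY K δ (T y) := by
    intro y hy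
    have : T y ∈ {u | 0 < YY K δ u} := by rw [himg]; exact ⟨y, hy, rfl⟩
    exact this
  have hFd : ∀ y ∈ ball (0:ℂ) 1, DifferentiableAt ℂ F (T y) := fun y hy =>
    hF.differentiableAt (hopen.mem_nhds (hTm y hy))
  have hHder : ∀ y ∈ ball (0:ℂ) 1, HasDerivAt H (deriv F (T y) * (-(R:ℂ) / (V y) ^ 2) * ((V y) ^ (m+2))⁻¹ +
      F (T y) * (-(((m+2 : ℕ) : ℂ) * V y ^ (m+2-1) * R) / ((V y) ^ (m+2)) ^ 2)) y := by
    intro y hy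
    exact ((hFd y hy).hasDerivAt.comp y (hTd y hy)).mul (((hVd y).pow (m+2)).inv (pow_ne_zero _ (hVne y hy).1))
  have hHd : DifferentiableOn ℂ H (ball 0 1) := fun y hy => (hHder y hy).differentiableAt.differentiableWithinAt
  have hHM : ∀ y ∈ ball (0:ℂ) 1, ‖H y‖ ≤ M * ((a - R) ^ (m+2))⁻¹ := by
    intro y hy
    have h1 := hM _ (hTm y hy)
    have h2 : 0 < a - R := by linarith
    simp only [hH, norm_mul, norm_inv, norm_pow]
    gcongr
    · exact (norm_nonneg _).trans h1
    · exact (hVne y hy).2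
  have hV0 : V 0 = a := by simp [hV]
  have hT0 : T 0 = δ := by simp only [hT, hV0, ha]; push_cast; simp
  have hH0 : H 0 = 0 := by simp only [hH, hT0, h0, zero_mul]
  have hH0' : deriv H 0 = deriv F δ * (-(R:ℂ) * δ ^ 2) * δ ^ (m+2) := by
    rw [(hHder 0 (by simp)).deriv, hT0, h0, hV0, ha]
    push_cast
    simp
  have hmean := disc_mean (m := m) hHd hHM hH0 a R
  rw [hH0'] at hmean
  rw [himg, integral_image_holo measurableSet_ball hTd hinj]
  have hcongr : ∀ y ∈ ball (0:ℂ) 1, ((‖-(R:ℂ) / V y ^ 2‖ ^ 2 : ℝ) : ℂ) * (((YY K δ (T y) ^ m : ℝ) : ℂ) *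
      (F (T y) * ((starRingEnd ℂ) (T y) ^ (m+3))⁻¹)) =
      ((R ^ 2 * (δ * R ^ 2) ^ m : ℝ) : ℂ) * ((((1 - ‖y‖ ^ 2) ^ m : ℝ) : ℂ) * (H y * (a + R * (starRingEnd ℂ) y))) := by
    intro y hy
    have hv := (hVne y hy).1
    have hvc : (starRingEnd ℂ) (V y) ≠ 0 := by simpa using hv
    have hvn : (‖V y‖ : ℝ) ≠ 0 := norm_ne_zero_iff.2 hv
    have e1 : YY K δ (T y) = δ * R ^ 2 * (1 - ‖y‖ ^ 2) / ‖V y‖ ^ 2 := by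
      rw [← hkey y hv]; field_simp
    have e2 : ((‖V y‖ : ℝ) : ℂ) ^ 2 = V y * (starRingEnd ℂ) (V y) := by
      rw [Complex.mul_conj, Complex.normSq_eq_norm_sq]; push_cast; rfl
    have e3 : (a:ℂ) + R * (starRingEnd ℂ) y = (starRingEnd ℂ) (V y) := by simp [hV]
    have e4 : ((‖-(R:ℂ) / V y ^ 2‖ ^ 2 : ℝ) : ℂ) = R ^ 2 / (V y * (starRingEnd ℂ) (V y)) ^ 2 := by
      rw [← e2, norm_div, norm_neg, Complex.norm_real, norm_pow, div_pow, Real.norm_eq_abs, sq_abs]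
      push_cast; rfl
    rw [e4, e1, e3]
    simp only [hH]
    have e5 : (starRingEnd ℂ) (T y) = ((starRingEnd ℂ) (V y))⁻¹ := by simp [hT]
    rw [e5]
    push_cast
    rw [e2]
    simp only [div_pow, mul_pow, inv_pow, inv_inv]
    field_simp
    try ring
  rw [setIntegral_congr_fun measurableSet_ball hcongr, integral_const_mul, hmean]
  have hc1 := c1_pos m
  simp only [norm_mul, norm_neg, norm_pow, Complex.norm_real, Real.norm_eq_abs, abs_of_pos hR0, abs_of_pos hδ, abs_of_pos hc1, abs_mul, abs_pow]
  have : (R ^ 2 * (δ * R ^ 2) ^ m * (R * (‖deriv F ↑δ‖ * (R * δ ^ 2) * δ ^ (m + 2)) * c1 m)) =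
     (R ^ 2 * δ ^ 2) ^ (m+2) * c1 m * ‖deriv F δ‖ := by ring
  rw [this, hR2]
  gcongr
  linarith

end GDJ

namespace GDJ
open Set Filter Topology MeasureTheory
open scoped ContDiff

set_option maxHeartbeats 1000000 in
lemma layer {X : Type*} [MeasurableSpace X] {μ : Measure X} [SFinite μ] {S : Set X} (hS : MeasurableSet S)
    {v : X → ℝ} (hv : Measurable v) {q a C : ℝ} (hq : 0 < q) (ha : 0 < a) (hC : 0 ≤ C) (hva : ∀ x ∈ S, a ≤ v x)
    (hm : ∀ l, 0 < l → μ (S ∩ {x | v x < l}) ≤ ENNReal.ofReal (C * l ^ (q - 1/2))) :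
    IntegrableOn (fun x => v x ^ (-q)) S μ ∧ ∫ x in S, v x ^ (-q) ∂μ ≤ 2 * q * C * a ^ (-(1/2) : ℝ) := by
  set k : ℝ → ENNReal := fun l => ENNReal.ofReal (q * l ^ (-q - 1)) with hk
  have hkm : Measurable k := by
    refine ENNReal.measurable_ofReal.comp ?_
    exact (measurable_id.pow_const _).const_mul q
  have e1 : ∀ x ∈ S, ENNReal.ofReal (v x ^ (-q)) = ∫⁻ l in Ioi a, (Ioi (v x)).indicator k l := by
    intro x hx
    have hvx : 0 < v x := ha.trans_le (hva x hx)
    rw [lintegral_indicator measurableSet_Ioi, Measure.restrict_restrict measurableSet_Ioi,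
      inter_eq_left.2 (Ioi_subset_Ioi (hva x hx))]
    have i1 : IntegrableOn (fun l : ℝ => q * l ^ (-q - 1)) (Ioi (v x)) :=
      (integrableOn_Ioi_rpow_of_lt (by linarith) hvx).const_mul q
    rw [hk, ← ofReal_integral_eq_lintegral_ofReal i1, integral_const_mul, integral_Ioi_rpow_of_lt (by linarith) hvx]
    · congr 1
      have : -q - 1 + 1 = -q := by ring
      rw [this]; field_simp
    · refine (ae_restrict_iff' measurableSet_Ioi).2 (ae_of_all _ fun l hl => ?_)
      have : 0 < l := hvx.trans hl
      simp only [Pi.zero_apply]; positivity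
  have e2 : ∫⁻ x in S, ENNReal.ofReal (v x ^ (-q)) ∂μ ≤ ENNReal.ofReal (2 * q * C * a ^ (-(1/2) : ℝ)) := by
    rw [setLIntegral_congr_fun hS e1]
    rw [lintegral_lintegral_swap]
    · have e3 : ∀ l ∈ Ioi a, ∫⁻ x in S, (Ioi (v x)).indicator k l ∂μ ≤ ENNReal.ofReal (q * C * l ^ (-(3/2) : ℝ)) := by
        intro l hl
        have hl0 : 0 < l := ha.trans hl
        have h1 : ∀ x, (Ioi (v x)).indicator k l = {x | v x < l}.indicator (fun _ => k l) x := by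
          intro x; simp [indicator]
        simp only [h1]
        rw [lintegral_indicator (measurableSet_lt hv measurable_const), lintegral_const,
          Measure.restrict_restrict (measurableSet_lt hv measurable_const), Measure.restrict_apply_univ, inter_comm]
        refine (mul_le_mul_right (hm l hl0) _).trans ?_
        rw [hk]
        simp only
        rw [← ENNReal.ofReal_mul (by positivity)]
        refine ENNReal.ofReal_le_ofReal (le_of_eq ?_)
        have : l ^ (-(3/2) : ℝ) = l ^ (-q - 1) * l ^ (q - 1/2) := by
          rw [← Real.rpow_add hl0]; congr 1; ring
        rw [this]; ring
      refine (setLIntegral_mono (by fun_prop) e3).trans ?_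
      have i1 : IntegrableOn (fun l : ℝ => q * C * l ^ (-(3/2) : ℝ)) (Ioi a) :=
        (integrableOn_Ioi_rpow_of_lt (by norm_num) ha).const_mul _
      rw [← ofReal_integral_eq_lintegral_ofReal i1, integral_const_mul, integral_Ioi_rpow_of_lt (by norm_num) ha]
      · refine ENNReal.ofReal_le_ofReal (le_of_eq ?_)
        norm_num
        ring
      · refine (ae_restrict_iff' measurableSet_Ioi).2 (ae_of_all _ fun l hl => ?_)
        have : 0 < l := ha.trans hl
        simp only [Pi.zero_apply]; positivity
    · have : (Function.uncurry fun (x : X) (l : ℝ) => (Ioi (v x)).indicator k l) =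
          {p : X × ℝ | v p.1 < p.2}.indicator (fun p => k p.2) := by
        ext ⟨x, l⟩; simp [indicator, Function.uncurry]
      rw [this]
      refine ((hkm.comp measurable_snd).indicator ?_).aemeasurable
      exact measurableSet_lt (hv.comp measurable_fst) measurable_snd
  have hae : 0 ≤ᵐ[μ.restrict S] fun x => v x ^ (-q) :=
    (ae_restrict_iff' hS).2 (ae_of_all _ fun x hx => by
      have := ha.trans_le (hva x hx)
      simp only [Pi.zero_apply]; positivity)
  have hms : AEStronglyMeasurable (fun x => v x ^ (-q)) (μ.restrict S) := (hv.pow_const _).aestronglyMeasurable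
  constructor
  · refine ⟨hms, ?_⟩
    rw [hasFiniteIntegral_iff_ofReal hae]
    exact e2.trans_lt ENNReal.ofReal_lt_top
  · rw [integral_eq_lintegral_of_nonneg_ae hae hms]
    refine ENNReal.toReal_le_of_le_ofReal (by positivity) e2

lemma rect_vol (e b l : ℝ) (hb : 0 ≤ b) (hl : 0 ≤ l) :
    volume {u : ℂ | |u.im| ≤ l ∧ |2 * u.re - e| ≤ b} ≤ ENNReal.ofReal (2 * l * b) := by
  have h1 : {u : ℂ | |u.im| ≤ l ∧ |2 * u.re - e| ≤ b} =
      Complex.measurableEquivRealProd ⁻¹' (Icc ((e - b)/2) ((e + b)/2) ×ˢ Icc (-l) l) := by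
    ext u
    simp only [mem_setOf_eq, mem_preimage, mem_prod, Complex.measurableEquivRealProd_apply, mem_Icc, abs_le]
    constructor
    · rintro ⟨⟨h1, h2⟩, h3, h4⟩; exact ⟨⟨by linarith, by linarith⟩, h1, h2⟩
    · rintro ⟨⟨h1, h2⟩, h3, h4⟩; exact ⟨⟨h3, h4⟩, by linarith, by linarith⟩
  rw [h1, Complex.volume_preserving_equiv_real_prod.measure_preimage
    (measurableSet_Icc.prod measurableSet_Icc).nullMeasurableSet]
  rw [Measure.volume_eq_prod, Measure.prod_prod, Real.volume_Icc, Real.volume_Icc, ← ENNReal.ofReal_mul (by linarith)]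
  refine ENNReal.ofReal_le_ofReal (le_of_eq ?_); ring

lemma box_vol (m : ℕ) : ∃ Vm : ℝ, 0 < Vm ∧ ∀ (A l b : ℝ) (e : EE m → ℝ), 0 ≤ A → 0 ≤ l → 0 ≤ b → Measurable e →
    volume {p : EE m × ℂ | ‖p.1‖ ^ 2 ≤ A * l ∧ |p.2.im| ≤ l ∧ |2 * p.2.re - e p.1| ≤ b}
      ≤ ENNReal.ofReal (Vm * (A * l) ^ m * (2 * l * b)) := by
  set Vm := (volume (ball (0 : EE m) 1)).toReal with hVm
  have hfin : volume (ball (0 : EE m) 1) ≠ ⊤ := measure_ball_lt_top.ne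
  have hpos : 0 < Vm := ENNReal.toReal_pos (measure_ball_pos volume _ one_pos).ne' hfin
  refine ⟨Vm, hpos, fun A l b e hA hl hb he => ?_⟩
  have hAl : 0 ≤ A * l := by positivity
  have hms : MeasurableSet {p : EE m × ℂ | ‖p.1‖ ^ 2 ≤ A * l ∧ |p.2.im| ≤ l ∧ |2 * p.2.re - e p.1| ≤ b} := by
    have h1 : Measurable fun p : EE m × ℂ => ‖p.1‖ ^ 2 := by fun_prop
    have h2 : Measurable fun p : EE m × ℂ => |p.2.im| :=
      (continuous_abs.comp (Complex.continuous_im.comp continuous_snd)).measurable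
    have h3 : Measurable fun p : EE m × ℂ => |2 * p.2.re - e p.1| := by
      have : Measurable fun p : EE m × ℂ => 2 * p.2.re :=
        (continuous_const.mul (Complex.continuous_re.comp continuous_snd)).measurable
      exact continuous_abs.measurable.comp (this.sub (he.comp measurable_fst))
    exact (measurableSet_le h1 measurable_const).inter ((measurableSet_le h2 measurable_const).inter
      (measurableSet_le h3 measurable_const))
  rw [Measure.volume_eq_prod, Measure.prod_apply hms]
  have hsl : ∀ t : EE m, volume (Prod.mk t ⁻¹' {p : EE m × ℂ | ‖p.1‖ ^ 2 ≤ A * l ∧ |p.2.im| ≤ l ∧ |2 * p.2.re - e p.1| ≤ b})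
      ≤ (closedBall (0 : EE m) (Real.sqrt (A * l))).indicator (fun _ => ENNReal.ofReal (2 * l * b)) t := by
    intro t
    by_cases ht : ‖t‖ ^ 2 ≤ A * l
    · have : t ∈ closedBall (0 : EE m) (Real.sqrt (A * l)) := by
        simpa using Real.le_sqrt_of_sq_le ht
      rw [indicator_of_mem this]
      refine (measure_mono ?_).trans (rect_vol (e t) b l hb hl)
      rintro u ⟨_, hu⟩; exact hu
    · have : Prod.mk t ⁻¹' {p : EE m × ℂ | ‖p.1‖ ^ 2 ≤ A * l ∧ |p.2.im| ≤ l ∧ |2 * p.2.re - e p.1| ≤ b} = ∅ := by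
        ext u; simp [ht]
      rw [this]; simp
  refine (lintegral_mono hsl).trans ?_
  rw [lintegral_indicator measurableSet_closedBall, lintegral_const, Measure.restrict_apply_univ,
    Measure.addHaar_closedBall volume _ (Real.sqrt_nonneg _)]
  have hfr : Module.finrank ℝ (EE m) = 2 * m := by
    rw [← Module.finrank_mul_finrank ℝ ℂ (EE m)]; simp
  rw [hfr, pow_mul, Real.sq_sqrt hAl, ← ENNReal.ofReal_toReal hfin, ← hVm, ← ENNReal.ofReal_mul (by positivity),
    ← ENNReal.ofReal_mul (by positivity)]
  refine ENNReal.ofReal_le_ofReal (le_of_eq ?_); ring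

end GDJ

namespace GDJ
open Set Filter Topology MeasureTheory
open scoped ContDiff

lemma shell_int (m : ℕ) : ∃ W > 0, ∀ (A B a : ℝ) (e : EE m → ℝ) (S : Set (EE m × ℂ)), 0 ≤ A → 0 ≤ B → 0 < a →
    Measurable e → MeasurableSet S → (∀ p ∈ S, a ≤ ‖p.2‖ ∧ ‖p.1‖ ^ 2 ≤ A * ‖p.2‖ ∧
      |2 * p.2.re - e p.1| ≤ B * ‖p.2‖ ^ (3/2 : ℝ)) →
    IntegrableOn (fun p : EE m × ℂ => ‖p.2‖ ^ (-((m:ℝ)+3))) S ∧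
      ∫ p in S, ‖p.2‖ ^ (-((m:ℝ)+3)) ≤ W * A ^ m * B * a ^ (-(1/2) : ℝ) := by
  obtain ⟨Vm, hVm, hbox⟩ := box_vol m
  refine ⟨2 * (m + 3) * (2 * Vm), by positivity, fun A B a e S hA hB ha he hS hSp => ?_⟩
  have hq : (0:ℝ) < (m:ℝ) + 3 := by positivity
  have := layer (μ := volume) hS (v := fun p : EE m × ℂ => ‖p.2‖) (by fun_prop) (q := m + 3) (a := a) (C := 2 * Vm * A ^ m * B) hq ha
    (by positivity) (fun p hp => (hSp p hp).1) ?_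
  · refine ⟨this.1, this.2.trans (le_of_eq ?_)⟩; ring
  · intro l hl
    refine (measure_mono ?_).trans ((hbox A l (B * l ^ (3/2 : ℝ)) e hA hl.le (by positivity) he).trans (le_of_eq ?_))
    · rintro p ⟨hp, hpl⟩
      have hpl' : ‖p.2‖ < l := hpl
      obtain ⟨h1, h2, h3⟩ := hSp p hp
      refine ⟨h2.trans (by gcongr), (Complex.abs_im_le_norm _).trans hpl'.le, h3.trans ?_⟩
      gcongr
    · congr 1
      have : l ^ ((m:ℝ) + 3 - 1/2) = l ^ m * (l * l ^ (3/2 : ℝ)) := by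
        have e1 : (m:ℝ) + 3 - 1/2 = m + (1 + 3/2) := by ring
        rw [e1, Real.rpow_add hl, Real.rpow_add hl, Real.rpow_one, Real.rpow_natCast]
      rw [this]; ring

lemma main_int (m : ℕ) : ∃ W > 0, ∀ (A a : ℝ) (S : Set (EE m × ℂ)), 0 ≤ A → 0 < a →
    MeasurableSet S → (∀ p ∈ S, a ≤ ‖p.2‖ ∧ ‖p.1‖ ^ 2 ≤ A * ‖p.2‖) →
    IntegrableOn (fun p : EE m × ℂ => ‖p.2‖ ^ (-((m:ℝ)+5/2))) S ∧
      ∫ p in S, ‖p.2‖ ^ (-((m:ℝ)+5/2)) ≤ W * A ^ m * a ^ (-(1/2) : ℝ) := by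
  obtain ⟨Vm, hVm, hbox⟩ := box_vol m
  refine ⟨2 * (m + 5/2) * (4 * Vm), by positivity, fun A a S hA ha hS hSp => ?_⟩
  have hq : (0:ℝ) < (m:ℝ) + 5/2 := by positivity
  have := layer (μ := volume) hS (v := fun p : EE m × ℂ => ‖p.2‖) (by fun_prop) (q := m + 5/2) (a := a) (C := 4 * Vm * A ^ m) hq ha
    (by positivity) (fun p hp => (hSp p hp).1) ?_
  · refine ⟨this.1, this.2.trans (le_of_eq ?_)⟩; ring
  · intro l hl
    refine (measure_mono ?_).trans ((hbox A l (2 * l) (fun _ => 0) hA hl.le (by positivity) measurable_const).trans (le_of_eq ?_))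
    · rintro p ⟨hp, hpl⟩
      have hpl' : ‖p.2‖ < l := hpl
      obtain ⟨h1, h2⟩ := hSp p hp
      refine ⟨h2.trans (by gcongr), (Complex.abs_im_le_norm _).trans hpl'.le, ?_⟩
      have := Complex.abs_re_le_norm p.2
      rw [sub_zero, abs_mul, abs_two]; linarith
    · congr 1
      have : l ^ ((m:ℝ) + 5/2 - 1/2) = l ^ m * (l * l) := by
        have e1 : (m:ℝ) + 5/2 - 1/2 = m + (1 + 1) := by ring
        rw [e1, Real.rpow_add hl, Real.rpow_add hl, Real.rpow_one, Real.rpow_natCast]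
      rw [this]; ring

/-- the Levi form hypotheses in the model -/
structure LForm {m : ℕ} (L : EE m → ℝ) (c C : ℝ) : Prop where
  hc : 0 < c
  hC : 1 ≤ C
  cont : Continuous L
  smul : ∀ (a : ℂ) t, L (a • t) = ‖a‖ ^ 2 * L t
  lower : ∀ t, c * ‖t‖ ^ 2 ≤ L t
  upper : ∀ t, L t ≤ C * ‖t‖ ^ 2

open scoped Pointwise in
lemma LForm.slice_vol {m : ℕ} {L : EE m → ℝ} {c C : ℝ} (h : LForm L c C) {Y : ℝ} (hY : 0 < Y) :
    (volume {t | L t < Y}).toReal = Y ^ m * (volume {t | L t < 1}).toReal := by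
  have hs : {t | L t < Y} = Real.sqrt Y • {t | L t < 1} := by
    have h0 : Real.sqrt Y ≠ 0 := (Real.sqrt_pos.2 hY).ne'
    ext t
    rw [mem_smul_set_iff_inv_smul_mem₀ h0]
    have : (Real.sqrt Y)⁻¹ • t = (((Real.sqrt Y)⁻¹ : ℝ) : ℂ) • t := (real_smul _ _).symm
    rw [this, mem_setOf_eq, mem_setOf_eq, h.smul, Complex.norm_real, norm_inv, Real.norm_eq_abs, inv_pow, sq_abs,
      Real.sq_sqrt hY.le, ← div_eq_inv_mul, div_lt_one hY]
  rw [hs, Measure.addHaar_smul, ENNReal.toReal_mul]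
  have hfr : Module.finrank ℝ (EE m) = 2 * m := by
    rw [← Module.finrank_mul_finrank ℝ ℂ (EE m)]; simp
  rw [hfr, pow_mul, Real.sq_sqrt hY.le, ENNReal.toReal_ofReal (abs_nonneg _), abs_of_nonneg (by positivity)]

lemma LForm.vol_lower {m : ℕ} {L : EE m → ℝ} {c C : ℝ} (h : LForm L c C) :
    (volume (ball (0 : EE m) (1 / C))).toReal ≤ (volume {t | L t < 1}).toReal := by
  have hC : 0 < C := by linarith [h.hC]
  refine ENNReal.toReal_mono ?_ (measure_mono ?_)
  · refine (lt_of_le_of_lt (measure_mono (t := ball (0 : EE m) (1 / c + 1)) ?_) measure_ball_lt_top).ne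
    intro t ht
    have h1 := h.lower t
    have ht' : L t < 1 := ht
    have hc := h.hc
    have h3 : ‖t‖ ^ 2 < 1 / c := by rw [lt_div_iff₀ hc]; linarith
    rw [mem_ball, dist_zero_right]
    have : 0 < 1 / c := by positivity
    nlinarith [norm_nonneg t]
  · intro t ht
    rw [mem_ball, dist_zero_right, lt_div_iff₀ hC] at ht
    have h1 := h.upper t
    have := h.hC
    show L t < 1
    nlinarith [norm_nonneg t, mul_nonneg (norm_nonneg t) hC.le]

def R0 {m : ℕ} (L : EE m → ℝ) (K δ : ℝ) : Set (EE m × ℂ) := {p | L p.1 < YY K δ p.2}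
def R1 {m : ℕ} (L : EE m → ℝ) (K δ K₁ : ℝ) : Set (EE m × ℂ) := {p | L p.1 + K₁ * ‖p.2‖ ^ (3/2 : ℝ) < YY K δ p.2}

lemma continuous_YY (K δ : ℝ) : Continuous (YY K δ) := by unfold YY; fun_prop

lemma isOpen_R0 {m : ℕ} {L : EE m → ℝ} {c C : ℝ} (h : LForm L c C) (K δ : ℝ) : IsOpen (R0 L K δ) :=
  isOpen_lt (h.cont.comp continuous_fst) ((continuous_YY K δ).comp continuous_snd)

lemma isOpen_R1 {m : ℕ} {L : EE m → ℝ} {c C : ℝ} (h : LForm L c C) (K δ K₁ : ℝ) : IsOpen (R1 L K δ K₁) := by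
  refine isOpen_lt ((h.cont.comp continuous_fst).add (continuous_const.mul ?_)) ((continuous_YY K δ).comp continuous_snd)
  exact (continuous_snd.norm).rpow_const (fun _ => Or.inr (by norm_num))

lemma R1_subset {m : ℕ} {L : EE m → ℝ} {K δ K₁ : ℝ} (hK₁ : 0 ≤ K₁) : R1 L K δ K₁ ⊆ R0 L K δ := by
  intro p hp
  have hp' : L p.1 + K₁ * ‖p.2‖ ^ (3/2 : ℝ) < YY K δ p.2 := hp
  show L p.1 < YY K δ p.2
  have : 0 ≤ K₁ * ‖p.2‖ ^ (3/2 : ℝ) := by positivity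
  linarith

lemma YY_pos_bounds {K δ : ℝ} (hK : 0 < K) (hδ : 0 < δ) {u : ℂ} (h : 0 < YY K δ u) :
    δ / 2 ≤ ‖u‖ ∧ ‖u‖ ≤ 2 / K ∧ YY K δ u ≤ 2 * ‖u‖ ∧ 0 < ‖u‖ := by
  have h1 := Complex.re_le_norm u
  have h2 : 0 ≤ K * ‖u‖ ^ 2 := by positivity
  unfold YY at *
  have h3 : δ / 2 ≤ ‖u‖ := by linarith
  have h4 : 0 < ‖u‖ := by linarith
  refine ⟨h3, ?_, by linarith, h4⟩
  rw [le_div_iff₀ hK]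
  have : K * ‖u‖ ^ 2 ≤ 2 * ‖u‖ := by linarith
  have : (‖u‖ * K) * ‖u‖ ≤ 2 * ‖u‖ := by linarith [this, (by ring : (‖u‖ * K) * ‖u‖ = K * ‖u‖ ^ 2)]
  exact le_of_mul_le_mul_right this h4

lemma R0_bounds {m : ℕ} {L : EE m → ℝ} {c C : ℝ} (h : LForm L c C) {K δ : ℝ} (hK : 0 < K) (hδ : 0 < δ) {p : EE m × ℂ}
    (hp : p ∈ R0 L K δ) : 0 < YY K δ p.2 ∧ ‖p.1‖ ^ 2 ≤ 2 / c * ‖p.2‖ := by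
  have h1 : L p.1 < YY K δ p.2 := hp
  have h2 := h.lower p.1
  have hc := h.hc
  have h3 : 0 < YY K δ p.2 := lt_of_le_of_lt (by positivity) (h2.trans_lt h1)
  refine ⟨h3, ?_⟩
  have := (YY_pos_bounds hK hδ h3).2.2.1
  rw [div_mul_eq_mul_div, le_div_iff₀ hc]
  linarith

lemma R0_finite {m : ℕ} {L : EE m → ℝ} {c C : ℝ} (h : LForm L c C) {K δ : ℝ} (hK : 0 < K) (hδ : 0 < δ) :
    volume (R0 L K δ) < ⊤ := by
  refine Bornology.IsBounded.measure_lt_top ?_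
  have hc := h.hc
  refine (Bornology.IsBounded.prod (isBounded_closedBall (x := (0 : EE m)) (r := 2 / c * (2 / K) + 1))
    (isBounded_closedBall (x := (0:ℂ)) (r := 2 / K))).subset ?_
  intro p hp
  obtain ⟨h1, h2⟩ := R0_bounds h hK hδ hp
  obtain ⟨h3, h4, h5, h6⟩ := YY_pos_bounds hK hδ h1
  have h7 : ‖p.1‖ ^ 2 ≤ 2 / c * (2 / K) := h2.trans (by gcongr)
  refine ⟨?_, by simpa using h4⟩
  rw [mem_closedBall, dist_zero_right]
  nlinarith [norm_nonneg p.1, sq_nonneg (‖p.1‖ - 1)]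

end GDJ

namespace GDJ
open Set Filter Topology MeasureTheory
open scoped ContDiff

lemma setIntegral_slices {m : ℕ} {R : Set (EE m × ℂ)} (hR : MeasurableSet R) {f : EE m × ℂ → ℂ} (hf : IntegrableOn f R) :
    ∫ p in R, f p = ∫ u, ∫ t in {t | (t, u) ∈ R}, f (t, u) := by
  rw [← integral_indicator hR, Measure.volume_eq_prod, integral_prod_symm]
  · refine integral_congr_ae (ae_of_all _ fun u => ?_)
    have hm : MeasurableSet {t : EE m | (t, u) ∈ R} := hR.preimage (by fun_prop : Measurable fun t : EE m => (t, u))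
    simp only
    rw [← integral_indicator hm]
    rfl
  · rw [← Measure.volume_eq_prod]; exact (integrable_indicator_iff hR).2 hf

def kk (m : ℕ) (u : ℂ) : ℂ := ((starRingEnd ℂ) u ^ (m+3))⁻¹

lemma norm_kk (m : ℕ) (u : ℂ) : ‖kk m u‖ = (‖u‖ ^ (m+3))⁻¹ := by simp [kk]

lemma norm_kk' (m : ℕ) (u : ℂ) : ‖kk m u‖ = ‖u‖ ^ (-((m:ℝ)+3)) := by
  rw [norm_kk, Real.rpow_neg (norm_nonneg _)]
  congr 1
  have : ((m:ℝ)+3) = ((m+3 : ℕ) : ℝ) := by push_cast; ring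
  rw [this, Real.rpow_natCast]

lemma continuousOn_kk (m : ℕ) : ContinuousOn (kk m) {u | u ≠ 0} := by
  unfold kk
  refine ContinuousOn.inv₀ (by fun_prop) fun u hu => pow_ne_zero _ ?_
  simpa using hu

variable {m : ℕ} {L : EE m → ℝ} {c C K δ K₁ M : ℝ}

lemma kk_integrable (h : LForm L c C) (hK : 0 < K) (hδ : 0 < δ) :
    IntegrableOn (fun p : EE m × ℂ => kk m p.2) (R0 L K δ) := by
  have hR := (isOpen_R0 h K δ).measurableSet
  have hc : ContinuousOn (fun p : EE m × ℂ => kk m p.2) (R0 L K δ) := by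
    refine (continuousOn_kk m).comp continuousOn_snd ?_
    intro p hp
    exact norm_pos_iff.1 (YY_pos_bounds hK hδ (R0_bounds h hK hδ hp).1).2.2.2
  have hae : ∀ᵐ p ∂(volume.restrict (R0 L K δ)), ‖kk m p.2‖ ≤ ((δ/2) ^ (m+3))⁻¹ := by
    refine (ae_restrict_iff' hR).2 (ae_of_all _ fun p hp => ?_)
    rw [norm_kk]
    have := (YY_pos_bounds hK hδ (R0_bounds h hK hδ hp).1).1
    gcongr
  haveI : IsFiniteMeasure (volume.restrict (R0 L K δ)) := ⟨by simpa using R0_finite h hK hδ⟩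
  exact Integrable.of_bound (hc.aestronglyMeasurable hR) _ hae

lemma L_zero (h : LForm L c C) : L 0 = 0 := by
  have := h.smul 0 0
  simpa using this

lemma R1_balanced (h : LForm L c C) {a : ℂ} (ha : ‖a‖ ≤ 1) {t : EE m} {u : ℂ} (hp : (t, u) ∈ R1 L K δ K₁) :
    (a • t, u) ∈ R1 L K δ K₁ := by
  have h1 : L t + K₁ * ‖u‖ ^ (3/2 : ℝ) < YY K δ u := hp
  show L (a • t) + K₁ * ‖u‖ ^ (3/2 : ℝ) < YY K δ u
  have h2 : 0 ≤ L t := le_trans (by have := h.hc; positivity) (h.lower t)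
  rw [h.smul]
  have h3 : ‖a‖ ^ 2 ≤ 1 := pow_le_one₀ (norm_nonneg a) ha
  have h4 : ‖a‖ ^ 2 * L t ≤ 1 * L t := mul_le_mul_of_nonneg_right h3 h2
  linarith

lemma model_rot (h : LForm L c C) (hK : 0 < K) (hδ : 0 < δ) (hK₁ : 0 ≤ K₁) {G : EE m × ℂ → ℂ}
    (hG : ∀ u, DifferentiableOn ℂ (fun t => G (t, u)) {t | (t, u) ∈ R1 L K δ K₁})
    (hGc : ContinuousOn G (R1 L K δ K₁)) (hM : ∀ p ∈ R1 L K δ K₁, ‖G p‖ ≤ M) :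
    ∫ p in R1 L K δ K₁, G p * kk m p.2 = ∫ p in R1 L K δ K₁, G (0, p.2) * kk m p.2 := by
  have hop := isOpen_R1 h K δ K₁
  have hR := hop.measurableSet
  have hki : IntegrableOn (fun p : EE m × ℂ => kk m p.2) (R1 L K δ K₁) := (kk_integrable h hK hδ).mono_set (R1_subset hK₁)
  have i1 : IntegrableOn (fun p => G p * kk m p.2) (R1 L K δ K₁) :=
    hki.bdd_mul (c := M) (hGc.aestronglyMeasurable hR) ((ae_restrict_iff' hR).2 (ae_of_all _ hM))
  have h0 : ∀ p ∈ R1 L K δ K₁, ((0 : EE m), p.2) ∈ R1 L K δ K₁ := by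
    rintro ⟨t, u⟩ hp
    have := R1_balanced h (a := 0) (by simp) hp
    simpa using this
  have i2 : IntegrableOn (fun p : EE m × ℂ => G (0, p.2) * kk m p.2) (R1 L K δ K₁) := by
    refine hki.bdd_mul (c := M) (ContinuousOn.aestronglyMeasurable ?_ hR) ((ae_restrict_iff' hR).2 (ae_of_all _ fun p hp => hM _ (h0 p hp)))
    exact hGc.comp (by fun_prop) h0
  rw [setIntegral_slices hR i1, setIntegral_slices hR i2]
  refine integral_congr_ae (ae_of_all _ fun u => ?_)
  simp only
  rw [integral_mul_const, integral_mul_const]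
  congr 1
  have hopu : IsOpen {t : EE m | (t, u) ∈ R1 L K δ K₁} := hop.preimage (by fun_prop : Continuous fun t : EE m => (t, u))
  have hfin : volume {t : EE m | (t, u) ∈ R1 L K δ K₁} ≠ ⊤ := by
    by_cases hu : 0 < YY K δ u
    · refine (lt_of_le_of_lt (measure_mono (t := closedBall (0 : EE m) (2 / c * ‖u‖ + 1)) ?_) measure_closedBall_lt_top).ne
      intro t ht
      have := (R0_bounds h hK hδ (R1_subset hK₁ ht)).2
      simp only at this
      rw [mem_closedBall, dist_zero_right]
      nlinarith [norm_nonneg t, sq_nonneg (‖t‖ - 1)]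
    · have : {t : EE m | (t, u) ∈ R1 L K δ K₁} = ∅ := by
        ext t
        simp only [mem_setOf_eq, mem_empty_iff_false, iff_false]
        intro ht
        exact hu (R0_bounds h hK hδ (R1_subset hK₁ ht)).1
      rw [this]; simp
  have := rot_mean (rot_EE m) hopu (fun a ha t ht => R1_balanced h ha ht) (w := fun _ => 1)
    (integrableOn_const hfin) (fun _ _ _ => rfl) (hG u) (fun t ht => hM _ ht)
  simp only [one_mul] at this
  rw [this]
  simp [mul_comm]

lemma model_slice (h : LForm L c C) (hK : 0 < K) (hδ : 0 < δ) {F : ℂ → ℂ}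
    (hF : ContinuousOn F {u | 0 < YY K δ u}) (hM : ∀ u, 0 < YY K δ u → ‖F u‖ ≤ M) :
    IntegrableOn (fun p : EE m × ℂ => F p.2 * kk m p.2) (R0 L K δ) ∧
    ∫ p in R0 L K δ, F p.2 * kk m p.2 = ((volume {t | L t < 1}).toReal : ℂ) *
      ∫ u in {u | 0 < YY K δ u}, ((YY K δ u ^ m : ℝ) : ℂ) * (F u * kk m u) := by
  have hop := isOpen_R0 h K δ
  have hR := hop.measurableSet
  have hD : MeasurableSet {u | 0 < YY K δ u} := (isOpen_lt continuous_const (continuous_YY K δ)).measurableSet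
  have i1 : IntegrableOn (fun p : EE m × ℂ => F p.2 * kk m p.2) (R0 L K δ) := by
    refine (kk_integrable h hK hδ).bdd_mul (c := M) (ContinuousOn.aestronglyMeasurable ?_ hR)
      ((ae_restrict_iff' hR).2 (ae_of_all _ fun p hp => hM _ (R0_bounds h hK hδ hp).1))
    exact hF.comp continuousOn_snd fun p hp => (R0_bounds h hK hδ hp).1
  refine ⟨i1, ?_⟩
  rw [setIntegral_slices hR i1, ← integral_const_mul, ← integral_indicator hD]
  refine integral_congr_ae (ae_of_all _ fun u => ?_)
  simp only
  rw [setIntegral_const]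
  by_cases hu : 0 < YY K δ u
  · rw [indicator_of_mem (show u ∈ {u | 0 < YY K δ u} from hu)]
    have : volume.real {t | (t, u) ∈ R0 L K δ} = YY K δ u ^ m * (volume {t | L t < 1}).toReal := h.slice_vol hu
    rw [this, Complex.real_smul]; push_cast; ring
  · rw [indicator_of_notMem (show u ∉ {u | 0 < YY K δ u} from hu)]
    have : {t : EE m | (t, u) ∈ R0 L K δ} = ∅ := by
      ext t
      simp only [mem_setOf_eq, mem_empty_iff_false, iff_false]
      intro ht
      exact hu (R0_bounds h hK hδ ht).1
    rw [this]; simp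

end GDJ

namespace GDJ
open Set Filter Topology MeasureTheory
open scoped ContDiff

set_option maxHeartbeats 1000000 in
lemma model_final (m : ℕ) {c C K K₁ A B a M : ℝ} (hC : 1 ≤ C) (hK : 2 ≤ K) (hK₁ : 0 ≤ K₁) (hA : 0 ≤ A) (hcA : 2 / c ≤ A)
    (hB : K₁ + K ≤ B) (ha : 0 < a) (ha2 : a ≤ 1/2) (hM0 : 0 ≤ M) :
    ∃ W > 0, ∀ (δ : ℝ) (L : EE m → ℝ) (G : EE m × ℂ → ℂ) (F : ℂ → ℂ) (χ : EE m × ℂ → ℝ) (S : Set (EE m × ℂ)),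
      LForm L c C → 0 < δ → K * δ ≤ 1/2 → MeasurableSet S → R1 L K δ K₁ ⊆ S →
      IntegrableOn (fun p => G p * (χ p * kk m p.2)) S →
      (∀ p ∈ S, p ∉ R1 L K δ K₁ → χ p ≠ 0 → a * δ ≤ ‖p.2‖ ∧ ‖p.1‖ ^ 2 ≤ A * ‖p.2‖ ∧
        |2 * p.2.re - (δ + L p.1)| ≤ B * ‖p.2‖ ^ (3/2 : ℝ)) →
      (∀ p ∈ S, ‖G p‖ ≤ M) → (∀ p, |χ p| ≤ 1) → Measurable χ → (∀ p ∈ R1 L K δ K₁, χ p = 1) →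
      (∀ u, DifferentiableOn ℂ (fun t => G (t, u)) {t | (t, u) ∈ R1 L K δ K₁}) →
      ContinuousOn G (R1 L K δ K₁) →
      DifferentiableOn ℂ F {u | 0 < YY K δ u} → (∀ u, 0 < YY K δ u → ‖F u‖ ≤ M) → F δ = 0 →
      (∀ p ∈ R1 L K δ K₁, G (0, p.2) = F p.2) →
      ‖deriv F δ‖ ≤ W * (‖∫ p in S, G p * (χ p * kk m p.2)‖ + δ ^ (-(1/2) : ℝ)) := by
  obtain ⟨W₀, hW₀, hshell⟩ := shell_int m
  have hB0 : 0 ≤ B := by linarith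
  set c₂ := (1/2 : ℝ) ^ (m+2) * c1 m * (volume (ball (0 : EE m) (1 / C))).toReal with hc₂
  have hvp : 0 < (volume (ball (0 : EE m) (1 / C))).toReal :=
    ENNReal.toReal_pos (measure_ball_pos volume _ (by positivity)).ne' measure_ball_lt_top.ne
  have hc₂0 : 0 < c₂ := by have := c1_pos m; positivity
  set Q := 2 * M * (W₀ * A ^ m * B * a ^ (-(1/2) : ℝ)) with hQ
  have hQ0 : 0 ≤ Q := by positivity
  refine ⟨(1 + Q) / c₂, by positivity, ?_⟩
  intro δ L G F χ S hL hδ hKδ hS hRS hGi hgeo hGM hχ1 hχm hχR hGd hGc hFd hFM hF0 hGF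
  have hK0 : 0 < K := by linarith
  have hR1m := (isOpen_R1 hL K δ K₁).measurableSet
  have hR0m := (isOpen_R0 hL K δ).measurableSet
  have hLm : Measurable fun t : EE m => δ + L t := (continuous_const.add hL.cont).measurable
  have hpow : (a * δ) ^ (-(1/2) : ℝ) = a ^ (-(1/2) : ℝ) * δ ^ (-(1/2) : ℝ) := Real.mul_rpow ha.le hδ.le
  -- shell 1
  set S1 := (S \ R1 L K δ K₁) ∩ {p | χ p ≠ 0} with hS1
  have hS1m : MeasurableSet S1 := (hS.diff hR1m).inter ((hχm (measurableSet_singleton 0)).compl)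
  have s1 := hshell A B (a * δ) (fun t => δ + L t) S1 hA hB0 (by positivity) hLm hS1m
    (fun p hp => hgeo p hp.1.1 hp.1.2 hp.2)
  have b1 : ‖∫ p in S \ R1 L K δ K₁, G p * (χ p * kk m p.2)‖ ≤ M * (W₀ * A ^ m * B * (a * δ) ^ (-(1/2) : ℝ)) := by
    have e : ∫ p in S \ R1 L K δ K₁, G p * (χ p * kk m p.2) = ∫ p in S1, G p * (χ p * kk m p.2) := by
      refine (setIntegral_eq_of_subset_of_forall_diff_eq_zero (hS.diff hR1m) inter_subset_left ?_)
      rintro p ⟨hp1, hp2⟩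
      have : χ p = 0 := by
        by_contra h; exact hp2 ⟨hp1, h⟩
      simp [this]
    rw [e]
    refine (norm_integral_le_of_norm_le (s1.1.const_mul M) ((ae_restrict_iff' hS1m).2 (ae_of_all _ fun p hp => ?_))).trans ?_
    · rw [norm_mul, norm_mul, norm_kk', Complex.norm_real, Real.norm_eq_abs]
      have h1 := hGM p hp.1.1
      have h2 := hχ1 p
      have h3 : 0 ≤ ‖p.2‖ ^ (-((m:ℝ)+3)) := by positivity
      calc _ ≤ M * (1 * ‖p.2‖ ^ (-((m:ℝ)+3))) := by gcongr
        _ = _ := by ring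
    · rw [integral_const_mul]; exact mul_le_mul_of_nonneg_left s1.2 hM0
  -- shell 2
  have hS2m : MeasurableSet (R0 L K δ \ R1 L K δ K₁) := hR0m.diff hR1m
  have s2 := hshell A B (a * δ) (fun t => δ + L t) (R0 L K δ \ R1 L K δ K₁) hA hB0 (by positivity) hLm hS2m (by
    rintro p ⟨hp0, hp1⟩
    obtain ⟨h1, h2⟩ := R0_bounds hL hK0 hδ hp0
    obtain ⟨h3, h4, h5, h6⟩ := YY_pos_bounds hK0 hδ h1
    have h7 : L p.1 < YY K δ p.2 := hp0
    have h8 : YY K δ p.2 ≤ L p.1 + K₁ * ‖p.2‖ ^ (3/2 : ℝ) := not_lt.1 hp1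
    have hu1 : ‖p.2‖ ≤ 1 := h4.trans (by rw [div_le_one hK0]; exact hK)
    have h9 : ‖p.2‖ ^ 2 ≤ ‖p.2‖ ^ (3/2 : ℝ) := by
      rw [← Real.rpow_natCast]
      exact Real.rpow_le_rpow_of_exponent_ge h6 hu1 (by norm_num)
    have h10 : 0 ≤ ‖p.2‖ ^ (3/2 : ℝ) := by positivity
    refine ⟨?_, h2.trans (by gcongr), ?_⟩
    · nlinarith
    · unfold YY at h7 h8
      rw [abs_of_nonneg (by nlinarith [mul_nonneg hK0.le (sq_nonneg ‖p.2‖)])]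
      nlinarith [mul_le_mul_of_nonneg_left h9 hK0.le, mul_le_mul_of_nonneg_right hB h10])
  obtain ⟨hFi, hslice⟩ := model_slice hL hK0 hδ hFd.continuousOn hFM
  have b2 : ‖∫ p in R0 L K δ \ R1 L K δ K₁, F p.2 * kk m p.2‖ ≤ M * (W₀ * A ^ m * B * (a * δ) ^ (-(1/2) : ℝ)) := by
    refine (norm_integral_le_of_norm_le (s2.1.const_mul M) ((ae_restrict_iff' hS2m).2 (ae_of_all _ fun p hp => ?_))).trans ?_
    · rw [norm_mul, norm_kk']
      have h1 := hFM p.2 (R0_bounds hL hK0 hδ hp.1).1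
      gcongr
    · rw [integral_const_mul]; exact mul_le_mul_of_nonneg_left s2.2 hM0
  have hrot := model_rot hL hK0 hδ hK₁ hGd hGc (fun p hp => hGM p (hRS hp))
  have e1 : ∫ p in R1 L K δ K₁, G p * (χ p * kk m p.2) = ∫ p in R1 L K δ K₁, F p.2 * kk m p.2 := by
    rw [setIntegral_congr_fun (g := fun p => G p * kk m p.2) hR1m (fun p hp => by simp [hχR p hp]), hrot]
    exact setIntegral_congr_fun hR1m (fun p hp => by simp only [hGF p hp])
  have e2 : ∫ p in S, G p * (χ p * kk m p.2) = (∫ p in S \ R1 L K δ K₁, G p * (χ p * kk m p.2)) +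
      ∫ p in R1 L K δ K₁, G p * (χ p * kk m p.2) := by
    rw [setIntegral_diff hR1m hGi hRS]; ring
  have e3 : ∫ p in R0 L K δ \ R1 L K δ K₁, F p.2 * kk m p.2 = (∫ p in R0 L K δ, F p.2 * kk m p.2) -
      ∫ p in R1 L K δ K₁, F p.2 * kk m p.2 := setIntegral_diff hR1m hFi (R1_subset hK₁)
  have e4 : ∫ p in R0 L K δ, F p.2 * kk m p.2 = (∫ p in S, G p * (χ p * kk m p.2)) -
      (∫ p in S \ R1 L K δ K₁, G p * (χ p * kk m p.2)) + ∫ p in R0 L K δ \ R1 L K δ K₁, F p.2 * kk m p.2 := by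
    rw [e2, e3, e1]; ring
  have h1 : ‖∫ p in R0 L K δ, F p.2 * kk m p.2‖ ≤ ‖∫ p in S, G p * (χ p * kk m p.2)‖ + Q * δ ^ (-(1/2) : ℝ) := by
    rw [e4]
    refine (norm_add_le _ _).trans ?_
    have := norm_sub_le (∫ p in S, G p * (χ p * kk m p.2)) (∫ p in S \ R1 L K δ K₁, G p * (χ p * kk m p.2))
    rw [hpow] at b1 b2
    have e : Q * δ ^ (-(1/2) : ℝ) = 2 * (M * (W₀ * A ^ m * B * (a ^ (-(1/2) : ℝ) * δ ^ (-(1/2) : ℝ)))) := by rw [hQ]; ring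
    linarith
  have hone := one_var m hK0 hδ hKδ hFd hFM hF0
  have h2 : c₂ * ‖deriv F δ‖ ≤ ‖∫ p in R0 L K δ, F p.2 * kk m p.2‖ := by
    rw [hslice, norm_mul, Complex.norm_real, Real.norm_eq_abs, abs_of_nonneg ENNReal.toReal_nonneg]
    have hv := hL.vol_lower
    calc c₂ * ‖deriv F δ‖ = (volume (ball (0 : EE m) (1 / C))).toReal * ((1/2) ^ (m+2) * c1 m * ‖deriv F δ‖) := by rw [hc₂]; ring
      _ ≤ _ := mul_le_mul hv hone (by have := c1_pos m; positivity) ENNReal.toReal_nonneg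
  have h3 : 0 ≤ δ ^ (-(1/2) : ℝ) := by positivity
  rw [div_mul_eq_mul_div, le_div_iff₀ hc₂0]
  have h4 := norm_nonneg (∫ p in S, G p * (χ p * kk m p.2))
  nlinarith [mul_nonneg hQ0 h4]

end GDJ

namespace GDJ
open Set Filter Topology MeasureTheory
open scoped ContDiff

/-- an orthonormal frame adapted to the unit vector `ν` -/
structure Frame {m : ℕ} (ν : EE (m + 1)) (ι : EE m →ₗᵢ[ℂ] EE (m + 1)) : Prop where
  hν : ‖ν‖ = 1
  ort : ∀ t, inner ℂ ν (ι t) = 0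
  surj : ∀ v, ∃ t, v = ι t + (inner ℂ ν v : ℂ) • ν

lemma exists_frame {m : ℕ} (ν : EE (m + 1)) (hν : ‖ν‖ = 1) : ∃ ι : EE m →ₗᵢ[ℂ] EE (m + 1), Frame ν ι := by
  have h0 : ν ≠ 0 := by intro h; simp [h] at hν
  haveI : Fact (Module.finrank ℂ (EE (m + 1)) = m + 1) := ⟨by simp⟩
  let U := (OrthonormalBasis.fromOrthogonalSpanSingleton (𝕜 := ℂ) m h0).repr
  let ι : EE m →ₗᵢ[ℂ] EE (m + 1) := (Submodule.subtypeₗᵢ _).comp U.symm.toLinearIsometry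
  have hι : ∀ t, ι t = ((U.symm t : _) : EE (m + 1)) := fun t => rfl
  refine ⟨ι, hν, fun t => ?_, fun v => ?_⟩
  · rw [hι]
    exact (Submodule.mem_orthogonal_singleton_iff_inner_right (𝕜 := ℂ)).1 (U.symm t).2
  · have hm : v - (inner ℂ ν v : ℂ) • ν ∈ (ℂ ∙ ν)ᗮ := by
      rw [Submodule.mem_orthogonal_singleton_iff_inner_right]
      rw [inner_sub_right, inner_smul_right, inner_self_eq_norm_sq_to_K, hν]
      simp
    refine ⟨U ⟨_, hm⟩, ?_⟩
    rw [hι, LinearIsometryEquiv.symm_apply_apply]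
    simp

lemma Frame.inner_self {m : ℕ} {ν : EE (m + 1)} {ι : EE m →ₗᵢ[ℂ] EE (m + 1)} (h : Frame ν ι) :
    inner ℂ ν ν = (1 : ℂ) := by
  rw [inner_self_eq_norm_sq_to_K, h.hν]; simp

lemma Frame.inner_eq {m : ℕ} {ν : EE (m + 1)} {ι : EE m →ₗᵢ[ℂ] EE (m + 1)} (h : Frame ν ι) (t : EE m) (s : ℂ) :
    inner ℂ ν (ι t + s • ν) = s := by
  rw [inner_add_right, h.ort, inner_smul_right, h.inner_self]; simp

lemma Frame.norm_sq {m : ℕ} {ν : EE (m + 1)} {ι : EE m →ₗᵢ[ℂ] EE (m + 1)} (h : Frame ν ι) (t : EE m) (s : ℂ) :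
    ‖ι t + s • ν‖ ^ 2 = ‖t‖ ^ 2 + ‖s‖ ^ 2 := by
  have h1 : inner ℂ (ι t) (s • ν) = 0 := by
    rw [inner_smul_right, ← inner_conj_symm, h.ort]; simp
  have h2 := norm_add_sq_eq_norm_sq_add_norm_sq_of_inner_eq_zero (𝕜 := ℂ) (ι t) (s • ν) h1
  rw [norm_smul, h.hν, mul_one, ι.norm_map] at h2
  nlinarith

/-- shear and affine change of variables -/
def PsiG {m : ℕ} (z ν : EE (m + 1)) (ι : EE m →ₗᵢ[ℂ] EE (m + 1)) (δ lam : ℝ) (q : EE m → ℂ)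
    (p : EE m × ℂ) : EE (m + 1) :=
  z + (ι p.1 + ((2 * ((δ : ℂ) - p.2) - q p.1) / (lam : ℂ)) • ν)

lemma PsiG_measure {m : ℕ} {z ν : EE (m + 1)} {ι : EE m →ₗᵢ[ℂ] EE (m + 1)} (h : Frame ν ι)
    {δ lam : ℝ} (hlam : 0 < lam) {q : EE m → ℂ} (hq : Continuous q) :
    MeasurableEmbedding (PsiG z ν ι δ lam q) ∧ ∃ k : ENNReal, k ≠ 0 ∧ k ≠ ⊤ ∧
      Measure.map (PsiG z ν ι δ lam q) (volume : Measure (EE m × ℂ)) = k • (volume : Measure (EE (m + 1))) := by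
  have hl : (lam : ℂ) ≠ 0 := by exact_mod_cast hlam.ne'
  -- the linear part
  let Λ₀ : (EE m × ℂ) →ₗ[ℝ] EE (m + 1) :=
    { toFun := fun p => ι p.1 + ((-2 * p.2) / (lam : ℂ)) • ν
      map_add' := by
        intro p p'
        simp only [Prod.fst_add, Prod.snd_add, map_add]
        rw [show (-2 * (p.2 + p'.2)) / (lam : ℂ) = (-2 * p.2) / (lam : ℂ) + (-2 * p'.2) / (lam : ℂ) by ring, add_smul]
        abel
      map_smul' := by
        intro a p
        simp only [Prod.smul_fst, Prod.smul_snd, RingHom.id_apply, smul_add]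
        rw [← real_smul a p.1, map_smul, real_smul]
        congr 1
        rw [← real_smul, smul_smul, Complex.real_smul]
        congr 1; ring }
  have hbij : Function.Bijective Λ₀ := by
    constructor
    · rw [← LinearMap.ker_eq_bot, LinearMap.ker_eq_bot']
      intro p hp
      have hp' : ι p.1 + ((-2 * p.2) / (lam : ℂ)) • ν = 0 := hp
      have h1 := h.norm_sq p.1 ((-2 * p.2) / (lam : ℂ))
      rw [hp'] at h1
      simp only [norm_zero] at h1
      have h2 : ‖p.1‖ = 0 := by nlinarith [sq_nonneg ‖p.1‖, sq_nonneg ‖(-2 * p.2) / (lam : ℂ)‖]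
      have h3 : ‖(-2 * p.2) / (lam : ℂ)‖ = 0 := by nlinarith [sq_nonneg ‖p.1‖, sq_nonneg ‖(-2 * p.2) / (lam : ℂ)‖]
      ext1
      · exact norm_eq_zero.1 h2
      · have := norm_eq_zero.1 h3
        simpa [hl] using this
    · intro v
      obtain ⟨t, ht⟩ := h.surj v
      refine ⟨(t, -(lam : ℂ) / 2 * inner ℂ ν v), ?_⟩
      show ι t + ((-2 * (-(lam : ℂ) / 2 * inner ℂ ν v)) / (lam : ℂ)) • ν = v
      rw [show (-2 * (-(lam : ℂ) / 2 * inner ℂ ν v)) / (lam : ℂ) = inner ℂ ν v by field_simp]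
      exact ht.symm
  let Λ : (EE m × ℂ) ≃L[ℝ] EE (m + 1) := (LinearEquiv.ofBijective Λ₀ hbij).toContinuousLinearEquiv
  have hΛ : ∀ p, Λ p = ι p.1 + ((-2 * p.2) / (lam : ℂ)) • ν := fun p => rfl
  -- the shear
  let T : (EE m × ℂ) ≃ₜ (EE m × ℂ) :=
    { toFun := fun p => (p.1, p.2 + q p.1 / 2)
      invFun := fun p => (p.1, p.2 - q p.1 / 2)
      left_inv := fun p => by simp
      right_inv := fun p => by simp
      continuous_toFun := by fun_prop
      continuous_invFun := by fun_prop }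
  have hT : MeasurePreserving T volume volume := by
    have := (MeasurePreserving.id (volume : Measure (EE m))).skew_product (μc := (volume : Measure ℂ))
      (μd := (volume : Measure ℂ)) (g := fun t u => u + q t / 2) (by
        apply Continuous.measurable
        show Continuous fun p : EE m × ℂ => p.2 + q p.1 / 2
        fun_prop)
      (ae_of_all _ fun t => (measurePreserving_add_right volume (q t / 2)).map_eq)
    exact this
  let A : EE (m + 1) ≃ₜ EE (m + 1) := Homeomorph.addLeft (z + ((2 * (δ : ℂ)) / (lam : ℂ)) • ν)
  have hA : MeasurePreserving A volume volume := measurePreserving_add_left volume _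
  have hcomp : PsiG z ν ι δ lam q = A ∘ (Λ ∘ T) := by
    funext p
    show _ = (z + ((2 * (δ : ℂ)) / (lam : ℂ)) • ν) + (ι p.1 + ((-2 * (p.2 + q p.1 / 2)) / (lam : ℂ)) • ν)
    unfold PsiG
    rw [show ((2 * ((δ : ℂ) - p.2) - q p.1) / (lam : ℂ)) = (2 * (δ : ℂ)) / (lam : ℂ) + (-2 * (p.2 + q p.1 / 2)) / (lam : ℂ) by
      field_simp; ring, add_smul]
    abel
  have hme : MeasurableEmbedding (PsiG z ν ι δ lam q) := by
    rw [hcomp]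
    exact A.measurableEmbedding.comp (Λ.toHomeomorph.measurableEmbedding.comp T.measurableEmbedding)
  refine ⟨hme, ?_⟩
  haveI hP : (volume : Measure (EE m × ℂ)).IsAddHaarMeasure := by
    rw [Measure.volume_eq_prod]; infer_instance
  have hH : (Measure.map Λ (volume : Measure (EE m × ℂ))).IsAddHaarMeasure :=
    Λ.isAddHaarMeasure_map volume
  obtain ⟨k, hk⟩ : ∃ k : NNReal, 0 < k ∧ Measure.map Λ (volume : Measure (EE m × ℂ)) = k • (volume : Measure (EE (m + 1))) :=
    ⟨_, Measure.addHaarScalarFactor_pos_of_isAddHaarMeasure _ _, Measure.isAddLeftInvariant_eq_smul _ _⟩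
  refine ⟨k, by exact_mod_cast hk.1.ne', ENNReal.coe_ne_top, ?_⟩
  rw [hcomp, ← Measure.map_map A.continuous.measurable (Λ.continuous.comp T.continuous).measurable,
    ← Measure.map_map Λ.continuous.measurable T.continuous.measurable, hT.map_eq, hk.2, Measure.map_smul, hA.map_eq]
  rfl

lemma PsiG_change {m : ℕ} {z ν : EE (m + 1)} {ι : EE m →ₗᵢ[ℂ] EE (m + 1)} (h : Frame ν ι)
    {δ lam : ℝ} (hlam : 0 < lam) {q : EE m → ℂ} (hq : Continuous q) :
    ∃ k : ℝ, 0 < k ∧ ∀ (S : Set (EE (m + 1))), 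
      (∀ g : EE (m + 1) → ℂ, (IntegrableOn g S → IntegrableOn (fun p => g (PsiG z ν ι δ lam q p)) (PsiG z ν ι δ lam q ⁻¹' S)) ∧
        ∫ p in PsiG z ν ι δ lam q ⁻¹' S, g (PsiG z ν ι δ lam q p) = k * ∫ w in S, g w) ∧
      (∀ g : EE (m + 1) → ℝ, (IntegrableOn g S → IntegrableOn (fun p => g (PsiG z ν ι δ lam q p)) (PsiG z ν ι δ lam q ⁻¹' S)) ∧
        ∫ p in PsiG z ν ι δ lam q ⁻¹' S, g (PsiG z ν ι δ lam q p) = k * ∫ w in S, g w) := by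
  obtain ⟨he, k, hk0, hk1, hk⟩ := PsiG_measure (z := z) (δ := δ) h hlam hq
  refine ⟨k.toReal, ENNReal.toReal_pos hk0 hk1, fun S => ?_⟩
  have hI : ∀ {F : Type} [NormedAddCommGroup F] (g : EE (m + 1) → F), IntegrableOn g S → 
      IntegrableOn (fun p => g (PsiG z ν ι δ lam q p)) (PsiG z ν ι δ lam q ⁻¹' S) := by
    intro F _ g hg
    have h1 : IntegrableOn g S (Measure.map (PsiG z ν ι δ lam q) volume) := by
      rw [hk]
      unfold IntegrableOn
      rw [Measure.restrict_smul]
      exact Integrable.smul_measure hg hk1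
    exact (he.integrableOn_map_iff).1 h1
  refine ⟨fun g => ⟨hI g, ?_⟩, fun g => ⟨hI g, ?_⟩⟩
  · rw [← he.setIntegral_map, hk, Measure.restrict_smul, integral_smul_measure, Complex.real_smul]
  · rw [← he.setIntegral_map, hk, Measure.restrict_smul, integral_smul_measure, smul_eq_mul]

end GDJ

namespace GDJ
open Set Filter Topology MeasureTheory
open scoped ContDiff

/-- local geometric data at a point near the boundary -/
structure Geo {m : ℕ} (Ω : Set (EE (m + 1))) (ρ : EE (m + 1) → ℝ) (c C r : ℝ) (z ν : EE (m + 1))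
    (ι : EE m →ₗᵢ[ℂ] EE (m + 1)) : Prop where
  D : Dom Ω ρ c C r
  c1 : c ≤ 1
  hz : z ∈ Ω
  hzc : -c < ρ z
  F : Frame ν ι
  hell : ∀ v, ell ρ z v = ‖ell ρ z‖ * inner ℂ ν v

/-- the normal coordinate -/
def sc {m : ℕ} (ρ : EE (m + 1) → ℝ) (z : EE (m + 1)) (ι : EE m →ₗᵢ[ℂ] EE (m + 1)) (p : EE m × ℂ) : ℂ :=
  (2 * (((-ρ z : ℝ) : ℂ) - p.2) - qf ρ z (ι p.1)) / ((‖ell ρ z‖ : ℝ) : ℂ)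

/-- the local coordinates -/
def Psi {m : ℕ} (ρ : EE (m + 1) → ℝ) (z ν : EE (m + 1)) (ι : EE m →ₗᵢ[ℂ] EE (m + 1)) (p : EE m × ℂ) : EE (m + 1) :=
  z + (ι p.1 + sc ρ z ι p • ν)

/-- the holomorphic support function -/
def uu {n : ℕ} (ρ : EE n → ℝ) (z ν w : EE n) : ℂ :=
  ((-ρ z : ℝ) : ℂ) - (ell ρ z (w - z) + qf ρ z ((w - z) - (inner ℂ ν (w - z) : ℂ) • ν)) / 2

variable {m : ℕ} {Ω : Set (EE (m + 1))} {ρ : EE (m + 1) → ℝ} {c C r : ℝ} {z ν : EE (m + 1)}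
    {ι : EE m →ₗᵢ[ℂ] EE (m + 1)}

lemma Psi_eq_PsiG : Psi ρ z ν ι = PsiG z ν ι (-ρ z) ‖ell ρ z‖ (fun t => qf ρ z (ι t)) := rfl

lemma Geo.ell_bounds (h : Geo Ω ρ c C r z ν ι) : c ≤ ‖ell ρ z‖ ∧ ‖ell ρ z‖ ≤ C ∧ 0 < ‖ell ρ z‖ := by
  rw [norm_ell]
  have := h.D.grad z h.hz h.hzc
  exact ⟨this, h.D.d1 z h.hz z (mem_ball_self h.D.hr), h.D.hc.trans_le this⟩

lemma Geo.D2_le (h : Geo Ω ρ c C r z ν ι) : ‖D2 ρ z‖ ≤ C := h.D.d2 z h.hz z (mem_ball_self h.D.hr)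

lemma Geo.q_le (h : Geo Ω ρ c C r z ν ι) (t : EE m) : ‖qf ρ z (ι t)‖ ≤ C * ‖t‖ ^ 2 := by
  refine (norm_qf_le ρ z _).trans ?_
  rw [ι.norm_map]
  exact mul_le_mul_of_nonneg_right h.D2_le (by positivity)

lemma Geo.ell_mul_sc (h : Geo Ω ρ c C r z ν ι) (p : EE m × ℂ) :
    ((‖ell ρ z‖ : ℝ) : ℂ) * sc ρ z ι p = 2 * (((-ρ z : ℝ) : ℂ) - p.2) - qf ρ z (ι p.1) := by
  have : ((‖ell ρ z‖ : ℝ) : ℂ) ≠ 0 := by exact_mod_cast h.ell_bounds.2.2.ne'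
  unfold sc; field_simp

lemma Geo.delta_pos (h : Geo Ω ρ c C r z ν ι) : 0 < -ρ z := by
  have := h.D.neg h.hz; linarith

lemma Geo.sc_le (h : Geo Ω ρ c C r z ν ι) (p : EE m × ℂ) :
    c * ‖sc ρ z ι p‖ ≤ 2 * (-ρ z) + 2 * ‖p.2‖ + C * ‖p.1‖ ^ 2 := by
  have h1 := congrArg norm (h.ell_mul_sc p)
  rw [norm_mul, Complex.norm_real, norm_norm] at h1
  have h2 : ‖2 * (((-ρ z : ℝ) : ℂ) - p.2) - qf ρ z (ι p.1)‖ ≤ 2 * (-ρ z) + 2 * ‖p.2‖ + C * ‖p.1‖ ^ 2 := by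
    refine (norm_sub_le _ _).trans (add_le_add ?_ (h.q_le _))
    rw [norm_mul]
    have h3 := norm_sub_le (((-ρ z : ℝ) : ℂ)) p.2
    rw [Complex.norm_real, Real.norm_of_nonneg h.delta_pos.le] at h3
    have h4 : ‖(2 : ℂ)‖ = 2 := by simp
    rw [h4]; linarith
  have h3 := mul_le_mul_of_nonneg_right h.ell_bounds.1 (norm_nonneg (sc ρ z ι p))
  linarith

lemma Geo.u_le (h : Geo Ω ρ c C r z ν ι) (p : EE m × ℂ) :
    2 * ‖p.2‖ ≤ 2 * (-ρ z) + C * ‖sc ρ z ι p‖ + C * ‖p.1‖ ^ 2 := by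
  have h1 := h.ell_mul_sc p
  have h2 : 2 * p.2 = 2 * ((-ρ z : ℝ) : ℂ) - ((‖ell ρ z‖ : ℝ) : ℂ) * sc ρ z ι p - qf ρ z (ι p.1) := by
    linear_combination h1
  have h3 := congrArg norm h2
  rw [norm_mul] at h3
  have h4 : ‖(2 : ℂ)‖ = 2 := by simp
  rw [h4] at h3
  rw [h3]
  refine (norm_sub_le _ _).trans (add_le_add ((norm_sub_le _ _).trans (add_le_add ?_ ?_)) (h.q_le _))
  · rw [norm_mul, h4, Complex.norm_real, Real.norm_of_nonneg h.delta_pos.le]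
  · rw [norm_mul, Complex.norm_real, norm_norm]
    exact mul_le_mul_of_nonneg_right h.ell_bounds.2.1 (norm_nonneg _)

lemma Geo.ell_zeta (h : Geo Ω ρ c C r z ν ι) (p : EE m × ℂ) :
    ell ρ z (ι p.1 + sc ρ z ι p • ν) = 2 * (((-ρ z : ℝ) : ℂ) - p.2) - qf ρ z (ι p.1) := by
  rw [h.hell, h.F.inner_eq, h.ell_mul_sc]

lemma Geo.uu_Psi (h : Geo Ω ρ c C r z ν ι) (p : EE m × ℂ) : uu ρ z ν (Psi ρ z ν ι p) = p.2 := by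
  unfold uu Psi
  rw [add_sub_cancel_left, h.ell_zeta, h.F.inner_eq, add_sub_cancel_right]
  ring

lemma Geo.rho_E (h : Geo Ω ρ c C r z ν ι) (p : EE m × ℂ) (hp : ‖ι p.1 + sc ρ z ι p • ν‖ < r) :
    |ρ (Psi ρ z ν ι p) - (-ρ z - 2 * p.2.re + Lv ρ z (ι p.1))| ≤
      C * (‖p.1‖ * ‖sc ρ z ι p‖ + ‖sc ρ z ι p‖ ^ 2 + ‖ι p.1 + sc ρ z ι p • ν‖ ^ 3) := by
  have h1 := h.D.t3 z h.hz _ hp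
  have h2 := congrArg Complex.re (h.ell_zeta p)
  rw [ell_re] at h2
  simp only [Complex.sub_re, Complex.mul_re, Complex.re_ofNat, Complex.im_ofNat, zero_mul, sub_zero,
    Complex.ofReal_re] at h2
  have h3 := half_D2_eq ρ z (ι p.1)
  set a := ι p.1 with ha
  set b := sc ρ z ι p • ν with hb
  have h4 : D2 ρ z (a + b) (a + b) = D2 ρ z a a + D2 ρ z a b + D2 ρ z b a + D2 ρ z b b := by
    simp only [map_add, ContinuousLinearMap.add_apply]; ring
  have na : ‖a‖ = ‖p.1‖ := ι.norm_map _
  have nb : ‖b‖ = ‖sc ρ z ι p‖ := by rw [hb, norm_smul, h.F.hν, mul_one]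
  have hC := h.D2_le
  have key : ∀ x y : EE (m + 1), |D2 ρ z x y| ≤ C * (‖x‖ * ‖y‖) := fun x y => by
    refine (abs_D2_le ρ z x y).trans ?_
    rw [mul_assoc]
    exact mul_le_mul_of_nonneg_right hC (by positivity)
  have k1 := key a b
  have k2 := key b a
  have k3 := key b b
  rw [na, nb] at k1 k2
  rw [nb] at k3
  rw [h4, h2] at h1
  have e : Psi ρ z ν ι p = z + (a + b) := rfl
  rw [e]
  have hCp : 0 ≤ C := by linarith [h.D.hC]
  have k3' : 0 ≤ C * (‖sc ρ z ι p‖ * ‖sc ρ z ι p‖) := by positivity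
  rw [abs_le] at *
  constructor <;> nlinarith [h1.1, h1.2, k1.1, k1.2, k2.1, k2.2, k3.1, k3.2]

lemma num_E {Q x τ σ Z : ℝ} (hQ : 1 ≤ Q) (hx : 0 ≤ x) (hτ : 0 ≤ τ) (hσ : 0 ≤ σ) (hZ : 0 ≤ Z)
    (hZ2 : Z ^ 2 = τ ^ 2 + σ ^ 2) (h1 : τ ^ 2 ≤ Q * x ^ 2) (h2 : σ ≤ Q * x ^ 2) (h3 : σ ≤ 1) :
    τ * σ + σ ^ 2 + Z ^ 3 ≤ 12 * Q ^ 3 * x ^ 3 ∧ Z ^ 2 ≤ 2 * Q * x ^ 2 := by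
  have hZ3 : Z ^ 2 ≤ 2 * Q * x ^ 2 := by nlinarith
  refine ⟨?_, hZ3⟩
  have hZx : Z ≤ 2 * Q * x := by
    rw [← pow_le_pow_iff_left₀ hZ (by positivity) two_ne_zero]
    have : Q * x ^ 2 ≤ Q ^ 2 * x ^ 2 := mul_le_mul_of_nonneg_right (by nlinarith) (by positivity)
    nlinarith [mul_nonneg (mul_nonneg (show (0 : ℝ) ≤ Q by linarith) hx) hx, sq_nonneg (Q * x)]
  have hτZ : τ ≤ Z := by nlinarith
  have hσZ : σ ≤ Z := by nlinarith
  have a1 : τ * σ ≤ (2 * Q * x) * (Q * x ^ 2) := mul_le_mul (hτZ.trans hZx) h2 hσ (by positivity)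
  have a2 : σ * σ ≤ (2 * Q * x) * (Q * x ^ 2) := mul_le_mul (hσZ.trans hZx) h2 hσ (by positivity)
  have a3 : Z ^ 3 ≤ (2 * Q * x) ^ 3 := pow_le_pow_left₀ hZ hZx 3
  have a4 : Q ^ 2 * x ^ 3 ≤ Q ^ 3 * x ^ 3 := mul_le_mul_of_nonneg_right (by nlinarith [sq_nonneg Q]) (by positivity)
  nlinarith

end GDJ

namespace GDJ
open Set Filter Topology MeasureTheory
open scoped ContDiff

/-- comparison constant -/
def Qc (c C : ℝ) : ℝ := 20 * C / c ^ 2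
/-- error constant -/
def Ec (c C : ℝ) : ℝ := 12 * C * Qc c C ^ 3

lemma Qc_ge {c C : ℝ} (hc : 0 < c) (hc1 : c ≤ 1) (hC : 1 ≤ C) : 1 ≤ Qc c C ∧ 3 / c ≤ Qc c C := by
  unfold Qc
  have : 0 < c ^ 2 := by positivity
  constructor
  · rw [le_div_iff₀ this]; nlinarith
  · rw [div_le_div_iff₀ hc this]; nlinarith [mul_le_mul hc1 hC (by norm_num) (by norm_num), mul_pos hc hc]

lemma Ec_ge {c C : ℝ} (hc : 0 < c) (hc1 : c ≤ 1) (hC : 1 ≤ C) : 1 ≤ Ec c C := by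
  unfold Ec
  have h := (Qc_ge hc hc1 hC).1
  have : 1 ≤ Qc c C ^ 3 := one_le_pow₀ h
  nlinarith

lemma sqrt_pow_three {a : ℝ} (ha : 0 ≤ a) : Real.sqrt a ^ 3 = a ^ (3 / 2 : ℝ) := by
  rw [Real.sqrt_eq_rpow, ← Real.rpow_natCast, ← Real.rpow_mul ha]; norm_num

variable {m : ℕ} {Ω : Set (EE (m + 1))} {ρ : EE (m + 1) → ℝ} {c C r : ℝ} {z ν : EE (m + 1)}
    {ι : EE m →ₗᵢ[ℂ] EE (m + 1)}

lemma Geo.sc_Q (h : Geo Ω ρ c C r z ν ι) (p : EE m × ℂ) (h1 : -ρ z ≤ 3 * ‖p.2‖) (h2 : c * ‖p.1‖ ^ 2 ≤ 3 * ‖p.2‖) :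
    ‖sc ρ z ι p‖ ≤ Qc c C * ‖p.2‖ ∧ ‖p.1‖ ^ 2 ≤ Qc c C * ‖p.2‖ := by
  have hc := h.D.hc
  have hC := h.D.hC
  have hc1 := h.c1
  have hu := norm_nonneg p.2
  constructor
  · have h3 := h.sc_le p
    have h4 : c * (c * ‖sc ρ z ι p‖) ≤ c * (8 * ‖p.2‖) + C * (3 * ‖p.2‖) := by
      have := mul_le_mul_of_nonneg_left h3 hc.le
      have := mul_le_mul_of_nonneg_left h2 (show 0 ≤ C by linarith)
      nlinarith
    have h5 : c * ‖p.2‖ ≤ C * ‖p.2‖ := mul_le_mul_of_nonneg_right (by linarith) hu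
    unfold Qc
    rw [div_mul_eq_mul_div, le_div_iff₀ (by positivity)]
    nlinarith
  · have := (Qc_ge hc hc1 hC).2
    calc ‖p.1‖ ^ 2 ≤ 3 / c * ‖p.2‖ := by rw [div_mul_eq_mul_div, le_div_iff₀ hc]; linarith
      _ ≤ _ := mul_le_mul_of_nonneg_right this hu

lemma Geo.E_le (h : Geo Ω ρ c C r z ν ι) (p : EE m × ℂ) (h1 : -ρ z ≤ 3 * ‖p.2‖) (h2 : c * ‖p.1‖ ^ 2 ≤ 3 * ‖p.2‖)
    (h3 : ‖sc ρ z ι p‖ ≤ 1) :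
    ‖ι p.1 + sc ρ z ι p • ν‖ ^ 2 ≤ 2 * Qc c C * ‖p.2‖ ∧ (‖ι p.1 + sc ρ z ι p • ν‖ < r →
      |ρ (Psi ρ z ν ι p) - (-ρ z - 2 * p.2.re + Lv ρ z (ι p.1))| ≤ Ec c C * ‖p.2‖ ^ (3 / 2 : ℝ)) := by
  obtain ⟨a1, a2⟩ := h.sc_Q p h1 h2
  have hx : Real.sqrt ‖p.2‖ ^ 2 = ‖p.2‖ := Real.sq_sqrt (norm_nonneg _)
  have hC := h.D.hC
  obtain ⟨b1, b2⟩ := num_E (Qc_ge h.D.hc h.c1 hC).1 (Real.sqrt_nonneg ‖p.2‖) (norm_nonneg p.1)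
    (norm_nonneg (sc ρ z ι p)) (norm_nonneg _) (h.F.norm_sq p.1 (sc ρ z ι p)) (by rw [hx]; exact a2) (by rw [hx]; exact a1) h3
  rw [hx] at b2
  refine ⟨b2, fun hr => (h.rho_E p hr).trans ?_⟩
  rw [sqrt_pow_three (norm_nonneg _)] at b1
  unfold Ec
  nlinarith [mul_le_mul_of_nonneg_left b1 (show 0 ≤ C by linarith)]

lemma Geo.lev (h : Geo Ω ρ c C r z ν ι) (t : EE m) : c * ‖t‖ ^ 2 ≤ Lv ρ z (ι t) ∧ Lv ρ z (ι t) ≤ C * ‖t‖ ^ 2 := by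
  have h1 := h.D.levi z h.hz h.hzc (ι t)
  have h2 := (le_abs_self _).trans (abs_Lv_le ρ z (ι t))
  rw [ι.norm_map] at h1 h2
  exact ⟨h1, h2.trans (mul_le_mul_of_nonneg_right h.D2_le (by positivity))⟩

set_option maxHeartbeats 1000000 in
/-- estimates inside the domain -/
lemma Geo.inside (h : Geo Ω ρ c C r z ν ι) {r₂ : ℝ} (hr2 : r₂ < r) (hr2' : 100 * C ^ 2 * r₂ ≤ c ^ 2)
    (p : EE m × ℂ) (hp : Psi ρ z ν ι p ∈ Ω) (hζ : ‖ι p.1 + sc ρ z ι p • ν‖ ≤ r₂) :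
    -ρ z ≤ 3 * ‖p.2‖ ∧ c * ‖p.1‖ ^ 2 ≤ 3 * ‖p.2‖ ∧ ‖sc ρ z ι p‖ ≤ 1 ∧ ‖p.2‖ ≤ 3 * C := by
  have hc := h.D.hc
  have hC := h.D.hC
  have hc1 := h.c1
  have hE := h.rho_E p (hζ.trans_lt hr2)
  have hneg := h.D.neg hp
  have hL := (h.lev p.1).1
  have hs := h.sc_le p
  have hu := h.u_le p
  have hδ : -ρ z ≤ C := by linarith [h.D.bnd z h.hz]
  have hδ0 := h.delta_pos
  have hZ2 := h.F.norm_sq p.1 (sc ρ z ι p)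
  have hre : p.2.re ≤ ‖p.2‖ := Complex.re_le_norm _
  set Z := ‖ι p.1 + sc ρ z ι p • ν‖ with hZ
  set τ := ‖p.1‖ with hτ
  set σ := ‖sc ρ z ι p‖ with hσ
  set U := ‖p.2‖ with hU
  have hZ0 : 0 ≤ Z := norm_nonneg _
  have hτ0 : 0 ≤ τ := norm_nonneg _
  have hσ0 : 0 ≤ σ := norm_nonneg _
  have hU0 : 0 ≤ U := norm_nonneg _
  have hτZ : τ ≤ Z := by nlinarith
  have hσZ : σ ≤ Z := by nlinarith
  have hr0 : 0 ≤ r₂ := hZ0.trans hζ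
  have hC2 : 1 ≤ C ^ 2 := one_le_pow₀ hC
  have hr1 : r₂ ≤ 1 := by nlinarith [mul_le_mul hC2 le_rfl hr0 (by positivity)]
  have e1 : τ * σ ≤ r₂ * σ := mul_le_mul_of_nonneg_right (hτZ.trans hζ) hσ0
  have e2 : σ ^ 2 ≤ r₂ * σ := by nlinarith [mul_le_mul_of_nonneg_right (hσZ.trans hζ) hσ0]
  have e3 : Z ^ 3 ≤ r₂ * τ ^ 2 + r₂ * σ := by
    have : Z ^ 3 ≤ r₂ * Z ^ 2 := by nlinarith [mul_le_mul_of_nonneg_right hζ (sq_nonneg Z)]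
    rw [hZ2] at this
    have : r₂ * σ ^ 2 ≤ r₂ * σ := mul_le_mul_of_nonneg_left (by nlinarith) hr0
    nlinarith
  have f1 : -ρ z + c * τ ^ 2 ≤ 2 * U + C * (3 * (r₂ * σ) + r₂ * τ ^ 2) := by
    have g1 := (abs_le.1 hE).1
    have g2 : C * (τ * σ + σ ^ 2 + Z ^ 3) ≤ C * (3 * (r₂ * σ) + r₂ * τ ^ 2) :=
      mul_le_mul_of_nonneg_left (by linarith) (by linarith)
    linarith
  -- multiply by c
  have hCr : 100 * (C * r₂) ≤ c ^ 2 := by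
    refine le_trans ?_ hr2'
    have : C * r₂ ≤ C ^ 2 * r₂ := mul_le_mul_of_nonneg_right (by nlinarith) hr0
    linarith
  have f2 : 100 * (c * (C * r₂ * σ)) ≤ c ^ 2 * (2 * (-ρ z) + 2 * U) + c ^ 2 * τ ^ 2 := by
    have g1 : 100 * (C * r₂) * (c * σ) ≤ 100 * (C * r₂) * (2 * (-ρ z) + 2 * U + C * τ ^ 2) :=
      mul_le_mul_of_nonneg_left hs (by positivity)
    have g2 : 100 * (C * r₂) * (2 * (-ρ z) + 2 * U) ≤ c ^ 2 * (2 * (-ρ z) + 2 * U) :=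
      mul_le_mul_of_nonneg_right hCr (by linarith)
    have g3 : (100 * C ^ 2 * r₂) * τ ^ 2 ≤ c ^ 2 * τ ^ 2 := mul_le_mul_of_nonneg_right hr2' (by positivity)
    have g4 : 100 * (c * (C * r₂ * σ)) = 100 * (C * r₂) * (c * σ) := by ring
    have g5 : 100 * (C * r₂) * (2 * (-ρ z) + 2 * U + C * τ ^ 2) =
      100 * (C * r₂) * (2 * (-ρ z) + 2 * U) + (100 * C ^ 2 * r₂) * τ ^ 2 := by ring
    linarith
  have f2' : 100 * (C * r₂ * σ) ≤ c * (2 * (-ρ z) + 2 * U) + c * τ ^ 2 := by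
    apply le_of_mul_le_mul_left _ hc
    have g : c * (c * (2 * (-ρ z) + 2 * U) + c * τ ^ 2) = c ^ 2 * (2 * (-ρ z) + 2 * U) + c ^ 2 * τ ^ 2 := by ring
    rw [g]; linarith
  have f3 : c * (2 * (-ρ z) + 2 * U) ≤ 2 * (-ρ z) + 2 * U :=
    mul_le_of_le_one_left (by linarith) hc1
  have f4 : 100 * (C * r₂) * τ ^ 2 ≤ c * τ ^ 2 :=
    mul_le_mul_of_nonneg_right (hCr.trans (by rw [sq]; exact mul_le_of_le_one_left hc.le hc1)) (by positivity)
  have f6 : C * (3 * (r₂ * σ) + r₂ * τ ^ 2) = 3 * (C * r₂ * σ) + (C * r₂) * τ ^ 2 := by ring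
  rw [f6] at f1
  have f7 : 100 * (C * r₂) * τ ^ 2 = 100 * ((C * r₂) * τ ^ 2) := by ring
  have f5 : 0 ≤ c * τ ^ 2 := by positivity
  refine ⟨?_, ?_, (hσZ.trans hζ).trans hr1, ?_⟩
  · linarith
  · linarith
  · have : C * σ ≤ C * 1 := mul_le_mul_of_nonneg_left ((hσZ.trans hζ).trans hr1) (by linarith)
    have t1 : τ ^ 2 ≤ 1 := by have := hτZ.trans (hζ.trans hr1); nlinarith
    have : C * τ ^ 2 ≤ C * 1 := mul_le_mul_of_nonneg_left t1 (by linarith)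
    linarith

/-- estimates in the model region -/
lemma Geo.model (h : Geo Ω ρ c C r z ν ι) {r₁ K : ℝ} (hr1 : 0 < r₁) (hr : r₁ ≤ r)
    (hK0 : 2 ≤ K) (hK1 : 2 * Qc c C ≤ K) (hK2 : 5 * Qc c C ≤ K * r₁ ^ 2) (p : EE m × ℂ)
    (hY : 0 < YY K (-ρ z) p.2) (h2 : c * ‖p.1‖ ^ 2 ≤ 3 * ‖p.2‖) :
    ‖ι p.1 + sc ρ z ι p • ν‖ < r₁ ∧ -ρ z ≤ 3 * ‖p.2‖ ∧ ‖sc ρ z ι p‖ ≤ 1 := by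
  obtain ⟨y1, y2, y3, y4⟩ := YY_pos_bounds (show 0 < K by linarith) h.delta_pos hY
  have h1 : -ρ z ≤ 3 * ‖p.2‖ := by linarith
  have hQ := (Qc_ge h.D.hc h.c1 h.D.hC).1
  have hs := (h.sc_Q p h1 h2).1
  have hK : 0 < K := by linarith
  have y5 : ‖p.2‖ * K ≤ 2 := by rwa [le_div_iff₀ hK] at y2
  have hQu : Qc c C * ‖p.2‖ ≤ 1 := by nlinarith [mul_le_mul_of_nonneg_right hK1 y4.le]
  have hs1 := hs.trans hQu
  refine ⟨?_, h1, hs1⟩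
  have := (h.E_le p h1 h2 hs1).1
  have h5 : ‖ι p.1 + sc ρ z ι p • ν‖ ^ 2 < r₁ ^ 2 := by
    have a : 2 * Qc c C * ‖p.2‖ * K ≤ 4 * Qc c C := by nlinarith
    have b : (2 * Qc c C * ‖p.2‖) * K < r₁ ^ 2 * K := by nlinarith
    exact this.trans_lt (lt_of_mul_lt_mul_right b hK.le)
  exact lt_of_pow_lt_pow_left₀ 2 hr1.le h5

/-- the model region is inside the domain -/
lemma Geo.model_mem (h : Geo Ω ρ c C r z ν ι) {r₁ K : ℝ} (hr1 : 0 < r₁) (hr : r₁ ≤ r)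
    (hK0 : 2 ≤ K) (hK1 : 2 * Qc c C ≤ K) (hK2 : 5 * Qc c C ≤ K * r₁ ^ 2) (p : EE m × ℂ)
    (hp : p ∈ R1 (fun t => Lv ρ z (ι t)) K (-ρ z) (Ec c C)) :
    Psi ρ z ν ι p ∈ Ω ∧ ‖ι p.1 + sc ρ z ι p • ν‖ < r₁ := by
  have hp' : Lv ρ z (ι p.1) + Ec c C * ‖p.2‖ ^ (3 / 2 : ℝ) < YY K (-ρ z) p.2 := hp
  have hE0 : 0 ≤ Ec c C * ‖p.2‖ ^ (3 / 2 : ℝ) :=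
    mul_nonneg (by linarith [Ec_ge h.D.hc h.c1 h.D.hC]) (by positivity)
  have hL := (h.lev p.1).1
  have hc := h.D.hc
  have hL0 : 0 ≤ c * ‖p.1‖ ^ 2 := by positivity
  have hY : 0 < YY K (-ρ z) p.2 := by linarith
  obtain ⟨y1, y2, y3, y4⟩ := YY_pos_bounds (show 0 < K by linarith) h.delta_pos hY
  have h2 : c * ‖p.1‖ ^ 2 ≤ 3 * ‖p.2‖ := by linarith
  obtain ⟨a1, a2, a3⟩ := h.model hr1 hr hK0 hK1 hK2 p hY h2
  refine ⟨?_, a1⟩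
  have hlt := a1.trans_le hr
  have hE := (h.E_le p a2 h2 a3).2 hlt
  have hb : Psi ρ z ν ι p ∈ ball z r := by
    rw [mem_ball_iff_norm]; unfold Psi; rw [add_sub_cancel_left]; exact hlt
  rw [h.D.mem z h.hz _ hb]
  have := (abs_le.1 hE).2
  unfold YY at hp'
  nlinarith [sq_nonneg ‖p.2‖]

lemma Geo.model_mem0 (h : Geo Ω ρ c C r z ν ι) {r₁ K : ℝ} (hr1 : 0 < r₁) (hr : r₁ ≤ r)
    (hK0 : 2 ≤ K) (hK1 : 2 * Qc c C ≤ K) (hK2 : 5 * Qc c C ≤ K * r₁ ^ 2) (hK3 : 2 * C * Qc c C ^ 2 ≤ K)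
    (u : ℂ) (hY : 0 < YY K (-ρ z) u) : Psi ρ z ν ι (0, u) ∈ Ω := by
  have h2 : c * ‖(0 : EE m)‖ ^ 2 ≤ 3 * ‖u‖ := by simp
  obtain ⟨a1, a2, a3⟩ := h.model hr1 hr hK0 hK1 hK2 (0, u) hY h2
  have hlt := a1.trans_le hr
  have hE := h.rho_E (0, u) hlt
  have hs := (h.sc_Q (0, u) a2 h2).1
  have hb : Psi ρ z ν ι (0, u) ∈ ball z r := by
    rw [mem_ball_iff_norm]; unfold Psi; rw [add_sub_cancel_left]; exact hlt
  rw [h.D.mem z h.hz _ hb]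
  have hL : Lv ρ z (ι (0 : EE m)) = 0 := by
    have := h.lev (0 : EE m)
    simp only [norm_zero] at this
    nlinarith [this.1, this.2]
  simp only [map_zero, norm_zero, zero_mul, zero_add] at hE hs hL
  rw [hL, norm_smul, h.F.hν, mul_one] at hE
  set σ := ‖sc ρ z ι (0, u)‖ with hσ
  have hσ0 : 0 ≤ σ := norm_nonneg _
  have hC := h.D.hC
  have e1 : σ ^ 3 ≤ σ ^ 2 := by nlinarith [sq_nonneg σ]
  have e2 : σ ^ 2 ≤ (Qc c C * ‖u‖) ^ 2 := pow_le_pow_left₀ hσ0 hs 2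
  have e3 : C * (σ ^ 2 + σ ^ 3) ≤ C * (2 * (Qc c C * ‖u‖) ^ 2) := mul_le_mul_of_nonneg_left (by linarith) (by linarith)
  have e4 : 2 * C * Qc c C ^ 2 * ‖u‖ ^ 2 ≤ K * ‖u‖ ^ 2 := mul_le_mul_of_nonneg_right hK3 (by positivity)
  have := (abs_le.1 hE).2
  unfold YY at hY
  nlinarith

end GDJ

namespace GDJ
open Set Filter Topology MeasureTheory
open scoped ContDiff

/-- cutoff functions -/
structure Cut {n : ℕ} (b : EE n → ℝ) (r₁ r₂ N : ℝ) : Prop where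
  h1 : 0 < r₁
  h12 : r₁ < r₂
  smooth : ContDiff ℝ ∞ b
  nonneg : ∀ x, 0 ≤ b x
  le_one : ∀ x, b x ≤ 1
  one : ∀ x, ‖x‖ < r₁ → b x = 1
  zero : ∀ x, r₂ ≤ ‖x‖ → b x = 0
  hN : 0 ≤ N
  der : ∀ x, ‖fderiv ℝ b x‖ ≤ N

lemma exists_cut (n : ℕ) {r₁ r₂ : ℝ} (h1 : 0 < r₁) (h12 : r₁ < r₂) : ∃ (b : EE n → ℝ) (N : ℝ), Cut b r₁ r₂ N := by
  let f : ContDiffBump (0 : EE n) := ⟨r₁, r₂, h1, h12⟩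
  have hs : ContDiff ℝ ∞ f := f.contDiff
  have hc : HasCompactSupport (fderiv ℝ f) := f.hasCompactSupport.fderiv ℝ
  obtain ⟨N, hN⟩ := hc.exists_bound_of_continuous (hs.continuous_fderiv (by simp))
  refine ⟨f, N, h1, h12, hs, fun x => f.nonneg, fun x => f.le_one, fun x hx => ?_, fun x hx => ?_, ?_, hN⟩
  · exact f.one_of_mem_closedBall (by simpa using hx.le)
  · exact f.zero_of_le_dist (by simpa using hx)
  · exact (norm_nonneg _).trans (hN 0)

variable {m : ℕ} {Ω : Set (EE (m + 1))} {ρ : EE (m + 1) → ℝ} {c C r : ℝ} {z ν : EE (m + 1)}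
    {ι : EE m →ₗᵢ[ℂ] EE (m + 1)}

lemma Geo.exists_p (h : Geo Ω ρ c C r z ν ι) (w : EE (m + 1)) : ∃ p, Psi ρ z ν ι p = w ∧ p.2 = uu ρ z ν w ∧
    w - z = ι p.1 + sc ρ z ι p • ν := by
  obtain ⟨t, ht⟩ := h.F.surj (w - z)
  have hl : ((‖ell ρ z‖ : ℝ) : ℂ) ≠ 0 := by exact_mod_cast h.ell_bounds.2.2.ne'
  have e1 : sc ρ z ι (t, uu ρ z ν w) = inner ℂ ν (w - z) := by
    have e2 : w - z - (inner ℂ ν (w - z) : ℂ) • ν = ι t := by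
      nth_rewrite 1 [ht]; simp
    unfold sc uu
    rw [e2, h.hell]
    field_simp
    ring
  refine ⟨(t, uu ρ z ν w), ?_, rfl, ?_⟩
  · unfold Psi; rw [e1, ← ht]; simp
  · rw [e1]; exact ht

lemma norm_Psi_sub (p : EE m × ℂ) : Psi ρ z ν ι p - z = ι p.1 + sc ρ z ι p • ν := by
  unfold Psi; rw [add_sub_cancel_left]

lemma differentiable_uu {n : ℕ} (ρ : EE n → ℝ) (z ν : EE n) : Differentiable ℂ (uu ρ z ν) := by
  have h1 : Differentiable ℂ fun w : EE n => (inner ℂ ν (w - z) : ℂ) := by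
    have : (fun w : EE n => (inner ℂ ν (w - z) : ℂ)) = fun w => innerSL ℂ ν (w - z) := by
      funext w; rw [innerSL_apply_apply]
    rw [this]; fun_prop
  have h2 : Differentiable ℂ fun w : EE n => qf ρ z ((w - z) - (inner ℂ ν (w - z) : ℂ) • ν) :=
    (differentiable_qf ρ z).comp (by fun_prop)
  unfold uu
  fun_prop

lemma Geo.w_est (h : Geo Ω ρ c C r z ν ι) {r₂ : ℝ} (hr2 : r₂ < r) (hr2' : 100 * C ^ 2 * r₂ ≤ c ^ 2)
    {w : EE (m + 1)} (hw : w ∈ Ω) (hζ : ‖w - z‖ ≤ r₂) :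
    -ρ z ≤ 3 * ‖uu ρ z ν w‖ ∧ ‖w - z‖ ^ 2 ≤ 2 * Qc c C * ‖uu ρ z ν w‖ := by
  obtain ⟨p, hp, hu, hs⟩ := h.exists_p w
  rw [hs] at hζ
  rw [← hp] at hw
  obtain ⟨a1, a2, a3, a4⟩ := h.inside hr2 hr2' p hw hζ
  have := (h.E_le p a1 a2 a3).1
  rw [← hu, hs]
  exact ⟨a1, this⟩

/-- the test function -/
def hh (b : EE (m + 1) → ℝ) (ρ : EE (m + 1) → ℝ) (z ν : EE (m + 1)) (w : EE (m + 1)) : ℂ :=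
  (b (w - z) : ℂ) * kk m (uu ρ z ν w)

lemma kk_uu_contDiffAt {w : EE (m + 1)} (hw : uu ρ z ν w ≠ 0) :
    ContDiffAt ℝ ∞ (fun w => kk m (uu ρ z ν w)) w := by
  have h1 : ContDiffAt ℝ ∞ (uu ρ z ν) w := by
    have := contDiffOn_holo isOpen_univ (differentiable_uu ρ z ν).differentiableOn
    exact (this.restrict_scalars ℝ).contDiffAt univ_mem
  have h2 : ContDiffAt ℝ ∞ (fun w => (starRingEnd ℂ) (uu ρ z ν w)) w :=
    (Complex.conjCLE.contDiff (n := ∞)).contDiffAt.comp w h1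
  unfold kk
  exact (h2.pow (m + 3)).inv (by simpa using hw)

lemma kk_uu_dz {w : EE (m + 1)} (hw : uu ρ z ν w ≠ 0) (v : EE (m + 1)) :
    dz (fun w => kk m (uu ρ z ν w)) w v = 0 := by
  have h1 : DifferentiableAt ℂ (fun w => ((uu ρ z ν w) ^ (m + 3))⁻¹) w := by
    have := (differentiable_uu ρ z ν) w
    exact (this.pow (m + 3)).inv (by simpa using hw)
  have := dz_conj h1 v
  have e : (fun w => kk m (uu ρ z ν w)) = fun w => (starRingEnd ℂ) (((uu ρ z ν w) ^ (m + 3))⁻¹) := by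
    funext w; simp [kk]
  rw [e]; exact this

variable {b : EE (m + 1) → ℝ} {r₁ r₂ N : ℝ}

lemma hh_zero_near (hb : Cut b r₁ r₂ N) {w : EE (m + 1)} (hw : r₂ < ‖w - z‖) :
    hh b ρ z ν =ᶠ[𝓝 w] fun _ => 0 := by
  have : ∀ᶠ y in 𝓝 w, r₂ < ‖y - z‖ := (by fun_prop : Continuous fun y : EE (m + 1) => ‖y - z‖).continuousAt.eventually
    (lt_mem_nhds hw)
  filter_upwards [this] with y hy
  simp [hh, hb.zero _ hy.le]

lemma uu_ne (h : Geo Ω ρ c C r z ν ι) (hr2 : r₂ < r) (hr2' : 100 * C ^ 2 * r₂ ≤ c ^ 2)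
    {w : EE (m + 1)} (hw : w ∈ Ω) (hζ : ‖w - z‖ ≤ r₂) : uu ρ z ν w ≠ 0 := by
  intro h0
  have := (h.w_est hr2 hr2' hw hζ).1
  rw [h0, norm_zero, mul_zero] at this
  linarith [h.delta_pos]

lemma hh_contDiffOn (h : Geo Ω ρ c C r z ν ι) (hr2 : r₂ < r) (hr2' : 100 * C ^ 2 * r₂ ≤ c ^ 2)
    (hb : Cut b r₁ r₂ N) : ContDiffOn ℝ 1 (hh b ρ z ν) Ω := by
  intro w hw
  apply ContDiffAt.contDiffWithinAt
  rcases le_or_gt ‖w - z‖ r₂ with h1 | h1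
  · have h2 : ContDiffAt ℝ ∞ (fun w => ((b (w - z) : ℝ) : ℂ)) w :=
      (Complex.ofRealCLM.contDiff (n := ∞)).contDiffAt.comp w
        ((hb.smooth.comp (contDiff_id.sub contDiff_const)).contDiffAt)
    exact (h2.mul (kk_uu_contDiffAt (uu_ne h hr2 hr2' hw h1))).of_le (by exact_mod_cast le_top)
  · exact contDiffAt_const.congr_of_eventuallyEq (hh_zero_near hb h1)

lemma hh_norm (hb : Cut b r₁ r₂ N) (w : EE (m + 1)) :
    ‖hh b ρ z ν w‖ ≤ (‖uu ρ z ν w‖ ^ (m + 3))⁻¹ := by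
  rw [hh, norm_mul, norm_kk, Complex.norm_real, Real.norm_of_nonneg (hb.nonneg _)]
  exact mul_le_of_le_one_left (by positivity) (hb.le_one _)

lemma hh_integrable (h : Geo Ω ρ c C r z ν ι) (hr2 : r₂ < r) (hr2' : 100 * C ^ 2 * r₂ ≤ c ^ 2)
    (hb : Cut b r₁ r₂ N) : IntegrableOn (hh b ρ z ν) Ω := by
  have hfin : volume Ω < ⊤ := h.D.bd.measure_lt_top
  have hm := h.D.op.measurableSet
  haveI : IsFiniteMeasure (volume.restrict Ω) := ⟨by simpa using hfin⟩
  have hδ := h.delta_pos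
  refine Integrable.of_bound ((hh_contDiffOn h hr2 hr2' hb).continuousOn.aestronglyMeasurable hm) (((-ρ z / 3) ^ (m + 3))⁻¹) ?_
  refine (ae_restrict_iff' hm).2 (ae_of_all _ fun w hw => ?_)
  rcases le_or_gt ‖w - z‖ r₂ with h1 | h1
  · refine (hh_norm hb w).trans ?_
    have := (h.w_est hr2 hr2' hw h1).1
    apply inv_anti₀ (by positivity)
    exact pow_le_pow_left₀ (by positivity) (by linarith) _
  · rw [(hh_zero_near hb h1).eq_of_nhds, norm_zero]
    positivity

/-- bound for the derivative of the test function -/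
lemma hh_dz (h : Geo Ω ρ c C r z ν ι) (hr2 : r₂ < r) (hr2' : 100 * C ^ 2 * r₂ ≤ c ^ 2)
    (hb : Cut b r₁ r₂ N) {w : EE (m + 1)} (hw : w ∈ Ω) (j : Fin (m + 1)) :
    ‖dz (hh b ρ z ν) w (ev j)‖ ≤ N * ((r₁ ^ 2 / (2 * Qc c C)) ^ (m + 3))⁻¹ ∧
      (r₂ < ‖w - z‖ → dz (hh b ρ z ν) w (ev j) = 0) := by
  have hQ := (Qc_ge h.D.hc h.c1 h.D.hC).1
  have h1 := hb.h1
  have hN := hb.hN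
  have hp : 0 ≤ N * ((r₁ ^ 2 / (2 * Qc c C)) ^ (m + 3))⁻¹ := by positivity
  have hz0 : r₂ < ‖w - z‖ → dz (hh b ρ z ν) w (ev j) = 0 := by
    intro h3
    rw [dz_congr (hh_zero_near hb h3)]
    simp [dz]
  refine ⟨?_, hz0⟩
  rcases le_or_gt ‖w - z‖ r₂ with h3 | h3
  · have hu := uu_ne h hr2 hr2' hw h3
    have hbd : DifferentiableAt ℝ b (w - z) := (hb.smooth.differentiable (by simp)) _
    have h4 : HasFDerivAt (fun w => ((b (w - z) : ℝ) : ℂ)) (Complex.ofRealCLM.comp (fderiv ℝ b (w - z))) w := by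
      have := hbd.hasFDerivAt.comp w ((hasFDerivAt_id (𝕜 := ℝ) w).sub_const z)
      exact Complex.ofRealCLM.hasFDerivAt.comp w this
    have e : dz (hh b ρ z ν) w (ev j) = dz (fun w => ((b (w - z) : ℝ) : ℂ)) w (ev j) * kk m (uu ρ z ν w) := by
      have := dz_mul (z := w) h4.differentiableAt
        ((kk_uu_contDiffAt (m := m) hu).differentiableAt (by simp)) (ev j)
      rw [kk_uu_dz hu, mul_zero, zero_add] at this
      exact this
    rw [e]
    rcases lt_or_ge ‖w - z‖ r₁ with h5 | h5
    · have : (fun w => ((b (w - z) : ℝ) : ℂ)) =ᶠ[𝓝 w] fun _ => 1 := by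
        have : ∀ᶠ y in 𝓝 w, ‖y - z‖ < r₁ :=
          (by fun_prop : Continuous fun y : EE (m + 1) => ‖y - z‖).continuousAt.eventually (gt_mem_nhds h5)
        filter_upwards [this] with y hy
        simp [hb.one _ hy]
      rw [dz_congr this]
      simp only [dz, fderiv_fun_const]
      simpa using hp
    · rw [norm_mul, norm_kk]
      refine mul_le_mul ?_ ?_ (by positivity) hN
      · refine (norm_dz_le _ _ _).trans ?_
        rw [norm_ev, mul_one, h4.fderiv]
        refine (ContinuousLinearMap.opNorm_comp_le _ _).trans ?_
        rw [Complex.ofRealCLM_norm, one_mul]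
        exact hb.der _
      · apply inv_anti₀ (by positivity)
        apply pow_le_pow_left₀ (by positivity)
        have := (h.w_est hr2 hr2' hw h3).2
        rw [div_le_iff₀ (by positivity)]
        nlinarith [pow_le_pow_left₀ h1.le h5 2]
  · rw [hz0 h3, norm_zero]; exact hp

lemma hh_dz_integrable (h : Geo Ω ρ c C r z ν ι) (hr2 : r₂ < r) (hr2' : 100 * C ^ 2 * r₂ ≤ c ^ 2)
    (hb : Cut b r₁ r₂ N) (j : Fin (m + 1)) : IntegrableOn (fun w => dz (hh b ρ z ν) w (ev j)) Ω := by
  have hfin : volume Ω < ⊤ := h.D.bd.measure_lt_top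
  have hm := h.D.op.measurableSet
  haveI : IsFiniteMeasure (volume.restrict Ω) := ⟨by simpa using hfin⟩
  refine Integrable.of_bound ((continuousOn_dz h.D.op (hh_contDiffOn h hr2 hr2' hb) (ev j)).aestronglyMeasurable hm)
    (N * ((r₁ ^ 2 / (2 * Qc c C)) ^ (m + 3))⁻¹) ?_
  exact (ae_restrict_iff' hm).2 (ae_of_all _ fun w hw => (hh_dz h hr2 hr2' hb hw j).1)

end GDJ

namespace GDJ
open Set Filter Topology MeasureTheory
open scoped ContDiff

variable {m : ℕ} {Ω : Set (EE (m + 1))} {ρ : EE (m + 1) → ℝ} {c C r : ℝ} {z ν : EE (m + 1)}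
    {ι : EE m →ₗᵢ[ℂ] EE (m + 1)} {b : EE (m + 1) → ℝ} {r₁ r₂ N : ℝ}

lemma continuous_sc : Continuous (sc ρ z ι) := by
  have h1 : Continuous fun t : EE m => qf ρ z (ι t) := (differentiable_qf ρ z).continuous.comp ι.continuous
  have h2 : Continuous fun p : EE m × ℂ => qf ρ z (ι p.1) := h1.comp continuous_fst
  unfold sc
  fun_prop

lemma continuous_Psi : Continuous (Psi ρ z ν ι) := by
  have := continuous_sc (ρ := ρ) (z := z) (ι := ι)
  have h1 : Continuous fun p : EE m × ℂ => ι p.1 := ι.continuous.comp continuous_fst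
  unfold Psi
  fun_prop

/-- the good part of the domain in the coordinates -/
def TR (Ω : Set (EE (m + 1))) (ρ : EE (m + 1) → ℝ) (z ν : EE (m + 1)) (ι : EE m →ₗᵢ[ℂ] EE (m + 1)) (r₂ : ℝ) :
    Set (EE m × ℂ) := {p | Psi ρ z ν ι p ∈ Ω ∧ ‖Psi ρ z ν ι p - z‖ ≤ r₂}

lemma TR_meas (h : Geo Ω ρ c C r z ν ι) : MeasurableSet (TR Ω ρ z ν ι r₂) := by
  have hc := continuous_Psi (ρ := ρ) (z := z) (ν := ν) (ι := ι)
  refine (h.D.op.preimage hc).measurableSet.inter (IsClosed.measurableSet ?_)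
  have h1 : Continuous fun p => ‖Psi ρ z ν ι p - z‖ := by fun_prop
  exact isClosed_le h1 continuous_const

lemma Geo.TR_est (h : Geo Ω ρ c C r z ν ι) (hr2 : r₂ < r) (hr2' : 100 * C ^ 2 * r₂ ≤ c ^ 2)
    {p : EE m × ℂ} (hp : p ∈ TR Ω ρ z ν ι r₂) :
    -ρ z / 3 ≤ ‖p.2‖ ∧ ‖p.1‖ ^ 2 ≤ Qc c C * ‖p.2‖ ∧ ‖p.2‖ ≤ 3 * C ∧ ‖p.1‖ ≤ 1 ∧
      |ρ (Psi ρ z ν ι p) - (-ρ z - 2 * p.2.re + Lv ρ z (ι p.1))| ≤ Ec c C * ‖p.2‖ ^ (3 / 2 : ℝ) := by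
  obtain ⟨hp1, hp2⟩ := hp
  rw [norm_Psi_sub] at hp2
  obtain ⟨a1, a2, a3, a4⟩ := h.inside hr2 hr2' p hp1 hp2
  refine ⟨by linarith, (h.sc_Q p a1 a2).2, a4, ?_, (h.E_le p a1 a2 a3).2 (hp2.trans_lt hr2)⟩
  have h1 := h.F.norm_sq p.1 (sc ρ z ι p)
  have hC2 : 1 ≤ C ^ 2 := one_le_pow₀ h.D.hC
  have hr0 : 0 ≤ r₂ := (norm_nonneg _).trans hp2
  have hc2 : c ^ 2 ≤ 1 := pow_le_one₀ h.D.hc.le h.c1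
  have hr1 : r₂ ≤ 1 := by nlinarith [mul_le_mul hC2 le_rfl hr0 (by positivity)]
  have h2 := hp2.trans hr1
  nlinarith [norm_nonneg (ι p.1 + sc ρ z ι p • ν), norm_nonneg p.1, sq_nonneg ‖sc ρ z ι p‖]

lemma Geo.rho_sqrt (h : Geo Ω ρ c C r z ν ι) (hr2 : r₂ < r) (hr2' : 100 * C ^ 2 * r₂ ≤ c ^ 2)
    {p : EE m × ℂ} (hp : p ∈ TR Ω ρ z ν ι r₂) :
    -ρ (Psi ρ z ν ι p) ≤ (6 * C + 9 * C ^ 2 * Ec c C) * Real.sqrt ‖p.2‖ := by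
  obtain ⟨a1, a2, a3, a4, a5⟩ := h.TR_est hr2 hr2' hp
  have hC := h.D.hC
  have hE := Ec_ge h.D.hc h.c1 hC
  have hL := (h.lev p.1).1
  have hc := h.D.hc
  have hL0 : 0 ≤ c * ‖p.1‖ ^ 2 := by positivity
  have hre : p.2.re ≤ ‖p.2‖ := Complex.re_le_norm _
  rw [← sqrt_pow_three (norm_nonneg _)] at a5
  have hx2 : Real.sqrt ‖p.2‖ ^ 2 = ‖p.2‖ := Real.sq_sqrt (norm_nonneg _)
  have hx := Real.sqrt_nonneg ‖p.2‖
  have hδ := h.delta_pos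
  set x := Real.sqrt ‖p.2‖
  rw [← hx2] at a3 hre
  have hx3 : x ≤ 3 * C := by
    rw [← pow_le_pow_iff_left₀ hx (by positivity) two_ne_zero]
    nlinarith
  have e1 : x ^ 2 ≤ 3 * C * x := by nlinarith
  have e2 : x ^ 3 ≤ 9 * C ^ 2 * x := by
    have : x ^ 2 ≤ (3 * C) ^ 2 := pow_le_pow_left₀ hx hx3 2
    nlinarith [mul_le_mul_of_nonneg_right this hx]
  have e3 := mul_le_mul_of_nonneg_left e2 (show 0 ≤ Ec c C by linarith)
  have := (abs_le.1 a5).1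
  nlinarith

lemma int_one (m : ℕ) {c C r r₁ r₂ : ℝ} (hc : 0 < c) (hc1 : c ≤ 1) (hC : 1 ≤ C) (hr2 : r₂ < r) (hr2' : 100 * C ^ 2 * r₂ ≤ c ^ 2) :
    ∃ W > 0, ∀ (N : ℝ) (Ω : Set (EE (m + 1))) (ρ b : EE (m + 1) → ℝ) (z ν : EE (m + 1)) (ι : EE m →ₗᵢ[ℂ] EE (m + 1)),
      Geo Ω ρ c C r z ν ι → Cut b r₁ r₂ N →
      ∫ p in Psi ρ z ν ι ⁻¹' Ω, (-ρ (Psi ρ z ν ι p)) * ‖hh b ρ z ν (Psi ρ z ν ι p)‖ ≤ W * (-ρ z) ^ (-(1/2) : ℝ) := by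
  obtain ⟨W, hW, hmain⟩ := main_int m
  have hQ := (Qc_ge hc hc1 hC).1
  have hE := Ec_ge hc hc1 hC
  set c₁ := 6 * C + 9 * C ^ 2 * Ec c C with hc₁
  have hc₁0 : 0 < c₁ := by positivity
  refine ⟨c₁ * (W * Qc c C ^ m * (1/3 : ℝ) ^ (-(1/2) : ℝ)), by positivity, fun N Ω ρ b z ν ι h hb => ?_⟩
  have hδ := h.delta_pos
  have hTm := TR_meas (r₂ := r₂) h
  have hSm : MeasurableSet (Psi ρ z ν ι ⁻¹' Ω) := (h.D.op.preimage continuous_Psi).measurableSet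
  have hT : TR Ω ρ z ν ι r₂ ⊆ Psi ρ z ν ι ⁻¹' Ω := fun p hp => hp.1
  rw [setIntegral_eq_of_subset_of_forall_diff_eq_zero hSm hT (by
    rintro p ⟨hp1, hp2⟩
    have : r₂ ≤ ‖Psi ρ z ν ι p - z‖ := by
      by_contra hlt
      exact hp2 ⟨hp1, (not_le.1 hlt).le⟩
    simp [hh, hb.zero _ this])]
  obtain ⟨i1, i2⟩ := hmain (Qc c C) (-ρ z / 3) (TR Ω ρ z ν ι r₂) (by linarith) (by positivity) hTm
    (fun p hp => ⟨(h.TR_est hr2 hr2' hp).1, (h.TR_est hr2 hr2' hp).2.1⟩)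
  have hle : ∫ p in TR Ω ρ z ν ι r₂, (-ρ (Psi ρ z ν ι p)) * ‖hh b ρ z ν (Psi ρ z ν ι p)‖ ≤
      ∫ p in TR Ω ρ z ν ι r₂, c₁ * ‖p.2‖ ^ (-((m:ℝ)+5/2)) := by
    refine (le_abs_self _).trans ?_
    rw [← Real.norm_eq_abs]
    refine norm_integral_le_of_norm_le (i1.const_mul c₁) ?_
    refine (ae_restrict_iff' hTm).2 (ae_of_all _ fun p hp => ?_)
    have hu : 0 < ‖p.2‖ := lt_of_lt_of_le (by positivity) (h.TR_est hr2 hr2' hp).1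
    have h1 := h.rho_sqrt hr2 hr2' hp
    have h2 : ‖hh b ρ z ν (Psi ρ z ν ι p)‖ ≤ ‖p.2‖ ^ (-((m:ℝ)+3)) := by
      have := hh_norm (ρ := ρ) (z := z) (ν := ν) hb (Psi ρ z ν ι p)
      rwa [h.uu_Psi, ← norm_kk, norm_kk'] at this
    have h3 : 0 < -ρ (Psi ρ z ν ι p) := by linarith [h.D.neg hp.1]
    rw [norm_mul, norm_norm, Real.norm_of_nonneg h3.le]
    calc _ ≤ (c₁ * Real.sqrt ‖p.2‖) * ‖p.2‖ ^ (-((m:ℝ)+3)) := mul_le_mul h1 h2 (norm_nonneg _) (by positivity)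
      _ = _ := by
        rw [Real.sqrt_eq_rpow, mul_assoc, ← Real.rpow_add hu]
        congr 2; ring
  refine hle.trans ?_
  rw [integral_const_mul, mul_assoc]
  refine mul_le_mul_of_nonneg_left (i2.trans (le_of_eq ?_)) hc₁0.le
  rw [div_eq_mul_one_div, Real.mul_rpow hδ.le (by norm_num)]
  ring

lemma int_two (m : ℕ) {c C r r₁ r₂ N : ℝ} (hc : 0 < c) (hc1 : c ≤ 1) (hC : 1 ≤ C) (hr2 : r₂ < r) (hr2' : 100 * C ^ 2 * r₂ ≤ c ^ 2) (hr1 : 0 < r₁) (hN : 0 ≤ N) :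
    ∃ W > 0, ∀ (Ω : Set (EE (m + 1))) (ρ b : EE (m + 1) → ℝ) (z ν : EE (m + 1)) (ι : EE m →ₗᵢ[ℂ] EE (m + 1)),
      Geo Ω ρ c C r z ν ι → Cut b r₁ r₂ N →
      ∫ p in Psi ρ z ν ι ⁻¹' Ω, ∑ j, ‖dz (hh b ρ z ν) (Psi ρ z ν ι p) (ev j)‖ ≤ W := by
  have hQ := (Qc_ge hc hc1 hC).1
  set N₁ := N * ((r₁ ^ 2 / (2 * Qc c C)) ^ (m + 3))⁻¹ with hN₁
  have hN₁0 : 0 ≤ N₁ := by positivity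
  set Bx : Set (EE m × ℂ) := closedBall 0 1 ×ˢ closedBall 0 (3 * C) with hBx
  have hBc : IsCompact Bx := (isCompact_closedBall _ _).prod (isCompact_closedBall _ _)
  refine ⟨((m + 1 : ℕ) : ℝ) * N₁ * volume.real Bx + 1, by positivity, fun Ω ρ b z ν ι h hb => ?_⟩
  have hTm := TR_meas (r₂ := r₂) h
  have hSm : MeasurableSet (Psi ρ z ν ι ⁻¹' Ω) := (h.D.op.preimage continuous_Psi).measurableSet
  have hT : TR Ω ρ z ν ι r₂ ⊆ Psi ρ z ν ι ⁻¹' Ω := fun p hp => hp.1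
  rw [setIntegral_eq_of_subset_of_forall_diff_eq_zero hSm hT (by
    rintro p ⟨hp1, hp2⟩
    have : r₂ < ‖Psi ρ z ν ι p - z‖ := by
      by_contra hlt
      exact hp2 ⟨hp1, not_lt.1 hlt⟩
    refine Finset.sum_eq_zero fun j _ => ?_
    rw [(hh_dz h hr2 hr2' hb hp1 j).2 this, norm_zero])]
  have hTB : TR Ω ρ z ν ι r₂ ⊆ Bx := fun p hp => by
    obtain ⟨a1, a2, a3, a4, a5⟩ := h.TR_est hr2 hr2' hp
    exact ⟨by simpa using a4, by simpa using a3⟩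
  have hfin : volume (TR Ω ρ z ν ι r₂) < ⊤ := (measure_mono hTB).trans_lt hBc.measure_lt_top
  have h1 : ‖∫ p in TR Ω ρ z ν ι r₂, ∑ j, ‖dz (hh b ρ z ν) (Psi ρ z ν ι p) (ev j)‖‖ ≤
      (((m + 1 : ℕ) : ℝ) * N₁) * volume.real (TR Ω ρ z ν ι r₂) := by
    refine norm_setIntegral_le_of_norm_le_const hfin fun p hp => ?_
    rw [Real.norm_of_nonneg (Finset.sum_nonneg fun j _ => norm_nonneg _)]
    refine (Finset.sum_le_sum fun j _ => (hh_dz h hr2 hr2' hb hp.1 j).1).trans ?_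
    rw [Finset.sum_const, Finset.card_univ, Fintype.card_fin, nsmul_eq_mul]
  have h2 : volume.real (TR Ω ρ z ν ι r₂) ≤ volume.real Bx :=
    ENNReal.toReal_mono hBc.measure_lt_top.ne (measure_mono hTB)
  have h3 : (((m + 1 : ℕ) : ℝ) * N₁) * volume.real (TR Ω ρ z ν ι r₂) ≤ (((m + 1 : ℕ) : ℝ) * N₁) * volume.real Bx :=
    mul_le_mul_of_nonneg_left h2 (by positivity)
  have h4 := (le_abs_self _).trans h1
  linarith

end GDJ

namespace GDJ
open Set Filter Topology MeasureTheory
open scoped ContDiff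

/-- the integral estimate of Bell type -/
def BellP {n : ℕ} (Ω : Set (EE n)) (ρ : EE n → ℝ) (f : EE n → ℂ) (A : ℝ) : Prop :=
  ∀ h : EE n → ℂ, ContDiffOn ℝ 1 h Ω →
    IntegrableOn h Ω → (∀ j, IntegrableOn (fun z => dz h z (ev j)) Ω) →
    ‖∫ z in Ω, f z * h z‖ ≤ A * ((∫ z in Ω, (-ρ z) * ‖h z‖) + ∫ z in Ω, ∑ j, ‖dz h z (ev j)‖)

variable {m : ℕ} {Ω : Set (EE (m + 1))} {ρ : EE (m + 1) → ℝ} {c C r : ℝ} {z ν : EE (m + 1)}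
    {ι : EE m →ₗᵢ[ℂ] EE (m + 1)} {b : EE (m + 1) → ℝ} {r₁ r₂ N : ℝ}

lemma Geo.lform (h : Geo Ω ρ c C r z ν ι) : LForm (fun t => Lv ρ z (ι t)) c C where
  hc := h.D.hc
  hC := h.D.hC
  cont := by
    have h1 : Continuous fun t : EE m => ι t := ι.continuous
    unfold Lv; fun_prop
  smul := fun a t => by simp only [map_smul]; exact Lv_smul ρ z (ι t) a
  lower := fun t => (h.lev t).1
  upper := fun t => (h.lev t).2

lemma qf_zero {n : ℕ} (ρ : EE n → ℝ) (z : EE n) : qf ρ z 0 = 0 := by simp [qf]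

lemma Geo.Psi_line (h : Geo Ω ρ c C r z ν ι) (u : ℂ) :
    Psi ρ z ν ι (0, u) = z + ((2 * (((-ρ z : ℝ) : ℂ) - u)) / ((‖ell ρ z‖ : ℝ) : ℂ)) • ν := by
  simp [Psi, sc, qf_zero]

lemma Geo.Psi_deriv (h : Geo Ω ρ c C r z ν ι) (u : ℂ) :
    HasDerivAt (fun u => Psi ρ z ν ι (0, u)) ((-2 / ((‖ell ρ z‖ : ℝ) : ℂ)) • ν) u := by
  have e : (fun u => Psi ρ z ν ι (0, u)) = fun u =>
      z + ((2 * (((-ρ z : ℝ) : ℂ) - u)) / ((‖ell ρ z‖ : ℝ) : ℂ)) • ν := funext h.Psi_line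
  rw [e]
  have h1 : HasDerivAt (fun u : ℂ => (2 * (((-ρ z : ℝ) : ℂ) - u)) / ((‖ell ρ z‖ : ℝ) : ℂ))
      (-2 / ((‖ell ρ z‖ : ℝ) : ℂ)) u := by
    have := (((hasDerivAt_id u).const_sub (((-ρ z : ℝ) : ℂ))).const_mul 2).div_const ((‖ell ρ z‖ : ℝ) : ℂ)
    rw [show (2 * -1 : ℂ) = -2 by ring] at this
    exact this
  exact (h1.smul_const ν).const_add z

lemma Psi_t_diff (u : ℂ) : Differentiable ℂ fun t => Psi ρ z ν ι (t, u) := by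
  have h0 : Differentiable ℂ fun t : EE m => ι t := ι.toContinuousLinearMap.differentiable
  have h1 : Differentiable ℂ fun t : EE m => qf ρ z (ι t) := (differentiable_qf ρ z).comp h0
  unfold Psi sc
  fun_prop

lemma Geo.int_est (h : Geo Ω ρ c C r z ν ι) (hr2 : r₂ < r) (hr2' : 100 * C ^ 2 * r₂ ≤ c ^ 2)
    (hb : Cut b r₁ r₂ N) {f : EE (m + 1) → ℂ} (hf : DifferentiableOn ℂ f Ω) {M A I₁ I₂ : ℝ}
    (hM : ∀ z ∈ Ω, ‖f z‖ ≤ M) (hA : 0 ≤ A) (bf : BellP Ω ρ f A) (b1 : BellP Ω ρ (fun _ => 1) A)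
    (h1 : ∫ p in Psi ρ z ν ι ⁻¹' Ω, (-ρ (Psi ρ z ν ι p)) * ‖hh b ρ z ν (Psi ρ z ν ι p)‖ ≤ I₁)
    (h2 : ∫ p in Psi ρ z ν ι ⁻¹' Ω, ∑ j, ‖dz (hh b ρ z ν) (Psi ρ z ν ι p) (ev j)‖ ≤ I₂) :
    IntegrableOn (fun p => (f (Psi ρ z ν ι p) - f z) * hh b ρ z ν (Psi ρ z ν ι p)) (Psi ρ z ν ι ⁻¹' Ω) ∧
    ‖∫ p in Psi ρ z ν ι ⁻¹' Ω, (f (Psi ρ z ν ι p) - f z) * hh b ρ z ν (Psi ρ z ν ι p)‖ ≤ A * (1 + M) * (I₁ + I₂) := by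
  have hq : Continuous fun t : EE m => qf ρ z (ι t) := (differentiable_qf ρ z).continuous.comp ι.continuous
  obtain ⟨k, hk, hch⟩ := PsiG_change (z := z) (δ := -ρ z) h.F h.ell_bounds.2.2 hq
  rw [← Psi_eq_PsiG] at hch
  obtain ⟨hC, hR⟩ := hch Ω
  have hop := h.D.op
  have hhi := hh_integrable h hr2 hr2' hb
  have hhd := fun j => hh_dz_integrable h hr2 hr2' hb j
  have hhc := hh_contDiffOn h hr2 hr2' hb
  have hM0 : 0 ≤ M := (norm_nonneg _).trans (hM z h.hz)
  have e1 := bf _ hhc hhi hhd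
  have e2 := b1 _ hhc hhi hhd
  simp only [one_mul] at e2
  have i1 : IntegrableOn (fun w => f w * hh b ρ z ν w) Ω := bdd_mul_integrable hop hf.continuousOn hM hhi
  have i2 : IntegrableOn (fun w => f z * hh b ρ z ν w) Ω := hhi.const_mul _
  have i3 : IntegrableOn (fun w => (f w - f z) * hh b ρ z ν w) Ω := by
    simp only [sub_mul]; exact i1.sub i2
  refine ⟨(hC _).1 i3, ?_⟩
  rw [(hC fun w => (f w - f z) * hh b ρ z ν w).2]
  rw [(hR fun w => (-ρ w) * ‖hh b ρ z ν w‖).2] at h1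
  rw [(hR fun w => ∑ j, ‖dz (hh b ρ z ν) w (ev j)‖).2] at h2
  have e3 : ∫ w in Ω, (f w - f z) * hh b ρ z ν w = (∫ w in Ω, f w * hh b ρ z ν w) - f z * ∫ w in Ω, hh b ρ z ν w := by
    simp only [sub_mul]
    rw [integral_sub i1 i2, integral_const_mul]
  set J := (∫ z_1 in Ω, (-ρ z_1) * ‖hh b ρ z ν z_1‖) + ∫ z_1 in Ω, ∑ j, ‖dz (hh b ρ z ν) z_1 (ev j)‖ with hJ
  have e4 : ‖∫ w in Ω, (f w - f z) * hh b ρ z ν w‖ ≤ A * (1 + M) * J := by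
    rw [e3]
    refine (norm_sub_le _ _).trans ?_
    rw [norm_mul]
    have : ‖f z‖ * ‖∫ w in Ω, hh b ρ z ν w‖ ≤ M * (A * J) := mul_le_mul (hM z h.hz) e2 (norm_nonneg _) hM0
    nlinarith
  rw [norm_mul, Complex.norm_real, Real.norm_of_nonneg hk.le]
  have e5 : k * ‖∫ w in Ω, (f w - f z) * hh b ρ z ν w‖ ≤ A * (1 + M) * (k * J) := by
    have := mul_le_mul_of_nonneg_left e4 hk.le
    linarith
  have e6 : k * J ≤ I₁ + I₂ := by rw [hJ, mul_add]; linarith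
  exact e5.trans (mul_le_mul_of_nonneg_left e6 (by positivity))

set_option maxHeartbeats 1000000 in
/-- bound for the normal derivative -/
lemma normal_est (D : Dom Ω ρ c C r) (hc1 : c ≤ 1) {f : EE (m + 1) → ℂ} (hf : DifferentiableOn ℂ f Ω) {M A : ℝ}
    (hM0 : 0 ≤ M) (hM : ∀ z ∈ Ω, ‖f z‖ ≤ M) (hA : 0 ≤ A) (bf : BellP Ω ρ f A) (b1 : BellP Ω ρ (fun _ => 1) A) :
    ∃ s > 0, s ≤ c ∧ ∃ W > 0, ∀ z ∈ Ω, -s < ρ z → ∀ ν : EE (m + 1), ‖ν‖ = 1 →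
      (∀ v, ell ρ z v = ‖ell ρ z‖ * inner ℂ ν v) → ‖fderiv ℂ f z ν‖ ≤ W * (-ρ z) ^ (-(1/2) : ℝ) := by
  have hc := D.hc
  have hC := D.hC
  have hr := D.hr
  obtain ⟨r₂, hr20, hr2, hr2'⟩ : ∃ r₂ > 0, r₂ < r ∧ 100 * C ^ 2 * r₂ ≤ c ^ 2 := by
    refine ⟨min (r / 2) (c ^ 2 / (100 * C ^ 2)), by positivity, (min_le_left _ _).trans_lt (by linarith), ?_⟩
    calc 100 * C ^ 2 * min (r / 2) (c ^ 2 / (100 * C ^ 2)) ≤ 100 * C ^ 2 * (c ^ 2 / (100 * C ^ 2)) :=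
          mul_le_mul_of_nonneg_left (min_le_right _ _) (by positivity)
      _ = c ^ 2 := by field_simp
  obtain ⟨r₁, hr1, hr12⟩ : ∃ r₁ > 0, r₁ < r₂ := ⟨r₂ / 2, by positivity, by linarith⟩
  obtain ⟨b, N, hb⟩ := exists_cut (m + 1) hr1 hr12
  obtain ⟨W₁, hW₁, hint1⟩ := int_one m (r₁ := r₁) hc hc1 hC hr2 hr2'
  obtain ⟨W₂, hW₂, hint2⟩ := int_two m hc hc1 hC hr2 hr2' hr1 hb.hN
  obtain ⟨hQ, hQc⟩ := Qc_ge hc hc1 hC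
  have hE := Ec_ge hc hc1 hC
  set K := 2 + 2 * Qc c C + 5 * Qc c C / r₁ ^ 2 + 2 * C * Qc c C ^ 2 with hK
  have p1 : 0 < 2 * Qc c C := by positivity
  have p2 : 0 < 5 * Qc c C / r₁ ^ 2 := by positivity
  have p3 : 0 < 2 * C * Qc c C ^ 2 := by positivity
  have hK0 : 2 ≤ K := by linarith
  have hK1 : 2 * Qc c C ≤ K := by linarith
  have hK2 : 5 * Qc c C ≤ K * r₁ ^ 2 := by
    rw [← div_le_iff₀ (by positivity)]; linarith
  have hK3 : 2 * C * Qc c C ^ 2 ≤ K := by linarith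
  set B := Ec c C + 3 * C * K with hB
  have hB1 : Ec c C + K ≤ B := by rw [hB]; nlinarith
  obtain ⟨W, hW, hmod⟩ := model_final m (c := c) (C := C) (K := K) (K₁ := Ec c C) (A := Qc c C) (B := B) (a := 1/3) (M := 2 * M)
    hC hK0 (by linarith) (by linarith) (le_trans (by gcongr; norm_num) hQc) hB1 (by norm_num) (by norm_num) (by positivity)
  have hKp : 0 < K := by linarith
  refine ⟨min c (1 / (2 * K)), by positivity, min_le_left _ _,
    C / 2 * (W * (A * (1 + M) * (W₁ + W₂) + 1)), by positivity, fun z hz hρ ν hν hell => ?_⟩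
  have hρc : -c < ρ z := by linarith [min_le_left c (1 / (2 * K))]
  have hρK : -ρ z < 1 / (2 * K) := by linarith [min_le_right c (1 / (2 * K))]
  obtain ⟨ι, hF⟩ := exists_frame ν hν
  have h : Geo Ω ρ c C r z ν ι := ⟨D, hc1, hz, hρc, hF, hell⟩
  have hδ := h.delta_pos
  have hKδ : K * (-ρ z) ≤ 1 / 2 := by
    rw [lt_div_iff₀ (by positivity)] at hρK
    linarith
  have hδ1 : -ρ z ≤ 1 := by nlinarith
  obtain ⟨q1, q2⟩ := h.int_est hr2 hr2' hb hf hM hA bf b1 (hint1 N Ω ρ b z ν ι h hb) (hint2 Ω ρ b z ν ι h hb)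
  have hcP := continuous_Psi (ρ := ρ) (z := z) (ν := ν) (ι := ι)
  have ee : ∀ p : EE m × ℂ, (f (Psi ρ z ν ι p) - f z) * (((b (Psi ρ z ν ι p - z) : ℝ) : ℂ) * kk m p.2) =
      (f (Psi ρ z ν ι p) - f z) * hh b ρ z ν (Psi ρ z ν ι p) := by
    intro p; rw [hh, h.uu_Psi]
  have hmem := fun p hp => h.model_mem hr1 (hr12.le.trans hr2.le) hK0 hK1 hK2 p hp
  have hmem0 := fun u hu => h.model_mem0 hr1 (hr12.le.trans hr2.le) hK0 hK1 hK2 hK3 u hu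
  have hGM : ∀ w ∈ Ω, ‖f w - f z‖ ≤ 2 * M := fun w hw => by
    refine (norm_sub_le _ _).trans ?_
    linarith [hM w hw, hM z hz]
  have hline0 : Psi ρ z ν ι (0, ((-ρ z : ℝ) : ℂ)) = z := by rw [h.Psi_line]; simp
  have key := hmod (-ρ z) (fun t => Lv ρ z (ι t)) (fun p => f (Psi ρ z ν ι p) - f z)
    (fun u => f (Psi ρ z ν ι (0, u)) - f z) (fun p => b (Psi ρ z ν ι p - z)) (Psi ρ z ν ι ⁻¹' Ω)
    h.lform hδ hKδ (D.op.preimage hcP).measurableSet (fun p hp => (hmem p hp).1)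
    (by simp only [ee]; exact q1)
    (by
      intro p hp hnR hχ
      have hT : p ∈ TR Ω ρ z ν ι r₂ := by
        refine ⟨hp, ?_⟩
        by_contra hlt
        exact hχ (hb.zero _ (not_le.1 hlt).le)
      obtain ⟨a1, a2, a3, a4, a5⟩ := h.TR_est hr2 hr2' hT
      refine ⟨by linarith, a2, ?_⟩
      have hneg := D.neg hp
      have hY : YY K (-ρ z) p.2 ≤ Lv ρ z (ι p.1) + Ec c C * ‖p.2‖ ^ (3 / 2 : ℝ) := not_lt.1 hnR
      unfold YY at hY
      have hsq : ‖p.2‖ ^ 2 ≤ 3 * C * ‖p.2‖ ^ (3 / 2 : ℝ) := by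
        rw [← sqrt_pow_three (norm_nonneg _)]
        have hx2 : Real.sqrt ‖p.2‖ ^ 2 = ‖p.2‖ := Real.sq_sqrt (norm_nonneg _)
        have hx := Real.sqrt_nonneg ‖p.2‖
        set x := Real.sqrt ‖p.2‖
        rw [← hx2] at a3 ⊢
        have hx3 : x ≤ 3 * C := by
          rw [← pow_le_pow_iff_left₀ hx (by positivity) two_ne_zero]
          nlinarith
        have := mul_le_mul_of_nonneg_right hx3 (pow_nonneg hx 3)
        linarith
      have hsq2 := mul_le_mul_of_nonneg_left hsq hKp.le
      have hBe : B * ‖p.2‖ ^ (3 / 2 : ℝ) = Ec c C * ‖p.2‖ ^ (3 / 2 : ℝ) + K * (3 * C * ‖p.2‖ ^ (3 / 2 : ℝ)) := by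
        rw [hB]; ring
      have hpos : 0 ≤ K * (3 * C * ‖p.2‖ ^ (3 / 2 : ℝ)) := by positivity
      have a6 := (abs_le.1 a5).1
      rw [abs_le, hBe]
      constructor <;> linarith)
    (fun p hp => hGM _ hp)
    (fun p => by rw [abs_of_nonneg (hb.nonneg _)]; exact hb.le_one _)
    (by
      have : Continuous fun p => b (Psi ρ z ν ι p - z) := hb.smooth.continuous.comp (hcP.sub continuous_const)
      exact this.measurable)
    (fun p hp => hb.one _ (by rw [norm_Psi_sub]; exact (hmem p hp).2))
    (fun u => ((hf.comp (Psi_t_diff u).differentiableOn fun t ht => (hmem (t, u) ht).1).sub_const _))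
    ((hf.continuousOn.comp hcP.continuousOn fun p hp => (hmem p hp).1).sub continuousOn_const)
    ((hf.comp (fun u _ => (h.Psi_deriv u).differentiableAt.differentiableWithinAt) fun u hu => hmem0 u hu).sub_const _)
    (fun u hu => hGM _ (hmem0 u hu))
    (by rw [hline0, sub_self])
    (fun p _ => rfl)
  simp only [ee] at key
  have hder : HasDerivAt (fun u => f (Psi ρ z ν ι (0, u)) - f z)
      (fderiv ℂ f z ((-2 / ((‖ell ρ z‖ : ℝ) : ℂ)) • ν)) ((-ρ z : ℝ) : ℂ) := by
    have h1 : HasFDerivAt f (fderiv ℂ f z) (Psi ρ z ν ι (0, ((-ρ z : ℝ) : ℂ))) := by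
      rw [hline0]; exact (hf.differentiableAt (D.op.mem_nhds hz)).hasFDerivAt
    exact (h1.comp_hasDerivAt _ (h.Psi_deriv _)).sub_const _
  rw [hder.deriv, map_smul, norm_smul, norm_div, Complex.norm_real, norm_norm, norm_neg] at key
  have h22 : ‖(2 : ℂ)‖ = 2 := by simp
  rw [h22] at key
  obtain ⟨_, l2, l3⟩ := h.ell_bounds
  have hone : 1 ≤ (-ρ z) ^ (-(1/2) : ℝ) := Real.one_le_rpow_of_pos_of_le_one_of_nonpos hδ hδ1 (by norm_num)
  set X := (-ρ z) ^ (-(1/2) : ℝ) with hX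
  have k1 : 2 / C * ‖fderiv ℂ f z ν‖ ≤ 2 / ‖ell ρ z‖ * ‖fderiv ℂ f z ν‖ :=
    mul_le_mul_of_nonneg_right (by gcongr) (norm_nonneg _)
  have k2 : W₁ * X + W₂ ≤ (W₁ + W₂) * X := by nlinarith
  have k3 := q2.trans (mul_le_mul_of_nonneg_left k2 (show 0 ≤ A * (1 + M) by positivity))
  have k4 : 2 / C * ‖fderiv ℂ f z ν‖ ≤ W * ((A * (1 + M) * (W₁ + W₂) + 1) * X) := by
    refine k1.trans (key.trans (mul_le_mul_of_nonneg_left ?_ hW.le))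
    nlinarith
  have hCp : 0 < C := by linarith
  calc ‖fderiv ℂ f z ν‖ = C / 2 * (2 / C * ‖fderiv ℂ f z ν‖) := by field_simp
    _ ≤ C / 2 * (W * ((A * (1 + M) * (W₁ + W₂) + 1) * X)) := mul_le_mul_of_nonneg_left k4 (by positivity)
    _ = _ := by ring

end GDJ

namespace GDJ
open Set Filter Topology MeasureTheory
open scoped ContDiff

lemma BellP.mono {n : ℕ} {Ω : Set (EE n)} {ρ : EE n → ℝ} {f : EE n → ℂ} {A A' c C r : ℝ} (D : Dom Ω ρ c C r)
    (h : BellP Ω ρ f A) (hA : A ≤ A') : BellP Ω ρ f A' := by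
  intro g h1 h2 h3
  refine (h g h1 h2 h3).trans (mul_le_mul_of_nonneg_right hA ?_)
  refine add_nonneg (setIntegral_nonneg D.op.measurableSet fun z hz => ?_)
    (setIntegral_nonneg D.op.measurableSet fun z hz => by positivity)
  have := D.neg hz
  exact mul_nonneg (by linarith) (norm_nonneg _)

lemma Jac_id {n : ℕ} (z : EE n) : (Jac (id : EE n → EE n) z).det = 1 := by
  have : Jac (id : EE n → EE n) z = 1 := by
    ext l j
    simp [Jac, ev, Matrix.one_apply, EuclideanSpace.single_apply]
  rw [this, Matrix.det_one]

lemma Dom.bell_one {n : ℕ} {Ω : Set (EE n)} {ρ : EE n → ℝ} {c C r : ℝ} (D : Dom Ω ρ c C r) :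
    ∃ A > 0, BellP Ω ρ (fun _ => 1) A := by
  have S : Setup Ω Ω ρ ρ c C r id := by
    refine ⟨D, D, differentiableOn_id, fun z hz => hz, fun K hK hc => ?_⟩
    have : {z ∈ Ω | id z ∈ K} = K := by
      ext z; exact ⟨fun h => h.2, fun h => ⟨hK h, h⟩⟩
    rwa [this]
  obtain ⟨A, hA, h⟩ := S.bell
  refine ⟨A, hA, fun g h1 h2 h3 => ?_⟩
  have := h g h1 h2 h3
  simpa only [Jac_id] using this

lemma infDist_frontier_pos {m : ℕ} {Ω : Set (EE (m + 1))} (ho : IsOpen Ω) (hb : Bornology.IsBounded Ω) {z : EE (m + 1)}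
    (hz : z ∈ Ω) : 0 < infDist z (frontier Ω) := by
  have hne : (frontier Ω).Nonempty := by
    by_contra h
    rw [not_nonempty_iff_eq_empty] at h
    have hcl : IsClopen Ω := isClopen_iff_frontier_eq_empty.2 h
    rcases isClopen_iff.1 hcl with h1 | h1
    · rw [h1] at hz; exact hz
    · rw [h1] at hb
      exact NormedSpace.unbounded_univ ℂ (EE (m + 1)) hb
  rw [← isClosed_frontier.notMem_iff_infDist_pos hne, ho.frontier_eq]
  exact fun h => h.2 hz

lemma fderiv_bound {m : ℕ} {Ω₁ Ω₂ : Set (EE (m + 1))} {ρ₁ ρ₂ : EE (m + 1) → ℝ} {c C r : ℝ} {φ : EE (m + 1) → EE (m + 1)}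
    (S : Setup Ω₁ Ω₂ ρ₁ ρ₂ c C r φ) (hc1 : c ≤ 1) : ∃ W > 0, ∀ z ∈ Ω₁, ∀ v,
      ‖fderiv ℂ (fun w => (Jac φ w).det) z v‖ ≤ W * (-ρ₁ z) ^ (-(1/2) : ℝ) * ‖v‖ := by
  have hf := differentiableOn_det S.D1.op S.holo
  obtain ⟨M, hM, hMb⟩ := S.bounds
  obtain ⟨A₁, hA₁, b1⟩ := S.D1.bell_one
  obtain ⟨A₂, hA₂, b2⟩ := S.bell
  have b2' : BellP Ω₁ ρ₁ (fun w => (Jac φ w).det) A₂ := b2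
  obtain ⟨s, hs, hsc, W, hW, hn⟩ := normal_est S.D1 hc1 hf (by linarith) (fun z hz => (hMb z hz).1)
    (hA₁.le.trans (le_max_left A₁ A₂)) (b2'.mono S.D1 (le_max_right _ _)) (b1.mono S.D1 (le_max_left _ _))
  obtain ⟨B, hB, ht⟩ := S.tangential
  have hcont : ContinuousOn (fderiv ℂ (fun w => (Jac φ w).det)) {z ∈ Ω₁ | ρ₁ z ≤ -s} :=
    (differentiableOn_fderiv S.D1.op hf).continuousOn.mono fun z hz => hz.1
  obtain ⟨C₀, hC₀, hcb⟩ := compact_bdd (S.D1.cpt s hs) hcont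
  have hC := S.D1.hC
  refine ⟨(W + 2 * B) + C₀ * C ^ (1/2 : ℝ), by positivity, fun z hz v => ?_⟩
  have hneg := S.D1.neg hz
  have hp : 0 < -ρ₁ z := by linarith
  have hrp : 0 < (-ρ₁ z) ^ (-(1/2) : ℝ) := Real.rpow_pos_of_pos hp _
  set q := (-ρ₁ z) ^ (-(1/2) : ℝ) with hq
  have hqs : q * Real.sqrt (-ρ₁ z) = 1 := by
    rw [hq, Real.sqrt_eq_rpow, ← Real.rpow_add hp]; norm_num
  set L := fderiv ℂ (fun w => (Jac φ w).det) z with hL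
  have hCp : 0 < C ^ (1/2 : ℝ) := Real.rpow_pos_of_pos (by linarith) _
  by_cases hzs : -s < ρ₁ z
  · have hg := S.D1.grad z hz (by linarith)
    have hc := S.D1.hc
    have hl0 : ell ρ₁ z ≠ 0 := by
      rw [← norm_pos_iff, norm_ell]; linarith
    obtain ⟨ν, hν, hνe⟩ := exists_unit (ell ρ₁ z) hl0
    have h1 := hn z hz hzs ν hν hνe
    have hin : ‖inner ℂ ν v‖ ≤ ‖v‖ := by
      have := norm_inner_le_norm (𝕜 := ℂ) ν v
      rwa [hν, one_mul] at this
    set t := v - (inner ℂ ν v : ℂ) • ν with htd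
    have ht0 : ell ρ₁ z t = 0 := by
      rw [hνe, htd, inner_sub_right, inner_smul_right, inner_self_eq_norm_sq_to_K, hν]
      simp
    have htn : ‖t‖ ≤ 2 * ‖v‖ := by
      refine (norm_sub_le _ _).trans ?_
      rw [norm_smul, hν]; linarith
    have h2 := ht z hz t ht0
    have h3 : ‖L t‖ ≤ B * ‖t‖ * q := by
      calc ‖L t‖ = (‖L t‖ * Real.sqrt (-ρ₁ z)) * q := by rw [mul_assoc, mul_comm (Real.sqrt _), hqs, mul_one]
        _ ≤ _ := mul_le_mul_of_nonneg_right h2 hrp.le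
    have hv : v = (inner ℂ ν v : ℂ) • ν + t := by rw [htd]; abel
    have h4 : ‖L v‖ ≤ ‖v‖ * (W * q) + B * (2 * ‖v‖) * q := by
      calc ‖L v‖ = ‖(inner ℂ ν v : ℂ) • L ν + L t‖ := by
            conv_lhs => rw [hv]
            rw [map_add, map_smul]
        _ ≤ ‖(inner ℂ ν v : ℂ)‖ * ‖L ν‖ + ‖L t‖ := by
            refine (norm_add_le _ _).trans ?_
            rw [norm_smul]
        _ ≤ _ := by
            refine add_le_add (mul_le_mul hin h1 (norm_nonneg _) (norm_nonneg _)) (h3.trans ?_)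
            gcongr
    have h5 : 0 ≤ C₀ * C ^ (1/2 : ℝ) * q * ‖v‖ := by positivity
    nlinarith
  · have h1 := hcb z ⟨hz, not_lt.1 hzs⟩
    have hb := S.D1.bnd z hz
    have h2 : 1 ≤ C ^ (1/2 : ℝ) * q := by
      have hle : Real.sqrt (-ρ₁ z) ≤ C ^ (1/2 : ℝ) := by
        rw [Real.sqrt_eq_rpow]
        exact Real.rpow_le_rpow hp.le (by linarith) (by norm_num)
      calc (1:ℝ) = Real.sqrt (-ρ₁ z) * q := by rw [mul_comm, hqs]
        _ ≤ _ := mul_le_mul_of_nonneg_right hle hrp.le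
    have h3 : ‖L v‖ ≤ C₀ * ‖v‖ := (L.le_opNorm v).trans (mul_le_mul_of_nonneg_right h1 (norm_nonneg _))
    have h4 : C₀ * ‖v‖ * 1 ≤ C₀ * ‖v‖ * (C ^ (1/2 : ℝ) * q) := mul_le_mul_of_nonneg_left h2 (by positivity)
    have h5 : 0 ≤ (W + 2 * B) * q * ‖v‖ := by positivity
    nlinarith

lemma final {n : ℕ} {Ω₁ Ω₂ : Set (EE n)} (h1 : IsStrictlyPseudoconvexDomain n ⊤ Ω₁)
    (h2 : IsStrictlyPseudoconvexDomain n ⊤ Ω₂) {φ : EE n → EE n} (hφ : DifferentiableOn ℂ φ Ω₁)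
    (hp : IsProperMapOn n φ Ω₁ Ω₂) :
    ∃ C : ℝ, ∀ z ∈ Ω₁,
      Real.sqrt (∑ k, ‖wDz n k (fun w => (jacobian n φ w).det) z‖ ^ 2)
        ≤ C * Metric.infDist z (frontier Ω₁) ^ (-(1 : ℝ) / 2) := by
  rcases n with _ | m
  · exact ⟨0, fun z hz => by simp⟩
  obtain ⟨ρ₁, ρ₂, c, C, r, S⟩ := exists_setup h1 h2 hφ hp
  have hc0 := S.D1.hc
  have hr0 := S.D1.hr
  have S' : Setup Ω₁ Ω₂ ρ₁ ρ₂ (min c 1) C r φ :=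
    ⟨S.D1.mono (by positivity) (min_le_left _ _) le_rfl hr0 le_rfl,
      S.D2.mono (by positivity) (min_le_left _ _) le_rfl hr0 le_rfl, S.holo, S.proper⟩
  obtain ⟨W, hW, hb⟩ := fderiv_bound S' (min_le_right _ _)
  have hC := S.D1.hC
  refine ⟨((m + 1 : ℕ) : ℝ) * (W * C ^ (1/2 : ℝ)), fun z hz => ?_⟩
  have hneg := S.D1.neg hz
  have hp : 0 < -ρ₁ z := by linarith
  have hd := infDist_frontier_pos S.D1.op S.D1.bd hz
  have hdist := S.D1.dist z hz
  set d := infDist z (frontier Ω₁)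
  have hq : (-ρ₁ z) ^ (-(1/2) : ℝ) ≤ C ^ (1/2 : ℝ) * d ^ (-(1 : ℝ) / 2) := by
    have e : (-(1 : ℝ) / 2) = -(1/2) := by norm_num
    rw [e, Real.rpow_neg hp.le, Real.rpow_neg hd.le, ← div_eq_mul_inv, inv_eq_one_div,
      div_le_div_iff₀ (Real.rpow_pos_of_pos hp _) (Real.rpow_pos_of_pos hd _), one_mul,
      ← Real.mul_rpow (by linarith) hp.le]
    exact Real.rpow_le_rpow hd.le hdist (by norm_num)
  have hk : ∀ k, ‖wDz (m + 1) k (fun w => (jacobian (m + 1) φ w).det) z‖ ≤ W * C ^ (1/2 : ℝ) * d ^ (-(1 : ℝ) / 2) := by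
    intro k
    have hcg : (fun w => (jacobian (m + 1) φ w).det) =ᶠ[𝓝 z] fun w => (Jac φ w).det := by
      filter_upwards [S.D1.op.mem_nhds hz] with w hw
      rw [jacobian_eq (hφ.differentiableAt (S.D1.op.mem_nhds hw))]
    rw [wDz_eq, dz_congr hcg, dz_of_complex ((differentiableOn_det S.D1.op hφ).differentiableAt (S.D1.op.mem_nhds hz))]
    have := hb z hz (ev k)
    rw [norm_ev, mul_one] at this
    refine this.trans ?_
    rw [mul_assoc]
    exact mul_le_mul_of_nonneg_left hq hW.le
  set Q := W * C ^ (1/2 : ℝ) * d ^ (-(1 : ℝ) / 2) with hQ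
  have hQ0 : 0 ≤ Q := (norm_nonneg _).trans (hk (0 : Fin (m + 1)))
  rw [mul_assoc, ← hQ]
  clear hQ
  clear_value Q
  apply Real.sqrt_le_iff.2
  refine ⟨by positivity, ?_⟩
  calc ∑ k, ‖wDz (m + 1) k (fun w => (jacobian (m + 1) φ w).det) z‖ ^ 2 ≤ ∑ k : Fin (m + 1), Q ^ 2 :=
        by
        refine Finset.sum_le_sum fun k _ => ?_
        exact pow_le_pow_left₀ (norm_nonneg _) (hk k) 2
    _ = ((m + 1 : ℕ) : ℝ) * Q ^ 2 := by simp
    _ ≤ (((m + 1 : ℕ) : ℝ) * Q) ^ 2 := by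
        rw [mul_pow]
        refine mul_le_mul_of_nonneg_right ?_ (sq_nonneg Q)
        have : (1:ℝ) ≤ ((m + 1 : ℕ) : ℝ) := by exact_mod_cast Nat.succ_le_succ (Nat.zero_le m)
        nlinarith

end GDJ

/-- For a proper holomorphic map `φ` between bounded strictly
pseudoconvex domains with `C^∞` boundary, the gradient of `det φ′` blows up at most
like `dist(z, ∂Ω₁)^{-1/2}`. -/
theorem grad_det_jacobian_estimate (n : ℕ)
    (Ω₁ Ω₂ : Set (EuclideanSpace ℂ (Fin n)))
    (hΩ₁ : IsStrictlyPseudoconvexDomain n ⊤ Ω₁)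
    (hΩ₂ : IsStrictlyPseudoconvexDomain n ⊤ Ω₂)
    (φ : EuclideanSpace ℂ (Fin n) → EuclideanSpace ℂ (Fin n))
    (hφ : DifferentiableOn ℂ φ Ω₁)
    (hproper : IsProperMapOn n φ Ω₁ Ω₂) :
    ∃ C : ℝ, ∀ z ∈ Ω₁,
      Real.sqrt (∑ k, ‖wDz n k (fun w => (jacobian n φ w).det) z‖ ^ 2)
        ≤ C * Metric.infDist z (frontier Ω₁) ^ (-(1 : ℝ) / 2) := by
  exact GDJ.final hΩ₁ hΩ₂ hφ hproper
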